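/- There exists d₀ ∈ ℕ such that for every d ≥ d₀ and every ε > 0 with p_c(d) + ε ≤ 1 there exists p ∈ (p_c(d), 1) such that, under the monotone coupling, almost surely the configuration obtained from ω_{p_c+ε} by closing every open edge having an endpoint in 𝒞∞(ω_p) contains an infinite open cluster. -/

import Mathlib

open MeasureTheory Set

namespace Perc

/-- Vertices of the lattice `ℤ^d`. -/
abbrev V (d : ℕ) : Type := Fin d → ℤ

/-- Nearest-neighbour adjacency in `ℤ^d`: `‖x - y‖₁ = 1`. -/
def Adjacent {d : ℕ} (x y : V d) : Prop := (∑ i, |x i - y i|) = 1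

/-- `e` is an edge of the nearest-neighbour lattice `ℤ^d`. -/
def IsEdge {d : ℕ} (e : Sym2 (V d)) : Prop := ∃ x y : V d, Adjacent x y ∧ e = s(x, y)

/-- The edge set `E(ℤ^d)` of the nearest-neighbour lattice. -/
abbrev Edge (d : ℕ) : Type := {e : Sym2 (V d) // IsEdge e}

/-- A bond percolation configuration: each edge is open (`true`) or closed (`false`). -/
abbrev Config (d : ℕ) : Type := Edge d → Bool

/-- `x` and `y` are joined by an open edge of `ω`. -/
def OpenAdj {d : ℕ} (ω : Config d) (x y : V d) : Prop :=
  ∃ h : IsEdge s(x, y), ω ⟨s(x, y), h⟩ = true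

/-- `x` and `y` lie in the same open cluster of `ω`. -/
def Connected {d : ℕ} (ω : Config d) (x y : V d) : Prop :=
  Relation.ReflTransGen (OpenAdj ω) x y

/-- The open cluster of `ω` containing `x`. -/
def cluster {d : ℕ} (ω : Config d) (x : V d) : Set (V d) := {y | Connected ω x y}

/-- `x` lies in an infinite open cluster of `ω`. -/
def InInfinite {d : ℕ} (ω : Config d) (x : V d) : Prop := (cluster ω x).Infinite

/-- `𝒞∞(ω)`: the set of vertices lying in infinite open clusters. -/
def Cinf {d : ℕ} (ω : Config d) : Set (V d) := {x | InInfinite ω x}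

/-- `ω` has an infinite open cluster. -/
def HasInfCluster {d : ℕ} (ω : Config d) : Prop := ∃ x : V d, InInfinite ω x

/-- The Bernoulli(p) weight of a single edge state (`true ↦ p`, `false ↦ 1 - p`). -/
noncomputable def bernoulliCyl (p : ℝ) (b : Bool) : ENNReal :=
  if b then ENNReal.ofReal p else ENNReal.ofReal (1 - p)

/-- `μ` is the product Bernoulli(`p`) measure on configurations: it is a probability
measure whose finite-dimensional cylinder probabilities are the i.i.d. Bernoulli ones. -/
def IsBernoulli (d : ℕ) (p : ℝ) (μ : Measure (Config d)) : Prop :=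
  IsProbabilityMeasure μ ∧
    ∀ (t : Finset (Edge d)) (f : Edge d → Bool),
      μ {ω | ∀ e ∈ t, ω e = f e} = ∏ e ∈ t, bernoulliCyl p (f e)

/-- The critical probability `p_c` associated with a family `P p` of Bernoulli(`p`)
percolation measures. -/
noncomputable def pcOf (d : ℕ) (P : ℝ → Measure (Config d)) : ℝ :=
  sInf {p | p ∈ Icc (0 : ℝ) 1 ∧ 0 < P p {ω | HasInfCluster ω}}

/-- The monotone coupling randomness: `U` is the law of i.i.d. uniform-`[0,1]` labels on
the edges (characterized by its finite-dimensional distribution functions). -/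
def IsUniform (d : ℕ) (U : Measure (Edge d → ℝ)) : Prop :=
  IsProbabilityMeasure U ∧
    ∀ (t : Finset (Edge d)) (a : Edge d → ℝ),
      U {u | ∀ e ∈ t, u e ≤ a e} = ∏ e ∈ t, ENNReal.ofReal (min (max (a e) 0) 1)

/-- The configuration `ω_p` obtained from uniform labels `u` in the monotone coupling. -/
noncomputable def level {d : ℕ} (p : ℝ) (u : Edge d → ℝ) : Config d :=
  fun e => decide (u e ≤ p)

open Classical in
/-- `ω^S`: the configuration obtained from `ω` by closing every edge with an endpoint
in `S`. -/
noncomputable def closeOn {d : ℕ} (S : Set (V d)) (ω : Config d) : Config d :=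
  fun e => if ∃ x ∈ e.val, x ∈ S then false else ω e

/-- `ω̃_p` built from `ω_p`: keep an edge open iff it is open and its cluster is finite. -/
noncomputable def burn {d : ℕ} (ω : Config d) : Config d := closeOn (Cinf ω) ω

open Classical in
/-- The restriction of `ω` to edges with both endpoints in `R` (other edges closed). -/
noncomputable def restrictTo {d : ℕ} (R : Set (V d)) (ω : Config d) : Config d :=
  fun e => if ∀ x ∈ e.val, x ∈ R then ω e else false

/-- The box `B_x(L) = {y : ‖y - x‖_∞ ≤ L}`. -/
def box {d : ℕ} (x : V d) (L : ℕ) : Set (V d) := {y | ∀ i, |y i - x i| ≤ (L : ℤ)}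

/-- The sphere `∂B_x(L) = {y : ‖y - x‖_∞ = L}`. -/
def sphere {d : ℕ} (x : V d) (L : ℕ) : Set (V d) :=
  {y | (∀ i, |y i - x i| ≤ (L : ℤ)) ∧ ∃ i, |y i - x i| = (L : ℤ)}

/-- The slab `S_ℓ = {x : |x_i| ≤ ℓ for all coordinates i ≥ 3}` (`0`-indexed: `i ≥ 2`). -/
def slab (d : ℕ) (ℓ : ℕ) : Set (V d) := {x | ∀ i : Fin d, 2 ≤ (i : ℕ) → |x i| ≤ (ℓ : ℤ)}

/-- `x` is connected by an open path to some vertex of `S`. -/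
def ConnectedToSet {d : ℕ} (ω : Config d) (x : V d) (S : Set (V d)) : Prop :=
  ∃ y ∈ S, Connected ω x y

/-- The set of vertices `y ∈ S_ℓ ∩ B_x(3L)` with `y ↔ ∂B_y(L)`. -/
def armSet {d : ℕ} (ω : Config d) (x : V d) (ℓ L : ℕ) : Set (V d) :=
  {y | y ∈ slab d ℓ ∩ box x (3 * L) ∧ ConnectedToSet ω y (sphere y L)}

/-- The event `𝒜(x,ℓ,L,M)`: strictly fewer than `M` vertices `y ∈ S_ℓ ∩ B_x(3L)`
are connected to `∂B_y(L)`. -/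
def eventA {d : ℕ} (x : V d) (ℓ L M : ℕ) : Set (Config d) :=
  {ω | (armSet ω x ℓ L).Finite ∧ (armSet ω x ℓ L).ncard < M}

/-- The set `C` has `ℓ∞`-diameter strictly larger than `L`. -/
def DiamGT {d : ℕ} (C : Set (V d)) (L : ℕ) : Prop :=
  ∃ a ∈ C, ∃ b ∈ C, ∃ i, (L : ℤ) < |a i - b i|

/-- The event `ℰ(x,ℓ,L)`: in the restriction of `ω` to `S_ℓ ∩ B_x(3L)` there is an open
crossing from `∂B_x(L)` to `∂B_x(3L)`, and there is exactly one open cluster of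
`ℓ∞`-diameter larger than `L`. -/
def eventE {d : ℕ} (x : V d) (ℓ L : ℕ) : Set (Config d) :=
  {ω |
    (∃ a ∈ sphere x L, ∃ b ∈ sphere x (3 * L),
        Connected (restrictTo (slab d ℓ ∩ box x (3 * L)) ω) a b) ∧
      ∃! C : Set (V d),
        (∃ y : V d, C = cluster (restrictTo (slab d ℓ ∩ box x (3 * L)) ω) y) ∧ DiamGT C L}

/-- The event `ℬ(x,ℓ,L,M)`: `ω^S ∈ ℰ(x,ℓ,L)` for every `S ⊆ B_x(3L)` with `|S| ≤ M`. -/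
def eventB {d : ℕ} (x : V d) (ℓ L M : ℕ) : Set (Config d) :=
  {ω | ∀ S : Set (V d), S ⊆ box x (3 * L) → S.Finite → S.ncard ≤ M →
    closeOn S ω ∈ eventE x ℓ L}

/-- The embedding of `ℤ²` into `ℤ^d` (last `d - 2` coordinates zero). -/
def emb (d : ℕ) (u : ℤ × ℤ) : V d :=
  fun i => if (i : ℕ) = 0 then u.1 else if (i : ℕ) = 1 then u.2 else 0

/-- Nearest-neighbour adjacency in `ℤ²`. -/
def Adjacent₂ (u v : ℤ × ℤ) : Prop := |u.1 - v.1| + |u.2 - v.2| = 1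

/-- `A ⊆ ℤ²` is nearest-neighbour-connected. -/
def ConnSet₂ (A : Set (ℤ × ℤ)) : Prop :=
  ∀ a ∈ A, ∀ b ∈ A,
    Relation.ReflTransGen (fun u v => u ∈ A ∧ v ∈ A ∧ Adjacent₂ u v) a b

open scoped ENNReal
open ENNReal (le_div_iff_mul_le continuous_ofReal div_le_iff div_le_of_le_mul iSup_mul inv_le_inv inv_le_one le_tsum mul_lt_top mul_ne_top ofReal ofReal_add ofReal_coe_nnreal ofReal_div_of_pos ofReal_inv_of_pos ofReal_le_ofReal ofReal_le_ofReal_iff ofReal_mul ofReal_natCast ofReal_ne_top ofReal_one ofReal_pow ofReal_sub ofReal_sum_of_nonneg ofReal_toReal one_le_ofReal one_lt_top pow_ne_top sum_le_tsum sum_ne_top summable toReal_nonneg toReal_ofReal tsum_add tsum_comm tsum_le_tsum)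
open Finset (induction_on prod_insert card_image_le card_product coe_injective erase_subset filter_subset le_sup measurableSet_biUnion mem_coe mem_erase mem_filter mem_of_mem_erase mem_product mul_sum ne_of_mem_erase prod_congr prod_nonneg single_le_sum sum_add_distrib sum_comm sum_congr sum_const sum_eq_single sum_eq_zero sum_filter sum_insert sum_le_card_nsmul sum_le_sum sum_le_sum_of_subset sum_map sum_mul sum_nonneg sum_product sum_range_succ sum_subset)
open Real (exp log exp_pos exp_le_exp)
open Equiv (addRight coe_addRight subRight)
open MeasureTheory.Measure (map_apply infinitePi)
open Function (update update_of_ne iterate_succ_apply' Injective)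
open Nat (cast_nonneg)
open Sym2 (out_fst_mem)
noncomputable section
open scoped Classical

variable {d : ℕ} {p : ℝ} {x y z u : V d} {S : Set (V d)} {ω : Config d} {A : Set (Config d)}

open ProbabilityTheory

theorem sum_ext {α M : Type*} [AddCommMonoid M] {s : Finset α} {f g : α → M} (h : ∀ i ∈ s, f i = g i) :
    ∑ i ∈ s, f i = ∑ i ∈ s, g i := sum_congr rfl h

theorem tsum_mul_left {α : Type*} {f : α → ENNReal} {a : ENNReal} : ∑' i, a * f i = a * ∑' i, f i :=
  ENNReal.tsum_mul_left

theorem tsum_mul_right {α : Type*} {f : α → ENNReal} {a : ENNReal} : ∑' i, f i * a = (∑' i, f i) * a :=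
  ENNReal.tsum_mul_right

theorem tsum_fsum {α β : Type*} {f : α → β → ENNReal} {s : Finset β} :
    ∑' i, ∑ j ∈ s, f i j = ∑ j ∈ s, ∑' i, f i j := Summable.tsum_finsetSum fun _ _ => summable

section
variable {ι X : Type*}

/-- The event `A` only depends on the coordinates in `J`. -/
def Dep (J : Set ι) (A : Set (ι → X)) : Prop :=
  ∀ ω ω' : ι → X, (∀ i ∈ J, ω i = ω' i) → ω ∈ A → ω' ∈ A

theorem Dep.iff {J : Set ι} {A : Set (ι → X)} (h : Dep J A) {ω ω' : ι → X}
    (hω : ∀ i ∈ J, ω i = ω' i) : ω ∈ A ↔ ω' ∈ A :=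
  ⟨h _ _ hω, h _ _ fun i hi => (hω i hi).symm⟩

theorem Dep.mono {J K : Set ι} {A : Set (ι → X)} (h : Dep J A) (hJK : J ⊆ K) : Dep K A :=
  fun ω ω' hω => h ω ω' fun i hi => hω i (hJK hi)

theorem Dep.inter {J : Set ι} {A B : Set (ι → X)} (hA : Dep J A) (hB : Dep J B) :
    Dep J (A ∩ B) := fun _ _ hω h => ⟨hA _ _ hω h.1, hB _ _ hω h.2⟩

theorem Dep.compl {J : Set ι} {A : Set (ι → X)} (hA : Dep J A) : Dep J Aᶜ :=
  fun _ _ hω h h' => h ((hA.iff hω).2 h')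

theorem Dep.iUnion {κ : Sort*} {J : Set ι} {A : κ → Set (ι → X)} (hA : ∀ k, Dep J (A k)) :
    Dep J (⋃ k, A k) := fun ω ω' hω h => by
  obtain ⟨k, hk⟩ := mem_iUnion.1 h
  exact mem_iUnion.2 ⟨k, hA k _ _ hω hk⟩

theorem Dep.iInter {κ : Sort*} {J : Set ι} {A : κ → Set (ι → X)} (hA : ∀ k, Dep J (A k)) :
    Dep J (⋂ k, A k) := fun ω ω' hω h => by
  rw [mem_iInter] at *
  exact fun k => hA k _ _ hω (h k)

variable [MeasurableSpace X] [Inhabited X]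

/-- Events depending on disjoint sets of coordinates are independent. -/
theorem infinitePi_inter_of_dep (μ : ι → Measure X) [∀ i, IsProbabilityMeasure (μ i)]
    {J K : Set ι} {A B : Set (ι → X)} (hA : Dep J A) (hB : Dep K B) (hJK : Disjoint J K)
    (mA : MeasurableSet A) (mB : MeasurableSet B) :
    infinitePi μ (A ∩ B) = infinitePi μ A * infinitePi μ B := by
  let m : ι → MeasurableSpace (ι → X) := fun i => MeasurableSpace.comap (fun ω => ω i) inferInstance
  have hi : iIndep m (infinitePi μ) :=
    iIndepFun_infinitePi (P := μ) (X := fun _ x => x) (fun _ => measurable_id)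
  have hle : ∀ i, m i ≤ MeasurableSpace.pi := fun i => (measurable_pi_apply i).comap_le
  have key : ∀ (J : Set ι) (A : Set (ι → X)), Dep J A → MeasurableSet A →
      MeasurableSet[⨆ i ∈ J, m i] A := by
    intro J A hA mA
    let r : (ι → X) → (ι → X) := fun ω i => if i ∈ J then ω i else default
    have hr : @Measurable _ _ (⨆ i ∈ J, m i) MeasurableSpace.pi r := by
      refine @measurable_pi_lambda _ _ _ (⨆ i ∈ J, m i) _ r fun i => ?_
      by_cases h : i ∈ J
      · simp only [r, h, if_true]
        exact Measurable.mono (comap_measurable (fun ω : ι → X => ω i)) (le_iSup₂ (f := fun i _ => m i) i h) le_rfl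
      · simp only [r, h, if_false]
        exact @measurable_const _ _ _ (⨆ i ∈ J, m i) _
    have : A = r ⁻¹' A := by
      ext ω
      exact hA.iff fun i hi => by simp [r, hi]
    rw [this]
    exact hr mA
  exact Indep_iff _ _ _ |>.1 (indep_iSup_of_disjoint hle hi hJK) A B (key J A hA mA) (key K B hB mB)

end

section
variable {ι : Type*}

/-- Clamping to the unit interval. -/
def clamp (p : ℝ) : ℝ := max 0 (min 1 p)

theorem clamp_of_mem (h : p ∈ Icc 0 1) : clamp p = p := by
  simp [clamp, h.1, h.2]

theorem clamp_mem (p : ℝ) : clamp p ∈ Icc 0 1 := by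
  simp [clamp]

theorem clamp_mono : Monotone clamp := fun _ _ h => max_le_max le_rfl (min_le_min le_rfl h)

/-- The Bernoulli distribution on `Bool` with parameter `p` (clamped to `[0,1]`). -/
def bern1 (p : ℝ) : Measure Bool :=
  ofReal (clamp p) • Measure.dirac true + ofReal (1 - clamp p) • Measure.dirac false

instance (p : ℝ) : IsProbabilityMeasure (bern1 p) := by
  constructor
  have := clamp_mem p
  simp only [bern1, Measure.coe_add, Measure.coe_smul, Pi.add_apply, Pi.smul_apply, measure_univ,
    smul_eq_mul, mul_one]
  rw [← ofReal_add this.1 (by linarith [this.2])]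
  simp

theorem bern1_true (p : ℝ) : bern1 p {true} = ofReal (clamp p) := by
  simp [bern1]

theorem bern1_false (p : ℝ) : bern1 p {false} = ofReal (1 - clamp p) := by
  simp [bern1]

/-- Product of Bernoulli measures with parameters `P i`. -/
def bern (P : ι → ℝ) : Measure (ι → Bool) := infinitePi fun i => bern1 (P i)

instance (P : ι → ℝ) : IsProbabilityMeasure (bern P) := by unfold bern; infer_instance

theorem bern_inter {P : ι → ℝ} {J K : Set ι} {A B : Set (ι → Bool)} (hA : Dep J A)
    (hB : Dep K B) (hJK : Disjoint J K) (mA : MeasurableSet A) (mB : MeasurableSet B) :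
    bern P (A ∩ B) = bern P A * bern P B := infinitePi_inter_of_dep _ hA hB hJK mA mB

theorem bern_true (P : ι → ℝ) (i : ι) : bern P {ω | ω i = true} = ofReal (clamp (P i)) := by
  have := Measure.infinitePi_map_eval (fun i => bern1 (P i)) i
  rw [← bern1_true, ← this, map_apply (by fun_prop) (by simp)]
  rfl

theorem dep_true (i : ι) : Dep {i} {ω : ι → Bool | ω i = true} := fun ω ω' h hω => by
  have := h i rfl
  simp_all

theorem meas_coord (i : ι) (b : Bool) : MeasurableSet {ω : ι → Bool | ω i = b} := by
  have : {ω : ι → Bool | ω i = b} = (fun ω => ω i) ⁻¹' {b} := rfl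
  rw [this]
  exact measurable_pi_apply i (by simp)

/-- The configuration equal to `true` exactly on `T`. -/
def conf (T : Finset ι) : ι → Bool := fun i => decide (i ∈ T)

/-- The probability of a finite-range event, as a polynomial in the parameters. -/
def fprob (F : Finset ι) (A : Set (ι → Bool)) (P : ι → ℝ) : ℝ :=
  ∑ T ∈ F.powerset, if conf T ∈ A then (∏ i ∈ T, P i) * ∏ i ∈ F \ T, (1 - P i) else 0

theorem meas_of_dep {F : Finset ι} {A : Set (ι → Bool)} (hA : Dep (↑F) A) :
    MeasurableSet A := by
  have : A = ⋃ T ∈ (F.powerset.filter fun T => conf T ∈ A), {ω | ∀ i ∈ F, ω i = conf T i} := by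
    ext ω
    simp only [mem_iUnion, mem_filter, Finset.mem_powerset, exists_prop, mem_ofPred_eq]
    constructor
    · intro h
      have h2 : ∀ i ∈ F, ω i = conf (F.filter fun i => ω i = true) i := by
        intro i hi
        cases hω : ω i <;> simp [conf, hi, hω]
      exact ⟨F.filter fun i => ω i = true, ⟨filter_subset _ _, hA _ _ h2 h⟩, h2⟩
    · rintro ⟨T, ⟨-, hT⟩, h⟩
      exact hA _ _ (fun i hi => (h i hi).symm) hT
  rw [this]
  refine measurableSet_biUnion _ fun T _ => ?_
  have : {ω : ι → Bool | ∀ i ∈ F, ω i = conf T i} = ⋂ i ∈ F, {ω | ω i = conf T i} := by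
    ext; simp
  rw [this]
  exact Finset.measurableSet_biInter _ fun i _ => meas_coord i _

theorem bern_eq_fprob {P : ι → ℝ} (hP : ∀ i, P i ∈ Icc 0 1) {F : Finset ι}
    {A : Set (ι → Bool)} (hA : Dep (↑F) A) : bern P A = ofReal (fprob F A P) := by
  have hcyl : ∀ T ∈ F.powerset, bern P {ω | ∀ i ∈ F, ω i = conf T i} =
      ofReal ((∏ i ∈ T, P i) * ∏ i ∈ F \ T, (1 - P i)) := by
    intro T hT
    have : {ω : ι → Bool | ∀ i ∈ F, ω i = conf T i} = Set.pi F fun i => {conf T i} := by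
      ext; simp [Set.pi]
    rw [this, bern, Measure.infinitePi_pi _ (fun _ _ => by simp),
      ofReal_mul (prod_nonneg fun i _ => (hP i).1),
      ENNReal.ofReal_prod_of_nonneg (fun i _ => (hP i).1),
      ENNReal.ofReal_prod_of_nonneg (fun i _ => by linarith [(hP i).2]), mul_comm,
      ← Finset.prod_sdiff (Finset.mem_powerset.1 hT)]
    congr 1
    · refine prod_congr rfl fun i hi => ?_
      simp only [Finset.mem_sdiff] at hi
      simp [conf, hi.2, bern1_false, clamp_of_mem (hP i)]
    · refine prod_congr rfl fun i hi => ?_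
      simp [conf, hi, bern1_true, clamp_of_mem (hP i)]
  have hdec : A = ⋃ T ∈ (F.powerset.filter fun T => conf T ∈ A), {ω | ∀ i ∈ F, ω i = conf T i} := by
    ext ω
    simp only [mem_iUnion, mem_filter, Finset.mem_powerset, exists_prop, mem_ofPred_eq]
    constructor
    · intro h
      have h2 : ∀ i ∈ F, ω i = conf (F.filter fun i => ω i = true) i := by
        intro i hi
        cases hω : ω i <;> simp [conf, hi, hω]
      exact ⟨F.filter fun i => ω i = true, ⟨filter_subset _ _, hA _ _ h2 h⟩, h2⟩
    · rintro ⟨T, ⟨-, hT⟩, h⟩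
      exact hA _ _ (fun i hi => (h i hi).symm) hT
  conv_lhs => rw [hdec]
  rw [measure_biUnion_finset]
  · rw [fprob, ← sum_filter, ofReal_sum_of_nonneg]
    · exact sum_ext fun T hT => hcyl T (mem_filter.1 hT).1
    · intro T _
      exact mul_nonneg (prod_nonneg fun i _ => (hP i).1)
        (prod_nonneg fun i _ => by linarith [(hP i).2])
  · intro T hT T' hT' hne
    simp only [Finset.coe_filter, Finset.mem_powerset, mem_ofPred_eq] at hT hT'
    refine disjoint_left.2 fun ω h h' => hne ?_
    ext i
    by_cases hi : i ∈ F
    · have := (h i hi).symm.trans (h' i hi)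
      simpa [conf] using this
    · exact ⟨fun h => absurd (hT.1 h) hi, fun h => absurd (hT'.1 h) hi⟩
  · intro T _
    refine meas_of_dep (F := F) fun ω ω' hω h i hi => ?_
    rw [← hω i hi]; exact h i hi

/-- Increasing events. -/
def Incr (A : Set (ι → Bool)) : Prop := ∀ ω η : ι → Bool, (∀ i, ω i = true → η i = true) →
  ω ∈ A → η ∈ A

/-- Uniform random variables. -/
def unif (ι : Type*) : Measure (ι → ℝ) :=
  infinitePi fun _ : ι => (volume.restrict (Icc (0 : ℝ) 1))

instance : IsProbabilityMeasure (volume.restrict (Icc (0 : ℝ) 1)) := ⟨by simp⟩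

instance : IsProbabilityMeasure (unif ι) := by unfold unif; infer_instance

theorem measurable_threshold (P : ι → ℝ) :
    Measurable fun (u : ι → ℝ) i => decide (u i ≤ P i) := by
  refine measurable_pi_lambda _ fun i => ?_
  exact Measurable.comp (g := fun x : ℝ => decide (x ≤ P i))
    (measurable_to_bool (by
      have : (fun x : ℝ => decide (x ≤ P i)) ⁻¹' {true} = Iic (P i) := by ext; simp
      rw [this]; exact measurableSet_Iic)) (measurable_pi_apply i)

theorem unif_map (P : ι → ℝ) : (unif ι).map (fun u i => decide (u i ≤ P i)) = bern P := by
  have hm : ∀ i, Measurable fun x : ℝ => decide (x ≤ P i) := fun i => measurable_to_bool (by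
      have : (fun x : ℝ => decide (x ≤ P i)) ⁻¹' {true} = Iic (P i) := by ext; simp
      rw [this]; exact measurableSet_Iic)
  rw [unif, Measure.infinitePi_map_pi _ (f := fun i x => decide (x ≤ P i)) hm, bern]
  have : ∀ i, (volume.restrict (Icc (0 : ℝ) 1)).map (fun x => decide (x ≤ P i)) = bern1 (P i) := by
    intro i
    have hv : (volume.restrict (Icc (0 : ℝ) 1)).map (fun x => decide (x ≤ P i)) {true} =
        ofReal (clamp (P i)) := by
      rw [map_apply (hm i) (by simp)]
      have : (fun x : ℝ => decide (x ≤ P i)) ⁻¹' {true} = Iic (P i) := by ext; simp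
      rw [this, Measure.restrict_apply measurableSet_Iic]
      have h2 : Iic (P i) ∩ Icc 0 1 = Icc 0 (min 1 (P i)) := by
        ext x; simp only [mem_inter_iff, mem_Iic, mem_Icc, le_min_iff]; tauto
      rw [h2, Real.volume_Icc, sub_zero, clamp]
      rcases le_total 0 (min 1 (P i)) with h | h
      · rw [max_eq_right h]
      · rw [max_eq_left h, ENNReal.ofReal_of_nonpos h, ENNReal.ofReal_zero]
    have hf : (volume.restrict (Icc (0 : ℝ) 1)).map (fun x => decide (x ≤ P i)) {false} =
        ofReal (1 - clamp (P i)) := by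
      have := Measure.isProbabilityMeasure_map (μ := volume.restrict (Icc (0 : ℝ) 1)) (hm i).aemeasurable
      have : ({false} : Set Bool) = {true}ᶜ := by ext b; cases b <;> simp
      rw [this, prob_compl_eq_one_sub (by simp), hv, ← ofReal_one,
        ofReal_sub _ (clamp_mem _).1]
    refine Measure.ext_of_singleton fun b => ?_
    cases b
    · rw [hf, bern1_false]
    · rw [hv, bern1_true]
  congr
  funext i
  exact this i

theorem bern_mono {P Q : ι → ℝ} (h : ∀ i, P i ≤ Q i) {A : Set (ι → Bool)} (hA : Incr A)
    (mA : MeasurableSet A) : bern P A ≤ bern Q A := by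
  rw [← unif_map, ← unif_map, map_apply (measurable_threshold P) mA,
    map_apply (measurable_threshold Q) mA]
  refine measure_mono fun u hu => hA _ _ ?_ hu
  intro i hi
  simp only [decide_eq_true_eq] at *
  exact hi.trans (h i)

/-- Reindexing along an injection. -/
theorem bern_reindex {κ : Type*} {P : ι → ℝ} {f : κ → ι} (hf : Injective f) {A : Set (κ → Bool)}
    (mA : MeasurableSet A) : bern P {ω | (fun k => ω (f k)) ∈ A} = bern (fun k => P (f k)) A := by
  rw [bern, bern, ← Measure.map_infinitePi_infinitePi_of_inj (P := fun i => bern1 (P i)) hf, map_apply (by fun_prop) mA]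
  rfl

/-- Uniqueness of the product measure, in terms of cylinders. -/
theorem eq_bern {P : ι → ℝ} (hP : ∀ i, P i ∈ Icc 0 1) {μ : Measure (ι → Bool)}
    (h : ∀ (t : Finset ι) (f : ι → Bool), μ {ω | ∀ e ∈ t, ω e = f e} =
      ∏ e ∈ t, bernoulliCyl (P e) (f e)) : μ = bern P := by
  classical
  refine ((Measure.isProjectiveLimit_infinitePi fun i => bern1 (P i)).unique fun s => ?_).symm
  refine Measure.ext_of_singleton fun g => ?_
  rw [map_apply (by fun_prop) (by simp), Measure.pi_singleton]
  have := h s fun i => if hi : i ∈ s then g ⟨i, hi⟩ else false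
  rw [← Finset.prod_coe_sort] at this
  have h2 : (s.restrict (π := fun _ => Bool)) ⁻¹' {g} =
      {ω | ∀ e ∈ s, ω e = if hi : e ∈ s then g ⟨e, hi⟩ else false} := by
    ext ω
    simp only [mem_preimage, mem_singleton_iff, mem_ofPred_eq, funext_iff, Finset.restrict,
      Subtype.forall]
    exact forall₂_congr fun a ha => by simp [ha]
  rw [h2, this]
  refine prod_congr rfl fun i _ => ?_
  cases hg : g i <;> simp [hg, bernoulliCyl, bern1_true, bern1_false, clamp_of_mem (hP i)]

theorem eq_unif {U : Measure (ι → ℝ)} [IsProbabilityMeasure U]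
    (h : ∀ (t : Finset ι) (a : ι → ℝ), U {u | ∀ e ∈ t, u e ≤ a e} =
      ∏ e ∈ t, ofReal (min (max (a e) 0) 1)) : U = unif ι := by
  classical
  refine ((Measure.isProjectiveLimit_infinitePi fun _ : ι => volume.restrict (Icc (0 : ℝ) 1)).unique
    fun s => ?_).symm
  refine (Measure.pi_eq_generateFrom (C := fun _ => range Iic)
    (fun _ => (borel_eq_generateFrom_Iic ℝ).symm.trans (BorelSpace.measurable_eq).symm)
    (fun _ => isPiSystem_Iic)
    (fun _ => ⟨fun n => Iic n, fun n => ⟨n, rfl⟩, fun n => measure_lt_top _ _,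
      by
        refine eq_univ_of_forall fun x => mem_iUnion.2 ?_
        exact (exists_nat_ge x)⟩) ?_).symm
  intro t ht
  choose a ha using ht
  rw [map_apply (by fun_prop)
    (MeasurableSet.univ_pi fun i => by rw [← ha i]; exact measurableSet_Iic)]
  have := h s fun i => if hi : i ∈ s then a ⟨i, hi⟩ else 0
  rw [← Finset.prod_coe_sort] at this
  have h2 : (s.restrict (π := fun _ => ℝ)) ⁻¹' (Set.univ.pi t) =
      {u | ∀ e ∈ s, u e ≤ if hi : e ∈ s then a ⟨e, hi⟩ else 0} := by
    ext u
    simp only [mem_preimage, mem_univ_pi, mem_ofPred_eq, Finset.restrict, Subtype.forall, ← ha,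
      mem_Iic]
    exact forall₂_congr fun a ha => by simp [ha]
  rw [h2, this]
  refine prod_congr rfl fun i _ => ?_
  have h3 : Iic (a i) ∩ Icc 0 1 = Icc 0 (min 1 (a i)) := by
    ext x; simp only [mem_inter_iff, mem_Iic, mem_Icc, le_min_iff]; tauto
  rw [← ha, Measure.restrict_apply measurableSet_Iic, h3, Real.volume_Icc, sub_zero]
  simp only [Finset.coe_mem, dite_true]
  rcases le_total 0 (a i) with h | h
  · rw [max_eq_left h, min_comm]
  · rw [max_eq_right h, min_eq_right (h.trans zero_le_one), ENNReal.ofReal_of_nonpos h]; simp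

end

section

theorem Adjacent.symm (h : Adjacent x y) : Adjacent y x := by
  unfold Adjacent at *
  simpa only [abs_sub_comm] using h

theorem isEdge_iff : IsEdge s(x, y) ↔ Adjacent x y := by
  constructor
  · rintro ⟨a, b, h, hab⟩
    rcases Sym2.eq_iff.1 hab with ⟨rfl, rfl⟩ | ⟨rfl, rfl⟩
    · exact h
    · exact h.symm
  · exact fun h => ⟨x, y, h, rfl⟩

/-- Directions: the `2 d` unit vectors. -/
abbrev Dir (d : ℕ) : Type := Fin d × Bool

/-- The unit vector of a direction. -/
def nb (ν : Dir d) : V d := Pi.single ν.1 (if ν.2 then 1 else -1)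

theorem abs_nb_le (ν : Dir d) (i : Fin d) : |nb ν i| ≤ 1 := by
  rcases ν with ⟨j, b⟩
  by_cases hi : i = j
  · subst hi; cases b <;> simp [nb]
  · simp [nb, hi]

theorem adjacent_add_nb (x : V d) (ν : Dir d) : Adjacent x (x + nb ν) := by
  unfold Adjacent
  rw [sum_eq_single ν.1]
  · rcases ν with ⟨i, b⟩; cases b <;> simp [nb]
  · intro j _ hj
    simp [nb, hj]
  · simp

theorem Adjacent.exists_nb (h : Adjacent x y) : ∃ ν : Dir d, y = x + nb ν := by
  unfold Adjacent at h
  obtain ⟨i, -, hi⟩ : ∃ i ∈ Finset.univ, |x i - y i| ≠ 0 := by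
    by_contra! hc
    rw [sum_eq_zero hc] at h
    exact zero_ne_one h
  have h1 : |x i - y i| = 1 ∧ ∀ j, j ≠ i → |x j - y j| = 0 := by
    rw [← Finset.add_sum_erase _ _ (Finset.mem_univ i)] at h
    have h0 : 0 ≤ ∑ j ∈ Finset.univ.erase i, |x j - y j| :=
      sum_nonneg fun j _ => abs_nonneg _
    have h2 : 0 < |x i - y i| := lt_of_le_of_ne (abs_nonneg _) (Ne.symm hi)
    refine ⟨by omega, fun j hj => ?_⟩
    have h3 : ∑ j ∈ Finset.univ.erase i, |x j - y j| = 0 := by omega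
    exact (Finset.sum_eq_zero_iff_of_nonneg fun j _ => abs_nonneg _).1 h3 j (by simp [hj])
  have hz : ∀ j, j ≠ i → y j = x j := fun j hj => by
    have := h1.2 j hj
    rw [abs_eq_zero] at this; omega
  rcases (abs_eq (zero_le_one)).1 h1.1 with h2 | h2
  · refine ⟨(i, false), ?_⟩
    ext j
    by_cases hj : j = i
    · subst hj; simp [nb]; omega
    · simp [nb, hj, hz j hj]
  · refine ⟨(i, true), ?_⟩
    ext j
    by_cases hj : j = i
    · subst hj; simp [nb]; omega
    · simp [nb, hj, hz j hj]

/-- The edge leaving `x` in direction `ν`. -/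
def edge (x : V d) (ν : Dir d) : Edge d :=
  ⟨s(x, x + nb ν), isEdge_iff.2 (adjacent_add_nb x ν)⟩

theorem openAdj_iff :
    OpenAdj ω x y ↔ ∃ ν, y = x + nb ν ∧ ω (edge x ν) = true := by
  constructor
  · rintro ⟨h, hω⟩
    obtain ⟨ν, rfl⟩ := (isEdge_iff.1 h).exists_nb
    exact ⟨ν, rfl, hω⟩
  · rintro ⟨ν, rfl, h⟩
    exact ⟨_, h⟩

theorem OpenAdj.symm (h : OpenAdj ω x y) : OpenAdj ω y x := by
  obtain ⟨h, hω⟩ := h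
  refine ⟨isEdge_iff.2 (isEdge_iff.1 h).symm, ?_⟩
  rw [← hω]
  congr 2
  exact Sym2.eq_swap

theorem OpenAdj.mono {ω ω' : Config d} (h : ∀ e, ω e = true → ω' e = true)
    (ho : OpenAdj ω x y) : OpenAdj ω' x y := ⟨ho.1, h _ ho.2⟩

/-- `x` and `y` are joined by an open path inside `S`. -/
def ConnIn (S : Set (V d)) (ω : Config d) (x y : V d) : Prop :=
  x ∈ S ∧ Relation.ReflTransGen (fun a b => OpenAdj ω a b ∧ a ∈ S ∧ b ∈ S) x y

/-- The open cluster of `x` inside `S`. -/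
def cl (S : Set (V d)) (ω : Config d) (x : V d) : Set (V d) := {y | ConnIn S ω x y}

variable {S S' Λ : Set (V d)} {ω ω' : Config d}

theorem ConnIn.refl (h : x ∈ S) : ConnIn S ω x x := ⟨h, .refl⟩

theorem ConnIn.left (h : ConnIn S ω x y) : x ∈ S := h.1

theorem ConnIn.right (h : ConnIn S ω x y) : y ∈ S := by
  obtain ⟨h1, h2⟩ := h
  cases h2 with
  | refl => exact h1
  | tail _ h => exact h.2.2

theorem ConnIn.symm (h : ConnIn S ω x y) : ConnIn S ω y x := by
  obtain ⟨hx, h⟩ := h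
  induction h with
  | refl => exact ⟨hx, .refl⟩
  | tail _ h ih => exact ⟨h.2.2, .head ⟨h.1.symm, h.2.2, h.2.1⟩ ih.2⟩

theorem ConnIn.trans (h : ConnIn S ω x y) (h' : ConnIn S ω y z) : ConnIn S ω x z :=
  ⟨h.1, h.2.trans h'.2⟩

theorem ConnIn.mono (hS : S ⊆ S') (h : ConnIn S ω x y) : ConnIn S' ω x y :=
  ⟨hS h.1, h.2.lift id fun _ _ hab => ⟨hab.1, hS hab.2.1, hS hab.2.2⟩⟩

theorem ConnIn.mono_conf (hω : ∀ e, ω e = true → ω' e = true) (h : ConnIn S ω x y) :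
    ConnIn S ω' x y := ⟨h.1, h.2.lift id fun _ _ hab => ⟨hab.1.mono hω, hab.2⟩⟩

theorem ConnIn.single (h : OpenAdj ω x y) (hx : x ∈ S) (hy : y ∈ S) : ConnIn S ω x y :=
  ⟨hx, .single ⟨h, hx, hy⟩⟩

theorem ConnIn.ind {p : V d → Prop} (h : ConnIn S ω x y) (h0 : p x)
    (hs : ∀ a b, ConnIn S ω x a → OpenAdj ω a b → b ∈ S → p a → p b) : p y := by
  obtain ⟨hx, h⟩ := h
  induction h with
  | refl => exact h0
  | tail h1 h2 ih => exact hs _ _ ⟨hx, h1⟩ h2.1 h2.2.2 ih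

theorem connected_iff : Connected ω x y ↔ ConnIn univ ω x y := by
  simp [Connected, ConnIn]

theorem cluster_eq : cluster ω x = cl univ ω x := by
  ext; exact connected_iff

/-- Edges with both ends in `S`. -/
def edgesIn (S : Set (V d)) : Set (Edge d) := {e | ∀ v ∈ e.1, v ∈ S}

/-- Edges with an end in `A`. -/
def touch (A : Set (V d)) : Set (Edge d) := {e | ∃ v ∈ e.1, v ∈ A}

theorem edge_mem_edgesIn {ν : Dir d} : edge x ν ∈ edgesIn S ↔ x ∈ S ∧ x + nb ν ∈ S := by
  simp [edge, edgesIn]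

theorem OpenAdj.congr (h : OpenAdj ω x y) (h' : ∀ h : IsEdge s(x, y), ω ⟨_, h⟩ = ω' ⟨_, h⟩) :
    OpenAdj ω' x y := ⟨h.1, (h' h.1) ▸ h.2⟩

theorem ConnIn.congr (h : ConnIn S ω x y) (h' : ∀ e ∈ edgesIn S, ω e = ω' e) :
    ConnIn S ω' x y :=
  ⟨h.1, h.2.lift id fun a b hab => ⟨hab.1.congr fun hh => h' _ (by
    simp only [edgesIn, mem_ofPred_eq, Sym2.mem_iff]
    rintro v (rfl | rfl)
    exacts [hab.2.1, hab.2.2]), hab.2⟩⟩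

theorem dep_connIn : Dep (edgesIn S) {ω | ConnIn S ω x y} := fun _ _ hω h => ConnIn.congr h hω

theorem incr_connIn : Incr {ω | ConnIn S ω x y} := fun _ _ hω h => ConnIn.mono_conf hω h

theorem dep_cl_eq {A : Set (V d)} (hx : x ∈ A) : Dep (edgesIn S ∩ touch A) {ω | cl S ω x = A} := by
  intro ω ω' hω h
  simp only [mem_ofPred_eq] at h ⊢
  have hin : ∀ a b, a ∈ S → b ∈ S → (a ∈ A) → ∀ h : IsEdge s(a, b), ω ⟨_, h⟩ = ω' ⟨_, h⟩ := by
    intro a b ha hb haA hh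
    refine hω _ ⟨?_, a, by simp, haA⟩
    simp only [edgesIn, mem_ofPred_eq, Sym2.mem_iff]
    rintro v (rfl | rfl)
    exacts [ha, hb]
  have hcl : ∀ y, ConnIn S ω x y ↔ y ∈ A := fun y => by rw [← h]; rfl
  ext y
  constructor
  · intro hy
    refine ConnIn.ind (p := fun y => y ∈ A) hy hx fun a b ha hab hb haA => ?_
    exact (hcl b).1 (((hcl a).2 haA).trans (.single (hab.congr fun hh =>
      (hin a b ha.right hb haA hh).symm) ha.right hb))
  · intro hy
    refine ConnIn.ind (p := fun y => ConnIn S ω' x y) ((hcl y).2 hy) (.refl ((hcl x).2 hx).1)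
      fun a b ha hab hb hc => ?_
    exact hc.trans (.single (hab.congr fun hh => hin a b ha.right hb ((hcl a).1 ha) hh) ha.right hb)

/-- Decomposition of a path at its last visit to `A`. -/
theorem ConnIn.last_exit {A : Set (V d)} (h : ConnIn Λ ω x u) (hx : x ∈ A) (hu : u ∉ A) :
    ∃ y ν, y ∈ A ∧ y ∈ Λ ∧ ω (edge y ν) = true ∧ ConnIn (Λ \ A) ω (y + nb ν) u := by
  have : u ∈ A ∨ ∃ y ν, y ∈ A ∧ y ∈ Λ ∧ ω (edge y ν) = true ∧ ConnIn (Λ \ A) ω (y + nb ν) u := by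
    refine ConnIn.ind (p := fun u => u ∈ A ∨ ∃ y ν, y ∈ A ∧ y ∈ Λ ∧ ω (edge y ν) = true ∧
      ConnIn (Λ \ A) ω (y + nb ν) u) h (.inl hx) fun a b ha hab hb hc => ?_
    by_cases hbA : b ∈ A
    · exact .inl hbA
    right
    rcases hc with hc | ⟨y, ν, h1, h2, h3, h4⟩
    · obtain ⟨ν, rfl, hν⟩ := openAdj_iff.1 hab
      exact ⟨a, ν, hc, ha.right, hν, .refl ⟨hb, hbA⟩⟩
    · exact ⟨y, ν, h1, h2, h3, h4.trans (.single hab h4.right ⟨hb, hbA⟩)⟩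
  exact this.resolve_left hu

instance : Countable (Edge d) := by
  have : Countable (Sym2 (V d)) := Quotient.countable
  exact Subtype.countable

theorem meas_reflTransGen {Ω α : Type*} [MeasurableSpace Ω] [Countable α]
    (r : Ω → α → α → Prop) (hr : ∀ a b, MeasurableSet {ω | r ω a b}) (a b : α) :
    MeasurableSet {ω | Relation.ReflTransGen (r ω) a b} := by
  classical
  let q : ℕ → α → Set Ω := fun n => n.rec (fun c => if a = c then univ else ∅) fun _ Q c =>
    ⋃ b, Q b ∩ {ω | r ω b c}
  have hq : ∀ n c, MeasurableSet (q n c) := by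
    intro n
    induction n with
    | zero => intro c; by_cases h : a = c <;> simp [q, h]
    | succ n ih => exact fun c => MeasurableSet.iUnion fun b => (ih b).inter (hr b c)
  have : {ω | Relation.ReflTransGen (r ω) a b} = ⋃ n, q n b := by
    ext ω
    simp only [mem_ofPred_eq, mem_iUnion]
    constructor
    · intro h
      induction h with
      | refl => exact ⟨0, by simp [q]⟩
      | tail _ h ih =>
        obtain ⟨n, hn⟩ := ih
        exact ⟨n + 1, mem_iUnion.2 ⟨_, hn, h⟩⟩
    · rintro ⟨n, hn⟩
      induction n generalizing b with
      | zero =>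
        by_cases h : a = b
        · subst h; exact .refl
        · simp [q, h] at hn
      | succ n ih =>
        obtain ⟨c, hc, h⟩ := mem_iUnion.1 hn
        exact (ih c hc).tail h
  rw [this]
  exact MeasurableSet.iUnion fun n => hq n b

theorem meas_openAdj : MeasurableSet {ω : Config d | OpenAdj ω x y} := by
  by_cases h : IsEdge s(x, y)
  · have : {ω : Config d | OpenAdj ω x y} = {ω | ω ⟨s(x, y), h⟩ = true} := by
      ext ω; exact ⟨fun h => h.2, fun h' => ⟨h, h'⟩⟩
    rw [this]; exact meas_coord _ _
  · have : {ω : Config d | OpenAdj ω x y} = ∅ := by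
      ext ω; simpa using fun h' : OpenAdj ω x y => h h'.1
    rw [this]; exact MeasurableSet.empty

theorem meas_connIn : MeasurableSet {ω : Config d | ConnIn S ω x y} := by
  refine MeasurableSet.inter (MeasurableSet.const _) (meas_reflTransGen _ (fun a b => ?_) x y)
  exact meas_openAdj.inter (MeasurableSet.const _)

theorem meas_cl_eq {A : Set (V d)} : MeasurableSet {ω : Config d | cl S ω x = A} := by
  have : {ω : Config d | cl S ω x = A} = ⋂ y, {ω | ConnIn S ω x y ↔ y ∈ A} := by
    ext ω; simp only [mem_ofPred_eq, Set.ext_iff, mem_iInter]; rfl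
  rw [this]
  refine MeasurableSet.iInter fun y => ?_
  by_cases h : y ∈ A
  · simpa [h] using meas_connIn
  · simp only [h, iff_false]
    exact meas_connIn.compl

end

/-- The indicator of a proposition. -/
def ind (P : Prop) : ENNReal := if P then 1 else 0

theorem ind_true {P : Prop} (h : P) : ind P = 1 := by simp [ind, h]

theorem ind_false {P : Prop} (h : ¬ P) : ind P = 0 := by simp [ind, h]

theorem ind_le_one {P : Prop} : ind P ≤ 1 := by by_cases h : P <;> simp [ind, h]

theorem ind_mono {P Q : Prop} (h : P → Q) : ind P ≤ ind Q := by
  by_cases hP : P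
  · simp [ind, hP, h hP]
  · simp [ind, hP]

section

/-- Bernoulli percolation with constant parameter. -/
noncomputable abbrev perc (d : ℕ) (p : ℝ) : Measure (Config d) := bern fun _ => p

/-- The probability that an edge is open. -/
def pE (p : ℝ) : ENNReal := ofReal (clamp p)

/-- The two-point function restricted to `S`. -/
def tau (p : ℝ) (S : Set (V d)) (x y : V d) : ENNReal := perc d p {ω | ConnIn S ω x y}

/-- Almost surely the cluster of `x` in `S` is finite. -/
def FinCl (p : ℝ) (S : Set (V d)) (x : V d) : Prop := ∀ᵐ ω ∂(perc d p), (cl S ω x).Finite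

variable {S S' Λ : Set (V d)}

theorem cl_subset : cl S ω x ⊆ S := fun _ h => ConnIn.right h

theorem cl_mono (h : S ⊆ S') : cl S ω x ⊆ cl S' ω x := fun _ h' => ConnIn.mono h h'

theorem finCl_of_finite (h : S.Finite) : FinCl p S x :=
  Filter.Eventually.of_forall fun _ => h.subset cl_subset

theorem FinCl.mono (h : FinCl p S' x) (hS : S ⊆ S') : FinCl p S x :=
  Filter.Eventually.mono h fun _ h => h.subset (cl_mono hS)

theorem tau_le_one : tau p S x y ≤ 1 := prob_le_one

theorem tau_mono (h : S ⊆ S') : tau p S x y ≤ tau p S' x y := measure_mono fun _ h' => ConnIn.mono h h'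

theorem tau_mono_p {q : ℝ} (h : p ≤ q) : tau p S x y ≤ tau q S x y :=
  bern_mono (fun _ => h) incr_connIn meas_connIn

theorem tau_symm : tau p S x y = tau p S y x := by
  unfold tau; congr 1; ext ω; exact ⟨ConnIn.symm, ConnIn.symm⟩

theorem tau_eq_zero_left (h : x ∉ S) : tau p S x y = 0 := by
  unfold tau
  rw [show {ω : Config d | ConnIn S ω x y} = ∅ from by
    ext ω; simpa using fun h' : ConnIn S ω x y => h h'.1]
  simp

theorem tau_eq_zero_right (h : y ∉ S) : tau p S x y = 0 := by
  rw [tau_symm, tau_eq_zero_left h]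

theorem tau_self (h : x ∈ S) : tau p S x x = 1 := by
  unfold tau
  rw [show {ω : Config d | ConnIn S ω x x} = univ from eq_univ_of_forall fun ω => .refl h]
  simp

theorem pE_le_one : pE p ≤ 1 := by
  simpa [pE] using (clamp_mem p).2

theorem perc_open (e : Edge d) : perc d p {ω | ω e = true} = pE p := bern_true _ _

/-- Independence of a cluster and the edges it does not explore. -/
theorem perc_cl_inter {A : Set (V d)} {K : Set (Edge d)} {B : Set (Config d)} (hx : x ∈ S)
    (hB : Dep K B) (mB : MeasurableSet B) (hK : Disjoint (edgesIn S ∩ touch A) K) :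
    perc d p ({ω | cl S ω x = A} ∩ B) = perc d p {ω | cl S ω x = A} * perc d p B := by
  by_cases h : x ∈ A
  · exact bern_inter (dep_cl_eq h) hB hK meas_cl_eq mB
  · have : {ω : Config d | cl S ω x = A} = ∅ := by
      ext ω
      simp only [mem_ofPred_eq, mem_empty_iff_false, iff_false]
      rintro rfl
      exact h (ConnIn.refl hx)
    simp [this]

theorem tsum_cl_mem (hfin : FinCl p S x) :
    ∑' A : Finset (V d), (if y ∈ A then perc d p {ω | cl S ω x = A} else 0) = tau p S x y := by
  have h : ∀ A : Finset (V d), (if y ∈ A then perc d p {ω | cl S ω x = A} else 0) =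
      perc d p ({ω | cl S ω x = A} ∩ {ω | ConnIn S ω x y}) := by
    intro A
    split_ifs with hy
    · congr 1
      ext ω
      simp only [mem_ofPred_eq, mem_inter_iff, iff_self_and]
      intro h
      have : y ∈ cl S ω x := by rw [h]; exact hy
      exact this
    · symm
      convert measure_empty (μ := perc d p)
      ext ω
      simp only [mem_ofPred_eq, mem_inter_iff, mem_empty_iff_false, iff_false, not_and]
      intro h hc
      have : y ∈ cl S ω x := hc
      rw [h] at this
      exact hy this
  simp_rw [h]
  rw [← measure_iUnion]
  · unfold tau
    refine measure_congr ?_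
    filter_upwards [hfin] with ω hω
    refine propext ⟨fun h => ?_, fun h => ?_⟩
    · obtain ⟨A, hA⟩ := mem_iUnion.1 h
      exact hA.2
    · exact mem_iUnion.2 ⟨hω.toFinset, by simp, h⟩
  · intro A B hAB
    refine disjoint_left.2 fun ω h1 h2 => hAB ?_
    exact coe_injective (h1.1.symm.trans h2.1)
  · exact fun A => meas_cl_eq.inter meas_connIn

theorem tsum_cl_sum (hfin : FinCl p S x) (f : V d → ENNReal) :
    ∑' A : Finset (V d), perc d p {ω | cl S ω x = A} * ∑ y ∈ A, f y = ∑' y, tau p S x y * f y := by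
  classical
  have h : ∀ A : Finset (V d), perc d p {ω | cl S ω x = A} * ∑ y ∈ A, f y =
      ∑' y, (if y ∈ A then perc d p {ω | cl S ω x = A} else 0) * f y := by
    intro A
    rw [tsum_eq_sum (s := A) fun y hy => by simp [hy], mul_sum]
    exact sum_ext fun y hy => by simp [hy]
  simp_rw [h]
  rw [tsum_comm]
  refine tsum_congr fun y => ?_
  rw [tsum_mul_right, tsum_cl_mem hfin]

/-- A set is covered by the values of a cluster. -/
theorem perc_le_tsum_cl (hfin : FinCl p S x) (E : Set (Config d)) :
    perc d p E ≤ ∑' A : Finset (V d), perc d p ({ω | cl S ω x = A} ∩ E) := by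
  calc perc d p E ≤ perc d p (⋃ A : Finset (V d), {ω | cl S ω x = A} ∩ E) := by
        refine measure_mono_ae ?_
        filter_upwards [hfin] with ω hω h
        exact mem_iUnion.2 ⟨hω.toFinset, by simp, h⟩
    _ ≤ _ := measure_iUnion_le _

theorem perc_open_inter_conn {A : Set (V d)} {ν : Dir d} (hx : x ∈ S) (hy : y ∈ A)
    (hyν : y + nb ν ∉ S) :
    perc d p ({ω | cl S ω x = A} ∩ ({ω | ω (edge y ν) = true} ∩ {ω | ConnIn (Λ \ A) ω z u})) =
      perc d p {ω | cl S ω x = A} * (pE p * tau p (Λ \ A) z u) := by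
  have hd : Disjoint {edge y ν} (edgesIn (Λ \ A)) := by
    rw [Set.disjoint_singleton_left, edge_mem_edgesIn]
    exact fun h => h.1.2 hy
  rw [perc_cl_inter hx (K := {edge y ν} ∪ edgesIn (Λ \ A)) (((dep_true _).mono subset_union_left).inter
      (dep_connIn.mono subset_union_right)) ((meas_coord _ _).inter meas_connIn),
    bern_inter (dep_true _) dep_connIn hd (meas_coord _ _) meas_connIn, bern_true]
  · rfl
  · rw [disjoint_left]
    rintro e ⟨h1, h2⟩ (h3 | h3)
    · rw [mem_singleton_iff] at h3
      subst h3
      exact hyν (edge_mem_edgesIn.1 h1).2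
    · obtain ⟨v, hv, hvA⟩ := h2
      exact (h3 v hv).2 hvA

/-- The Simon–Lieb inequality. -/
theorem simon_lieb (hx : x ∈ S) (hfin : FinCl p S x) :
    tau p Λ x u ≤ tau p S x u + ∑' y, tau p S x y *
      ∑ ν, ind (y + nb ν ∈ Λ \ S) * (pE p * tau p Λ (y + nb ν) u) := by
  have h1 : tau p Λ x u ≤ tau p S x u + perc d p {ω | ConnIn Λ ω x u ∧ ¬ ConnIn S ω x u} := by
    refine (measure_mono fun ω h => ?_).trans (measure_union_le _ _)
    by_cases h' : ConnIn S ω x u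
    · exact .inl h'
    · exact .inr ⟨h, h'⟩
  refine h1.trans (add_le_add le_rfl ?_)
  rw [← tsum_cl_sum hfin]
  refine (perc_le_tsum_cl hfin _).trans (tsum_le_tsum fun A => ?_)
  calc _ ≤ perc d p (⋃ y ∈ A, ⋃ ν ∈ (Finset.univ.filter fun ν : Dir d => y + nb ν ∈ Λ \ S),
        ({ω | cl S ω x = A} ∩ ({ω | ω (edge y ν) = true} ∩ {ω | ConnIn (Λ \ A) ω (y + nb ν) u}))) := by
        refine measure_mono fun ω ⟨h1, h2, h3⟩ => ?_
        rw [mem_ofPred_eq] at h1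
        have hu : u ∉ (A : Set (V d)) := by rw [← h1]; exact h3
        obtain ⟨y, ν, hy, hyΛ, ho, hc⟩ := h2.last_exit (A := A) (by rw [← h1]; exact .refl hx) hu
        have hyS : y + nb ν ∉ S := fun h => hc.left.2 <| by
          rw [← h1] at hy ⊢
          exact ConnIn.trans hy (.single (openAdj_iff.2 ⟨ν, rfl, ho⟩) (ConnIn.right hy) h)
        simp only [mem_iUnion]
        exact ⟨y, hy, ν, by simp [hyS, hc.left.1], h1, ho, hc⟩
    _ ≤ ∑ y ∈ A, ∑ ν ∈ (Finset.univ.filter fun ν : Dir d => y + nb ν ∈ Λ \ S), _ :=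
        (measure_biUnion_finset_le _ _).trans (sum_le_sum fun y _ => measure_biUnion_finset_le _ _)
    _ ≤ _ := by
        rw [mul_sum]
        refine sum_le_sum fun y hy => ?_
        rw [sum_filter, mul_sum]
        refine sum_le_sum fun ν _ => ?_
        split_ifs with hν
        · rw [perc_open_inter_conn hx hy hν.2, ind_true hν, one_mul]
          gcongr
          exact tau_mono sdiff_subset
        · exact zero_le

/-- Lattice automorphisms act on configurations. -/
def edgeMap (g : V d ≃ V d) (hg : ∀ x y, Adjacent x y → Adjacent (g x) (g y)) (e : Edge d) : Edge d :=
  ⟨e.1.map g, by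
    obtain ⟨x, y, h, he⟩ := e.2
    exact ⟨g x, g y, hg _ _ h, by rw [he]; rfl⟩⟩

theorem edgeMap_injective (g : V d ≃ V d) (hg : ∀ x y, Adjacent x y → Adjacent (g x) (g y)) :
    Injective (edgeMap g hg) := fun _ _ h =>
  Subtype.ext (Sym2.map.injective g.injective (congrArg Subtype.val h))

theorem connIn_edgeMap (g : V d ≃ V d) (hg : ∀ x y, Adjacent x y ↔ Adjacent (g x) (g y))
    : ConnIn (g ⁻¹' S) (fun e => ω (edgeMap g (fun x y => (hg x y).1) e)) x y ↔
      ConnIn S ω (g x) (g y) := by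
  have ho : ∀ a b, OpenAdj (fun e => ω (edgeMap g (fun x y => (hg x y).1) e)) a b ↔
      OpenAdj ω (g a) (g b) := fun a b =>
    ⟨fun h => ⟨isEdge_iff.2 ((hg _ _).1 (isEdge_iff.1 h.1)), h.2⟩,
     fun h => ⟨isEdge_iff.2 ((hg _ _).2 (isEdge_iff.1 h.1)), h.2⟩⟩
  constructor
  · rintro ⟨hx, h⟩
    exact ⟨hx, h.lift g fun a b hab => ⟨(ho a b).1 hab.1, hab.2⟩⟩
  · rintro ⟨hx, h⟩
    refine ⟨hx, ?_⟩
    have := h.lift (p := fun a b => OpenAdj (fun e => ω (edgeMap g (fun x y => (hg x y).1) e)) a b ∧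
      a ∈ g ⁻¹' S ∧ b ∈ g ⁻¹' S) g.symm fun a b hab =>
      ⟨(ho _ _).2 (by simpa using hab.1), by simpa using hab.2.1, by simpa using hab.2.2⟩
    simpa [Function.onFun] using this

theorem perc_edgeMap (g : V d ≃ V d) (hg : ∀ x y, Adjacent x y → Adjacent (g x) (g y))
    (mA : MeasurableSet A) :
    perc d p {ω | (fun e => ω (edgeMap g hg e)) ∈ A} = perc d p A :=
  bern_reindex (edgeMap_injective g hg) mA

theorem tau_equiv (g : V d ≃ V d) (hg : ∀ x y, Adjacent x y ↔ Adjacent (g x) (g y)) :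
    tau p S (g x) (g y) = tau p (g ⁻¹' S) x y := by
  unfold tau
  rw [← perc_edgeMap g (fun x y => (hg x y).1)
    (A := {ω | ConnIn (g ⁻¹' S) ω x y}) meas_connIn]
  congr 1
  ext ω
  exact (connIn_edgeMap g hg).symm

theorem adjacent_add (a x y : V d) : Adjacent x y ↔ Adjacent (x + a) (y + a) := by
  simp [Adjacent]

theorem tau_add (a : V d) : tau p S (x + a) (y + a) = tau p ((· + a) ⁻¹' S) x y :=
  tau_equiv (addRight a) fun x y => adjacent_add a x y

theorem tau_univ_add (a : V d) : tau p univ (x + a) (y + a) = tau p univ x y := by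
  rw [tau_add]; simp

end

section

variable {ι : Type*}

/-- The event that `A` holds after setting coordinate `e` to `b`. -/
def setTo (e : ι) (b : Bool) (A : Set (ι → Bool)) : Set (ι → Bool) :=
  {ω | update ω e b ∈ A}

theorem fprob_insert {F : Finset ι} {e : ι} (he : e ∉ F) (A : Set (ι → Bool)) (P : ι → ℝ) :
    fprob (insert e F) A P = P e * fprob F (setTo e true A) P + (1 - P e) * fprob F (setTo e false A) P := by
  have h1 : ∀ T ∈ F.powerset, conf (insert e T) ∈ A ↔ conf T ∈ setTo e true A := by
    intro T hT
    have : conf (insert e T) = update (conf T) e true := by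
      ext i; by_cases h : i = e
      · subst h; simp [conf]
      · simp [conf, h]
    simp [setTo, this]
  have h0 : ∀ T ∈ F.powerset, conf T ∈ A ↔ conf T ∈ setTo e false A := by
    intro T hT
    have heT : e ∉ T := fun h => he (Finset.mem_powerset.1 hT h)
    have : update (conf T) e false = conf T := by
      ext i; by_cases h : i = e
      · subst h; simp [conf, heT]
      · simp [h]
    simp [setTo, this]
  unfold fprob
  rw [Finset.sum_powerset_insert he, add_comm, mul_sum, mul_sum]
  congr 1
  · refine sum_ext fun T hT => ?_
    have heT : e ∉ T := fun h => he (Finset.mem_powerset.1 hT h)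
    rw [if_congr (h1 T hT) rfl rfl, mul_ite, mul_zero]
    congr 1
    rw [prod_insert heT, Finset.insert_sdiff_insert, Finset.sdiff_insert_of_notMem he]
    ring
  · refine sum_ext fun T hT => ?_
    have heT : e ∉ T := fun h => he (Finset.mem_powerset.1 hT h)
    rw [if_congr (h0 T hT) rfl rfl, mul_ite, mul_zero]
    congr 1
    rw [Finset.insert_sdiff_of_notMem _ heT, prod_insert (by simp [he])]
    ring

theorem setTo_comm {e e' : ι} (h : e ≠ e') (b b' : Bool) (A : Set (ι → Bool)) :
    setTo e b (setTo e' b' A) = setTo e' b' (setTo e b A) := by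
  ext ω; simp only [setTo, mem_ofPred_eq]; rw [Function.update_comm h]

theorem setTo_self {e : ι} (b b' : Bool) (A : Set (ι → Bool)) :
    setTo e b (setTo e b' A) = setTo e b' A := by
  ext ω; simp [setTo]

/-- Russo's formula. -/
theorem hasDerivAt_fprob (F : Finset ι) (A : Set (ι → Bool)) (p : ℝ) :
    HasDerivAt (fun p => fprob F A fun _ => p)
      (∑ e ∈ F, (fprob F (setTo e true A) (fun _ => p) - fprob F (setTo e false A) fun _ => p)) p := by
  induction F using induction_on generalizing A with
  | empty =>
    have : (fun p : ℝ => fprob (∅ : Finset ι) A fun _ => p) = fun _ => fprob (∅ : Finset ι) A fun _ => (0 : ℝ) := by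
      ext p; simp [fprob]
    rw [this]
    simpa using hasDerivAt_const p _
  | insert e F he ih =>
    have h1 := (hasDerivAt_id p).mul (ih (setTo e true A))
    have h0 := ((hasDerivAt_const p (1 : ℝ)).sub (hasDerivAt_id p)).mul (ih (setTo e false A))
    have := h1.add h0
    simp only [id, Pi.sub_apply] at this
    refine (this.congr_deriv ?_).congr_of_eventuallyEq (Filter.Eventually.of_forall fun q => ?_)
    · rw [sum_insert he]
      simp only [fprob_insert he, setTo_self]
      have : ∀ x ∈ F, p * fprob F (setTo e true (setTo x true A)) (fun _ => p) +
            (1 - p) * fprob F (setTo e false (setTo x true A)) (fun _ => p) -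
          (p * fprob F (setTo e true (setTo x false A)) (fun _ => p) +
            (1 - p) * fprob F (setTo e false (setTo x false A)) fun _ => p) =
          p * (fprob F (setTo x true (setTo e true A)) (fun _ => p) -
            fprob F (setTo x false (setTo e true A)) fun _ => p) +
          (1 - p) * (fprob F (setTo x true (setTo e false A)) (fun _ => p) -
            fprob F (setTo x false (setTo e false A)) fun _ => p) := by
        intro x hx
        have hne : e ≠ x := fun h => he (h ▸ hx)
        rw [setTo_comm hne, setTo_comm hne, setTo_comm hne, setTo_comm hne]; ring
      rw [sum_congr rfl this, sum_add_distrib, ← mul_sum, ← mul_sum]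
      ring
    · simp [fprob_insert he]

theorem dep_setTo {F : Set ι} {A : Set (ι → Bool)} (hA : Dep F A) (e : ι) (b : Bool) :
    Dep F (setTo e b A) := fun ω ω' h hω => hA _ _ (fun i hi => by
  by_cases h' : i = e
  · subst h'; simp
  · simp [h', h i hi]) hω

theorem fprob_nonneg {P : ι → ℝ} (hP : ∀ i, P i ∈ Icc 0 1) (F : Finset ι) (A : Set (ι → Bool)) :
    0 ≤ fprob F A P := by
  refine sum_nonneg fun T _ => ?_
  split_ifs
  · exact mul_nonneg (prod_nonneg fun i _ => (hP i).1)
        (prod_nonneg fun i _ => by linarith [(hP i).2])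
  · exact le_rfl

/-- Lower bound on the derivative of an increasing event by configurations where `e` is pivotal. -/
theorem toReal_le_pivotal {F : Finset ι} {A W : Set (ι → Bool)} (hA : Dep (↑F) A)
    {e : ι} {P : ι → ℝ} (hP : ∀ i, P i ∈ Icc 0 1)
    (hi : Incr A) (h1 : ∀ ω ∈ W, update ω e true ∈ A) (h0 : ∀ ω ∈ W, ω ∉ A) :
    (bern P W).toReal ≤ fprob F (setTo e true A) P - fprob F (setTo e false A) P := by
  have e1 := bern_eq_fprob hP (dep_setTo hA e true)
  have e0 := bern_eq_fprob hP (dep_setTo hA e false)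
  have hsub : setTo e false A ⊆ setTo e true A := fun ω h => hi _ _ (fun i hi => by
    by_cases h' : i = e
    · subst h'; simp
    · simpa [h'] using hi) h
  have hdis : Disjoint W (setTo e false A) := disjoint_left.2 fun ω hω h => h0 ω hω <|
    hi _ _ (fun i hi => by
    by_cases h' : i = e
    · subst h'; simp at hi
    · simpa [h'] using hi) h
  have hu : bern P W + bern P (setTo e false A) ≤ bern P (setTo e true A) := by
    rw [← measure_union hdis (meas_of_dep (dep_setTo hA e false))]
    exact measure_mono (union_subset (fun ω hω => h1 ω hω) hsub)
  rw [e1, e0] at hu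
  have := ENNReal.toReal_mono (by simp) hu
  rw [ENNReal.toReal_add (measure_ne_top _ _) (by simp), toReal_ofReal (fprob_nonneg hP _ _),
    toReal_ofReal (fprob_nonneg hP _ _)] at this
  linarith

end

section

/-- `x` is joined inside `Λ` to a vertex having a neighbour outside `Λ`. -/
def Reach (Λ : Set (V d)) (ω : Config d) (x : V d) : Prop :=
  ∃ t, (∃ ν, t + nb ν ∉ Λ) ∧ ConnIn Λ ω x t

theorem ConnIn.inter_or_exit {Λ Λ' : Set (V d)} {x t : V d} (h : ConnIn Λ ω x t) (hx : x ∈ Λ') :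
    ConnIn (Λ ∩ Λ') ω x t ∨ ∃ y, (∃ ν, y + nb ν ∉ Λ') ∧ ConnIn (Λ ∩ Λ') ω x y := by
  by_contra! hc
  refine hc.1 (h.ind (.refl ⟨h.left, hx⟩) fun a b _ hab hb ha => ha.trans (.single hab ha.right ⟨hb, ?_⟩))
  obtain ⟨ν, rfl, -⟩ := openAdj_iff.1 hab
  by_contra hν
  exact hc.2 a ⟨ν, hν⟩ ha

theorem Reach.anti {Λ Λ' : Set (V d)} (h : Λ' ⊆ Λ) (hx : x ∈ Λ') (hr : Reach Λ ω x) : Reach Λ' ω x := by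
  obtain ⟨t, ⟨ν, ht⟩, hc⟩ := hr
  rcases hc.inter_or_exit hx with h' | ⟨y, hy, h'⟩
  · exact ⟨t, ⟨ν, fun h'' => ht (h h'')⟩, h'.mono inter_subset_right⟩
  · exact ⟨y, hy, h'.mono inter_subset_right⟩

theorem ConnIn.of_not_reach {Λ : Set (V d)} {v t : V d} (hv : v ∈ Λ) (hr : ¬ Reach Λ ω v) (h : ConnIn univ ω v t) : ConnIn Λ ω v t :=
  (h.inter_or_exit hv).elim (·.mono inter_subset_right) fun ⟨y, hy, h'⟩ => absurd ⟨y, hy, h'.mono inter_subset_right⟩ hr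

/-- The expected number of boundary edges of `S` reached from the seeds `W` inside `S`. -/
def flux (p : ℝ) (W S : Finset (V d)) : ENNReal :=
  ∑ y ∈ S, ∑ ν, ind (y + nb ν ∉ S) * perc d p {ω | ∃ v ∈ W, ConnIn S ω v y}

/-- All edges starting in `Λ`. -/
def edgesOf (Λ : Finset (V d)) : Finset (Edge d) :=
  (Λ ×ˢ (Finset.univ : Finset (Dir d))).image fun a => edge a.1 a.2

theorem exists_edge (e : Edge d) : ∃ x ν, e = edge x ν := by
  obtain ⟨e, x, y, h, rfl⟩ := e
  obtain ⟨ν, rfl⟩ := h.exists_nb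
  exact ⟨x, ν, rfl⟩

theorem edgesIn_subset_edgesOf (Λ : Finset (V d)) : edgesIn (Λ : Set (V d)) ⊆ edgesOf Λ := by
  intro e he
  obtain ⟨x, ν, rfl⟩ := exists_edge e
  simp only [edgesOf, Finset.coe_image, mem_image, mem_coe, mem_product]
  exact ⟨(x, ν), ⟨(edge_mem_edgesIn.1 he).1, Finset.mem_univ _⟩, rfl⟩

theorem nb_injective : Injective (nb : Dir d → V d) := by
  rintro ⟨i, b⟩ ⟨j, c⟩ h
  have hij : i = j := by
    by_contra hij
    have := congrFun h i
    cases b <;> simp [nb, hij] at this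
  subst hij
  have := congrFun h i
  cases b <;> cases c <;> simp [nb] at this ⊢

variable {W Λ S : Finset (V d)} {ω ω' : Config d}

/-- The vertices of `Λ` not reaching the boundary. -/
def lost (Λ : Finset (V d)) (ω : Config d) : Finset (V d) := Λ.filter fun x => ¬ Reach Λ ω x

theorem dep_lost : Dep (edgesIn Λ ∩ touch ((S : Set (V d))ᶜ)) {ω | lost Λ ω = S} := by
  intro ω ω' hω h
  rw [mem_ofPred_eq] at h ⊢
  have hR : ∀ x ∈ Λ, (Reach Λ ω x ↔ x ∉ S) := fun x hx => by
    rw [← h]; simp [lost, hx]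
  have hE : ∀ a b, a ∈ Λ → b ∈ Λ → a ∉ S → ∀ h : IsEdge s(a, b), ω ⟨_, h⟩ = ω' ⟨_, h⟩ := by
    intro a b ha hb haS h
    refine hω _ ⟨?_, a, by simp, haS⟩
    simp only [edgesIn, mem_ofPred_eq, Sym2.mem_iff]
    rintro v (rfl | rfl)
    exacts [ha, hb]
  have key : ∀ x ∈ Λ, (Reach Λ ω x ↔ Reach Λ ω' x) := by
    intro x hx
    constructor
    · rintro ⟨t, ht, hc⟩
      refine ⟨t, ht, ConnIn.symm ?_⟩
      refine hc.symm.ind (p := fun y => ConnIn Λ ω' t y) (.refl hc.right) ?_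
      intro a b ha hab hb hc'
      refine hc'.trans (.single (hab.congr (hE a b ha.right hb ?_)) ha.right hb)
      exact (hR a ha.right).1 ⟨t, ht, ha.symm⟩
    · rintro ⟨t, ht, hc⟩
      refine ⟨t, ht, ConnIn.symm ?_⟩
      refine hc.symm.ind (p := fun y => ConnIn Λ ω t y) (.refl hc.right) ?_
      intro a b ha hab hb hc'
      refine hc'.trans (.single (hab.congr fun hh => (hE a b ha.right hb ?_ hh).symm) ha.right hb)
      exact (hR a ha.right).1 ⟨t, ht, hc'.symm⟩
  rw [← h]
  unfold lost
  exact Finset.filter_congr fun x hx => not_congr (key x hx).symm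

theorem dep_reach : Dep (edgesIn Λ) {ω | ∃ v ∈ W, Reach Λ ω v} := by
  rintro ω ω' hω ⟨v, hv, t, ht, hc⟩
  exact ⟨v, hv, t, ht, hc.congr hω⟩

theorem incr_reach : Incr {ω | ∃ v ∈ W, Reach Λ ω v} := by
  rintro ω ω' hω ⟨v, hv, t, ht, hc⟩
  exact ⟨v, hv, t, ht, hc.mono_conf hω⟩

/-- `ω` lets the seeds be lost and joins them to `y` whose `ν`-neighbour is not lost. -/
def pivotalAt (W Λ : Finset (V d)) (y : V d) (ν : Dir d) (S : Finset (V d)) : Set (Config d) :=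
  {_ω | W ⊆ S ∧ y + nb ν ∉ S} ∩ ({ω | lost Λ ω = S} ∩ {ω | ∃ v ∈ W, ConnIn S ω v y})

theorem meas_conn_seeds : MeasurableSet {ω : Config d | ∃ v ∈ W, ConnIn S ω v y} := by
  have : {ω : Config d | ∃ v ∈ W, ConnIn S ω v y} = ⋃ v ∈ W, {ω | ConnIn S ω v y} := by
    ext; simp
  rw [this]
  exact measurableSet_biUnion _ fun v _ => meas_connIn

theorem dep_conn_seeds : Dep (edgesIn S) {ω : Config d | ∃ v ∈ W, ConnIn S ω v y} := by
  rintro ω ω' hω ⟨v, hv, h⟩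
  exact ⟨v, hv, h.congr hω⟩

theorem meas_lost : MeasurableSet {ω : Config d | lost Λ ω = S} :=
  meas_of_dep (F := edgesOf Λ)
    (dep_lost.mono (inter_subset_left.trans (edgesIn_subset_edgesOf Λ)))

theorem meas_pivotalAt (y : V d) (ν : Dir d) : MeasurableSet (pivotalAt W Λ y ν S) :=
  (MeasurableSet.const _).inter (meas_lost.inter meas_conn_seeds)

theorem perc_pivotalAt (y : V d) (ν : Dir d) :
    perc d p (pivotalAt W Λ y ν S) = if W ⊆ S ∧ y + nb ν ∉ S then
      perc d p {ω | lost Λ ω = S} * perc d p {ω | ∃ v ∈ W, ConnIn S ω v y} else 0 := by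
  unfold pivotalAt
  split_ifs with h
  · simp only [h, and_self, not_false_eq_true]
    rw [show ({_ω : Config d | True} : Set (Config d)) = univ from rfl, univ_inter]
    refine bern_inter dep_lost dep_conn_seeds ?_ meas_lost meas_conn_seeds
    rw [disjoint_left]
    rintro e ⟨-, v, hv, hvS⟩ h
    exact hvS (h v hv)
  · simp only [h]
    rw [show ({_ω : Config d | False} : Set (Config d)) = ∅ from rfl, empty_inter, measure_empty]

theorem update_mem_of_pivotalAt {ν : Dir d} (h : ω ∈ pivotalAt W Λ y ν S) :
    update ω (edge y ν) true ∈ {ω | ∃ v ∈ W, Reach Λ ω v} := by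
  obtain ⟨⟨hWS, hyν⟩, hl, v, hv, hc⟩ := h
  rw [mem_ofPred_eq] at hl
  have hSΛ : ∀ x, x ∈ S → x ∈ Λ ∧ ¬ Reach Λ ω x := fun x hx => by
    rw [← hl] at hx; simpa [lost] using hx
  have hy := hSΛ y hc.right
  have hyν' : y + nb ν ∈ Λ := by
    by_contra h
    exact hy.2 ⟨y, ⟨ν, h⟩, .refl hy.1⟩
  have hr : Reach Λ ω (y + nb ν) := by
    by_contra h
    exact hyν (by rw [← hl]; simp [lost, hyν', h])
  obtain ⟨t, ht, hct⟩ := hr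
  have hup : ∀ e, ω e = true → update ω (edge y ν) true e = true := fun e he => by
    by_cases h : e = edge y ν
    · subst h; simp
    · simp [h, he]
  refine ⟨v, hv, t, ht, ?_⟩
  refine ((hc.mono fun x hx => (hSΛ x hx).1).mono_conf hup).trans (ConnIn.trans (.single ?_ hy.1 hyν')
    (hct.mono_conf hup))
  exact openAdj_iff.2 ⟨ν, rfl, by simp⟩

theorem not_mem_of_pivotalAt {ν : Dir d} (h : ω ∈ pivotalAt W Λ y ν S) :
    ω ∉ {ω | ∃ v ∈ W, Reach Λ ω v} := by
  obtain ⟨⟨hWS, hyν⟩, hl, -⟩ := h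
  rw [mem_ofPred_eq] at hl
  rintro ⟨v, hv, hr⟩
  have := hWS hv
  rw [← hl] at this
  exact (mem_filter.1 this).2 hr

theorem pivotalAt_disjoint {a b : V d × Dir d} (hab : a ≠ b) (he : edge a.1 a.2 = edge b.1 b.2)
    {S S' : Finset (V d)} : Disjoint (pivotalAt W Λ a.1 a.2 S) (pivotalAt W Λ b.1 b.2 S') := by
  rw [disjoint_left]
  rintro ω ⟨⟨-, ha⟩, hl, v, -, hc⟩ ⟨⟨-, hb⟩, hl', v', -, hc'⟩
  have hS : S = S' := hl.symm.trans hl'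
  subst hS
  obtain ⟨x, ν⟩ := a
  obtain ⟨y, ν'⟩ := b
  simp only [edge, Subtype.mk.injEq, Sym2.eq_iff] at he
  rcases he with ⟨rfl, h⟩ | ⟨h1, h2⟩
  · exact hab (by rw [nb_injective (add_left_cancel h)])
  · exact hb (by rw [← h1]; exact hc.right)

theorem sum_pivotalAt_ge {c : ENNReal} (hWΛ : W ⊆ Λ)
    (hc : ∀ S : Finset (V d), W ⊆ S → S ⊆ Λ → (∀ y ∈ S, ∀ ν, y + nb ν ∈ Λ) → c ≤ flux p W S) :
    c * perc d p {ω | ∃ v ∈ W, Reach Λ ω v}ᶜ ≤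
      ∑ a ∈ Λ ×ˢ (Finset.univ : Finset (Dir d)), ∑ S ∈ Λ.powerset, perc d p (pivotalAt W Λ a.1 a.2 S) := by
  have h1 : perc d p {ω | ∃ v ∈ W, Reach Λ ω v}ᶜ ≤
      ∑ S ∈ Λ.powerset, if W ⊆ S then perc d p {ω | lost Λ ω = S} else 0 := by
    rw [← sum_filter]
    refine (measure_mono fun ω hω => ?_).trans (measure_biUnion_finset_le _ _)
    simp only [mem_iUnion]
    refine ⟨lost Λ ω, ?_, rfl⟩
    simp only [mem_filter, Finset.mem_powerset]
    refine ⟨filter_subset _ _, fun v hv => ?_⟩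
    simp only [lost, mem_filter]
    exact ⟨hWΛ hv, fun hr => hω ⟨v, hv, hr⟩⟩
  refine (mul_le_mul_right h1 c).trans ?_
  rw [sum_comm, mul_sum]
  refine sum_le_sum fun S hS => ?_
  rw [Finset.mem_powerset] at hS
  split_ifs with hW
  swap; · simp
  by_cases hb : ∀ y ∈ S, ∀ ν, y + nb ν ∈ Λ
  · calc c * perc d p {ω | lost Λ ω = S} ≤ flux p W S * perc d p {ω | lost Λ ω = S} := by
          gcongr; exact hc S hW hS hb
      _ = ∑ a ∈ S ×ˢ (Finset.univ : Finset (Dir d)), perc d p (pivotalAt W Λ a.1 a.2 S) := by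
          rw [flux, sum_mul, sum_product]
          refine sum_ext fun y _ => ?_
          rw [sum_mul]
          refine sum_ext fun ν _ => ?_
          rw [perc_pivotalAt]
          by_cases h : y + nb ν ∉ S
          · simp [hW, mul_comm, ind, h]
          · simp [hW, ind, h]
      _ ≤ _ := sum_le_sum_of_subset (Finset.product_subset_product_left hS)
  · have : {ω : Config d | lost Λ ω = S} = ∅ := by
      ext ω
      simp only [mem_ofPred_eq, mem_empty_iff_false, iff_false]
      rintro rfl
      refine hb fun y hy ν => ?_
      by_contra h
      exact (mem_filter.1 hy).2 ⟨y, ⟨ν, h⟩, .refl (mem_filter.1 hy).1⟩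
    simp [this]

theorem flux_mono {q : ℝ} (h : p ≤ q) : flux p W S ≤ flux q W S := by
  refine sum_le_sum fun y _ => sum_le_sum fun ν _ => ?_
  refine mul_le_mul' le_rfl (bern_mono (fun _ => h) ?_ meas_conn_seeds)
  rintro ω ω' hω ⟨v, hv, h⟩
  exact ⟨v, hv, h.mono_conf hω⟩

/-- If every set containing the seeds has a large flux, the seeds reach the boundary
with high probability after increasing the parameter. -/
theorem perc_not_reach_le {c p₀ p₁ : ℝ} (h0 : 0 ≤ p₀) (h01 : p₀ ≤ p₁) (h1 : p₁ ≤ 1) (hc0 : 0 ≤ c) (hWΛ : W ⊆ Λ)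
    (hc : ∀ S : Finset (V d), W ⊆ S → S ⊆ Λ → (∀ y ∈ S, ∀ ν, y + nb ν ∈ Λ) →
      ofReal c ≤ flux p₀ W S) :
    perc d p₁ {ω | ∃ v ∈ W, Reach Λ ω v}ᶜ ≤ ofReal (exp (-c * (p₁ - p₀))) := by
  set A : Set (Config d) := {ω | ∃ v ∈ W, Reach Λ ω v} with hA
  set F := edgesOf Λ with hF
  have hdep : Dep (F : Set (Edge d)) A := dep_reach.mono (edgesIn_subset_edgesOf Λ)
  let f : ℝ → ℝ := fun p => fprob F A fun _ => p
  have hf : ∀ p ∈ Icc 0 1, perc d p Aᶜ = ofReal (1 - f p) := by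
    intro p hp
    rw [prob_compl_eq_one_sub (meas_of_dep hdep), bern_eq_fprob (fun _ => hp) hdep,
      ofReal_sub _ (fprob_nonneg (fun _ => hp) _ _), ofReal_one]
  have hf1 : ∀ p ∈ Icc 0 1, 0 ≤ f p ∧ f p ≤ 1 := by
    intro p hp
    refine ⟨fprob_nonneg (fun _ => hp) _ _, ?_⟩
    have := bern_eq_fprob (fun _ => hp) hdep (P := fun _ => p)
    have h2 : ofReal (f p) ≤ 1 := by rw [← this]; exact prob_le_one
    simpa using h2
  let D : ℝ → ℝ := fun p => ∑ e ∈ F, (fprob F (setTo e true A) (fun _ => p) - fprob F (setTo e false A) fun _ => p)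
  have hder : ∀ p, HasDerivAt f (D p) p := fun p => hasDerivAt_fprob F A p
  have hD : ∀ p ∈ Icc p₀ p₁, c * (1 - f p) ≤ D p := by
    intro p hp
    have hpI : p ∈ Icc 0 1 := ⟨h0.trans hp.1, hp.2.trans h1⟩
    have hs := sum_pivotalAt_ge (p := p) (c := ofReal c) hWΛ
      fun S a b e => (hc S a b e).trans (flux_mono hp.1)
    rw [← hA, hf p hpI, ← ofReal_mul hc0] at hs
    have hmaps : ∀ a ∈ Λ ×ˢ (Finset.univ : Finset (Dir d)), edge a.1 a.2 ∈ F := fun a ha =>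
      Finset.mem_image_of_mem (fun a : V d × Dir d => edge a.1 a.2) ha
    rw [← Finset.sum_fiberwise_of_maps_to hmaps] at hs
    have hbound : ∀ e ∈ F, ∑ a ∈ Λ ×ˢ (Finset.univ : Finset (Dir d)) with edge a.1 a.2 = e,
        ∑ S ∈ Λ.powerset, perc d p (pivotalAt W Λ a.1 a.2 S) ≤
        ofReal (fprob F (setTo e true A) (fun _ => p) - fprob F (setTo e false A) fun _ => p) := by
      intro e he
      have hu : ∑ a ∈ Λ ×ˢ (Finset.univ : Finset (Dir d)) with edge a.1 a.2 = e,
          ∑ S ∈ Λ.powerset, perc d p (pivotalAt W Λ a.1 a.2 S) =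
          perc d p (⋃ a ∈ (Λ ×ˢ (Finset.univ : Finset (Dir d))).filter (fun a => edge a.1 a.2 = e),
            ⋃ S ∈ Λ.powerset, pivotalAt W Λ a.1 a.2 S) := by
        rw [measure_biUnion_finset]
        · refine sum_ext fun a _ => ?_
          rw [measure_biUnion_finset]
          · intro S _ S' _ hSS
            exact disjoint_left.2 fun ω h h' => hSS (h.2.1.symm.trans h'.2.1)
          · exact fun S _ => meas_pivotalAt _ _
        · intro a ha b hb hab
          simp only [Finset.coe_filter, mem_ofPred_eq] at ha hb
          refine disjoint_left.2 fun ω h h' => ?_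
          simp only [mem_iUnion] at h h'
          obtain ⟨S, -, h⟩ := h
          obtain ⟨S', -, h'⟩ := h'
          exact disjoint_left.1 (pivotalAt_disjoint hab (ha.2.trans hb.2.symm)) h h'
        · exact fun a _ => measurableSet_biUnion _ fun S _ => meas_pivotalAt _ _
      rw [hu, ← ofReal_toReal (measure_ne_top (perc d p) _)]
      refine ofReal_le_ofReal (toReal_le_pivotal hdep (fun _ => hpI) incr_reach ?_ ?_)
      · intro ω hω
        simp only [mem_iUnion] at hω
        obtain ⟨a, ha, S, -, h⟩ := hω
        rw [← (mem_filter.1 ha).2]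
        convert update_mem_of_pivotalAt h
      · intro ω hω
        simp only [mem_iUnion] at hω
        obtain ⟨a, ha, S, -, h⟩ := hω
        exact not_mem_of_pivotalAt h
    have hnn : ∀ e ∈ F, 0 ≤ fprob F (setTo e true A) (fun _ => p) - fprob F (setTo e false A) fun _ => p := by
      intro e _
      have := toReal_le_pivotal (W := ∅) (e := e) (P := fun _ => p) hdep (fun _ => hpI) incr_reach (by simp) (by simp)
      simpa using this
    have := hs.trans (sum_le_sum hbound)
    rw [← ofReal_sum_of_nonneg hnn] at this
    exact (ofReal_le_ofReal_iff (sum_nonneg hnn)).1 this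
  have hanti : AntitoneOn (fun p => (1 - f p) * exp (c * p)) (Icc p₀ p₁) := by
    have hd : ∀ p, HasDerivAt (fun p => (1 - f p) * exp (c * p))
        ((-D p + c * (1 - f p)) * exp (c * p)) p := by
      intro p
      have h2 : HasDerivAt (fun p => exp (c * p)) (exp (c * p) * (c * 1)) p :=
        ((hasDerivAt_id p).const_mul c).exp
      have := ((hder p).const_sub 1).mul h2
      refine this.congr_deriv ?_
      ring
    refine antitoneOn_of_deriv_nonpos (convex_Icc _ _) ?_ ?_ ?_
    · exact fun p _ => (hd p).continuousAt.continuousWithinAt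
    · exact fun p _ => (hd p).differentiableAt.differentiableWithinAt
    · intro p hp
      rw [interior_Icc] at hp
      rw [(hd p).deriv]
      have := hD p ⟨hp.1.le, hp.2.le⟩
      exact mul_nonpos_of_nonpos_of_nonneg (by linarith) (exp_pos _).le
  have hfin := hanti (left_mem_Icc.2 h01) (right_mem_Icc.2 h01) h01
  simp only at hfin
  rw [hf p₁ ⟨h0.trans h01, h1⟩]
  refine ofReal_le_ofReal ?_
  have h3 := (hf1 p₀ ⟨h0, h01.trans h1⟩).1
  have h4 : (1 - f p₁) * exp (c * p₁) ≤ exp (c * p₀) :=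
    hfin.trans (mul_le_of_le_one_left (exp_pos _).le (by linarith))
  rw [show -c * (p₁ - p₀) = c * p₀ - c * p₁ by ring, Real.exp_sub, le_div_iff₀ (exp_pos _)]
  exact h4

end

section
variable {p q : ℝ}

theorem clamp_clamp (p : ℝ) : clamp (clamp p) = clamp p := clamp_of_mem (clamp_mem p)

theorem continuous_clamp : Continuous clamp := by unfold clamp; fun_prop

theorem bern_clamp {ι : Type*} (P : ι → ℝ) : bern (fun i => clamp (P i)) = bern P := by
  unfold bern; congr; funext i; unfold bern1; rw [clamp_clamp]

theorem continuous_fprob {ι : Type*} (F : Finset ι) (A : Set (ι → Bool)) : Continuous fun P => fprob F A P := by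
  unfold fprob
  refine continuous_finsetSum _ fun T _ => ?_
  split_ifs
  · fun_prop
  · fun_prop

theorem continuous_perc {F : Finset (Edge d)} (hA : Dep (↑F) A) :
    Continuous fun p => perc d p A := by
  have : (fun p => perc d p A) = fun p => ofReal (fprob F A fun _ => clamp p) := by
    ext p
    rw [← bern_eq_fprob (fun _ => clamp_mem p) hA, bern_clamp (fun _ : Edge d => p)]
  rw [this]
  exact continuous_ofReal.comp ((continuous_fprob F A).comp (continuous_pi fun _ => continuous_clamp))

theorem continuous_tau (hS : S.Finite) : Continuous fun p => tau p S x y := by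
  refine continuous_perc (F := edgesOf hS.toFinset) (dep_connIn.mono ?_)
  convert edgesIn_subset_edgesOf hS.toFinset
  simp

theorem continuous_pE : Continuous pE := continuous_ofReal.comp continuous_clamp

/-- The expected number of open edges leaving `S`, counted from the cluster of `x` inside `S`. -/
def phi (p : ℝ) (S : Set (V d)) (x : V d) : ENNReal :=
  ∑' y, tau p S x y * ∑ ν, ind (y + nb ν ∉ S) * pE p

/-- Some finite set containing the origin has `phi < 1`. -/
def Subcrit (d : ℕ) (p : ℝ) : Prop := ∃ S : Finset (V d), 0 ∈ S ∧ phi p (S : Set (V d)) 0 < 1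

theorem phi_finset (S : Finset (V d)) : phi p S x = ∑ y ∈ S, tau p S x y * ∑ ν, ind (y + nb ν ∉ (S : Set (V d))) * pE p := by
  unfold phi
  exact tsum_eq_sum fun y hy => by rw [tau_eq_zero_right (by simpa using hy), zero_mul]

theorem continuous_phi (S : Finset (V d)) : Continuous fun p => phi p S x := by
  simp_rw [phi_finset]
  refine continuous_finsetSum _ fun y _ => ?_
  refine continuous_iff_continuousAt.2 fun p => ?_
  refine ENNReal.Tendsto.mul (continuous_tau S.finite_toSet).continuousAt (.inr ?_) ?_ (.inr ?_)
  · refine sum_ne_top.2 fun ν _ => ?_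
    exact mul_ne_top (ind_le_one.trans_lt (by simp)).ne (by simp [pE])
  · refine tendsto_finsetSum _ fun ν _ => ?_
    by_cases h : y + nb ν ∉ (S : Set (V d))
    · simp only [ind_true h, one_mul]
      exact continuous_pE.continuousAt
    · simp only [ind_false h, zero_mul]
      exact tendsto_const_nhds
  · exact (tau_le_one.trans_lt (by simp)).ne

theorem Subcrit.exists_gt (h : Subcrit d p) : ∃ q > p, Subcrit d q := by
  obtain ⟨S, h0, hS⟩ := h
  have := (continuous_phi S (x := 0)).continuousAt (x := p) |>.eventually_lt continuousAt_const hS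
  obtain ⟨ε, hε, h⟩ := Metric.eventually_nhds_iff.1 this
  exact ⟨p + ε / 2, by linarith, S, h0, h (by simp [abs_of_pos hε]; linarith)⟩

theorem pE_mono (h : p ≤ q) : pE p ≤ pE q := ofReal_le_ofReal (clamp_mono h)

theorem phi_mono (h : p ≤ q) : phi p S x ≤ phi q S x := by
  refine tsum_le_tsum fun y => mul_le_mul' (tau_mono_p h) (sum_le_sum fun ν _ => ?_)
  exact mul_le_mul' le_rfl (pE_mono h)

theorem Subcrit.mono (h : Subcrit d q) (hpq : p ≤ q) : Subcrit d p := by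
  obtain ⟨S, h0, hS⟩ := h
  exact ⟨S, h0, (phi_mono hpq).trans_lt hS⟩

/-- The `ℓ¹` norm. -/
def nrm1 (x : V d) : ℕ := ∑ i, (x i).natAbs

theorem nrm1_add (x y : V d) : nrm1 (x + y) ≤ nrm1 x + nrm1 y := by
  unfold nrm1
  rw [← sum_add_distrib]
  exact sum_le_sum fun i _ => Int.natAbs_add_le _ _

theorem box_eq (x : V d) (L : ℕ) : box x L = Icc (fun i => x i - L) (fun i => x i + L) := by
  ext y
  simp only [box, mem_ofPred_eq, mem_Icc, Pi.le_def, ← forall_and]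
  refine forall_congr' fun i => ?_
  rw [abs_le]; omega

theorem box_finite (x : V d) (L : ℕ) : (box x L).Finite := by
  rw [box_eq]; exact Set.finite_Icc _ _

/-- The box as a finset. -/
def boxF (x : V d) (L : ℕ) : Finset (V d) := (box_finite x L).toFinset

theorem coe_boxF (x : V d) (L : ℕ) : (boxF x L : Set (V d)) = box x L := by simp [boxF]

theorem mem_boxF {L : ℕ} : y ∈ boxF x L ↔ ∀ i, |y i - x i| ≤ (L : ℤ) := by
  simp [boxF, box]

theorem exists_box (A : Finset (V d)) : ∃ n : ℕ, ∀ y ∈ A, y ∈ box 0 n := by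
  refine ⟨A.sup nrm1, fun y hy i => ?_⟩
  have h1 : nrm1 y ≤ A.sup nrm1 := le_sup hy
  have h2 : (y i).natAbs ≤ nrm1 y := single_le_sum (f := fun i => (y i).natAbs) (fun _ _ => Nat.zero_le _) (Finset.mem_univ i)
  simp only [Pi.zero_apply, sub_zero]
  rw [Int.abs_eq_natAbs]
  exact_mod_cast h2.trans h1

theorem add_nb_mem_box {m : ℕ} (h : y ∈ box x m) (ν : Dir d) : y + nb ν ∈ box x (m + 1) := fun i => by
  have := abs_add_le (y i - x i) (nb ν i)
  have := h i
  have := abs_nb_le ν i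
  rw [Pi.add_apply, add_sub_right_comm]; push_cast; omega

theorem box_mono {m n : ℕ} (h : m ≤ n) : box x m ⊆ box x n := fun y hy i =>
  (hy i).trans (by exact_mod_cast h)

/-- Weighted finite-volume susceptibility bound. -/
theorem tsum_weight_le {S : Finset (V d)} (h0 : 0 ∈ S) {w : V d → ENNReal}
    (hw : ∀ x y, w (x + y) ≤ w x * w y) (hwtop : ∀ x, w x ≠ ∞) {r : ENNReal}
    (hr : ∑' y, tau p S 0 y * ∑ ν, ind (y + nb ν ∉ (S : Set (V d))) * (pE p * w (y + nb ν)) ≤ r) (hr1 : r < 1)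
    (Λ : Finset (V d)) (hx : x ∈ Λ) :
    ∑' u, tau p Λ x u * w (u - x) ≤ (∑ u ∈ S, w u) / (1 - r) := by
  set C := ∑ u ∈ S, w u with hC
  set m := Λ.sup fun x => ∑' u, tau p Λ x u * w (u - x) with hm
  have hmtop : m ≠ ∞ := by
    refine ((Finset.sup_lt_iff (by simp)).2 fun x _ => ?_).ne
    rw [tsum_eq_sum (s := Λ) fun u hu => by rw [tau_eq_zero_right (by simpa using hu), zero_mul]]
    refine ENNReal.sum_lt_top.2 fun u _ => mul_lt_top (tau_le_one.trans_lt (by simp)) (hwtop _).lt_top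
  have key : ∀ x ∈ Λ, ∑' u, tau p Λ x u * w (u - x) ≤ C + r * m := by
    intro x hx
    set Sx : Set (V d) := {v | v - x ∈ S} ∩ Λ with hSx
    have htr : ∀ y, tau p Sx x (y + x) ≤ tau p S 0 y := fun y => by
      have h1 : tau p {v | v - x ∈ S} (0 + x) (y + x) = tau p S 0 y := by
        rw [tau_add]; congr 1; ext v; simp
      rw [← h1, zero_add]
      exact tau_mono inter_subset_left
    have hsl : ∀ u, tau p Λ x u * w (u - x) ≤ tau p Sx x u * w (u - x) + ∑' y, tau p Sx x y *
        ∑ ν, ind (y + nb ν ∈ (Λ : Set (V d)) \ Sx) * (pE p * w (y + nb ν - x) * (tau p Λ (y + nb ν) u * w (u - (y + nb ν)))) := by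
      intro u
      refine (mul_le_mul_left (simon_lieb (S := Sx) (u := u) ⟨by simpa using h0, hx⟩
        (finCl_of_finite (Λ.finite_toSet.subset inter_subset_right))) _).trans ?_
      rw [add_mul, ← tsum_mul_right]
      refine add_le_add le_rfl (tsum_le_tsum fun y => ?_)
      rw [mul_assoc, sum_mul]
      refine mul_le_mul' le_rfl (sum_le_sum fun ν _ => ?_)
      rw [mul_assoc]
      refine mul_le_mul' le_rfl ?_
      have : w (u - x) ≤ w (y + nb ν - x) * w (u - (y + nb ν)) := by
        convert hw (y + nb ν - x) (u - (y + nb ν)) using 2; abel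
      calc _ ≤ pE p * tau p Λ (y + nb ν) u * (w (y + nb ν - x) * w (u - (y + nb ν))) := by gcongr
        _ = _ := by ring
    refine (tsum_le_tsum hsl).trans ?_
    rw [tsum_add]
    refine add_le_add ?_ ?_
    · rw [← (addRight x).tsum_eq]
      calc _ ≤ ∑' u, (if u ∈ S then w u else 0) := by
            refine tsum_le_tsum fun u => ?_
            simp only [coe_addRight, add_sub_cancel_right]
            split_ifs with h
            · exact mul_le_of_le_one_left' tau_le_one
            · rw [nonpos_iff_eq_zero.1 ((htr u).trans_eq (tau_eq_zero_right (by simpa using h))), zero_mul]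
        _ = _ := by rw [tsum_eq_sum (s := S) (by simp +contextual), hC]; exact sum_congr rfl (by simp +contextual)
    · rw [tsum_comm, ← (addRight x).tsum_eq]
      calc _ ≤ ∑' y, (tau p S 0 y * ∑ ν, ind (y + nb ν ∉ (S : Set (V d))) * (pE p * w (y + nb ν))) * m := by
            refine tsum_le_tsum fun y => ?_
            simp only [coe_addRight]
            rw [tsum_mul_left, mul_assoc]
            refine mul_le_mul' (htr y) ?_
            rw [tsum_fsum, sum_mul]
            refine sum_le_sum fun ν _ => ?_
            by_cases h : y + x + nb ν ∈ (Λ : Set (V d)) \ Sx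
            · have h' : y + nb ν ∉ (S : Set (V d)) := fun hh => h.2 ⟨by
                rw [mem_ofPred_eq, show y + x + nb ν - x = y + nb ν by abel]; exact hh, h.1⟩
              simp only [ind_true h, ind_true h', one_mul, tsum_mul_left]
              rw [show y + x + nb ν - x = y + nb ν by abel]
              gcongr
              exact le_sup (f := fun x => ∑' u, tau p Λ x u * w (u - x)) h.1
            · simp only [ind_false h, zero_mul, tsum_zero]
              exact zero_le
        _ ≤ _ := by rw [tsum_mul_right]; gcongr
  have hle : m ≤ C + r * m := Finset.sup_le key
  have h1 : m * (1 - r) ≤ C := by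
    rw [ENNReal.mul_sub (fun _ _ => hmtop), mul_one, mul_comm m r]
    exact tsub_le_iff_right.2 hle
  exact (le_sup (f := fun x => ∑' u, tau p Λ x u * w (u - x)) hx).trans
    ((le_div_iff_mul_le (.inl (tsub_pos_of_lt hr1).ne') (.inl (by simp))).2 h1)

theorem connIn_iff_exists_box : ConnIn S ω x y ↔ ∃ n, ConnIn (S ∩ box 0 n) ω x y := by
  refine ⟨fun h => ?_, fun ⟨n, h⟩ => h.mono inter_subset_left⟩
  refine h.ind (p := fun y => ∃ n, ConnIn (S ∩ box 0 n) ω x y) ?_ ?_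
  · obtain ⟨n, hn⟩ := exists_box {x}
    exact ⟨n, .refl ⟨h.1, hn x (by simp)⟩⟩
  · rintro a b - hab hb ⟨n, hn⟩
    obtain ⟨m, hm⟩ := exists_box {b}
    have hsub : S ∩ box 0 n ⊆ S ∩ box 0 (max n m) := inter_subset_inter_right _ (box_mono (le_max_left _ _))
    have := hn.mono hsub
    exact ⟨max n m, this.trans (.single hab this.right ⟨hb, box_mono (le_max_right _ _) (hm b (by simp))⟩)⟩

theorem tau_eq_iSup : tau p S x y = ⨆ n, tau p (S ∩ box 0 n) x y := by
  unfold tau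
  rw [← Monotone.measure_iUnion]
  · congr 1; ext ω; simp only [mem_ofPred_eq, mem_iUnion]; exact connIn_iff_exists_box
  · exact fun m n h ω hω => ConnIn.mono (inter_subset_inter_right _ (box_mono h)) hω

theorem tsum_tau_le_of_box {w : V d → ENNReal} {C : ENNReal}
    (h : ∀ n : ℕ, x ∈ box 0 n → ∑' u, tau p (S ∩ box 0 n) x u * w u ≤ C) : ∑' u, tau p S x u * w u ≤ C := by
  have h1 : ∀ u, tau p S x u * w u = ⨆ n, tau p (S ∩ box 0 n) x u * w u := fun u => by
    rw [tau_eq_iSup, iSup_mul]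
  have hmono : ∀ u, Monotone fun n : ℕ => tau p (S ∩ box 0 n) x u * w u := fun u m n h =>
    mul_le_mul' (tau_mono (inter_subset_inter_right _ (box_mono h))) le_rfl
  simp_rw [h1]
  rw [ENNReal.tsum_eq_iSup_sum]
  refine iSup_le fun s => ?_
  rw [ENNReal.finsetSum_iSup_of_monotone fun u => hmono u]
  refine iSup_le fun n => ?_
  refine (sum_le_tsum s).trans ?_
  obtain ⟨m, hm⟩ := exists_box {x}
  have := h (max n m) (box_mono (le_max_right _ _) (hm x (by simp)))
  exact (tsum_le_tsum fun u => hmono u (le_max_left n m)).trans this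

/-- Below criticality the two-point function has an exponential moment. -/
theorem Subcrit.exp_moment (h : Subcrit d p) :
    ∃ a : ℝ, 1 < a ∧ ∑' u, tau p univ (0 : V d) u * ofReal a ^ nrm1 u < ∞ := by
  obtain ⟨S, h0, hS⟩ := h
  set D := S.sup nrm1 + 1 with hD
  have hnb : ∀ ν : Dir d, nrm1 (nb ν) ≤ 1 := fun ν => by
    unfold nrm1
    rw [sum_eq_single ν.1]
    · rcases ν with ⟨i, b⟩; cases b <;> simp [nb]
    · intro j _ hj; simp [nb, hj]
    · simp
  obtain ⟨a, ha1, har⟩ : ∃ a : ℝ, 1 < a ∧ ofReal a ^ D * phi p (S : Set (V d)) 0 < 1 := by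
    have hc : Continuous fun a : ℝ => ofReal a ^ D * phi p (S : Set (V d)) 0 := by
      refine ENNReal.continuous_mul_const (ne_top_of_lt hS) |>.comp ?_
      exact (ENNReal.continuous_pow D).comp continuous_ofReal
    have := hc.continuousAt (x := 1) |>.eventually_lt continuousAt_const (by simpa using hS)
    obtain ⟨ε, hε, h⟩ := Metric.eventually_nhds_iff.1 this
    exact ⟨1 + ε / 2, by linarith, h (by simp [abs_of_pos hε]; linarith)⟩
  have ha : (1 : ENNReal) ≤ ofReal a := by simpa using ha1.le
  refine ⟨a, ha1, ?_⟩
  have hfin : (∑ u ∈ S, ofReal a ^ nrm1 u) / (1 - ofReal a ^ D * phi p (S : Set (V d)) 0) < ∞ :=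
    ENNReal.div_lt_top (sum_ne_top.2 fun u _ => pow_ne_top (by simp)) (tsub_pos_of_lt har).ne'
  refine lt_of_le_of_lt (tsum_tau_le_of_box fun n hn => ?_) hfin
  have := tsum_weight_le (p := p) (x := (0 : V d)) h0 (w := fun u => ofReal a ^ nrm1 u) (fun x y => by
      rw [← pow_add]; exact pow_le_pow_right₀ ha (nrm1_add x y)) (fun x => pow_ne_top (by simp))
    (r := ofReal a ^ D * phi p (S : Set (V d)) 0) ?_ har (boxF 0 n) (by rw [mem_boxF]; exact hn)
  · simpa [coe_boxF] using this
  · unfold phi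
    rw [← tsum_mul_left]
    refine tsum_le_tsum fun y => ?_
    by_cases hy : y ∈ S
    · rw [mul_left_comm (ofReal a ^ D), mul_sum (a := ofReal a ^ D)]
      refine mul_le_mul_right (sum_le_sum fun ν _ => ?_) _
      rw [mul_left_comm (ofReal a ^ D), mul_comm (pE p)]
      gcongr
      exact (nrm1_add _ _).trans (add_le_add (le_sup hy) (hnb ν))
    · rw [tau_eq_zero_right (by simpa using hy)]; simp

theorem Subcrit.chi_lt_top (h : Subcrit d p) : ∑' u, tau p univ (0 : V d) u < ∞ := by
  obtain ⟨a, ha, h⟩ := h.exp_moment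
  refine lt_of_le_of_lt (tsum_le_tsum fun u => ?_) h
  exact le_mul_of_one_le_right' (one_le_pow₀ (by simpa using ha.le))

theorem tsum_tau_univ (x : V d) : ∑' u, tau p univ x u = ∑' u, tau p univ (0 : V d) u := by
  rw [← (addRight x).tsum_eq]
  refine tsum_congr fun u => ?_
  have := tau_univ_add (p := p) (x := 0) (y := u) x
  simpa using this

theorem Subcrit.finCl (h : Subcrit d p) (S : Set (V d)) (x : V d) : FinCl p S x := by
  refine FinCl.mono ?_ (subset_univ S)
  have := ae_finite_setOfPred_mem (μ := perc d p) (s := fun u => {ω | ConnIn univ ω x u})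
    ((tsum_tau_univ (p := p) x).trans_lt h.chi_lt_top).ne
  exact this

end

section
variable {p q : ℝ}

theorem meas_cl_finite : MeasurableSet {ω : Config d | (cl S ω x).Finite} := by
  have : {ω : Config d | (cl S ω x).Finite} = ⋃ A : Finset (V d), {ω | cl S ω x = A} := by
    ext ω
    simp only [mem_ofPred_eq, mem_iUnion]
    exact ⟨fun h => ⟨h.toFinset, by simp⟩, fun ⟨A, hA⟩ => hA ▸ A.finite_toSet⟩
  rw [this]
  exact MeasurableSet.iUnion fun _ => meas_cl_eq

theorem Subcrit.no_inf (h : Subcrit d p) : perc d p {ω | HasInfCluster ω} = 0 := by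
  have : ∀ᵐ ω ∂(perc d p), ∀ x : V d, (cl univ ω x).Finite := ae_all_iff.2 fun x => h.finCl univ x
  refine measure_mono_null (fun ω hω => ?_) (ae_iff.1 this)
  obtain ⟨x, hx⟩ := hω
  rw [mem_ofPred_eq, not_forall]
  refine ⟨x, ?_⟩
  rw [← cluster_eq]
  exact hx

theorem exit_norm {n : ℕ} {t : V d} (ht : t ∈ box 0 n) {ν : Dir d} (h : t + nb ν ∉ box 0 n) :
    ∃ i, |t i| = n := by
  by_contra! hc
  refine h fun i => ?_
  have h1 := ht i
  have h2 := abs_nb_le ν i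
  have h3 := hc i
  simp only [Pi.zero_apply, sub_zero, Pi.add_apply] at h1 ⊢
  have h4 := abs_add_le (t i) (nb ν i)
  omega

theorem infinite_of_reach (h : ∀ n : ℕ, x ∈ box 0 n → Reach (box 0 n) ω x) :
    (cl univ ω x).Infinite := by
  intro hf
  obtain ⟨n, hn⟩ := exists_box hf.toFinset
  simp only [Finite.mem_toFinset] at hn
  obtain ⟨t, ⟨ν, ht⟩, hc⟩ := h (n + 1) (box_mono (Nat.le_succ n) (hn x (ConnIn.refl trivial)))
  obtain ⟨i, hi⟩ := exit_norm hc.right ht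
  have := hn t (hc.mono (subset_univ _)) i
  simp only [Pi.zero_apply, sub_zero] at this
  rw [hi] at this
  push_cast at this
  omega

theorem flux_singleton (S : Finset (V d)) : phi p (S : Set (V d)) 0 = pE p * flux p {0} S := by
  rw [phi_finset, flux, mul_sum]
  refine sum_ext fun y _ => ?_
  rw [mul_sum, mul_sum]
  refine sum_ext fun ν _ => ?_
  simp only [Finset.mem_singleton, exists_eq_left, mem_coe]
  unfold tau
  ring

theorem meas_reach {Λ : Set (V d)} : MeasurableSet {ω : Config d | Reach Λ ω x} := by
  have : {ω : Config d | Reach Λ ω x} = ⋃ t : V d, {_ω | ∃ ν, t + nb ν ∉ Λ} ∩ {ω | ConnIn Λ ω x t} := by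
    ext ω; simp [Reach]
  rw [this]
  exact MeasurableSet.iUnion fun t => (MeasurableSet.const _).inter meas_connIn

/-- Percolation occurs strictly above any parameter that is not subcritical. -/
theorem inf_pos_of_not_subcrit (h0 : 0 ≤ p) (hpq : p < q) (hq : q ≤ 1) (h : ¬ Subcrit d p) :
    0 < perc d q {ω | HasInfCluster ω} := by
  have hfl : ∀ S : Finset (V d), {0} ⊆ S → ofReal 1 ≤ flux p {0} S := by
    intro S hS
    have h1 : 1 ≤ phi p (S : Set (V d)) 0 := by
      by_contra hc
      exact h ⟨S, by simpa using hS, not_le.1 hc⟩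
    rw [flux_singleton] at h1
    simpa using h1.trans (mul_le_of_le_one_left' pE_le_one)
  have hn : ∀ n : ℕ, perc d q {ω | Reach (box 0 n) ω (0 : V d)}ᶜ ≤ ofReal (exp (-1 * (q - p))) := by
    intro n
    have := perc_not_reach_le (W := {(0 : V d)}) (Λ := boxF 0 n) (c := 1) h0 hpq.le hq zero_le_one
      (by simp [mem_boxF]) fun S h1 _ _ => hfl S h1
    simpa [coe_boxF] using this
  have hlim : perc d q (⋃ n, {ω | Reach (box 0 n) ω (0 : V d)}ᶜ) ≤ ofReal (exp (-1 * (q - p))) := by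
    rw [Monotone.measure_iUnion]
    · exact iSup_le hn
    · intro m n hmn ω hω hr
      exact hω (hr.anti (box_mono hmn) (by intro i; simp))
  have hlt : perc d q (⋃ n, {ω | Reach (box 0 n) ω (0 : V d)}ᶜ) < 1 := hlim.trans_lt (by
    rw [ENNReal.ofReal_lt_one, Real.exp_lt_one_iff]; linarith)
  rw [← compl_iInter, prob_compl_eq_one_sub (MeasurableSet.iInter fun n => meas_reach)] at hlt
  have hpos : 0 < perc d q (⋂ n, {ω | Reach (box 0 n) ω (0 : V d)}) := by
    rw [pos_iff_ne_zero]
    intro hz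
    simp [hz] at hlt
  refine hpos.trans_le (measure_mono fun ω hω => ⟨0, ?_⟩)
  rw [InInfinite, cluster_eq]
  exact infinite_of_reach fun n _ => mem_iInter.1 hω n

theorem inf_of_all_open (hd : 0 < d) (h : ∀ e, ω e = true) : HasInfCluster ω := by
  refine ⟨0, ?_⟩
  rw [InInfinite, cluster_eq]
  have hc : ∀ n : ℕ, Pi.single ⟨0, hd⟩ (n : ℤ) ∈ cl univ ω (0 : V d) := by
    intro n
    induction n with
    | zero => simpa using (show (0 : V d) ∈ cl univ ω 0 from ConnIn.refl trivial)
    | succ n ih =>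
      refine ConnIn.trans ih (.single (openAdj_iff.2 ⟨(⟨0, hd⟩, true), ?_, h _⟩) trivial trivial)
      push_cast
      rw [Pi.single_add]
      simp [nb]
  refine infinite_of_injective_forall_mem (f := fun n : ℕ => (Pi.single ⟨0, hd⟩ (n : ℤ) : V d)) ?_ hc
  intro m n hmn
  have := congrFun hmn ⟨0, hd⟩
  simpa using this

/-- Critical parameters in terms of finite-volume criteria. -/
structure IsCrit (d : ℕ) (pc : ℝ) : Prop where
  pos : 0 < pc
  lt_one : pc < 1
  subcrit : ∀ p < pc, Subcrit d p
  not_subcrit : ¬ Subcrit d pc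

theorem isCrit_pcOf (hd : 0 < d) {P : ℝ → Measure (Config d)} (hP : ∀ p ∈ Icc 0 1, IsBernoulli d p (P p))
    (h1 : pcOf d P < 1) : IsCrit d (pcOf d P) := by
  have hPe : ∀ p ∈ Icc 0 1, P p = perc d p := fun p hp => eq_bern (fun _ => hp) (hP p hp).2
  set A := {p | p ∈ Icc 0 1 ∧ 0 < P p {ω | HasInfCluster ω}} with hA
  have hbdd : BddBelow A := ⟨0, fun p hp => hp.1.1⟩
  have hne : (1 : ℝ) ∈ A := by
    refine ⟨by simp, ?_⟩
    rw [hPe 1 (by simp)]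
    have : ∀ᵐ ω ∂(perc d 1), ∀ e, ω e = true := by
      refine ae_all_iff.2 fun e => ?_
      refine (mem_ae_iff_prob_eq_one (meas_coord e true)).2 ?_
      rw [perc_open, pE, clamp_of_mem (by simp)]; simp
    have h2 : {ω : Config d | HasInfCluster ω} =ᵐ[perc d 1] univ :=
      Filter.eventuallyEq_univ.2 (this.mono fun ω h => inf_of_all_open hd h)
    rw [measure_congr h2]
    simp
  have hpc0 : 0 ≤ pcOf d P := le_csInf ⟨1, hne⟩ fun p hp => hp.1.1
  have hns : ¬ Subcrit d (pcOf d P) := by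
    intro h
    obtain ⟨q, hq, hs⟩ := h.exists_gt
    have : q ≤ pcOf d P := by
      refine le_csInf ⟨1, hne⟩ fun p hp => ?_
      by_contra hlt
      have := hp.2
      rw [hPe p hp.1, (hs.mono (not_le.1 hlt).le).no_inf] at this
      exact lt_irrefl _ this
    linarith
  have hsub : ∀ p < pcOf d P, Subcrit d p := by
    intro p hp
    by_contra hc
    have hp' : ¬ Subcrit d (max p 0) := fun h => hc (h.mono (le_max_left _ _))
    rcases hpc0.eq_or_lt with h | h
    · refine hp' ⟨{0}, by simp, ?_⟩
      rw [phi_finset]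
      have : max p 0 = 0 := max_eq_right (h ▸ hp.le)
      simp [this, pE, clamp]
    · obtain ⟨q, hq1, hq2⟩ := exists_between (max_lt hp h)
      have := inf_pos_of_not_subcrit (le_max_right p 0) hq1 (hq2.trans h1).le hp'
      have hqI : q ∈ Icc 0 1 := ⟨(le_max_right p 0).trans hq1.le, (hq2.trans h1).le⟩
      rw [← hPe q hqI] at this
      exact absurd (csInf_le hbdd ⟨hqI, this⟩) (not_le.2 hq2)
  refine ⟨lt_of_le_of_ne hpc0 fun h => ?_, h1, hsub, hns⟩
  refine hns ⟨{0}, by simp, ?_⟩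
  rw [phi_finset]
  simp [← h, pE, clamp]

end

section
variable {ι : Type*}

/-- Disjoint occurrence of two (increasing) events. -/
def disjOcc (A B : Set (ι → Bool)) : Set (ι → Bool) :=
  {ω | ∃ K L : Finset ι, Disjoint K L ∧ (∀ i ∈ K, ω i = true) ∧ (∀ i ∈ L, ω i = true) ∧ conf K ∈ A ∧ conf L ∈ B}

theorem incr_disjOcc (A B : Set (ι → Bool)) : Incr (disjOcc A B) := by
  rintro ω ω' h ⟨K, L, h1, h2, h3, h4⟩
  exact ⟨K, L, h1, fun i hi => h i (h2 i hi), fun i hi => h i (h3 i hi), h4⟩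

theorem dep_disjOcc {F : Set ι} {A B : Set (ι → Bool)} (hA : Dep F A) (hB : Dep F B) : Dep F (disjOcc A B) := by
  rintro ω ω' h ⟨K, L, h1, h2, h3, h4, h5⟩
  refine ⟨K.filter (· ∈ F), L.filter (· ∈ F), Finset.disjoint_filter_filter h1, ?_, ?_, ?_, ?_⟩
  · intro i hi
    rw [mem_filter] at hi
    rw [← h i hi.2, h2 i hi.1]
  · intro i hi
    rw [mem_filter] at hi
    rw [← h i hi.2, h3 i hi.1]
  · exact hA _ _ (fun i hi => by simp [conf, hi]) h4
  · exact hB _ _ (fun i hi => by simp [conf, hi]) h5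

theorem Incr.setTo {A : Set (ι → Bool)} (hA : Incr A) (e : ι) (b : Bool) : Incr (setTo e b A) := by
  intro ω ω' h hω
  refine hA _ _ (fun i hi => ?_) hω
  by_cases h' : i = e
  · subst h'; simpa using hi
  · simp only [update_of_ne h'] at hi ⊢; exact h i hi

theorem Incr.setTo_le {A : Set (ι → Bool)} (hA : Incr A) (e : ι) : Perc.setTo e false A ⊆ Perc.setTo e true A := by
  intro ω hω
  refine hA _ _ (fun i hi => ?_) hω
  by_cases h' : i = e
  · subst h'; simp
  · simpa [h'] using hi

theorem disjOcc_mono {A A' B B' : Set (ι → Bool)} (hA : A ⊆ A') (hB : B ⊆ B') : disjOcc A B ⊆ disjOcc A' B' := by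
  rintro ω ⟨K, L, h1, h2, h3, h4, h5⟩
  exact ⟨K, L, h1, h2, h3, hA h4, hB h5⟩

theorem conf_mem_setTo_false {K : Finset ι} {e : ι} (he : e ∉ K) {A : Set (ι → Bool)} (h : conf K ∈ A) :
    conf K ∈ setTo e false A := by
  have : update (conf K) e false = conf K := by
    ext i; by_cases h : i = e
    · subst h; simp [conf, he]
    · simp [h]
  simpa [setTo, this] using h

theorem conf_erase_mem_setTo_true {K : Finset ι} {e : ι} (he : e ∈ K) {A : Set (ι → Bool)} (h : conf K ∈ A) :
    conf (K.erase e) ∈ setTo e true A := by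
  have : update (conf (K.erase e)) e true = conf K := by
    ext i; by_cases h : i = e
    · subst h; simp [conf, he]
    · simp [conf, h]
  simpa [setTo, this] using h

theorem setTo_false_disjOcc (A B : Set (ι → Bool)) (e : ι) :
    setTo e false (disjOcc A B) ⊆ disjOcc (setTo e false A) (setTo e false B) := by
  rintro ω ⟨K, L, h1, h2, h3, h4, h5⟩
  have hK : e ∉ K := fun h => by simpa using h2 e h
  have hL : e ∉ L := fun h => by simpa using h3 e h
  refine ⟨K, L, h1, fun i hi => ?_, fun i hi => ?_, conf_mem_setTo_false hK h4, conf_mem_setTo_false hL h5⟩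
  · rw [← h2 i hi, update_of_ne (ne_of_mem_of_not_mem hi hK)]
  · rw [← h3 i hi, update_of_ne (ne_of_mem_of_not_mem hi hL)]

theorem setTo_true_disjOcc {A B : Set (ι → Bool)} (hA : Incr A) (e : ι) :
    setTo e true (disjOcc A B) ⊆ disjOcc (setTo e true A) (setTo e false B) ∪
      disjOcc (setTo e false A) (setTo e true B) := by
  rintro ω ⟨K, L, h1, h2, h3, h4, h5⟩
  by_cases hL : e ∈ L
  · have hK : e ∉ K := Finset.disjoint_right.1 h1 hL
    refine .inr ⟨K, L.erase e, h1.mono_right (erase_subset _ _), fun i hi => ?_, fun i hi => ?_,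
      conf_mem_setTo_false hK h4, conf_erase_mem_setTo_true hL h5⟩
    · rw [← h2 i hi, update_of_ne (ne_of_mem_of_not_mem hi hK)]
    · rw [← h3 i (mem_of_mem_erase hi), update_of_ne (ne_of_mem_erase hi)]
  · by_cases hK : e ∈ K
    · refine .inl ⟨K.erase e, L, h1.mono_left (erase_subset _ _), fun i hi => ?_, fun i hi => ?_,
        conf_erase_mem_setTo_true hK h4, conf_mem_setTo_false hL h5⟩
      · rw [← h2 i (mem_of_mem_erase hi), update_of_ne (ne_of_mem_erase hi)]
      · rw [← h3 i hi, update_of_ne (ne_of_mem_of_not_mem hi hL)]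
    · refine .inl ⟨K, L, h1, fun i hi => ?_, fun i hi => ?_, hA.setTo_le e (conf_mem_setTo_false hK h4),
        conf_mem_setTo_false hL h5⟩
      · rw [← h2 i hi, update_of_ne (ne_of_mem_of_not_mem hi hK)]
      · rw [← h3 i hi, update_of_ne (ne_of_mem_of_not_mem hi hL)]

theorem fprob_add_le {F : Finset ι} {P : ι → ℝ} (hP : ∀ i, P i ∈ Icc 0 1) {X Y Z W : Set (ι → Bool)}
    (hW : W ⊆ X ∪ Y) (hZ : Z ⊆ X ∩ Y) : fprob F W P + fprob F Z P ≤ fprob F X P + fprob F Y P := by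
  unfold fprob
  rw [← sum_add_distrib, ← sum_add_distrib]
  refine sum_le_sum fun T _ => ?_
  have hnn : 0 ≤ (∏ i ∈ T, P i) * ∏ i ∈ F \ T, (1 - P i) :=
    mul_nonneg (prod_nonneg fun i _ => (hP i).1) (prod_nonneg fun i _ => by linarith [(hP i).2])
  generalize (∏ i ∈ T, P i) * ∏ i ∈ F \ T, (1 - P i) = a at hnn
  have h1 := @hW (conf T)
  have h2 := @hZ (conf T)
  simp only [mem_union, mem_inter_iff] at h1 h2
  by_cases hx : conf T ∈ X <;> by_cases hy : conf T ∈ Y <;> by_cases hz : conf T ∈ Z <;>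
    by_cases hw : conf T ∈ W <;> simp [hx, hy, hz, hw] at h1 h2 ⊢ <;> linarith

theorem fprob_mono {F : Finset ι} {P : ι → ℝ} (hP : ∀ i, P i ∈ Icc 0 1) {X Y : Set (ι → Bool)}
    (h : X ⊆ Y) : fprob F X P ≤ fprob F Y P := by
  have := fprob_add_le (F := F) hP (W := X) (Z := ∅) (X := Y) (Y := ∅) (by simpa using h) (by simp)
  simpa [fprob] using this

/-- The van den Berg–Kesten inequality for increasing events and parameters at most `1/2`. -/
theorem fprob_disjOcc_le {P : ι → ℝ} (hP : ∀ i, P i ∈ Icc (0 : ℝ) (1 / 2)) (F : Finset ι) {A B : Set (ι → Bool)}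
    (hA : Incr A) (hB : Incr B) : fprob F (disjOcc A B) P ≤ fprob F A P * fprob F B P := by
  have hP1 : ∀ i, P i ∈ Icc 0 1 := fun i => ⟨(hP i).1, (hP i).2.trans (by norm_num)⟩
  induction F using induction_on generalizing A B with
  | empty =>
    simp only [fprob, Finset.powerset_empty, Finset.sum_singleton, Finset.prod_empty, Finset.sdiff_self,
      mul_one]
    by_cases h : conf ∅ ∈ disjOcc A B
    · obtain ⟨K, L, h1, h2, h3, h4, h5⟩ := h
      have hK : K = ∅ := Finset.eq_empty_of_forall_notMem fun i hi => by simpa [conf] using h2 i hi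
      have hL : L = ∅ := Finset.eq_empty_of_forall_notMem fun i hi => by simpa [conf] using h3 i hi
      subst hK hL
      simp only [h4, h5, if_true, mul_one]
      split_ifs <;> norm_num
    · simp only [h, if_false]
      split_ifs <;> norm_num
  | insert e F he ih =>
    rw [fprob_insert he, fprob_insert he, fprob_insert he]
    have ih00 := ih (hA.setTo e false) (hB.setTo e false)
    have ih10 := ih (hA.setTo e true) (hB.setTo e false)
    have ih01 := ih (hA.setTo e false) (hB.setTo e true)
    have hu := fprob_add_le (F := F) hP1 (setTo_true_disjOcc (B := B) hA e)
      (Z := disjOcc (setTo e false A) (setTo e false B))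
      (subset_inter (disjOcc_mono (hA.setTo_le e) le_rfl) (disjOcc_mono le_rfl (hB.setTo_le e)))
    have h0 := fprob_mono (F := F) hP1 (setTo_false_disjOcc A B e)
    have ha := fprob_mono (F := F) hP1 (hA.setTo_le e)
    have hb := fprob_mono (F := F) hP1 (hB.setTo_le e)
    have hp := hP e
    generalize fprob F (setTo e true A) P = a1 at *
    generalize fprob F (setTo e false A) P = a0 at *
    generalize fprob F (setTo e true B) P = b1 at *
    generalize fprob F (setTo e false B) P = b0 at *
    generalize P e = p at *
    nlinarith [mul_nonneg (mul_nonneg hp.1 hp.1) (mul_nonneg (sub_nonneg.2 ha) (sub_nonneg.2 hb)),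
      mul_le_mul_of_nonneg_left hu hp.1, mul_le_mul_of_nonneg_left h0 (show 0 ≤ 1 - p by linarith [hp.2]),
      mul_le_mul_of_nonneg_left ih00 (show 0 ≤ 1 - 2 * p by linarith [hp.2]),
      mul_le_mul_of_nonneg_left ih10 hp.1, mul_le_mul_of_nonneg_left ih01 hp.1]

theorem bern_disjOcc_le {P : ι → ℝ} (hP : ∀ i, P i ∈ Icc (0 : ℝ) (1 / 2)) {F : Finset ι} {A B : Set (ι → Bool)}
    (hA : Incr A) (hB : Incr B) (dA : Dep (↑F) A) (dB : Dep (↑F) B) :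
    bern P (disjOcc A B) ≤ bern P A * bern P B := by
  have hP1 : ∀ i, P i ∈ Icc 0 1 := fun i => ⟨(hP i).1, (hP i).2.trans (by norm_num)⟩
  rw [bern_eq_fprob hP1 dA, bern_eq_fprob hP1 dB, bern_eq_fprob hP1 (dep_disjOcc dA dB),
    ← ofReal_mul (fprob_nonneg hP1 _ _)]
  exact ofReal_le_ofReal (fprob_disjOcc_le hP F hA hB)

end

section
variable {x y b : V d}

theorem not_adjacent_self (x : V d) : ¬ Adjacent x x := by simp [Adjacent]

/-- The graph of open edges inside `S`. -/
def openGraph (S : Set (V d)) (ω : Config d) : SimpleGraph (V d) where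
  Adj a b := OpenAdj ω a b ∧ a ∈ S ∧ b ∈ S
  symm := ⟨fun _ _ h => ⟨h.1.symm, h.2.2, h.2.1⟩⟩
  loopless := ⟨fun a h => not_adjacent_self a (isEdge_iff.1 h.1.1)⟩

theorem exists_walk (h : ConnIn S ω x y) : Nonempty ((openGraph S ω).Walk x y) := by
  have := (SimpleGraph.reachable_iff_reflTransGen (G := openGraph S ω) x y).2 h.2
  exact this

/-- The open edges used by a list of unordered pairs. -/
def witness (l : List (Sym2 (V d))) : Finset (Edge d) := Finset.subtype IsEdge l.toFinset

theorem mem_witness {l : List (Sym2 (V d))} {e : Edge d} : e ∈ witness l ↔ e.1 ∈ l := by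
  simp [witness]

theorem conn_witness {u v : V d} (w : (openGraph S ω).Walk u v) (hu : u ∈ S) :
    ConnIn S (conf (witness w.edges)) u v := by
  suffices h : ∀ l : List (Sym2 (V d)), (∀ e ∈ w.edges, e ∈ l) → ConnIn S (conf (witness l)) u v from h _ fun _ h => h
  intro l
  induction w with
  | nil => exact fun _ => .refl hu
  | cons hadj w ih =>
    intro hl
    refine ConnIn.trans (.single ⟨hadj.1.1, ?_⟩ hu hadj.2.2) (ih hadj.2.2 fun e he => hl e (by simp [he]))
    simp only [conf, decide_eq_true_eq, mem_witness]
    exact hl _ (by simp)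

theorem open_of_mem_edges {u v : V d} (w : (openGraph S ω).Walk u v) {e : Edge d} (he : e ∈ witness w.edges) :
    ω e = true := by
  rw [mem_witness] at he
  have := w.edges_subset_edgeSet he
  obtain ⟨e, he'⟩ := e
  induction e using Sym2.ind with
  | _ a b => exact this.1.2

/-- The branching point of the paths from `x` to `y` and to `b`. -/
theorem exists_branch (hy : ConnIn S ω x y) (hb : ConnIn S ω x b) :
    ∃ a ∈ S, ω ∈ disjOcc (disjOcc {ω | ConnIn S ω x a} {ω | ConnIn S ω a y}) {ω | ConnIn S ω a b} := by
  obtain ⟨w0⟩ := exists_walk hy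
  obtain ⟨q⟩ := exists_walk hb.symm
  let w := w0.toPath
  have hP : (w : (openGraph S ω).Walk x y).IsPath := w.2
  have key : ∀ {c z : V d} (q : (openGraph S ω).Walk c z), z ∈ (w : (openGraph S ω).Walk x y).support → ∃ a, ∃ r : (openGraph S ω).Walk c a,
      a ∈ (w : (openGraph S ω).Walk x y).support ∧ ∀ e ∈ r.edges, e ∉ (w : (openGraph S ω).Walk x y).edges := by
    intro c z q hz
    induction q with
    | nil => exact ⟨_, .nil, hz, by simp⟩
    | @cons u v z h q ih =>
      by_cases hu : u ∈ (w : (openGraph S ω).Walk x y).support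
      · exact ⟨u, .nil, hu, by simp⟩
      · obtain ⟨a, r, ha, hr⟩ := ih hz
        refine ⟨a, .cons h r, ha, ?_⟩
        intro e he
        rw [SimpleGraph.Walk.edges_cons, List.mem_cons] at he
        rcases he with rfl | he
        · exact fun hc => hu (SimpleGraph.Walk.fst_mem_support_of_mem_edges _ hc)
        · exact hr e he
  obtain ⟨a, r, ha, hr⟩ := key q (by simp)
  have haS : ∀ {u v : V d} (r : (openGraph S ω).Walk u v), u ∈ S → v ∈ S := by
    intro u v r hu
    induction r with
    | nil => exact hu
    | cons h _ ih => exact ih h.2.2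
  have haS' := haS r hb.right
  set t := (w : (openGraph S ω).Walk x y).takeUntil a ha
  set s := (w : (openGraph S ω).Walk x y).dropUntil a ha
  have hts : t.append s = (w : (openGraph S ω).Walk x y) := SimpleGraph.Walk.take_spec _ ha
  have hedges : (w : (openGraph S ω).Walk x y).edges = t.edges ++ s.edges := by
    rw [← hts, SimpleGraph.Walk.edges_append]
  have hnd : (t.edges ++ s.edges).Nodup := hedges ▸ hP.isTrail.edges_nodup
  refine ⟨a, haS', witness t.edges ∪ witness s.edges, witness r.edges, ?_, ?_, ?_, ?_, ?_⟩
  · rw [Finset.disjoint_left]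
    intro e he h
    rw [mem_witness] at h
    refine hr _ h ?_
    rw [hedges]
    simpa [mem_witness] using he
  · intro i hi
    rw [Finset.mem_union] at hi
    rcases hi with hi | hi
    exacts [open_of_mem_edges _ hi, open_of_mem_edges _ hi]
  · exact fun i hi => open_of_mem_edges _ hi
  · refine ⟨witness t.edges, witness s.edges, ?_, by simp +contextual [conf], by simp +contextual [conf],
      conn_witness t hy.1, conn_witness s haS'⟩
    rw [Finset.disjoint_left]
    intro e h h'
    rw [mem_witness] at h h'
    exact (List.nodup_append.1 hnd).2.2 _ h _ h' rfl
  · exact (conn_witness r hb.right).symm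

/-- The tree-graph inequality. -/
theorem tree_bound (hp0 : 0 ≤ p) (hp : p ≤ 1 / 2) :
    perc d p {ω | ConnIn S ω x y ∧ ConnIn S ω x b} ≤ ∑' a, tau p S x a * tau p S a y * tau p S a b := by
  have hfin : ∀ T : Set (V d), T.Finite → T ⊆ S → perc d p {ω | ConnIn T ω x y ∧ ConnIn T ω x b} ≤
      ∑' a, tau p S x a * tau p S a y * tau p S a b := by
    intro T hT hTS
    have hdep : ∀ u v, Dep (edgesOf hT.toFinset : Set (Edge d)) {ω | ConnIn T ω u v} := fun u v =>
      dep_connIn.mono (by convert edgesIn_subset_edgesOf hT.toFinset; simp)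
    calc _ ≤ perc d p (⋃ a, disjOcc (disjOcc {ω | ConnIn T ω x a} {ω | ConnIn T ω a y}) {ω | ConnIn T ω a b}) := by
          refine measure_mono fun ω h => ?_
          obtain ⟨a, -, ha⟩ := exists_branch h.1 h.2
          exact mem_iUnion.2 ⟨a, ha⟩
      _ ≤ ∑' a, perc d p (disjOcc (disjOcc {ω | ConnIn T ω x a} {ω | ConnIn T ω a y}) {ω | ConnIn T ω a b}) :=
          measure_iUnion_le _
      _ ≤ _ := by
          refine tsum_le_tsum fun a => ?_
          refine (bern_disjOcc_le (fun _ => ⟨hp0, hp⟩) (incr_disjOcc _ _) incr_connIn (dep_disjOcc (hdep _ _) (hdep _ _)) (hdep _ _)).trans ?_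
          refine mul_le_mul' ((bern_disjOcc_le (fun _ => ⟨hp0, hp⟩) incr_connIn incr_connIn (hdep _ _) (hdep _ _)).trans
            (mul_le_mul' (tau_mono hTS) (tau_mono hTS))) (tau_mono hTS)
  have hU : {ω | ConnIn S ω x y ∧ ConnIn S ω x b} =
      ⋃ n, {ω | ConnIn (S ∩ box 0 n) ω x y ∧ ConnIn (S ∩ box 0 n) ω x b} := by
    ext ω
    simp only [mem_ofPred_eq, mem_iUnion]
    constructor
    · rintro ⟨h1, h2⟩
      obtain ⟨n, hn⟩ := connIn_iff_exists_box.1 h1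
      obtain ⟨m, hm⟩ := connIn_iff_exists_box.1 h2
      exact ⟨max n m, hn.mono (inter_subset_inter_right _ (box_mono (le_max_left _ _))),
        hm.mono (inter_subset_inter_right _ (box_mono (le_max_right _ _)))⟩
    · rintro ⟨n, h1, h2⟩
      exact ⟨h1.mono inter_subset_left, h2.mono inter_subset_left⟩
  rw [hU, Monotone.measure_iUnion]
  · exact iSup_le fun n => hfin _ ((box_finite 0 n).subset inter_subset_right) inter_subset_left
  · exact fun m n h ω hω => ⟨hω.1.mono (inter_subset_inter_right _ (box_mono h)),
      hω.2.mono (inter_subset_inter_right _ (box_mono h))⟩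

end

section
variable {x y b z u : V d}

/-- The translation invariant two-point function. -/
def tt (p : ℝ) (x : V d) : ENNReal := tau p univ 0 x

/-- The susceptibility. -/
def chi (d : ℕ) (p : ℝ) : ENNReal := ∑' u : V d, tt p u

theorem tau_univ_eq (x y : V d) : tau p univ x y = tt p (y - x) := by
  have := tau_univ_add (p := p) (x := 0) (y := y - x) x
  rw [zero_add, sub_add_cancel] at this
  exact this

theorem tt_neg (x : V d) : tt p (-x) = tt p x := by
  rw [← sub_zero x, ← tau_univ_eq, tau_symm, tau_univ_eq]; simp

theorem tt_sub_comm (x y : V d) : tt p (x - y) = tt p (y - x) := by rw [← tt_neg, neg_sub]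

theorem tsum_tau_univ_eq_chi (x : V d) : ∑' u, tau p univ x u = chi d p := tsum_tau_univ x

/-- Convolution on the lattice. -/
def conv (f g : V d → ENNReal) (x : V d) : ENNReal := ∑' y, f y * g (x - y)

theorem conv_sub (f g : V d → ENNReal) (x z : V d) : ∑' y, f (y - z) * g (x - y) = conv f g (x - z) := by
  rw [← (addRight z).tsum_eq]
  simp [conv, sub_sub, add_comm]

theorem sum_measure_le_union {Ω κ : Type*} [DecidableEq κ] [MeasurableSpace Ω] (μ : Measure Ω) (s : Finset κ) (E : κ → Set Ω)
    (mE : ∀ i ∈ s, MeasurableSet (E i)) :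
    ∑ i ∈ s, μ (E i) ≤ μ (⋃ i ∈ s, E i) + ∑ i ∈ s, ∑ j ∈ s.erase i, μ (E i ∩ E j) := by
  induction s using induction_on with
  | empty => simp
  | insert a s ha ih =>
    have ih' := ih fun i hi => mE i (Finset.mem_insert_of_mem hi)
    set U := ⋃ i ∈ s, E i with hU
    have mU : MeasurableSet U := measurableSet_biUnion _ fun i hi => mE i (Finset.mem_insert_of_mem hi)
    rw [sum_insert ha, sum_insert ha, Finset.set_biUnion_insert, Finset.erase_insert ha]
    have h1 : μ (E a) ≤ μ (E a \ U) + ∑ j ∈ s, μ (E a ∩ E j) := by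
      rw [← measure_diff_add_inter (E a) mU]
      refine add_le_add le_rfl ?_
      rw [hU, inter_iUnion₂]
      exact measure_biUnion_finset_le _ _
    have h2 : μ (E a ∪ U) = μ (E a \ U) + μ U := by
      rw [← sdiff_union_self, measure_union disjoint_sdiff_left mU]
    have h3 : ∑ i ∈ s, ∑ j ∈ s.erase i, μ (E i ∩ E j) ≤ ∑ i ∈ s, ∑ j ∈ (insert a s).erase i, μ (E i ∩ E j) :=
      sum_le_sum fun i _ => sum_le_sum_of_subset (Finset.erase_subset_erase _ (Finset.subset_insert _ _))
    calc _ ≤ (μ (E a \ U) + ∑ j ∈ s, μ (E a ∩ E j)) + (μ U + ∑ i ∈ s, ∑ j ∈ s.erase i, μ (E i ∩ E j)) :=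
          add_le_add h1 ih'
      _ ≤ (μ (E a \ U) + ∑ j ∈ s, μ (E a ∩ E j)) + (μ U + ∑ i ∈ s, ∑ j ∈ (insert a s).erase i, μ (E i ∩ E j)) := by gcongr
      _ = _ := by rw [h2]; ring

theorem tsum_perc_cl_inter_le {E : Set (Config d)} (mE : MeasurableSet E) :
    ∑' A : Finset (V d), perc d p ({ω | cl S ω x = A} ∩ E) ≤ perc d p E := by
  rw [← measure_iUnion]
  · exact measure_mono (iUnion_subset fun A => inter_subset_right)
  · intro A B hAB
    exact disjoint_left.2 fun ω h1 h2 => hAB (coe_injective (h1.1.symm.trans h2.1))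
  · exact fun A => meas_cl_eq.inter mE

theorem tsum_cl_pair_le (G : V d → V d → ENNReal) :
    ∑' A : Finset (V d), perc d p {ω | cl S ω x = A} * ∑ y ∈ A, ∑ b ∈ A, G y b ≤
      ∑' y, ∑' b, perc d p {ω | ConnIn S ω x y ∧ ConnIn S ω x b} * G y b := by
  have h : ∀ A : Finset (V d), perc d p {ω | cl S ω x = A} * ∑ y ∈ A, ∑ b ∈ A, G y b ≤
      ∑' y, ∑' b, perc d p ({ω | cl S ω x = A} ∩ {ω | ConnIn S ω x y ∧ ConnIn S ω x b}) * G y b := by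
    intro A
    rw [mul_sum]
    refine le_trans (sum_le_sum fun y hy => ?_) (sum_le_tsum A)
    rw [mul_sum]
    refine le_trans (sum_le_sum fun b hb => ?_) (sum_le_tsum A)
    refine mul_le_mul' (measure_mono fun ω hω => ⟨hω, ?_⟩) le_rfl
    have hA : cl S ω x = A := hω
    exact ⟨by change y ∈ cl S ω x; rw [hA]; exact hy, by change b ∈ cl S ω x; rw [hA]; exact hb⟩
  refine (tsum_le_tsum h).trans ?_
  rw [tsum_comm]
  refine tsum_le_tsum fun y => ?_
  rw [tsum_comm]
  refine tsum_le_tsum fun b => ?_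
  rw [tsum_mul_right]
  exact mul_le_mul' (tsum_perc_cl_inter_le (meas_connIn.inter meas_connIn)) le_rfl

/-- Two exits of a cluster both leading to `u`. -/
theorem perc_two_exits_le {A : Set (V d)} {i j : V d × Dir d} (hx : x ∈ S) (hij : i ≠ j)
    (hi : i.1 ∈ A) (hi' : i.1 + nb i.2 ∉ S) (hj : j.1 ∈ A) (hj' : j.1 + nb j.2 ∉ S) (hAS : A ⊆ S) :
    perc d p (({ω | cl S ω x = A} ∩ ({ω | ω (edge i.1 i.2) = true} ∩ {ω | ConnIn (univ \ A) ω (i.1 + nb i.2) u})) ∩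
      ({ω | cl S ω x = A} ∩ ({ω | ω (edge j.1 j.2) = true} ∩ {ω | ConnIn (univ \ A) ω (j.1 + nb j.2) u}))) ≤
    perc d p {ω | cl S ω x = A} * (pE p * pE p *
      perc d p {ω | ConnIn univ ω u (i.1 + nb i.2) ∧ ConnIn univ ω u (j.1 + nb j.2)}) := by
  have hne : edge i.1 i.2 ≠ edge j.1 j.2 := by
    intro h
    obtain ⟨a, ν⟩ := i
    obtain ⟨b, ν'⟩ := j
    simp only [edge, Subtype.mk.injEq, Sym2.eq_iff] at h
    rcases h with ⟨rfl, h⟩ | ⟨h, -⟩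
    · exact hij (by rw [nb_injective (add_left_cancel h)])
    · exact hj' (by rw [← h]; exact hAS hi)
  set K := {ω : Config d | ConnIn (univ \ A) ω (i.1 + nb i.2) u} ∩ {ω | ConnIn (univ \ A) ω (j.1 + nb j.2) u}
  have dK : Dep (edgesIn (univ \ A)) K := dep_connIn.inter dep_connIn
  have mK : MeasurableSet K := meas_connIn.inter meas_connIn
  have hni : ∀ k : V d × Dir d, k.1 ∈ A → edge k.1 k.2 ∉ edgesIn (univ \ A) := fun k hk h =>
    (edge_mem_edgesIn.1 h).1.2 hk
  have h1 : perc d p ({ω | ω (edge j.1 j.2) = true} ∩ K) = pE p * perc d p K := by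
    rw [bern_inter (dep_true _) dK (by simpa using hni j hj) (meas_coord _ _) mK, bern_true]; rfl
  have h2 : perc d p ({ω | ω (edge i.1 i.2) = true} ∩ ({ω | ω (edge j.1 j.2) = true} ∩ K)) = pE p * (pE p * perc d p K) := by
    rw [bern_inter (dep_true _) (K := {edge j.1 j.2} ∪ edgesIn (univ \ A)) (((dep_true _).mono subset_union_left).inter
      (dK.mono subset_union_right)) ?_ (meas_coord _ _) ((meas_coord _ _).inter mK), bern_true, h1]; rfl
    rw [Set.disjoint_singleton_left]
    rintro (h | h)
    · exact hne h
    · exact hni i hi h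
  calc _ ≤ perc d p ({ω | cl S ω x = A} ∩ ({ω | ω (edge i.1 i.2) = true} ∩ ({ω | ω (edge j.1 j.2) = true} ∩ K))) := by
        refine measure_mono ?_
        rintro ω ⟨⟨h1, h2, h3⟩, -, h5, h6⟩
        exact ⟨h1, h2, h5, h3, h6⟩
    _ = perc d p {ω | cl S ω x = A} * (pE p * (pE p * perc d p K)) := by
        rw [perc_cl_inter hx (K := {edge i.1 i.2} ∪ ({edge j.1 j.2} ∪ edgesIn (univ \ A)))
          (((dep_true _).mono subset_union_left).inter ((((dep_true _).mono subset_union_left).inter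
          (dK.mono subset_union_right)).mono subset_union_right)) ((meas_coord _ _).inter
            ((meas_coord _ _).inter mK)) ?_, h2]
        rw [disjoint_left]
        rintro e ⟨h1, h2⟩ (h3 | h3 | h3)
        · rw [mem_singleton_iff] at h3; subst h3; exact hi' (edge_mem_edgesIn.1 h1).2
        · rw [mem_singleton_iff] at h3; subst h3; exact hj' (edge_mem_edgesIn.1 h1).2
        · obtain ⟨v, hv, hvA⟩ := h2
          exact (h3 v hv).2 hvA
    _ ≤ _ := by
        rw [mul_assoc]
        gcongr
        intro ω h
        exact ⟨(h.1.mono (subset_univ _)).symm, (h.2.mono (subset_univ _)).symm⟩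

/-- The pair weight in the reversed Simon–Lieb inequality. -/
def pairW (p : ℝ) (S : Set (V d)) (y b : V d) : ENNReal :=
  ∑ ν, ind (y + nb ν ∉ S) * ∑ ν', (pE p * pE p) * (tt p (b + nb ν' - (y + nb ν)) +
    ind (b + nb ν' ∉ S) * conv (tt p) (tt p) (b + nb ν' - (y + nb ν)))

theorem tsum_conn_pair_le (hp0 : 0 ≤ p) (hp : p ≤ 1 / 2) (z z' : V d) :
    ∑' u, perc d p {ω | ConnIn univ ω u z ∧ ConnIn univ ω u z'} ≤ chi d p * conv (tt p) (tt p) (z' - z) := by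
  calc _ ≤ ∑' u, ∑' a, tau p univ u a * tau p univ a z * tau p univ a z' :=
        tsum_le_tsum fun u => tree_bound hp0 hp
    _ = ∑' a, (∑' u, tau p univ u a) * (tau p univ a z * tau p univ a z') := by
        rw [tsum_comm]
        refine tsum_congr fun a => ?_
        rw [← tsum_mul_right]
        exact tsum_congr fun u => mul_assoc _ _ _
    _ = ∑' a, chi d p * (tt p (a - z) * tt p (z' - a)) := by
        refine tsum_congr fun a => ?_
        simp_rw [tau_symm (y := a), tsum_tau_univ_eq_chi]
        rw [tau_univ_eq, tau_univ_eq, tt_sub_comm z a]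
    _ = _ := by rw [tsum_mul_left, conv_sub]

theorem chi_le_off (h : Subcrit d p) (A : Finset (V d)) (hz : z ∉ A) :
    chi d p ≤ ∑' u, tau p (univ \ (A : Set (V d))) z u + (∑ b ∈ A, ∑ ν, pE p * tt p (b + nb ν - z)) * chi d p := by
  rw [← tsum_tau_univ_eq_chi z]
  have hs : ∀ u, tau p univ z u ≤ tau p (univ \ (A : Set (V d))) z u + ∑' y, tau p (univ \ (A : Set (V d))) z y *
      ∑ ν, ind (y + nb ν ∈ A) * (pE p * tau p univ (y + nb ν) u) := fun u => by
    refine (simon_lieb (S := univ \ (A : Set (V d))) (Λ := univ) ⟨trivial, by simpa using hz⟩ (h.finCl _ _)).trans (le_of_eq ?_)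
    simp
  refine (tsum_le_tsum hs).trans ?_
  rw [tsum_add]
  refine add_le_add le_rfl ?_
  rw [tsum_comm, tsum_tau_univ_eq_chi z]
  calc _ ≤ ∑' y, (∑ ν, tt p (y - z) * (ind (y + nb ν ∈ A) * pE p)) * chi d p := by
        refine tsum_le_tsum fun y => ?_
        rw [tsum_mul_left, tsum_fsum, mul_sum, sum_mul]
        refine sum_le_sum fun ν _ => ?_
        rw [tsum_mul_left, tsum_mul_left, tsum_tau_univ_eq_chi, ← tau_univ_eq]
        calc _ ≤ tau p univ z y * (ind (y + nb ν ∈ A) * (pE p * chi d p)) := by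
              gcongr; exact tau_mono (subset_univ _)
          _ = _ := by ring
    _ = _ := by
        rw [tsum_mul_right, tsum_fsum, sum_comm]
        congr 1
        have hinv : ∀ ν : Dir d, nb (ν.1, !ν.2) = -nb ν := fun ν => by
          rcases ν with ⟨i, b⟩; cases b <;> simp [nb, ← Pi.single_neg]
        let e : Dir d ≃ Dir d := ⟨fun ν => (ν.1, !ν.2), fun ν => (ν.1, !ν.2), fun ν => by simp, fun ν => by simp⟩
        rw [← e.sum_comp]
        refine sum_ext fun ν _ => ?_
        change ∑' y, tt p (y - z) * (ind (y + nb (ν.1, !ν.2) ∈ A) * pE p) = _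
        rw [← (addRight (nb ν)).tsum_eq, tsum_eq_sum (s := A)]
        · refine sum_ext fun b hb => ?_
          simp only [coe_addRight, hinv, add_neg_cancel_right]
          rw [ind_true hb, one_mul, mul_comm]
        · intro b hb
          simp only [coe_addRight, hinv, add_neg_cancel_right]
          rw [ind_false hb, zero_mul, mul_zero]

theorem chi_ne_zero : chi d p ≠ 0 := by
  have : tt p (0 : V d) ≤ chi d p := le_tsum _
  rw [tt, tau_self (mem_univ _)] at this
  exact (lt_of_lt_of_le one_pos this).ne'

theorem phi_eq_tsum (hfin : FinCl p S x) :
    phi p S x = ∑' A : Finset (V d), perc d p {ω | cl S ω x = A} * ∑ y ∈ A, ∑ ν, ind (y + nb ν ∉ S) * pE p :=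
  (tsum_cl_sum hfin _).symm

/-- The reversed Simon–Lieb inequality. -/
theorem phi_le_of_cl (hp0 : 0 ≤ p) (hp : p ≤ 1 / 2) (h : Subcrit d p) (hx : x ∈ S) :
    phi p S x ≤ 1 + ∑' A : Finset (V d), perc d p {ω | cl S ω x = A} * ∑ y ∈ A, ∑ b ∈ A, pairW p S y b := by
  set m : Finset (V d) → ENNReal := fun A => perc d p {ω | cl S ω x = A} with hm
  have htop : chi d p ≠ ∞ := h.chi_lt_top.ne
  have hsum : ∀ (A : Finset (V d)) (f : V d × Dir d → ENNReal),
      ∑ i ∈ (A ×ˢ (Finset.univ : Finset (Dir d))).filter (fun i => i.1 + nb i.2 ∉ S), f i =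
        ∑ y ∈ A, ∑ ν, ind (y + nb ν ∉ S) * f (y, ν) := by
    intro A f
    rw [sum_filter, sum_product]
    refine sum_ext fun y _ => sum_ext fun ν _ => ?_
    by_cases hν : y + nb ν ∉ S
    · rw [if_pos hν, ind_true hν, one_mul]
    · rw [if_neg hν, ind_false hν, zero_mul]
  have key : ∀ A : Finset (V d), m A * (∑ y ∈ A, ∑ ν, ind (y + nb ν ∉ S) * pE p) * chi d p ≤
      ∑' u, perc d p ({ω | cl S ω x = A} ∩ {ω | ConnIn univ ω x u}) +
        m A * (∑ y ∈ A, ∑ b ∈ A, pairW p S y b) * chi d p := by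
    intro A
    by_cases hAS : (A : Set (V d)) ⊆ S
    swap
    · have : m A = 0 := by
        rw [hm]
        convert measure_empty (μ := perc d p)
        ext ω
        simp only [mem_ofPred_eq, mem_empty_iff_false, iff_false]
        intro hA
        exact hAS (hA ▸ cl_subset)
      simp [this]
    set I := (A ×ˢ (Finset.univ : Finset (Dir d))).filter (fun i => i.1 + nb i.2 ∉ S) with hI
    have hI1 : ∀ i ∈ I, i.1 ∈ A ∧ i.1 + nb i.2 ∉ S := fun i hi => by
      simpa [hI] using hi
    set E : V d → V d × Dir d → Set (Config d) := fun u i => {ω | cl S ω x = A} ∩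
      ({ω | ω (edge i.1 i.2) = true} ∩ {ω | ConnIn (univ \ A) ω (i.1 + nb i.2) u}) with hE
    have hmE : ∀ u, ∀ i ∈ I, perc d p (E u i) = m A * (pE p * tau p (univ \ A) (i.1 + nb i.2) u) := fun u i hi =>
      perc_open_inter_conn hx (hI1 i hi).1 (hI1 i hi).2
    have hU : ∀ u, perc d p (⋃ i ∈ I, E u i) ≤ perc d p ({ω | cl S ω x = A} ∩ {ω | ConnIn univ ω x u}) := by
      intro u
      refine measure_mono fun ω hω => ?_
      simp only [mem_iUnion] at hω
      obtain ⟨i, hi, hcl, ho, hc⟩ := hω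
      refine ⟨hcl, ?_⟩
      have hxy : ConnIn S ω x i.1 := by
        change i.1 ∈ cl S ω x
        rw [show cl S ω x = A from hcl]
        exact (hI1 i hi).1
      exact (hxy.mono (subset_univ _)).trans ((ConnIn.single (openAdj_iff.2 ⟨i.2, rfl, ho⟩) (mem_univ _) (mem_univ _)).trans
        (hc.mono (subset_univ _)))
    have hBonf : ∀ u, ∑ i ∈ I, m A * (pE p * tau p (univ \ A) (i.1 + nb i.2) u) ≤
        perc d p ({ω | cl S ω x = A} ∩ {ω | ConnIn univ ω x u}) + ∑ i ∈ I, ∑ j ∈ I, m A * (pE p * pE p *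
          perc d p {ω | ConnIn univ ω u (i.1 + nb i.2) ∧ ConnIn univ ω u (j.1 + nb j.2)}) := by
      intro u
      rw [← sum_congr rfl (hmE u)]
      refine (sum_measure_le_union _ I (E u) fun i _ => meas_cl_eq.inter
        ((meas_coord _ _).inter meas_connIn)).trans (add_le_add (hU u) ?_)
      refine sum_le_sum fun i hi => ?_
      refine le_trans (sum_le_sum fun j hj => ?_) (sum_le_sum_of_subset (erase_subset i I))
      have hj' := mem_of_mem_erase hj
      exact perc_two_exits_le hx (ne_of_mem_erase hj).symm (hI1 i hi).1 (hI1 i hi).2 (hI1 j hj').1 (hI1 j hj').2 hAS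
    have hBonf' : ∑ i ∈ I, m A * (pE p * ∑' u, tau p (univ \ A) (i.1 + nb i.2) u) ≤
        ∑' u, perc d p ({ω | cl S ω x = A} ∩ {ω | ConnIn univ ω x u}) + ∑ i ∈ I, ∑ j ∈ I, m A * (pE p * pE p *
          (chi d p * conv (tt p) (tt p) (j.1 + nb j.2 - (i.1 + nb i.2)))) := by
      have := tsum_le_tsum hBonf
      rw [tsum_add, tsum_fsum,
        tsum_fsum] at this
      simp_rw [tsum_mul_left] at this
      refine this.trans (add_le_add le_rfl (sum_le_sum fun i _ => ?_))
      rw [tsum_fsum]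
      refine sum_le_sum fun j _ => ?_
      rw [tsum_mul_left, tsum_mul_left]
      gcongr
      exact tsum_conn_pair_le hp0 hp _ _
    calc m A * (∑ y ∈ A, ∑ ν, ind (y + nb ν ∉ S) * pE p) * chi d p
        = ∑ i ∈ I, m A * (pE p * chi d p) := by
          rw [← hsum A fun _ => pE p, ← hI, mul_assoc, sum_mul, mul_sum]
      _ ≤ ∑ i ∈ I, (m A * (pE p * ∑' u, tau p (univ \ A) (i.1 + nb i.2) u) +
            m A * (pE p * ((∑ b ∈ A, ∑ ν, pE p * tt p (b + nb ν - (i.1 + nb i.2))) * chi d p))) := by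
          refine sum_le_sum fun i hi => ?_
          rw [← mul_add, ← mul_add]
          gcongr
          exact chi_le_off h A fun hz => (hI1 i hi).2 (hAS hz)
      _ ≤ _ := by
          rw [sum_add_distrib]
          refine (add_le_add hBonf' le_rfl).trans (le_of_eq ?_)
          rw [add_assoc]
          congr 1
          have e1 : ∀ i : V d × Dir d, ∑ j ∈ I, m A * (pE p * pE p * (chi d p * conv (tt p) (tt p) (j.1 + nb j.2 - (i.1 + nb i.2)))) =
              ∑ b ∈ A, ∑ ν', ind (b + nb ν' ∉ S) * (m A * (pE p * pE p * (chi d p * conv (tt p) (tt p) (b + nb ν' - (i.1 + nb i.2))))) :=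
            fun i => hsum A fun j => m A * (pE p * pE p * (chi d p * conv (tt p) (tt p) (j.1 + nb j.2 - (i.1 + nb i.2))))
          simp_rw [e1]
          rw [← sum_add_distrib, hI, hsum, mul_sum, sum_mul]
          refine sum_ext fun y _ => ?_
          simp only [pairW]
          rw [sum_comm (s := A), mul_sum, sum_mul]
          refine sum_ext fun ν _ => ?_
          rw [← mul_sum, mul_assoc (m A) _ (chi d p), mul_assoc (ind (y + nb ν ∉ S)) _ (chi d p),
            mul_left_comm (m A) (ind (y + nb ν ∉ S))]
          congr 1
          rw [sum_mul, mul_sum, mul_sum, ← sum_add_distrib, sum_mul, mul_sum]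
          refine sum_ext fun b _ => ?_
          rw [sum_mul, mul_sum, mul_sum, ← sum_add_distrib, sum_mul, mul_sum]
          refine sum_ext fun ν' _ => ?_
          ring
  have hphi := phi_eq_tsum (h.finCl S x)
  have hfinal : phi p S x * chi d p ≤ (1 + ∑' A : Finset (V d), m A * ∑ y ∈ A, ∑ b ∈ A, pairW p S y b) * chi d p := by
    rw [hphi, ← tsum_mul_right, add_mul, one_mul, ← tsum_mul_right]
    refine (tsum_le_tsum key).trans ?_
    rw [tsum_add]
    refine add_le_add ?_ le_rfl
    rw [tsum_comm, ← tsum_tau_univ_eq_chi x]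
    exact tsum_le_tsum fun u => tsum_perc_cl_inter_le meas_connIn
  exact (ENNReal.mul_le_mul_iff_left chi_ne_zero htop).1 hfinal

/-- The reversed Simon–Lieb inequality in terms of two-point functions. -/
theorem phi_le (hp0 : 0 ≤ p) (hp : p ≤ 1 / 2) (h : Subcrit d p) (hx : x ∈ S) :
    phi p S x ≤ 1 + ∑' a, tau p S x a * ∑' y, ∑' b, tau p S a y * tau p S a b * pairW p S y b := by
  refine (phi_le_of_cl hp0 hp h hx).trans (add_le_add le_rfl ((tsum_cl_pair_le _).trans ?_))
  calc _ ≤ ∑' y, ∑' b, ∑' a, tau p S x a * (tau p S a y * tau p S a b * pairW p S y b) := by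
        refine tsum_le_tsum fun y => tsum_le_tsum fun b => ?_
        refine (mul_le_mul' (tree_bound hp0 hp) le_rfl).trans (le_of_eq ?_)
        rw [← tsum_mul_right]
        exact tsum_congr fun a => by ring
    _ = _ := by
        have h1 : ∀ y, ∑' b, ∑' a, tau p S x a * (tau p S a y * tau p S a b * pairW p S y b) =
            ∑' a, ∑' b, tau p S x a * (tau p S a y * tau p S a b * pairW p S y b) := fun y => tsum_comm
        simp_rw [h1]
        rw [tsum_comm]
        refine tsum_congr fun a => ?_
        rw [← tsum_mul_left]
        refine tsum_congr fun y => ?_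
        rw [← tsum_mul_left]

end

section

/-- The signed coordinate in direction `ν`. -/
def lin (ν : Dir d) (x : V d) : ℤ := if ν.2 then x ν.1 else -x ν.1

theorem lin_add (ν : Dir d) (x y : V d) : lin ν (x + y) = lin ν x + lin ν y := by
  unfold lin; split_ifs <;> simp; ring

theorem lin_neg (ν : Dir d) (x : V d) : lin ν (-x) = -lin ν x := by
  unfold lin; split_ifs <;> simp

theorem lin_sub (ν : Dir d) (x y : V d) : lin ν (x - y) = lin ν x - lin ν y := by
  rw [sub_eq_add_neg, lin_add, lin_neg]; ring

theorem lin_zero (ν : Dir d) : lin ν 0 = 0 := by simp [lin]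

theorem lin_nb_self (ν : Dir d) : lin ν (nb ν) = 1 := by
  rcases ν with ⟨i, b⟩; cases b <;> simp [lin, nb]

theorem lin_nb_le {ν ν' : Dir d} (h : ν ≠ ν') : lin ν (nb ν') ≤ 0 := by
  rcases ν with ⟨i, b⟩; rcases ν' with ⟨j, c⟩
  by_cases hij : i = j
  · subst hij
    cases b <;> cases c <;> simp [lin, nb] at h ⊢
  · cases b <;> cases c <;> simp [lin, nb, hij]

theorem abs_lin_nb_le (ν ν' : Dir d) : |lin ν (nb ν')| ≤ 1 := by
  rcases ν with ⟨i, b⟩; rcases ν' with ⟨j, c⟩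
  by_cases hij : i = j
  · subst hij
    cases b <;> cases c <;> simp [lin, nb]
  · cases b <;> cases c <;> simp [lin, nb, hij]

/-- The points whose signed coordinates in the directions of `F` are at most `r`. -/
def slabF (F : Finset (Dir d)) (r : ℕ) : Set (V d) := {x | ∀ ν ∈ F, lin ν x ≤ r}

variable {F : Finset (Dir d)} {ν ν' : Dir d} {r j : ℕ}

theorem zero_mem_slabF : (0 : V d) ∈ slabF F r := fun ν _ => by rw [lin_zero]; positivity

theorem exit_slabF (hy : y ∈ slabF F r) : y + nb ν ∉ slabF F r ↔ ν ∈ F ∧ lin ν y = r := by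
  constructor
  · intro h
    simp only [slabF, mem_ofPred_eq, not_forall] at h
    obtain ⟨ν', hν', h⟩ := h
    have h1 := hy ν' hν'
    rw [lin_add] at h
    by_cases hνν : ν' = ν
    · subst hνν
      rw [lin_nb_self] at h
      exact ⟨hν', by omega⟩
    · have := lin_nb_le hνν
      omega
  · rintro ⟨hν, hl⟩ h
    have := h ν hν
    rw [lin_add, lin_nb_self, hl] at this
    omega

theorem slabF_anti {F' : Finset (Dir d)} (h : F' ⊆ F) : slabF F r ⊆ slabF F' r := fun _ hx ν hν => hx ν (h hν)

/-- Mass of a layer at depth `j` below the boundary of a half-space. -/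
def lay (p : ℝ) (ν : Dir d) (r j : ℕ) : ENNReal :=
  ∑' a, tau p (slabF {ν} r) 0 a * ind (lin ν a = r - j)

theorem phi_slabF : phi p (slabF F r) x = ∑ ν ∈ F, (∑' y, tau p (slabF F r) x y * ind (lin ν y = r)) * pE p := by
  unfold phi
  have h : ∀ y, tau p (slabF F r) x y * ∑ ν, ind (y + nb ν ∉ slabF F r) * pE p =
      ∑ ν ∈ F, tau p (slabF F r) x y * ind (lin ν y = r) * pE p := by
    intro y
    by_cases hy : y ∈ slabF F r
    · rw [mul_sum, ← sum_subset (Finset.subset_univ F)]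
      · refine sum_ext fun ν hν => ?_
        rw [mul_assoc, exit_slabF hy]
        simp [hν]
      · intro ν _ hν
        rw [exit_slabF hy, ind_false (by simp [hν])]; simp
    · simp [tau_eq_zero_right hy]
  simp_rw [h]
  rw [tsum_fsum]
  exact sum_ext fun ν _ => tsum_mul_right

theorem phi_half : phi p (slabF {ν} r) 0 = lay p ν r 0 * pE p := by
  rw [phi_slabF, Finset.sum_singleton]
  simp [lay]

/-- Translating a half-space. -/
theorem tau_half_shift {s : ℕ} (h : lin ν z + s = r) :
    tau p (slabF {ν} r) (x + z) (y + z) = tau p (slabF {ν} s) x y := by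
  rw [tau_add]
  congr 1
  ext v
  simp only [slabF, mem_preimage, mem_ofPred_eq, Finset.mem_singleton, forall_eq, lin_add]
  omega

theorem lay_zero : lay p ν 0 j = lay p ν j 0 := by
  unfold lay
  rw [← (Equiv.neg (V d)).tsum_eq]
  refine tsum_congr fun a => ?_
  simp only [Equiv.neg_apply, lin_neg]
  by_cases h : lin ν a = j
  · have := tau_half_shift (p := p) (ν := ν) (x := a) (y := 0) (z := -a) (r := 0) (s := j) (by rw [lin_neg]; push_cast; omega)
    rw [zero_add, add_neg_cancel] at this
    rw [this, tau_symm]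
    simp [h]
  · rw [ind_false (P := -lin ν a = _) (by push_cast; omega), ind_false (P := lin ν a = _) (by push_cast; omega)]; simp

theorem lay_succ (hs : Subcrit d p) : lay p ν (r + 1) (j + 1) ≤ lay p ν r j + phi p (slabF {ν} r) 0 * lay p ν 0 (j + 1) := by
  have hsl : ∀ a, tau p (slabF {ν} (r + 1)) 0 a * ind (lin ν a = (r + 1 : ℕ) - (j + 1 : ℕ)) ≤
      tau p (slabF {ν} r) 0 a * ind (lin ν a = r - j) + ∑' y, tau p (slabF {ν} r) 0 y * ∑ ν', ind (y + nb ν' ∉ slabF {ν} r) *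
        (pE p * (tau p (slabF {ν} (r + 1)) (y + nb ν') a * ind (lin ν a = r - j))) := by
    intro a
    rw [show (lin ν a = (r + 1 : ℕ) - (j + 1 : ℕ)) = (lin ν a = r - j) by push_cast; congr 1; ring]
    refine (mul_le_mul_left (simon_lieb (S := slabF {ν} r) zero_mem_slabF (hs.finCl _ _)) _).trans ?_
    rw [add_mul, ← tsum_mul_right]
    refine add_le_add le_rfl (tsum_le_tsum fun y => ?_)
    rw [mul_assoc, sum_mul]
    refine mul_le_mul_right (sum_le_sum fun ν' _ => ?_) _
    rw [mul_assoc, mul_assoc]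
    exact mul_le_mul' (ind_mono fun h => h.2) le_rfl
  unfold lay
  refine (tsum_le_tsum hsl).trans ?_
  rw [tsum_add]
  refine add_le_add le_rfl ?_
  rw [tsum_comm]
  unfold phi
  rw [← tsum_mul_right]
  refine tsum_le_tsum fun y => ?_
  by_cases hy : y ∈ slabF {ν} r
  swap
  · simp [tau_eq_zero_right hy]
  rw [tsum_mul_left, mul_assoc]
  refine mul_le_mul_right ?_ _
  rw [tsum_fsum, sum_mul]
  refine sum_le_sum fun ν' _ => ?_
  by_cases hν : y + nb ν' ∉ slabF {ν} r
  swap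
  · rw [ind_false hν]; simp
  obtain ⟨h1, h2⟩ := (exit_slabF hy).1 hν
  rw [Finset.mem_singleton] at h1
  subst h1
  rw [tsum_mul_left, tsum_mul_left, ← mul_assoc]
  refine mul_le_mul_right (le_of_eq ?_) _
  rw [← (addRight (y + nb ν')).tsum_eq]
  refine tsum_congr fun a => ?_
  simp only [coe_addRight]
  have := tau_half_shift (p := p) (ν := ν') (x := 0) (y := a) (z := y + nb ν') (r := r + 1) (s := 0)
    (by rw [lin_add, lin_nb_self, h2]; push_cast; ring)
  rw [zero_add] at this
  rw [this, lin_add, lin_add, lin_nb_self, h2]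
  congr 2
  rw [eq_iff_iff]
  push_cast
  omega

theorem lay_le (hs : Subcrit d p) (h2 : ∀ r, phi p (slabF {ν} r) 0 ≤ 2) : lay p ν r j * pE p ≤ 4 * (j + 1) := by
  have h0 : ∀ r, lay p ν r 0 * pE p ≤ 2 := fun r => phi_half.symm.trans_le (h2 r)
  suffices h : lay p ν r j * pE p ≤ 2 + 4 * j from h.trans (by rw [mul_add, mul_one, add_comm]; gcongr; norm_num)
  induction r generalizing j with
  | zero => rw [lay_zero]; exact (h0 j).trans le_self_add
  | succ r ih =>
    cases j with
    | zero => exact (h0 _).trans le_self_add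
    | succ j =>
      calc lay p ν (r + 1) (j + 1) * pE p ≤ (lay p ν r j + 2 * lay p ν 0 (j + 1)) * pE p :=
            mul_le_mul_left ((lay_succ hs).trans (add_le_add le_rfl (mul_le_mul_left (h2 r) _))) _
        _ = lay p ν r j * pE p + 2 * (lay p ν (j + 1) 0 * pE p) := by rw [lay_zero]; ring
        _ ≤ 2 + 4 * j + 2 * 2 := add_le_add ih (mul_le_mul_right (h0 _) _)
        _ = 2 + 4 * ((j + 1 : ℕ) : ENNReal) := by push_cast; ring

/-- Total mass of the restricted two-point function in a slab. -/
theorem tsum_tau_slabF_le (hs : Subcrit d p) {I : Finset (Fin d)} (hI : I.Nonempty) (h2 : ∀ (ν : Dir d) r, phi p (slabF {ν} r) 0 ≤ 2) :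
    (∑' b, tau p (slabF (I ×ˢ Finset.univ) r) 0 b) * pE p ≤ 8 * (r + 1) ^ 2 := by
  obtain ⟨i, hi⟩ := hI
  set ν : Dir d := (i, true)
  have h1 : ∀ b, tau p (slabF (I ×ˢ Finset.univ) r) 0 b ≤
      ∑ j ∈ Finset.range (2 * r + 1), tau p (slabF {ν} r) 0 b * ind (lin ν b = r - j) := by
    intro b
    by_cases hb : b ∈ slabF (I ×ˢ Finset.univ) r
    swap
    · rw [tau_eq_zero_right hb]; exact zero_le
    have e1 := hb (i, true) (by simp [hi])
    have e2 := hb (i, false) (by simp [hi])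
    have e3 : lin (i, false) b = - lin ν b := by simp [lin, ν]
    rw [e3] at e2
    change lin ν b ≤ r at e1
    have hj : lin ν b = r - ((r - lin ν b).toNat : ℕ) := by omega
    refine le_trans ?_ (single_le_sum (f := fun j : ℕ => tau p (slabF {ν} r) 0 b * ind (lin ν b = r - j))
      (fun _ _ => zero_le) (Finset.mem_range.2 (show (r - lin ν b).toNat < 2 * r + 1 by omega)))
    rw [ind_true hj, mul_one]
    exact tau_mono (slabF_anti (by simp [ν, hi]))
  calc _ ≤ (∑ j ∈ Finset.range (2 * r + 1), lay p ν r j) * pE p := by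
        refine mul_le_mul_left ((tsum_le_tsum h1).trans ?_) _
        rw [tsum_fsum]
        rfl
    _ ≤ ∑ j ∈ Finset.range (2 * r + 1), (4 * (j + 1) : ENNReal) := by
        rw [sum_mul]
        exact sum_le_sum fun j _ => lay_le hs (h2 ν)
    _ ≤ 8 * (r + 1) ^ 2 := by
        have : ∀ n : ℕ, ∑ j ∈ Finset.range n, 4 * (j + 1) = 2 * n * (n + 1) := fun n => by
          induction n with
          | zero => simp
          | succ n ih => rw [sum_range_succ, ih]; ring
        have h3 := this (2 * r + 1)
        have h4 : ∑ j ∈ Finset.range (2 * r + 1), (4 * (j + 1) : ENNReal) = ((2 * (2 * r + 1) * (2 * r + 1 + 1) : ℕ) : ENNReal) := by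
          rw [← h3]; push_cast; rfl
        rw [h4]
        have : 2 * (2 * r + 1) * (2 * r + 1 + 1) ≤ 8 * (r + 1) ^ 2 := by nlinarith
        exact_mod_cast this

end

section

/-- Second-order upper bound for `(1 + u)⁻ᵏ` near zero. -/
abbrev QuadBound (k : ℕ) (C : ℝ) : Prop := ∀ u : ℝ, |u| ≤ 1 / 2 → ((1 + u) ^ k)⁻¹ ≤ 1 - k * u + C * u ^ 2

theorem exists_taylor (k : ℕ) : ∃ C : ℝ, 0 ≤ C ∧ QuadBound k C := by
  induction k with
  | zero => exact ⟨0, le_rfl, fun u _ => by simp⟩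
  | succ k ih =>
    obtain ⟨C, hC, h⟩ := ih
    refine ⟨2 * k + 2 + 2 * C, by positivity, fun u hu => ?_⟩
    obtain ⟨h1, h2⟩ := abs_le.1 hu
    have hpos : 0 < 1 + u := by linarith
    have h3 : (1 + u)⁻¹ ≤ 1 - u + 2 * u ^ 2 := by
      rw [inv_le_iff_one_le_mul₀ hpos]
      nlinarith [mul_nonneg (sq_nonneg u) (by linarith : (0 : ℝ) ≤ 1 + 2 * u)]
    rw [pow_succ, mul_inv]
    refine (mul_le_mul (h u hu) h3 (by positivity) (le_trans (by positivity) (h u hu))).trans ?_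
    push_cast
    have hk : (0 : ℝ) ≤ k := cast_nonneg k
    have e1 : 0 ≤ u ^ 2 * (1 / 2 + u) * (2 * k + C) := by
      refine mul_nonneg (mul_nonneg (sq_nonneg u) (by linarith)) (by positivity)
    have e2 : 0 ≤ u ^ 2 * (1 / 4 - u ^ 2) * (2 * C) := by
      refine mul_nonneg (mul_nonneg (sq_nonneg u) (by nlinarith)) (by positivity)
    nlinarith [e1, e2]

/-- Reflection of one coordinate. -/
def flip (i : Fin d) : V d ≃ V d := Equiv.piCongrRight fun k => if k = i then Equiv.neg ℤ else Equiv.refl ℤ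

/-- Exchange of two coordinates. -/
def swp (i j : Fin d) : V d ≃ V d := (Equiv.swap i j).arrowCongr (Equiv.refl ℤ)

theorem flip_self (i : Fin d) (Y : V d) : flip i Y i = -Y i := by simp [flip]

theorem flip_ne {i k : Fin d} (h : k ≠ i) (Y : V d) : flip i Y k = Y k := by simp [flip, h]

theorem swp_apply (i j k : Fin d) (Y : V d) : swp i j Y k = Y (Equiv.swap i j k) := by
  simp [swp, Equiv.arrowCongr]

theorem adjacent_flip (i : Fin d) (x y : V d) : Adjacent x y ↔ Adjacent (flip i x) (flip i y) := by
  unfold Adjacent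
  have : ∀ k, |flip i x k - flip i y k| = |x k - y k| := fun k => by
    by_cases h : k = i
    · subst h; rw [flip_self, flip_self, ← abs_neg]; congr 1; ring
    · rw [flip_ne h, flip_ne h]
  simp_rw [this]

theorem adjacent_swp (i j : Fin d) (x y : V d) : Adjacent x y ↔ Adjacent (swp i j x) (swp i j y) := by
  unfold Adjacent
  simp_rw [swp_apply]
  rw [Equiv.sum_comp (Equiv.swap i j) fun k => |x k - y k|]

/-- Squared Euclidean norm of the coordinates in `I`. -/
def sqI (I : Finset (Fin d)) (x : V d) : ℝ := ∑ i ∈ I, (x i : ℝ) ^ 2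

/-- Inner product of the coordinates in `I`. -/
def dotI (I : Finset (Fin d)) (x y : V d) : ℝ := ∑ i ∈ I, (x i : ℝ) * y i

variable {I : Finset (Fin d)} {q : V d → ℝ} {T : ℝ}

theorem sqI_nonneg (I : Finset (Fin d)) (x : V d) : 0 ≤ sqI I x := sum_nonneg fun _ _ => sq_nonneg _

theorem sqI_add (x y : V d) : sqI I (x + y) = sqI I x + (2 * dotI I x y + sqI I y) := by
  simp only [sqI, dotI, mul_sum, ← sum_add_distrib]
  refine sum_ext fun i _ => ?_
  simp only [Pi.add_apply]; push_cast; ring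

theorem dotI_sq_le (x y : V d) : dotI I x y ^ 2 ≤ sqI I x * sqI I y := Finset.sum_mul_sq_le_sq_mul_sq _ _ _

theorem sq_le_sqI {i : Fin d} (hi : i ∈ I) (y : V d) : (y i : ℝ) ^ 2 ≤ sqI I y :=
  single_le_sum (f := fun i => (y i : ℝ) ^ 2) (fun _ _ => sq_nonneg _) hi

theorem summable_moment (hs : Summable q) (hq : ∀ Y, 0 ≤ q Y) (hT : ∀ Y, q Y ≠ 0 → sqI I Y ≤ T)
    {f : V d → ℝ} {c : ℝ} (hf : ∀ Y, sqI I Y ≤ T → |f Y| ≤ c) : Summable fun Y => q Y * f Y := by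
  refine Summable.of_norm_bounded (hs.mul_right c) fun Y => ?_
  rw [Real.norm_eq_abs, abs_mul, abs_of_nonneg (hq Y)]
  by_cases h : q Y = 0
  · simp [h]
  · exact mul_le_mul_of_nonneg_left (hf Y (hT Y h)) (hq Y)

theorem tsum_moment_one (hs : Summable q) (hq : ∀ Y, 0 ≤ q Y) (hT : ∀ Y, q Y ≠ 0 → sqI I Y ≤ T)
    (hflip : ∀ i ∈ I, ∀ Y, q (flip i Y) = q Y) (X : V d) : ∑' Y, q Y * dotI I X Y = 0 := by
  have hsum : ∀ i ∈ I, Summable fun Y => q Y * ((X i : ℝ) * Y i) := fun i hi =>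
    summable_moment hs hq hT (c := |(X i : ℝ)| * (T + 1)) fun Y hY => by
      rw [abs_mul]
      refine mul_le_mul_of_nonneg_left ?_ (abs_nonneg _)
      have := (sq_le_sqI hi Y).trans hY
      rw [← sq_abs] at this
      nlinarith [sq_nonneg (|(Y i : ℝ)| - 1)]
  simp_rw [dotI, mul_sum]
  rw [Summable.tsum_finsetSum hsum]
  refine sum_eq_zero fun i hi => ?_
  have := (flip i).tsum_eq fun Y => q Y * ((X i : ℝ) * Y i)
  simp_rw [hflip i hi, flip_self] at this
  push_cast at this
  simp_rw [mul_neg, tsum_neg] at this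
  linarith

theorem tsum_moment_two (hs : Summable q) (hq : ∀ Y, 0 ≤ q Y) (hT : ∀ Y, q Y ≠ 0 → sqI I Y ≤ T)
    (hflip : ∀ i ∈ I, ∀ Y, q (flip i Y) = q Y) (hswp : ∀ i ∈ I, ∀ j ∈ I, ∀ Y, q (swp i j Y) = q Y) (X : V d) :
    I.card * ∑' Y, q Y * dotI I X Y ^ 2 = sqI I X * ∑' Y, q Y * sqI I Y := by
  have hb : ∀ i ∈ I, ∀ j ∈ I, ∀ Y : V d, sqI I Y ≤ T → |(Y i : ℝ) * Y j| ≤ T := fun i hi j hj Y hY => by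
    have h1 := (sq_le_sqI hi Y).trans hY
    have h2 := (sq_le_sqI hj Y).trans hY
    rw [abs_le]; constructor <;> nlinarith [sq_nonneg ((Y i : ℝ) - Y j), sq_nonneg ((Y i : ℝ) + Y j)]
  have hsum : ∀ i ∈ I, ∀ j ∈ I, Summable fun Y => q Y * ((Y i : ℝ) * Y j) := fun i hi j hj =>
    summable_moment hs hq hT (hb i hi j hj)
  have hoff : ∀ i ∈ I, ∀ j ∈ I, i ≠ j → ∑' Y, q Y * ((Y i : ℝ) * Y j) = 0 := fun i hi j hj hij => by
    have := (flip i).tsum_eq fun Y => q Y * ((Y i : ℝ) * Y j)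
    simp_rw [hflip i hi, flip_self, flip_ne hij.symm] at this
    push_cast at this
    simp_rw [neg_mul, mul_neg, tsum_neg] at this
    linarith
  have hdiag : ∀ i ∈ I, ∀ j ∈ I, ∑' Y, q Y * ((Y i : ℝ) * Y i) = ∑' Y, q Y * ((Y j : ℝ) * Y j) := fun i hi j hj => by
    have := (swp i j).tsum_eq fun Y => q Y * ((Y i : ℝ) * Y i)
    simp_rw [hswp i hi j hj, swp_apply, Equiv.swap_apply_left] at this
    exact this.symm
  have hsq : ∑' Y, q Y * sqI I Y = ∑ i ∈ I, ∑' Y, q Y * ((Y i : ℝ) * Y i) := by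
    rw [← Summable.tsum_finsetSum fun i hi => hsum i hi i hi]
    refine tsum_congr fun Y => ?_
    simp only [sqI, mul_sum, sq]
  have hdot : ∑' Y, q Y * dotI I X Y ^ 2 = ∑ i ∈ I, (X i : ℝ) ^ 2 * ∑' Y, q Y * ((Y i : ℝ) * Y i) := by
    have e1 : ∀ Y, q Y * dotI I X Y ^ 2 = ∑ i ∈ I, ∑ j ∈ I, ((X i : ℝ) * X j) * (q Y * ((Y i : ℝ) * Y j)) := fun Y => by
      rw [dotI, sq, Finset.sum_mul_sum, mul_sum]
      refine sum_ext fun i _ => ?_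
      rw [mul_sum]
      exact sum_ext fun j _ => by ring
    simp_rw [e1]
    rw [Summable.tsum_finsetSum fun i hi => summable_sum fun j hj => (hsum i hi j hj).mul_left _]
    refine sum_ext fun i hi => ?_
    rw [Summable.tsum_finsetSum fun j hj => (hsum i hi j hj).mul_left _]
    rw [sum_eq_single i]
    · rw [_root_.tsum_mul_left, sq]
    · intro j hj hji
      rw [_root_.tsum_mul_left, hoff i hi j hj hji.symm, mul_zero]
    · exact fun h => absurd hi h
  rw [hdot, hsq, sqI, sum_mul, mul_sum]
  refine sum_ext fun i hi => ?_
  rw [sum_ext fun j hj => hdiag j hj i hi, sum_const, nsmul_eq_mul]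
  ring

/-- A symmetric kernel acting on `|x|^{-2k}` at a point far from the origin. -/
theorem drift {k : ℕ} {C : ℝ} (hC0 : 0 ≤ C) (hC : QuadBound k C)
    (hk : 1 ≤ k) (hI : I.Nonempty)
    (hs : Summable q) (hq : ∀ Y, 0 ≤ q Y) (hT : ∀ Y, q Y ≠ 0 → sqI I Y ≤ T)
    (hflip : ∀ i ∈ I, ∀ Y, q (flip i Y) = q Y) (hswp : ∀ i ∈ I, ∀ j ∈ I, ∀ Y, q (swp i j Y) = q Y) (X : V d)
    (hX : 0 < sqI I X) (hTX : 25 * T ≤ sqI I X) (hCM : 32 * C ≤ I.card) (hCT : 8 * C * T ≤ sqI I X) {t : ℝ}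
    (ht : ∀ Y, q Y ≠ 0 → t * sqI I X ≤ sqI I Y) :
    ∑' Y, q Y * (sqI I X / sqI I (X + Y)) ^ k ≤ (1 - t / 2) * ∑' Y, q Y := by
  set n := sqI I X with hn
  have hu : ∀ Y, sqI I Y ≤ T → |(2 * dotI I X Y + sqI I Y) / n| ≤ 1 / 2 := fun Y hY => by
    have h1 := dotI_sq_le (I := I) X Y
    have h2 := sqI_nonneg I Y
    have h3 : dotI I X Y ^ 2 ≤ (n / 5) ^ 2 := by rw [← hn] at h1; nlinarith
    have h4 := abs_le_of_sq_le_sq' h3 (by positivity)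
    rw [abs_div, abs_of_pos hX, div_le_iff₀ hX, abs_le]
    constructor <;> nlinarith [h4.1, h4.2]
  have hpt : ∀ Y, q Y * (n / sqI I (X + Y)) ^ k ≤
      q Y * (1 - k * ((2 * dotI I X Y + sqI I Y) / n) + C * (8 * dotI I X Y ^ 2 + 2 * T * sqI I Y) / n ^ 2) := fun Y => by
    by_cases h0 : q Y = 0
    · simp [h0]
    refine mul_le_mul_of_nonneg_left ?_ (hq Y)
    have hY := hT Y h0
    have h1 : n / sqI I (X + Y) = (1 + (2 * dotI I X Y + sqI I Y) / n)⁻¹ := by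
      rw [sqI_add, ← hn, eq_comm, inv_eq_iff_eq_inv, inv_div]; field_simp
    rw [h1, inv_pow]
    refine (hC _ (hu Y hY)).trans (add_le_add le_rfl ?_)
    rw [mul_div_assoc]
    refine mul_le_mul_of_nonneg_left ?_ hC0
    rw [div_pow]
    gcongr
    have := sqI_nonneg I Y
    nlinarith [sq_nonneg (2 * dotI I X Y - sqI I Y), mul_le_mul_of_nonneg_right hY this]
  have hT0 : ∀ Y, sqI I Y ≤ T → 0 ≤ T := fun Y hY => (sqI_nonneg I Y).trans hY
  have s1 : Summable fun Y => q Y * dotI I X Y := summable_moment hs hq hT (c := n * T + 1) fun Y hY => by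
    have h1 := dotI_sq_le (I := I) X Y
    have h2 : dotI I X Y ^ 2 ≤ n * T := h1.trans (mul_le_mul_of_nonneg_left hY hX.le)
    rw [abs_le]; constructor <;> nlinarith [sq_nonneg (dotI I X Y - 1), sq_nonneg (dotI I X Y + 1)]
  have s2 : Summable fun Y => q Y * dotI I X Y ^ 2 := summable_moment hs hq hT (c := n * T) fun Y hY => by
    rw [abs_of_nonneg (sq_nonneg _)]
    exact (dotI_sq_le (I := I) X Y).trans (mul_le_mul_of_nonneg_left hY hX.le)
  have s3 : Summable fun Y => q Y * sqI I Y := summable_moment hs hq hT (c := T) fun Y hY => by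
    rwa [abs_of_nonneg (sqI_nonneg I Y)]
  have e1 := tsum_moment_one hs hq hT hflip X
  have e2 := tsum_moment_two hs hq hT hflip hswp X
  set s := ∑' Y, q Y * sqI I Y with hs_def
  set D := ∑' Y, q Y * dotI I X Y ^ 2
  have hexp : ∀ Y, q Y * (1 - k * ((2 * dotI I X Y + sqI I Y) / n) + C * (8 * dotI I X Y ^ 2 + 2 * T * sqI I Y) / n ^ 2) =
      q Y - 2 * k / n * (q Y * dotI I X Y) - k / n * (q Y * sqI I Y) + 8 * C / n ^ 2 * (q Y * dotI I X Y ^ 2)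
        + 2 * C * T / n ^ 2 * (q Y * sqI I Y) := fun Y => by ring
  have sR : Summable fun Y => q Y * (1 - k * ((2 * dotI I X Y + sqI I Y) / n) + C * (8 * dotI I X Y ^ 2 + 2 * T * sqI I Y) / n ^ 2) := by
    simp_rw [hexp]
    exact (((hs.sub (s1.mul_left _)).sub (s3.mul_left _)).add (s2.mul_left _)).add (s3.mul_left _)
  have sL : Summable fun Y => q Y * (n / sqI I (X + Y)) ^ k :=
    sR.of_nonneg_of_le (fun Y => mul_nonneg (hq Y) (pow_nonneg (div_nonneg hX.le (sqI_nonneg _ _)) _)) hpt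
  refine (sL.tsum_le_tsum hpt sR).trans ?_
  simp_rw [hexp]
  rw [(((hs.sub (s1.mul_left _)).sub (s3.mul_left _)).add (s2.mul_left _)).tsum_add (s3.mul_left _),
    ((hs.sub (s1.mul_left _)).sub (s3.mul_left _)).tsum_add (s2.mul_left _),
    (hs.sub (s1.mul_left _)).tsum_sub (s3.mul_left _), hs.tsum_sub (s1.mul_left _)]
  simp only [_root_.tsum_mul_left]
  rw [e1, mul_zero, sub_zero, ← hs_def]
  have hs0 : 0 ≤ s := tsum_nonneg fun Y => mul_nonneg (hq Y) (sqI_nonneg I Y)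
  have hM : (0 : ℝ) < I.card := mod_cast hI.card_pos
  have hD : 8 * C / n ^ 2 * D ≤ s / n / 4 := by
    have : D = n * s / I.card := by rw [eq_div_iff hM.ne']; linarith
    rw [this, show 8 * C / n ^ 2 * (n * s / I.card) = s / n * (8 * C / I.card) by field_simp]
    rw [div_eq_mul_one_div (s / n) 4]
    refine mul_le_mul_of_nonneg_left ?_ (by positivity)
    rw [div_le_iff₀ hM]; linarith
  have hE : 2 * C * T / n ^ 2 * s ≤ s / n / 4 := by
    rw [show 2 * C * T / n ^ 2 * s = s / n * (2 * C * T / n) by field_simp, div_eq_mul_one_div (s / n) 4]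
    refine mul_le_mul_of_nonneg_left ?_ (by positivity)
    rw [div_le_iff₀ hX]; linarith
  have hk' : s / n ≤ k / n * s := by
    rw [show (k : ℝ) / n * s = k * (s / n) by ring]
    exact le_mul_of_one_le_left (by positivity) (by exact_mod_cast hk)
  have ht' : t * ∑' Y, q Y ≤ s / n := by
    rw [le_div_iff₀ hX, ← _root_.tsum_mul_left, ← _root_.tsum_mul_right]
    refine ((hs.mul_left t).mul_right n).tsum_le_tsum (fun Y => ?_) s3
    by_cases h0 : q Y = 0
    · simp [h0]
    · calc t * q Y * n = q Y * (t * n) := by ring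
        _ ≤ _ := mul_le_mul_of_nonneg_left (ht Y h0) (hq Y)
  linarith

end

section

theorem sum_nb_eq_tsum (f : V d → ENNReal) (y : V d) : ∑ ν, f (y + nb ν) = ∑' Y, ind (Adjacent y Y) * f Y := by
  have hinj : Injective fun ν : Dir d => y + nb ν := fun a b h => nb_injective (add_left_cancel h)
  rw [tsum_eq_sum (s := Finset.univ.map ⟨_, hinj⟩), sum_map]
  · refine sum_ext fun ν _ => ?_
    simp [ind_true (adjacent_add_nb y ν)]
  · intro Y hY
    rw [ind_false, zero_mul]
    intro h
    obtain ⟨ν, rfl⟩ := h.exists_nb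
    exact hY (by simp)

/-- The expected number of open edges of the cluster of `0` in `S` that leave `S` and end at `Y`. -/
def land (p : ℝ) (S : Set (V d)) (Y : V d) : ENNReal :=
  ∑' y, ind (Adjacent y Y) * (tau p S 0 y * (ind (Y ∉ S) * pE p))

theorem tsum_land (f : V d → ENNReal) : ∑' y, tau p S 0 y * ∑ ν, ind (y + nb ν ∉ S) * (pE p * f (y + nb ν)) =
    ∑' Y, land p S Y * f Y := by
  have h : ∀ y, tau p S 0 y * ∑ ν, ind (y + nb ν ∉ S) * (pE p * f (y + nb ν)) =
      ∑' Y, ind (Adjacent y Y) * (tau p S 0 y * (ind (Y ∉ S) * pE p)) * f Y := fun y => by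
    rw [sum_nb_eq_tsum (fun Y => ind (Y ∉ S) * (pE p * f Y)), ← tsum_mul_left]
    exact tsum_congr fun Y => by ring
  simp_rw [h]
  rw [tsum_comm]
  exact tsum_congr fun Y => tsum_mul_right

theorem tsum_land_one : ∑' Y, land p S Y = phi p S 0 := by
  have := tsum_land (p := p) (S := S) fun _ => 1
  simp only [mul_one] at this
  rw [← this, phi]

theorem land_equiv (g : V d ≃ V d) (hg : ∀ x y, Adjacent x y ↔ Adjacent (g x) (g y)) (h0 : g 0 = 0)
    (hS : g ⁻¹' S = S) (Y : V d) : land p S (g Y) = land p S Y := by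
  unfold land
  rw [← g.tsum_eq]
  refine tsum_congr fun y => ?_
  rw [← hg]
  have h1 : tau p S 0 (g y) = tau p S 0 y := by
    have := tau_equiv (p := p) (S := S) (x := 0) (y := y) g hg
    rwa [h0, hS] at this
  have h2 : (g Y ∉ S) = (Y ∉ S) := by
    conv_rhs => rw [← hS]
    rfl
  rw [h1, h2]

theorem land_support {Y : V d} (h : land p S Y ≠ 0) : Y ∉ S ∧ ∃ y ∈ S, ∃ ν, Y = y + nb ν := by
  by_contra hc
  refine h (ENNReal.tsum_eq_zero.2 fun y => ?_)
  by_cases h1 : Adjacent y Y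
  · obtain ⟨ν, rfl⟩ := h1.exists_nb
    by_cases hy : y ∈ S
    · by_cases h2 : y + nb ν ∉ S
      · exact absurd ⟨h2, y, hy, ν, rfl⟩ hc
      · simp [ind_false h2]
    · simp [tau_eq_zero_right hy]
  · simp [ind_false h1]

theorem conv_tt_eq (v : V d → ENNReal) (x : V d) : conv (tt p) v x = ∑' z, tt p z * v (x + z) := by
  unfold conv
  rw [← (Equiv.neg (V d)).tsum_eq]
  exact tsum_congr fun y => by simp [tt_neg]

theorem conv_tt_le_land (hs : Subcrit d p) (h0 : 0 ∈ S) (v : V d → ENNReal) (x : V d) :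
    conv (tt p) v x ≤ ∑' u, tau p S 0 u * v (x + u) + ∑' Y, land p S Y * conv (tt p) v (x + Y) := by
  rw [conv_tt_eq, ← tsum_land, ← tsum_add]
  have h : ∀ z, tt p z * v (x + z) ≤ tau p S 0 z * v (x + z) + ∑' y, tau p S 0 y *
      ∑ ν, ind (y + nb ν ∉ S) * (pE p * (tt p (z - (y + nb ν)) * v (x + z))) := fun z => by
    refine (mul_le_mul_left (simon_lieb (S := S) h0 (hs.finCl _ _)) _).trans ?_
    rw [add_mul, ← tsum_mul_right]
    refine add_le_add le_rfl (tsum_le_tsum fun y => ?_)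
    rw [mul_assoc, sum_mul]
    refine mul_le_mul_right (sum_le_sum fun ν' _ => ?_) _
    rw [mul_assoc, mul_assoc, tau_univ_eq]
    exact mul_le_mul' (ind_mono fun h => h.2) le_rfl
  refine (tsum_le_tsum h).trans (le_of_eq ?_)
  rw [tsum_add, tsum_add]
  congr 1
  rw [tsum_comm]
  refine tsum_congr fun y => ?_
  rw [tsum_mul_left, tsum_fsum]
  congr 1
  refine sum_ext fun ν _ => ?_
  rw [tsum_mul_left, tsum_mul_left, conv_tt_eq, ← (addRight (y + nb ν)).tsum_eq]
  congr 2
  refine tsum_congr fun z => ?_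
  simp only [coe_addRight, add_sub_cancel_right]
  congr 2
  abel

end

section
variable {I : Finset (Fin d)} {R : ℕ} {k : ℕ}

/-- The cube of side `2r+1` in the coordinates `I`. -/
def cubeI (I : Finset (Fin d)) (r : ℕ) : Set (V d) := slabF (I ×ˢ Finset.univ) r

theorem mem_cubeI {r : ℕ} : x ∈ cubeI I r ↔ ∀ i ∈ I, |x i| ≤ r := by
  simp only [cubeI, slabF, mem_ofPred_eq, mem_product, Finset.mem_univ, and_true, Prod.forall, Bool.forall_bool, lin]
  refine forall_congr' fun i => ?_
  simp only [abs_le]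
  grind

/-- A truncated power of the Euclidean norm of the coordinates in `I`. -/
def hpow (R : ℕ) (I : Finset (Fin d)) (k : ℕ) (x : V d) : ℝ :=
  ((R : ℝ) ^ 2 / max ((R : ℝ) ^ 2) (sqI I x)) ^ k

theorem hpow_base_le (hR : 1 ≤ R) : (R : ℝ) ^ 2 / max ((R : ℝ) ^ 2) (sqI I x) ≤ 1 := by
  have : (0 : ℝ) < (R : ℝ) ^ 2 := by positivity
  rw [div_le_one (lt_max_of_lt_left this)]
  exact le_max_left _ _

theorem hpow_base_pos (hR : 1 ≤ R) : 0 < (R : ℝ) ^ 2 / max ((R : ℝ) ^ 2) (sqI I x) := by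
  have : (0 : ℝ) < (R : ℝ) ^ 2 := by positivity
  exact div_pos this (lt_max_of_lt_left this)

theorem hpow_pos (hR : 1 ≤ R) : 0 < hpow R I k x := pow_pos (hpow_base_pos hR) k

theorem hpow_le_one (hR : 1 ≤ R) : hpow R I k x ≤ 1 := pow_le_one₀ (hpow_base_pos hR).le (hpow_base_le hR)

theorem hpow_far (h : (R : ℝ) ^ 2 ≤ sqI I x) : hpow R I k x = (R ^ 2 / sqI I x) ^ k := by
  rw [hpow, max_eq_right h]

theorem hpow_near (hR : 1 ≤ R) (h : sqI I x ≤ R ^ 2) : hpow R I k x = 1 := by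
  have : (0 : ℝ) < R ^ 2 := by positivity
  rw [hpow, max_eq_left h, div_self this.ne', one_pow]

theorem hpow_succ_le (hR : 1 ≤ R) : hpow R I (k + 1) x ≤ hpow R I k x :=
  pow_le_pow_of_le_one (hpow_base_pos hR).le (hpow_base_le hR) (Nat.le_succ k)

theorem dotI_abs_le {a : ℝ} (ha : 0 ≤ a) (h : sqI I x * sqI I y ≤ a ^ 2) : |dotI I x y| ≤ a :=
  abs_le_of_sq_le_sq ((dotI_sq_le x y).trans h) ha

theorem sqI_le_of_small (h : 25 * sqI I y ≤ sqI I x) : sqI I x ≤ 4 * sqI I (x + y) := by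
  have h0 := sqI_nonneg I y
  have := abs_le.1 (dotI_abs_le (I := I) (x := x) (y := y) (a := sqI I x / 5) (by linarith) (by nlinarith))
  rw [sqI_add]
  linarith

theorem sqI_le_nrm1 (z : V d) : sqI I z ≤ (nrm1 z : ℝ) ^ 2 := by
  calc sqI I z = ∑ i ∈ I, |(z i : ℝ)| ^ 2 := by simp [sqI]
    _ ≤ (∑ i ∈ I, |(z i : ℝ)|) ^ 2 := Finset.sum_sq_le_sq_sum_of_nonneg fun _ _ => abs_nonneg _
    _ ≤ (nrm1 z : ℝ) ^ 2 := by
      have : ∑ i ∈ I, |(z i : ℝ)| ≤ nrm1 z := by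
        rw [nrm1]; push_cast
        refine (Finset.sum_le_sum_of_subset_of_nonneg (Finset.subset_univ I) fun _ _ _ => abs_nonneg _).trans (le_of_eq ?_)
        exact sum_ext fun i _ => by rw [Nat.cast_natAbs]; simp
      gcongr

theorem hpow_translate (hR : 1 ≤ R) : hpow R I k (x + z) ≤ hpow R I k x * ((nrm1 z + 1 : ℝ) ^ 2) ^ k := by
  unfold hpow
  rw [← mul_pow]
  refine pow_le_pow_left₀ (hpow_base_pos hR).le ?_ _
  have hR2 : (1 : ℝ) ≤ R ^ 2 := one_le_pow₀ (by exact_mod_cast hR)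
  set L := max ((R : ℝ) ^ 2) (sqI I (x + z)) with hL
  have hL1 : 1 ≤ L := hR2.trans (le_max_left _ _)
  set t : ℝ := (nrm1 z : ℝ)
  have ht : 0 ≤ t := cast_nonneg _
  have h1 : sqI I (-z) ≤ t ^ 2 := by
    have : sqI I (-z) = sqI I z := by simp [sqI]
    rw [this]; exact sqI_le_nrm1 z
  have hsL : sqI I (x + z) ≤ L := le_max_right _ _
  have h2 : |dotI I (x + z) (-z)| ≤ L * t := dotI_abs_le (by positivity) (by
    calc _ ≤ L * t ^ 2 := mul_le_mul hsL h1 (sqI_nonneg _ _) (by positivity)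
      _ ≤ (L * t) ^ 2 := by nlinarith [sq_nonneg t])
  have h3 : sqI I x ≤ L * (t + 1) ^ 2 := by
    have := sqI_add (I := I) (x + z) (-z)
    rw [add_neg_cancel_right] at this
    rw [this]
    nlinarith [(abs_le.1 h2).2, sq_nonneg t]
  have h4 : max ((R : ℝ) ^ 2) (sqI I x) ≤ L * (t + 1) ^ 2 := max_le (by
    have := le_max_left ((R : ℝ) ^ 2) (sqI I (x + z)); rw [← hL] at this
    nlinarith [mul_nonneg (zero_le_one.trans hL1) ht, mul_nonneg (zero_le_one.trans hL1) (sq_nonneg t)]) h3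
  have hm : (0 : ℝ) < max ((R : ℝ) ^ 2) (sqI I x) := lt_max_of_lt_left (by positivity)
  rw [div_mul_eq_mul_div, div_le_div_iff₀ (by positivity) hm]
  nlinarith

theorem cube_exit {r : ℕ} (hy : y ∈ cubeI I r) {ν : Dir d} (h : y + nb ν ∉ cubeI I r) :
    (∃ i ∈ I, |(y + nb ν) i| = r + 1) ∧ ∀ i ∈ I, |(y + nb ν) i| ≤ r + 1 := by
  have h1 : ∀ i ∈ I, |(y + nb ν) i| ≤ r + 1 := fun i hi =>
    (abs_add_le _ _).trans (add_le_add (mem_cubeI.1 hy i hi) (abs_nb_le ν i))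
  refine ⟨?_, h1⟩
  rw [mem_cubeI] at h
  push Not at h
  obtain ⟨i, hi, h⟩ := h
  exact ⟨i, hi, le_antisymm (h1 i hi) (by omega)⟩

theorem sqI_le_of_abs {a : ℝ} (h : ∀ i ∈ I, |(y i : ℝ)| ≤ a) : sqI I y ≤ I.card * a ^ 2 := by
  rw [sqI, ← nsmul_eq_mul]
  refine sum_le_card_nsmul _ _ _ fun i hi => ?_
  rw [← sq_abs]
  exact pow_le_pow_left₀ (abs_nonneg _) (h i hi) 2

theorem preimage_flip_cubeI {r : ℕ} (i : Fin d) : flip i ⁻¹' cubeI I r = cubeI I r := by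
  ext v
  simp only [mem_preimage, mem_cubeI]
  refine forall₂_congr fun k _ => ?_
  by_cases h : k = i
  · subst h; rw [flip_self, abs_neg]
  · rw [flip_ne h]

theorem preimage_swp_cubeI {r : ℕ} {i j : Fin d} (hi : i ∈ I) (hj : j ∈ I) : swp i j ⁻¹' cubeI I r = cubeI I r := by
  have hm : ∀ k, Equiv.swap i j k ∈ I ↔ k ∈ I := fun k => by
    by_cases h1 : k = i
    · subst h1; simp [hi, hj]
    · by_cases h2 : k = j
      · subst h2; simp [hi, hj]
      · rw [Equiv.swap_apply_of_ne_of_ne h1 h2]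
  ext v
  simp only [mem_preimage, mem_cubeI, swp_apply]
  constructor
  · intro h k hk
    have := h (Equiv.swap i j k) ((hm k).2 hk)
    simpa using this
  · intro h k hk
    exact h _ ((hm k).2 hk)

theorem land_lyap {r : ℕ} {C : ℝ} (hk : 1 ≤ k) (hC0 : 0 ≤ C)
    (hC : QuadBound k C)
    (hI : I.Nonempty) {T t : ℝ} (hx : (R : ℝ) ^ 2 ≤ sqI I x) (hR : 1 ≤ R) (hTX : 25 * T ≤ sqI I x)
    (hCM : 32 * C ≤ I.card) (hCT : 8 * C * T ≤ sqI I x)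
    (hphi : phi p (cubeI I r) 0 ≠ ∞)
    (hT : ∀ Y, land p (cubeI I r) Y ≠ 0 → sqI I Y ≤ T) (ht : ∀ Y, land p (cubeI I r) Y ≠ 0 → t * sqI I x ≤ sqI I Y) (ht1 : t ≤ 1) :
    ∑' Y, land p (cubeI I r) Y * ofReal (hpow R I k (x + Y)) ≤
      ofReal (1 - t / 2) * phi p (cubeI I r) 0 * ofReal (hpow R I k x) := by
  have hR2 : (1 : ℝ) ≤ (R : ℝ) ^ 2 := one_le_pow₀ (by exact_mod_cast hR)
  set n := sqI I x with hn
  have hn0 : 0 < n := by linarith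
  set K := land p (cubeI I r) with hK
  have htot : ∑' Y, K Y ≠ ∞ := by rw [hK, tsum_land_one]; exact hphi
  set q : V d → ℝ := fun Y => (K Y).toReal with hq
  have hKtop : ∀ Y, K Y ≠ ∞ := ENNReal.ne_top_of_tsum_ne_top htot
  have hq0 : ∀ Y, q Y ≠ 0 → K Y ≠ 0 := fun Y h h' => h (by simp [hq, h'])
  have hKq : ∀ Y, K Y = ofReal (q Y) := fun Y => (ofReal_toReal (hKtop Y)).symm
  have hsum : Summable q := ENNReal.summable_toReal htot
  have hd := drift hC0 hC hk hI hsum (fun Y => toReal_nonneg) (fun Y h => hT Y (hq0 Y h))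
    (fun i _ Y => by
      simp only [hq, hK]
      rw [land_equiv (flip i) (adjacent_flip i) (by ext k; by_cases h : k = i <;> simp [flip, h]) (preimage_flip_cubeI i)])
    (fun i hi j hj Y => by
      simp only [hq, hK]
      rw [land_equiv (swp i j) (adjacent_swp i j) (by ext k; simp [swp_apply]) (preimage_swp_cubeI hi hj)])
    x hn0 hTX hCM hCT (fun Y h => ht Y (hq0 Y h))
  have hle : ∀ Y, q Y * hpow R I k (x + Y) ≤ q Y * (n / sqI I (x + Y)) ^ k * hpow R I k x := fun Y => by
    by_cases h0 : q Y = 0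
    · simp [h0]
    rw [mul_assoc]
    refine mul_le_mul_of_nonneg_left ?_ toReal_nonneg
    have h1 := sqI_le_of_small (I := I) (x := x) (y := Y) (by linarith [hT Y (hq0 Y h0)])
    have h2 : 0 < sqI I (x + Y) := by linarith
    rw [hpow_far hx, ← mul_pow, div_mul_div_cancel₀' hn0.ne']
    unfold hpow
    gcongr
    exact le_max_right _ _
  have hsm : Summable fun Y => q Y * (n / sqI I (x + Y)) ^ k := by
    refine Summable.of_norm_bounded (hsum.mul_right (4 ^ k)) fun Y => ?_
    by_cases h0 : q Y = 0
    · simp [h0]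
    have h1 := sqI_le_of_small (I := I) (x := x) (y := Y) (by linarith [hT Y (hq0 Y h0)])
    have h2 : 0 < sqI I (x + Y) := by linarith
    have hq00 : 0 ≤ q Y := toReal_nonneg
    rw [Real.norm_of_nonneg (by positivity)]
    gcongr
    rw [div_le_iff₀ h2]; exact h1
  calc ∑' Y, K Y * ofReal (hpow R I k (x + Y))
      ≤ ∑' Y, ofReal (q Y * (n / sqI I (x + Y)) ^ k * hpow R I k x) := by
        refine tsum_le_tsum fun Y => ?_
        rw [hKq, ← ofReal_mul toReal_nonneg]
        exact ofReal_le_ofReal (hle Y)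
    _ = ofReal (∑' Y, q Y * (n / sqI I (x + Y)) ^ k * hpow R I k x) := by
        rw [ENNReal.ofReal_tsum_of_nonneg (fun Y => ?_) (hsm.mul_right _)]
        have := sqI_nonneg I (x + Y)
        have := (hpow_pos (I := I) (k := k) (x := x) hR).le
        have hq00 : 0 ≤ q Y := toReal_nonneg
        positivity
    _ ≤ ofReal ((1 - t / 2) * (∑' Y, q Y) * hpow R I k x) := by
        rw [_root_.tsum_mul_right]
        exact ofReal_le_ofReal (mul_le_mul_of_nonneg_right hd (hpow_pos hR).le)
    _ = _ := by
        have h0 : 0 ≤ 1 - t / 2 := by linarith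
        rw [ofReal_mul (mul_nonneg h0 (tsum_nonneg fun _ => toReal_nonneg)), ofReal_mul h0,
          ← tsum_land_one, ENNReal.ofReal_tsum_of_nonneg (fun _ => toReal_nonneg) hsum]
        rw [tsum_congr fun Y => (hKq Y).symm]

end

section
variable {I : Finset (Fin d)} {R : ℕ} {k : ℕ}

theorem exists_abs_max (hI : I.Nonempty) (x : V d) : ∃ m : ℕ, (∀ i ∈ I, |(x i : ℝ)| ≤ m) ∧ (m : ℝ) ^ 2 ≤ sqI I x := by
  obtain ⟨i, hi, h⟩ := I.exists_max_image (fun i => (x i).natAbs) hI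
  have habs : ∀ j, |(x j : ℝ)| = ((x j).natAbs : ℝ) := fun j => by rw [Nat.cast_natAbs]; simp
  refine ⟨(x i).natAbs, fun j hj => ?_, ?_⟩
  · rw [habs]; exact_mod_cast h j hj
  · rw [← habs, sq_abs]; exact sq_le_sqI hi x

theorem land_cube_ge {r : ℕ} {Y : V d} (h : land p (cubeI I r) Y ≠ 0) :
    (∃ i ∈ I, |(Y i : ℝ)| = r + 1) ∧ ∀ i ∈ I, |(Y i : ℝ)| ≤ r + 1 := by
  obtain ⟨h1, y, hy, ν, rfl⟩ := land_support h
  obtain ⟨⟨i, hi, h2⟩, h3⟩ := cube_exit hy h1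
  exact ⟨⟨i, hi, by exact_mod_cast h2⟩, fun i hi => by exact_mod_cast h3 i hi⟩

theorem land_cube_zero {Y : V d} (h : land p (cubeI I 0) Y ≠ 0) : sqI I Y ≤ 1 := by
  obtain ⟨h1, y, hy, ν, rfl⟩ := land_support h
  have : ∀ i ∈ I, ((y + nb ν) i : ℝ) ^ 2 = (nb ν i : ℝ) ^ 2 := fun i hi => by
    have := mem_cubeI.1 hy i hi
    have h0 : y i = 0 := by simpa using this
    simp [h0]
  rw [sqI, sum_congr rfl this]
  refine (Finset.sum_le_sum_of_subset_of_nonneg (Finset.subset_univ I) fun _ _ _ => sq_nonneg _).trans (le_of_eq ?_)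
  rw [sum_eq_single ν.1]
  · rcases ν with ⟨i, b⟩; cases b <;> simp [nb]
  · intro j _ hj; simp [nb, hj]
  · simp

theorem gam_bounds {γ : ℝ} (hI : I.Nonempty) (hγ : γ * (400 * I.card ^ 3) = 1) : (1 : ℝ) ≤ I.card ∧ 0 < γ ∧ γ ≤ 1 / 400 := by
  have hM1 : (1 : ℝ) ≤ I.card := mod_cast hI.card_pos
  have hM3 : (1 : ℝ) ≤ I.card ^ 3 := one_le_pow₀ hM1
  have hγ0 : 0 < γ := by by_contra h; nlinarith
  exact ⟨hM1, hγ0, by nlinarith⟩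

theorem lyap_step {C : ℝ} (hk : 1 ≤ k) (hC0 : 0 ≤ C)
    (hC : QuadBound k C)
    (hI : I.Nonempty) (hR : 5 ≤ R) (hRC : 8 * C ≤ R ^ 2) (hCM : 32 * C ≤ I.card) {γ : ℝ}
    (hγ : γ * (400 * I.card ^ 3) = 1)
    (hphi : ∀ r, phi p (cubeI I r) 0 ≤ ofReal (1 + γ)) (x : V d) :
    ∃ r, (∀ u ∈ cubeI I r, 8 * (r + 1) ^ 2 * hpow R I (k + 1) (x + u) ≤ 72 * 4 ^ (k + 1) * R ^ 2 * hpow R I k x) ∧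
      ∑' Y, land p (cubeI I r) Y * ofReal (hpow R I k (x + Y)) ≤
        ofReal (1 - γ) * ofReal (hpow R I k x) := by
  obtain ⟨hM1, hγ0, hγ1⟩ := gam_bounds hI hγ
  have hR5 : (5 : ℝ) ≤ R := mod_cast hR
  have hR1 : 1 ≤ R := by omega
  have hR25 : (25 : ℝ) ≤ R ^ 2 := by nlinarith
  rcases le_total ((R : ℝ) ^ 2) (sqI I x) with hx | hx
  · obtain ⟨m, hm1, hm2⟩ := exists_abs_max hI x
    have hnm : sqI I x ≤ I.card * (m : ℝ) ^ 2 := sqI_le_of_abs hm1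
    set M : ℕ := I.card
    have hMpos : 0 < M := hI.card_pos
    set n := sqI I x with hn
    obtain ⟨r, hr1, hr2⟩ : ∃ r : ℕ, (r = 0 ∨ (r + 1) * (5 * M) ≤ m) ∧ m < 10 * M * (r + 1) := by
      refine ⟨m / (5 * M) - 1, ?_, ?_⟩
      · rcases lt_or_ge (m / (5 * M)) 2 with h | h
        · left; omega
        · right
          rw [Nat.sub_add_cancel (by omega)]
          exact Nat.div_mul_le_self m (5 * M)
      · have := Nat.lt_div_mul_add (a := m) (b := 5 * M) (by positivity)
        rcases lt_or_ge (m / (5 * M)) 2 with h | h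
        · have h0 : m / (5 * M) - 1 = 0 := by omega
          rw [h0]
          nlinarith
        · obtain ⟨c, hc⟩ := Nat.exists_eq_add_of_le h
          rw [hc] at this ⊢
          have : 2 + c - 1 = c + 1 := by omega
          rw [this]
          nlinarith
    have hr2' : (m : ℝ) ≤ 10 * M * (r + 1) := mod_cast hr2.le
    have hn2 : n ≤ 100 * M ^ 3 * (r + 1) ^ 2 := by
      have : (m : ℝ) ^ 2 ≤ (10 * M * (r + 1)) ^ 2 := pow_le_pow_left₀ (by positivity) hr2' 2
      calc n ≤ M * m ^ 2 := hnm
        _ ≤ M * (10 * M * (r + 1)) ^ 2 := by gcongr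
        _ = _ := by ring
    have hcase : r = 0 ∨ 25 * (M * (r + 1) ^ 2) * M ≤ n := by
      refine hr1.imp_right fun h => ?_
      have h' : ((r : ℝ) + 1) * (5 * M) ≤ m := mod_cast h
      calc 25 * ((M : ℝ) * (r + 1) ^ 2) * M = (((r : ℝ) + 1) * (5 * M)) ^ 2 := by ring
        _ ≤ (m : ℝ) ^ 2 := pow_le_pow_left₀ (by positivity) h' 2
        _ ≤ n := hm2
    refine ⟨r, fun u hu => ?_, ?_⟩
    · have hu' : ∀ i ∈ I, |(u i : ℝ)| ≤ r := fun i hi => by exact_mod_cast mem_cubeI.1 hu i hi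
      have hsu := sqI_le_of_abs hu'
      have h25 : 25 * sqI I u ≤ n := by
        rcases hcase with h | h
        · subst h; simp at hsu; linarith
        · have : (r : ℝ) ^ 2 ≤ (r + 1) ^ 2 := by gcongr; linarith
          have h4 : (M : ℝ) * r ^ 2 ≤ M * (r + 1) ^ 2 := by gcongr
          nlinarith [mul_le_mul_of_nonneg_left hM1 (by positivity : (0 : ℝ) ≤ 25 * (M * (r + 1) ^ 2))]
      have h4 := sqI_le_of_small h25
      have hrn : ((r : ℝ) + 1) ^ 2 ≤ n := by
        rcases hcase with h | h
        · subst h; norm_num; linarith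
        · nlinarith [mul_le_mul hM1 hM1 zero_le_one (by positivity), sq_nonneg ((r : ℝ) + 1)]
      have hn0 : 0 < n := by linarith
      have hbase : hpow R I (k + 1) (x + u) ≤ 4 ^ (k + 1) * ((R : ℝ) ^ 2 / n) ^ (k + 1) := by
        rw [← mul_pow]
        unfold hpow
        refine pow_le_pow_left₀ (hpow_base_pos hR1).le ?_ _
        rw [mul_div_assoc', div_le_div_iff₀ (lt_max_of_lt_left (by positivity)) hn0]
        have := le_max_right ((R : ℝ) ^ 2) (sqI I (x + u))
        nlinarith
      rw [hpow_far hx]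
      calc 8 * ((r : ℝ) + 1) ^ 2 * hpow R I (k + 1) (x + u)
          ≤ 8 * n * (4 ^ (k + 1) * (R ^ 2 / n) ^ (k + 1)) := by
            have := (hpow_pos (I := I) (k := k + 1) (x := x + u) hR1).le
            gcongr
        _ = 8 * 4 ^ (k + 1) * R ^ 2 * (R ^ 2 / n) ^ k := by
            rw [pow_succ (R ^ 2 / n)]; field_simp
        _ ≤ _ := by gcongr; norm_num
    · have hphi' : phi p (cubeI I r) 0 ≠ ∞ := ((hphi r).trans_lt ENNReal.ofReal_lt_top).ne
      have ht : ∀ Y, land p (cubeI I r) Y ≠ 0 → (4 * γ) * n ≤ sqI I Y := fun Y hY => by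
        obtain ⟨⟨i, hi, h⟩, -⟩ := land_cube_ge hY
        refine le_trans ?_ ((sq_abs _).le.trans (sq_le_sqI hi Y))
        rw [h]
        calc 4 * γ * n ≤ 4 * γ * (100 * (M : ℝ) ^ 3 * (r + 1) ^ 2) := by gcongr
          _ = (γ * (400 * (M : ℝ) ^ 3)) * (r + 1) ^ 2 := by ring
          _ = _ := by rw [hγ, one_mul]
      have hfin : ofReal (1 - (4 * γ) / 2) * phi p (cubeI I r) 0 * ofReal (hpow R I k x) ≤
          ofReal (1 - γ) * ofReal (hpow R I k x) := by
        refine mul_le_mul_left ((mul_le_mul_right (hphi r) _).trans ?_) _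
        rw [← ofReal_mul (by linarith)]
        exact ofReal_le_ofReal (by nlinarith)
      refine le_trans ?_ hfin
      rcases hcase with h | h
      · subst h
        exact land_lyap hk hC0 hC hI (T := 1) hx hR1 (by linarith) hCM (by linarith) hphi' (fun Y hY => land_cube_zero hY) ht (by linarith)
      · refine land_lyap hk hC0 hC hI (T := M * (r + 1) ^ 2) hx hR1 ?_ hCM ?_ hphi' (fun Y hY => sqI_le_of_abs (land_cube_ge hY).2) ht (by linarith)
        · nlinarith [mul_le_mul_of_nonneg_left hM1 (by positivity : (0 : ℝ) ≤ 25 * (M * (r + 1) ^ 2))]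
        · nlinarith [mul_le_mul_of_nonneg_left hCM (by positivity : (0 : ℝ) ≤ (M * (r + 1) ^ 2 : ℝ)), (by positivity : (0 : ℝ) ≤ (M * (r + 1) ^ 2 : ℝ) * M)]
  · have h1 : (((3 * R - 1 : ℕ) : ℝ) + 1) = 3 * R := mod_cast (by omega : 3 * R - 1 + 1 = 3 * R)
    refine ⟨3 * R - 1, fun u _ => ?_, ?_⟩
    · rw [hpow_near (k := k) hR1 hx]
      rw [h1, mul_one]
      have h2 : (1 : ℝ) ≤ 4 ^ (k + 1) := one_le_pow₀ (by norm_num)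
      calc 8 * (3 * R) ^ 2 * hpow R I (k + 1) (x + u) ≤ 8 * (3 * R) ^ 2 * 1 := by gcongr; exact hpow_le_one hR1
        _ = 72 * 1 * (R : ℝ) ^ 2 := by ring
        _ ≤ _ := by gcongr
    · rw [hpow_near (k := k) hR1 hx, ofReal_one, mul_one]
      have hY : ∀ Y, land p (cubeI I (3 * R - 1)) Y * ofReal (hpow R I k (x + Y)) ≤
          land p (cubeI I (3 * R - 1)) Y * ofReal (1 / 4) := fun Y => by
        by_cases h0 : land p (cubeI I (3 * R - 1)) Y = 0
        · simp [h0]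
        refine mul_le_mul_right (ofReal_le_ofReal ?_) _
        obtain ⟨⟨i, hi, h⟩, -⟩ := land_cube_ge h0
        rw [h1] at h
        have hxi : |(x i : ℝ)| ≤ R := abs_le_of_sq_le_sq ((sq_le_sqI hi x).trans hx) (by positivity)
        have h2 : 2 * R ≤ |((x + Y) i : ℝ)| := by
          have := abs_sub_abs_le_abs_sub (Y i : ℝ) (-(x i : ℝ))
          rw [abs_neg, sub_neg_eq_add] at this
          simp only [Pi.add_apply]; push_cast
          rw [add_comm (x i : ℝ)]
          linarith
        have h3 : 4 * R ^ 2 ≤ sqI I (x + Y) := by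
          have := pow_le_pow_left₀ (by positivity) h2 2
          rw [sq_abs] at this
          have := this.trans (sq_le_sqI hi (x + Y))
          linarith
        unfold hpow
        obtain ⟨l, rfl⟩ := Nat.exists_eq_add_of_le hk
        refine (pow_le_of_le_one (hpow_base_pos hR1).le (hpow_base_le hR1) (by omega)).trans ?_
        rw [div_le_div_iff₀ (lt_max_of_lt_left (by positivity)) (by norm_num)]
        have := le_max_right ((R : ℝ) ^ 2) (sqI I (x + Y))
        linarith
      refine (tsum_le_tsum hY).trans ?_
      rw [tsum_mul_right, tsum_land_one]
      refine (mul_le_mul_left (hphi _) _).trans ?_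
      rw [← ofReal_mul (by linarith)]
      exact ofReal_le_ofReal (by linarith)

theorem exists_pow_le_geom {a : ℝ} (ha : 1 < a) (k : ℕ) : ∃ C : ℝ, 0 ≤ C ∧ ∀ m : ℕ, ((m + 1 : ℝ) ^ 2) ^ k ≤ C * a ^ m := by
  obtain ⟨C, hC⟩ := (tendsto_pow_const_div_const_pow_of_one_lt (2 * k) ha).bddAbove_range
  have hC' : ∀ m : ℕ, (m : ℝ) ^ (2 * k) ≤ C * a ^ m := fun m => by
    have := hC (mem_range_self m)
    rwa [div_le_iff₀ (by positivity)] at this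
  refine ⟨max C 0 * a, by positivity, fun m => ?_⟩
  have := hC' (m + 1)
  rw [← pow_mul]
  push_cast at this
  refine this.trans ?_
  rw [mul_assoc, ← pow_succ']
  gcongr
  exact le_max_left _ _

theorem conv_tt_finite (hs : Subcrit d p) (hR : 1 ≤ R) (I : Finset (Fin d)) (k : ℕ) {B : ENNReal} (hB : B ≠ ∞) {v : V d → ENNReal}
    (hv : ∀ x, v x ≤ B * ofReal (hpow R I (k + 1) x)) :
    ∃ A : ENNReal, A ≠ ∞ ∧ ∀ x, conv (tt p) v x ≤ A * ofReal (hpow R I k x) := by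
  obtain ⟨a, ha, hexp⟩ := hs.exp_moment
  obtain ⟨C, hC0, hC⟩ := exists_pow_le_geom ha k
  set E := ∑' u, tau p univ (0 : V d) u * ofReal a ^ nrm1 u
  refine ⟨B * ofReal C * E, mul_ne_top (mul_ne_top hB ofReal_ne_top) hexp.ne, fun x => ?_⟩
  rw [conv_tt_eq]
  calc ∑' z, tt p z * v (x + z) ≤ ∑' z, B * ofReal C * ofReal (hpow R I k x) * (tau p univ 0 z * ofReal a ^ nrm1 z) := by
        refine tsum_le_tsum fun z => ?_
        have h1 : hpow R I (k + 1) (x + z) ≤ hpow R I k x * (C * a ^ nrm1 z) :=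
          (hpow_succ_le hR).trans ((hpow_translate hR).trans (mul_le_mul_of_nonneg_left (hC _) (hpow_pos hR).le))
        have h2 := (hv (x + z)).trans (mul_le_mul_right (ofReal_le_ofReal h1) B)
        rw [ofReal_mul (hpow_pos hR).le, ofReal_mul hC0, ofReal_pow (by linarith)] at h2
        refine (mul_le_mul_right h2 _).trans (le_of_eq ?_)
        rw [tt]; ring
    _ = _ := by rw [tsum_mul_left]; ring

/-- Convolution with the two-point function loses one power. -/
theorem conv_tt_hpow_le (hs : Subcrit d p) {C : ℝ} (hk : 1 ≤ k) (hC0 : 0 ≤ C)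
    (hC : QuadBound k C)
    (hI : I.Nonempty) (hR : 5 ≤ R) (hRC : 8 * C ≤ R ^ 2) (hCM : 32 * C ≤ I.card) {γ : ℝ}
    (hγ : γ * (400 * I.card ^ 3) = 1)
    (hphi : ∀ r, phi p (cubeI I r) 0 ≤ ofReal (1 + γ)) (h2 : ∀ (ν : Dir d) r, phi p (slabF {ν} r) 0 ≤ 2)
    {B : ENNReal} (hB : B ≠ ∞) {v : V d → ENNReal} (hv : ∀ x, v x ≤ B * ofReal (hpow R I (k + 1) x)) (x : V d) :
    conv (tt p) v x * pE p ≤ B * ofReal (72 * 4 ^ (k + 1) * R ^ 2 * (400 * I.card ^ 3)) * ofReal (hpow R I k x) := by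
  have hR1 : 1 ≤ R := by omega
  set H : V d → ENNReal := fun x => ofReal (hpow R I k x) with hH
  have hH0 : ∀ x, H x ≠ 0 := fun x => by simpa [hH] using hpow_pos hR1
  have hHt : ∀ x, H x ≠ ∞ := fun x => ofReal_ne_top
  set w := conv (tt p) v with hw
  set A := ⨆ x, w x / H x with hA
  have hAtop : A ≠ ∞ := by
    obtain ⟨A', h1, h2⟩ := conv_tt_finite hs hR1 I k hB hv
    exact ne_top_of_le_ne_top h1 (iSup_le fun x => div_le_of_le_mul (h2 x))
  have hwA : ∀ x, w x ≤ A * H x := fun x => by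
    have := le_iSup (fun x => w x / H x) x
    rwa [div_le_iff (hH0 x) (hHt x)] at this
  set a := B * ofReal (72 * 4 ^ (k + 1) * R ^ 2) with ha
  have hstep : ∀ x, w x * pE p ≤ (a + ofReal (1 - γ) * (A * pE p)) * H x := fun x => by
    obtain ⟨r, hr1, hr2⟩ := lyap_step hk hC0 hC hI hR hRC hCM hγ hphi x
    have h0 : (0 : V d) ∈ cubeI I r := zero_mem_slabF
    refine (mul_le_mul_left (conv_tt_le_land hs h0 v x) _).trans ?_
    rw [add_mul, add_mul]
    refine add_le_add ?_ ?_
    · have hG := tsum_tau_slabF_le (r := r) hs hI h2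
      have hr8 : ofReal (8 * (r + 1) ^ 2) = 8 * (r + 1) ^ 2 := by
        rw [ofReal_mul (by norm_num), ofReal_pow (by positivity), ofReal_add (by positivity) (by norm_num)]
        simp
      have hpt : ∀ u, tau p (cubeI I r) 0 u * v (x + u) ≤ tau p (cubeI I r) 0 u * (a * H x / (8 * (r + 1) ^ 2)) := fun u => by
        by_cases hu : u ∈ cubeI I r
        swap
        · simp [tau_eq_zero_right hu]
        refine mul_le_mul_right ?_ _
        rw [le_div_iff_mul_le (.inl (by positivity)) (.inl (by finiteness))]
        refine (mul_le_mul_left (hv (x + u)) _).trans ?_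
        rw [ha, mul_assoc, mul_assoc, ← hr8, ← ofReal_mul (hpow_pos hR1).le, hH, ← ofReal_mul (by positivity)]
        refine mul_le_mul_right (ofReal_le_ofReal ?_) _
        rw [mul_comm]; exact hr1 u hu
      refine (mul_le_mul_left (tsum_le_tsum hpt) _).trans ?_
      rw [tsum_mul_right]
      calc _ = ((∑' u, tau p (cubeI I r) 0 u) * pE p) * (a * H x / (8 * (r + 1) ^ 2)) := by ring
        _ ≤ (8 * (r + 1) ^ 2) * (a * H x / (8 * (r + 1) ^ 2)) := mul_le_mul_left hG _
        _ ≤ a * H x := ENNReal.mul_div_le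
    · calc (∑' Y, land p (cubeI I r) Y * w (x + Y)) * pE p ≤ (∑' Y, A * (land p (cubeI I r) Y * H (x + Y))) * pE p := by
            refine mul_le_mul_left (tsum_le_tsum fun Y => ?_) _
            rw [← mul_assoc, mul_comm A, mul_assoc]
            exact mul_le_mul_right (hwA _) _
        _ = A * pE p * (∑' Y, land p (cubeI I r) Y * H (x + Y)) := by rw [tsum_mul_left]; ring
        _ ≤ A * pE p * (ofReal (1 - γ) * H x) := mul_le_mul_right hr2 _
        _ = _ := by ring
  have hAp : A * pE p ≤ a + ofReal (1 - γ) * (A * pE p) := by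
    have e : A * pE p = ⨆ x, w x / H x * pE p := by rw [hA, iSup_mul]
    refine e.le.trans (iSup_le fun x => ?_)
    rw [ENNReal.div_eq_inv_mul, mul_assoc, ← ENNReal.div_eq_inv_mul, div_le_iff (hH0 x) (hHt x)]
    exact hstep x
  obtain ⟨hM1, hγ0, hγ1⟩ := gam_bounds hI hγ
  have hatop : a ≠ ∞ := mul_ne_top hB ofReal_ne_top
  have hAptop : A * pE p ≠ ∞ := mul_ne_top hAtop (pE_le_one.trans_lt one_lt_top).ne
  have hfin : A * pE p ≤ a * ofReal (400 * I.card ^ 3) := by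
    lift A * pE p to NNReal using hAptop with b
    lift a to NNReal using hatop with a'
    rw [← ofReal_coe_nnreal, ← ofReal_coe_nnreal, ← ofReal_mul (by linarith), ← ofReal_add (by positivity) (mul_nonneg (by linarith) (by positivity)),
      ofReal_le_ofReal_iff (add_nonneg (by positivity) (mul_nonneg (by linarith) (by positivity)))] at hAp
    rw [← ofReal_coe_nnreal, ← ofReal_coe_nnreal, ← ofReal_mul (by positivity)]
    refine ofReal_le_ofReal ?_
    have h3 : γ * b ≤ a' := by linarith
    calc (b : ℝ) = (γ * b) * (400 * I.card ^ 3) := by linear_combination (-(b : ℝ)) * hγ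
      _ ≤ _ := by gcongr
  calc w x * pE p ≤ A * H x * pE p := mul_le_mul_left (hwA x) _
    _ = A * pE p * H x := by ring
    _ ≤ a * ofReal (400 * I.card ^ 3) * H x := mul_le_mul_left hfin _
    _ = _ := by rw [ofReal_mul (p := 72 * 4 ^ (k + 1) * R ^ 2) (by positivity), ha]; ring

end

section
variable {f g v : V d → ENNReal} {a b s Λ : ENNReal}

/-- The step operator of the simple random walk with mass `2dp`. -/
def stepOp (p : ℝ) (f : V d → ENNReal) (x : V d) : ENNReal := pE p * ∑ ν, f (x + nb ν)

theorem stepOp_mono (h : ∀ x, f x ≤ g x) (x : V d) : stepOp p f x ≤ stepOp p g x :=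
  mul_le_mul_right (sum_le_sum fun _ _ => h _) _

theorem stepOp_add (f g : V d → ENNReal) : stepOp p (fun x => f x + g x) = fun x => stepOp p f x + stepOp p g x := by
  ext x
  simp only [stepOp, sum_add_distrib, mul_add]

theorem stepOp_sum {ι : Type*} (s : Finset ι) (f : ι → V d → ENNReal) :
    stepOp p (fun x => ∑ i ∈ s, f i x) = fun x => ∑ i ∈ s, stepOp p (f i) x := by
  ext x
  simp only [stepOp, ← mul_sum]
  rw [sum_comm]

theorem stepOp_le (hΛ : 2 * d * pE p ≤ Λ) (h : ∀ x, f x ≤ b) (x : V d) : stepOp p f x ≤ Λ * b := by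
  calc stepOp p f x ≤ pE p * ∑ _ν : Dir d, b := mul_le_mul_right (sum_le_sum fun _ _ => h _) _
    _ = 2 * d * pE p * b := by simp [Dir]; ring
    _ ≤ _ := mul_le_mul_left hΛ _

theorem stepOp_iter_le (hΛ : 2 * d * pE p ≤ Λ) (h : ∀ x, f x ≤ b) (n : ℕ) (x : V d) : (stepOp p)^[n] f x ≤ Λ ^ n * b := by
  induction n generalizing x with
  | zero => simpa using h x
  | succ n ih =>
    rw [iterate_succ_apply', pow_succ', mul_assoc]
    exact stepOp_le hΛ ih x

theorem stepOp_iter_mono (h : ∀ x, f x ≤ g x) (n : ℕ) (x : V d) : (stepOp p)^[n] f x ≤ (stepOp p)^[n] g x := by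
  induction n generalizing x with
  | zero => simpa using h x
  | succ n ih =>
    rw [iterate_succ_apply', iterate_succ_apply']
    exact stepOp_mono ih x

/-- The number of nonzero coordinates. -/
def num0 (x : V d) : ℕ := (Finset.univ.filter fun i => x i ≠ 0).card

theorem stepOp_le_of_num0 (hΛ : 2 * d * pE p ≤ Λ) {n : ℕ} (ha : ∀ x, n + 1 ≤ num0 x → f x ≤ a) (hb : ∀ x, f x ≤ b)
    (hx : n ≤ num0 x) : stepOp p f x ≤ Λ * a + 2 * (n + 1) * pE p * b := by
  set T : Finset (Dir d) := Finset.univ.filter fun ν => ¬ n + 1 ≤ num0 (x + nb ν) with hT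
  have hcoord : ∀ ν : Dir d, ∀ j, j ≠ ν.1 → (x + nb ν) j = x j := fun ν j hj => by simp [nb, hj]
  have hcard : T.card ≤ 2 * (n + 1) := by
    rcases lt_or_ge (n + 1) (num0 x) with h | h
    · have : T = ∅ := by
        refine Finset.filter_false_of_mem fun ν _ => not_not.2 ?_
        have h1 : (Finset.univ.filter fun i => x i ≠ 0).erase ν.1 ⊆ Finset.univ.filter fun i => (x + nb ν) i ≠ 0 := fun j hj => by
          rw [mem_erase] at hj
          simp only [mem_filter, Finset.mem_univ, true_and] at hj ⊢
          rw [hcoord ν j hj.1]; exact hj.2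
        have h2 := Finset.card_le_card h1
        have h3 := Finset.pred_card_le_card_erase (s := Finset.univ.filter fun i => x i ≠ 0) (a := ν.1)
        unfold num0 at h ⊢
        omega
      simp [this]
    · have h1 : T ⊆ (Finset.univ.filter fun i => x i ≠ 0) ×ˢ Finset.univ := fun ν hν => by
        simp only [hT, mem_filter, Finset.mem_univ, true_and, not_le] at hν
        simp only [mem_product, mem_filter, Finset.mem_univ, true_and, and_true]
        intro h0
        have h2 : insert ν.1 (Finset.univ.filter fun i => x i ≠ 0) ⊆ Finset.univ.filter fun i => (x + nb ν) i ≠ 0 := fun j hj => by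
          rw [Finset.mem_insert] at hj
          simp only [mem_filter, Finset.mem_univ, true_and] at hj ⊢
          by_cases hjν : j = ν.1
          · subst hjν
            rcases ν with ⟨i, c⟩
            simp only at h0
            cases c <;> simp [nb, h0]
          · rw [hcoord ν j hjν]
            exact hj.resolve_left hjν
        have h3 := Finset.card_le_card h2
        rw [Finset.card_insert_of_notMem (by simp [h0])] at h3
        unfold num0 at hx hν
        omega
      have h2 := Finset.card_le_card h1
      rw [card_product] at h2
      simp only [Finset.card_univ, Fintype.card_bool] at h2
      unfold num0 at h
      omega
  have hpt : ∀ ν, f (x + nb ν) ≤ a + if ν ∈ T then b else 0 := fun ν => by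
    by_cases h : ν ∈ T
    · rw [if_pos h]; exact (hb _).trans le_add_self
    · rw [if_neg h, add_zero]
      exact ha _ (by simpa [hT] using h)
  calc stepOp p f x ≤ pE p * ∑ ν, (a + if ν ∈ T then b else 0) := mul_le_mul_right (sum_le_sum fun ν _ => hpt ν) _
    _ = 2 * d * pE p * a + pE p * (T.card * b) := by
        rw [sum_add_distrib, mul_add]
        congr 1
        · simp [Dir]; ring
        · simp
    _ ≤ Λ * a + pE p * ((2 * (n + 1) : ℕ) * b) := by gcongr
    _ = _ := by push_cast; ring

theorem stepOp_iter_le_of_num0 (hΛ : 2 * d * pE p ≤ Λ) (h1 : 1 ≤ Λ) (n : ℕ) (ha : ∀ x, n ≤ num0 x → f x ≤ a) (hb : ∀ x, f x ≤ b)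
    (x : V d) : (stepOp p)^[n] f x ≤ Λ ^ n * (a + 2 * n ^ 2 * pE p * b) := by
  induction n generalizing f a b with
  | zero => simpa using ha x (Nat.zero_le _)
  | succ n ih =>
    rw [Function.iterate_succ_apply]
    refine (ih (fun x hx => stepOp_le_of_num0 hΛ ha hb hx) (fun x => stepOp_le hΛ hb x)).trans ?_
    calc Λ ^ n * (Λ * a + 2 * (n + 1) * pE p * b + 2 * n ^ 2 * pE p * (Λ * b))
        ≤ Λ ^ n * (Λ * a + Λ * (2 * (n + 1) * pE p * b) + 2 * n ^ 2 * pE p * (Λ * b)) := by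
          exact mul_le_mul_right (add_le_add (add_le_add le_rfl (le_mul_of_one_le_left' h1)) le_rfl) _
      _ = Λ ^ (n + 1) * (a + (n ^ 2 + (n + 1)) * (2 * pE p * b)) := by ring
      _ ≤ Λ ^ (n + 1) * (a + ((n + 1 : ℕ)) ^ 2 * (2 * pE p * b)) := by
          gcongr
          have : n ^ 2 + (n + 1) ≤ (n + 1) ^ 2 := by nlinarith
          exact_mod_cast this
      _ = _ := by ring

theorem le_sum_stepOp (h : ∀ x, g x ≤ v x + stepOp p g x) (n : ℕ) (x : V d) :
    g x ≤ ∑ i ∈ Finset.range n, (stepOp p)^[i] v x + (stepOp p)^[n] g x := by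
  induction n generalizing x with
  | zero => simp
  | succ n ih =>
    refine (ih x).trans ?_
    rw [sum_range_succ, add_assoc]
    refine add_le_add le_rfl ((stepOp_iter_mono h n x).trans (le_of_eq ?_))
    have : ∀ (n : ℕ) (f g : V d → ENNReal), (stepOp p)^[n] (fun x => f x + g x) = fun x => (stepOp p)^[n] f x + (stepOp p)^[n] g x := by
      intro n
      induction n with
      | zero => intros; rfl
      | succ n ih => intro f g; rw [Function.iterate_succ_apply, stepOp_add, ih]; rfl
    rw [this]
    rfl

variable {N : ℕ}

theorem sum_pow_le (h1 : 1 ≤ Λ) (h3 : Λ ^ N ≤ 3) {F : ℕ → ENNReal} (hF : ∀ i, F i ≤ Λ ^ i * b) : ∑ i ∈ Finset.range N, F i ≤ 3 * N * b := by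
  calc ∑ i ∈ Finset.range N, F i ≤ ∑ _i ∈ Finset.range N, 3 * b := by
        refine sum_le_sum fun i hi => (hF i).trans (mul_le_mul_left (le_trans ?_ h3) _)
        exact pow_le_pow_right₀ h1 (Finset.mem_range.1 hi).le
    _ = _ := by simp; ring

theorem sup_le_of_stepOp (hΛ : 2 * d * pE p ≤ Λ) (h1 : 1 ≤ Λ) (h3 : Λ ^ N ≤ 3) (hP : 12 * N ^ 2 * pE p ≤ 1)
    (h : ∀ x, g x ≤ v x + stepOp p g x) (hv : ∀ x, v x ≤ b) (ha : ∀ x, N ≤ num0 x → g x ≤ a) {G : ENNReal} (hG : G ≠ ∞)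
    (hg : ∀ x, g x ≤ G) (x : V d) : g x ≤ 6 * N * b + 6 * a := by
  set G' := ⨆ x, g x
  have hG' : G' ≠ ∞ := ne_top_of_le_ne_top hG (iSup_le hg)
  have key : G' ≤ 3 * N * b + 3 * a + G' / 2 := by
    refine iSup_le fun x => (le_sum_stepOp h N x).trans ?_
    rw [add_assoc]
    refine add_le_add (sum_pow_le h1 h3 fun i => stepOp_iter_le hΛ hv i x) ?_
    refine (stepOp_iter_le_of_num0 hΛ h1 N ha (le_iSup g) x).trans ((mul_le_mul_left h3 _).trans ?_)
    rw [mul_add]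
    refine add_le_add le_rfl ?_
    rw [le_div_iff_mul_le (by norm_num) (by norm_num)]
    calc 3 * (2 * N ^ 2 * pE p * G') * 2 = (12 * N ^ 2 * pE p) * G' := by ring
      _ ≤ 1 * G' := mul_le_mul_left hP _
      _ = _ := one_mul _
  have h2 : G' / 2 ≤ 3 * N * b + 3 * a := by
    have : G' / 2 + G' / 2 ≤ (3 * N * b + 3 * a) + G' / 2 := by rwa [ENNReal.add_halves]
    exact (ENNReal.add_le_add_iff_right (ENNReal.div_ne_top hG' (by norm_num))).1 this
  rw [div_le_iff (by norm_num) (by norm_num)] at h2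
  exact (le_iSup g x).trans (h2.trans (le_of_eq (by ring)))

theorem stepOp_sup_le (hΛ : 2 * d * pE p ≤ Λ) (h1 : 1 ≤ Λ) (h2 : Λ ≤ 2) (h3 : Λ ^ N ≤ 3)
    (h : ∀ x, g x ≤ v x + stepOp p g x) (hs : ∀ x, stepOp p v x ≤ s) (ha : ∀ x, N ≤ num0 x → g x ≤ a)
    (hb : ∀ x, g x ≤ b) (x : V d) : stepOp p g x ≤ 3 * N * s + 6 * (a + 2 * N ^ 2 * pE p * b) := by
  refine (stepOp_mono (le_sum_stepOp h N) x).trans ?_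
  rw [stepOp_add, stepOp_sum]
  refine add_le_add ?_ ?_
  · refine sum_pow_le h1 h3 fun i => ?_
    rw [← iterate_succ_apply' (stepOp p), Function.iterate_succ_apply]
    exact stepOp_iter_le hΛ hs i x
  · refine (stepOp_le hΛ (fun x => (stepOp_iter_le_of_num0 hΛ h1 N ha hb x).trans (mul_le_mul_left h3 _)) x).trans ?_
    rw [← mul_assoc]
    refine mul_le_mul_left ((mul_le_mul_left h2 _).trans (by norm_num)) _

/-- Convolution powers of the two-point function. -/
def gg (p : ℝ) : ℕ → V d → ENNReal
  | 0 => fun x => ind (x = 0)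
  | j + 1 => conv (tt p) (gg p j)

theorem gg_succ (j : ℕ) : gg p (j + 1) = conv (tt p) (gg (d := d) p j) := rfl

theorem gg_one : gg (d := d) p 1 = tt p := by
  ext x
  rw [gg_succ, conv, tsum_eq_single x]
  · simp [gg, ind]
  · intro y hy
    simp [gg, ind_false (P := x - y = 0) (by rwa [sub_eq_zero, eq_comm])]

theorem gg_two : gg (d := d) p 2 = conv (tt p) (tt p) := by rw [gg_succ, gg_one]

theorem tau_singleton (u : V d) : tau p {0} 0 u = ind (u = 0) := by
  by_cases h : u = 0
  · subst h; rw [tau_self (mem_singleton 0), ind_true rfl]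
  · rw [tau_eq_zero_right (by simpa using h), ind_false h]

theorem tsum_ind_zero (F : V d → ENNReal) : ∑' u, ind (u = 0) * F u = F 0 := by
  rw [tsum_eq_single 0]
  · simp [ind]
  · intro u hu; simp [ind_false hu]

theorem nb_ne_zero (ν : Dir d) : nb ν ≠ 0 := fun h => by
  have := lin_nb_self ν
  rw [h, lin_zero] at this
  omega

theorem conv_tt_le_stepOp (hs : Subcrit d p) (v : V d → ENNReal) (x : V d) :
    conv (tt p) v x ≤ v x + stepOp p (conv (tt p) v) x := by
  refine (conv_tt_le_land hs (S := {0}) (mem_singleton 0) v x).trans ?_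
  rw [← tsum_land]
  simp_rw [tau_singleton]
  rw [tsum_ind_zero, tsum_ind_zero, add_zero]
  refine add_le_add le_rfl (le_of_eq ?_)
  rw [stepOp, mul_sum]
  refine sum_ext fun ν _ => ?_
  rw [zero_add, ind_true (by simpa using nb_ne_zero ν), one_mul]

theorem gg_succ_le (hs : Subcrit d p) (j : ℕ) (x : V d) : gg p (j + 1) x ≤ gg p j x + stepOp p (gg p (j + 1)) x :=
  conv_tt_le_stepOp hs _ x

theorem conv_tt_stepOp (f : V d → ENNReal) : conv (tt p) (stepOp p f) = stepOp p (conv (tt p) f) := by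
  ext x
  simp only [conv, stepOp]
  rw [← tsum_fsum, ← tsum_mul_left]
  refine tsum_congr fun y => ?_
  rw [← mul_sum, mul_left_comm]
  congr 3
  exact funext fun ν => by congr 1; abel

theorem gg_neg (j : ℕ) (x : V d) : gg p j (-x) = gg p j x := by
  induction j generalizing x with
  | zero => simp [gg]
  | succ j ih =>
    rw [gg_succ, conv_tt_eq, conv]
    refine tsum_congr fun y => ?_
    rw [← ih]
    congr 2
    abel

theorem stepOp_neg (hf : ∀ x, f (-x) = f x) (x : V d) : stepOp p f (-x) = stepOp p f x := by
  unfold stepOp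
  rw [← (Equiv.prodCongr (Equiv.refl (Fin d)) Equiv.boolNot).sum_comp]
  congr 1
  refine sum_ext fun ν _ => ?_
  rw [← hf]
  congr 1
  rcases ν with ⟨i, b⟩
  have : nb ((Equiv.prodCongr (Equiv.refl (Fin d)) Equiv.boolNot) (i, b)) = - nb (i, b) := by
    cases b <;> simp [nb, ← Pi.single_neg]
  rw [this]
  abel

theorem gg_le_chi (j : ℕ) (x : V d) : gg p j x ≤ chi d p ^ j := by
  induction j generalizing x with
  | zero => simp [gg, ind_le_one]
  | succ j ih =>
    rw [gg_succ, conv, pow_succ', chi, ← tsum_mul_right]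
    exact tsum_le_tsum fun y => mul_le_mul_right (ih _) _

theorem gg_mono (j : ℕ) (x : V d) : gg p j x ≤ gg p (j + 1) x := by
  rw [gg_succ, conv]
  refine le_trans ?_ (le_tsum 0)
  rw [tt, tau_self (mem_univ _), one_mul, sub_zero]

end

section
variable {F : Finset (Dir d)} {r : ℕ}

theorem tsum_tt_shift (f : V d → ENNReal) (a w : V d) : ∑' b, tt p (b - a) * f (b + w) = conv (tt p) f (a + w) := by
  rw [conv_tt_eq, ← (addRight a).tsum_eq]
  refine tsum_congr fun c => ?_
  simp only [coe_addRight, add_sub_cancel_right]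
  congr 2
  abel

theorem stepOp_gg_sub_comm (j : ℕ) (a z : V d) : stepOp p (gg p j) (a - z) = stepOp p (gg p j) (z - a) := by
  rw [← stepOp_neg (gg_neg j), neg_sub]

theorem tsum_tau_pairW_inner (a z : V d) :
    ∑' b, tau p (slabF F r) a b * ∑ ν', (pE p * pE p) * (tt p (b + nb ν' - z) +
      ind (b + nb ν' ∉ slabF F r) * conv (tt p) (tt p) (b + nb ν' - z)) ≤
    pE p * (stepOp p (gg p 2) (z - a) + ∑ ν' ∈ F, pE p * gg p 3 (z - nb ν' - a)) := by
  have hb : ∀ b, tau p (slabF F r) a b * ∑ ν', (pE p * pE p) * (tt p (b + nb ν' - z) +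
      ind (b + nb ν' ∉ slabF F r) * conv (tt p) (tt p) (b + nb ν' - z)) ≤
      pE p * (tt p (b - a) * stepOp p (tt p) (b + -z)) + pE p * ∑ ν' ∈ F, pE p * (tt p (b - a) * gg p 2 (b + (nb ν' - z))) := fun b => by
    by_cases h : b ∈ slabF F r
    swap
    · rw [tau_eq_zero_right h, zero_mul]; exact zero_le
    have h1 : tau p (slabF F r) a b ≤ tt p (b - a) := by rw [← tau_univ_eq]; exact tau_mono (subset_univ _)
    refine (mul_le_mul_left h1 _).trans ?_
    have h2 : ∑ ν', (pE p * pE p) * (tt p (b + nb ν' - z) + ind (b + nb ν' ∉ slabF F r) * conv (tt p) (tt p) (b + nb ν' - z)) =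
        pE p * stepOp p (tt p) (b + -z) + pE p * ∑ ν' ∈ F, pE p * (ind (b + nb ν' ∉ slabF F r) * gg p 2 (b + (nb ν' - z))) := by
      simp_rw [mul_add, sum_add_distrib]
      congr 1
      · rw [stepOp, ← mul_assoc, mul_sum]
        exact sum_ext fun ν' _ => by congr 2; abel
      · rw [← sum_subset (Finset.subset_univ F), mul_sum]
        · exact sum_ext fun ν' _ => by rw [gg_two, add_sub_assoc]; ring
        · intro ν' _ hν'
          rw [exit_slabF h, ind_false (by simp [hν'])]; simp
    rw [h2, mul_add]
    refine add_le_add (le_of_eq (by ring)) ?_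
    rw [mul_left_comm, mul_sum]
    refine mul_le_mul_right (sum_le_sum fun ν' _ => ?_) _
    rw [mul_left_comm]
    refine mul_le_mul_right (mul_le_mul_right ?_ _) _
    exact mul_le_of_le_one_left' ind_le_one
  refine (tsum_le_tsum hb).trans (le_of_eq ?_)
  rw [tsum_add, tsum_mul_left, tsum_mul_left, tsum_tt_shift, conv_tt_stepOp,
    tsum_fsum, ← gg_two, ← sub_eq_add_neg, stepOp_gg_sub_comm, ← mul_add]
  congr 2
  refine sum_ext fun ν' _ => ?_
  rw [tsum_mul_left, tsum_tt_shift, ← gg_succ, ← gg_neg]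
  congr 2
  abel

/-- The error weight at an exit edge. -/
def errW (p : ℝ) (F : Finset (Dir d)) (w : V d) : ENNReal :=
  stepOp p (gg p 2) w + ∑ ν' ∈ F, pE p * gg p 3 (w - nb ν')

theorem phi_slabF_le_errW (hp0 : 0 ≤ p) (hp : p ≤ 1 / 2) (h : Subcrit d p) :
    phi p (slabF F r) 0 ≤ 1 + ∑ ν ∈ F, ∑' a, tau p (slabF F r) 0 a *
      ∑' y, tau p (slabF F r) a y * (ind (lin ν y = r) * (pE p * errW p F (y + nb ν - a))) := by
  refine (phi_le hp0 hp h zero_mem_slabF).trans (add_le_add le_rfl ?_)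
  rw [← tsum_fsum]
  refine tsum_le_tsum fun a => ?_
  rw [← mul_sum, ← tsum_fsum]
  refine mul_le_mul_right (tsum_le_tsum fun y => ?_) _
  by_cases hy : y ∈ slabF F r
  swap
  · simp [tau_eq_zero_right hy]
  simp_rw [mul_assoc]
  rw [tsum_mul_left, ← mul_sum]
  refine mul_le_mul_right ?_ _
  have hpw : ∀ b, tau p (slabF F r) a b * pairW p (slabF F r) y b = ∑ ν ∈ F, ind (lin ν y = r) *
      (tau p (slabF F r) a b * ∑ ν', (pE p * pE p) * (tt p (b + nb ν' - (y + nb ν)) +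
      ind (b + nb ν' ∉ slabF F r) * conv (tt p) (tt p) (b + nb ν' - (y + nb ν)))) := fun b => by
    rw [pairW, ← sum_subset (Finset.subset_univ F), mul_sum]
    · refine sum_ext fun ν hν => ?_
      rw [exit_slabF hy, mul_left_comm]
      simp [hν]
    · intro ν _ hν
      rw [exit_slabF hy, ind_false (by simp [hν]), zero_mul]
  simp_rw [hpw]
  rw [tsum_fsum]
  refine sum_le_sum fun ν _ => ?_
  rw [tsum_mul_left]
  refine mul_le_mul_right ((tsum_tau_pairW_inner a (y + nb ν)).trans (le_of_eq ?_)) _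
  rw [errW]
  congr 2
  exact sum_ext fun ν' _ => by congr 2; abel

theorem phi_slabF_le (hp0 : 0 ≤ p) (hp : p ≤ 1 / 2) (h : Subcrit d p) (h2 : ∀ (ν : Dir d) r, phi p (slabF {ν} r) 0 ≤ 2)
    (hd : 2 * d * pE p ≤ 2) (hF : F.card * pE p ≤ 1) {s b : ENNReal} (hs : ∀ x : V d, stepOp p (gg p 3) x ≤ s)
    (hb : ∀ x : V d, gg p 4 x ≤ b) {G W : ℕ → ENNReal} (hG : ∀ (ν : Dir d) (j : ℕ) x, (j : ℤ) ≤ lin ν x → gg p 3 x ≤ G j)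
    (hW : ∀ j, s + F.card * pE p * b ≤ W j ∨ 6 * G j ≤ W j * pE p) :
    phi p (slabF F r) 0 ≤ 1 + F.card * ∑' j : ℕ, 4 * (j + 1) * W j := by
  refine (phi_slabF_le_errW hp0 hp h).trans (add_le_add le_rfl ?_)
  rw [← nsmul_eq_mul]
  refine sum_le_card_nsmul _ _ _ fun ν hν => ?_
  have hE : ∀ (a : V d) (j : ℕ), a ∈ slabF F r → lin ν a = r - j →
      ∑' y, tau p (slabF F r) a y * (ind (lin ν y = r) * (pE p * errW p F (y + nb ν - a))) ≤ W j * pE p := by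
    intro a j ha haj
    rcases hW j with hj | hj
    · calc _ ≤ ∑' y, pE p * (tt p (y - a) * stepOp p (gg p 2) (y + (nb ν - a)) +
              ∑ ν' ∈ F, pE p * (tt p (y - a) * gg p 3 (y + (nb ν - a - nb ν')))) := by
            refine tsum_le_tsum fun y => ?_
            have h1 : tau p (slabF F r) a y ≤ tt p (y - a) := by rw [← tau_univ_eq]; exact tau_mono (subset_univ _)
            refine (mul_le_mul' h1 (mul_le_of_le_one_left' ind_le_one)).trans (le_of_eq ?_)
            rw [errW, mul_left_comm, mul_add, mul_sum]
            congr 2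
            · rw [add_sub_assoc]
            · refine sum_ext fun ν' _ => ?_
              rw [mul_left_comm]
              congr 3
              abel
        _ = pE p * (stepOp p (gg p 3) (nb ν) + ∑ ν' ∈ F, pE p * gg p 4 (nb ν - nb ν')) := by
            rw [tsum_mul_left, tsum_add, tsum_tt_shift, conv_tt_stepOp, ← gg_succ,
              tsum_fsum]
            simp_rw [tsum_mul_left, tsum_tt_shift, ← gg_succ]
            congr 2
            · congr 1; abel
            · exact sum_ext fun ν' _ => by congr 2; abel
        _ ≤ pE p * (s + F.card * pE p * b) := by
            refine mul_le_mul_right (add_le_add (hs _) ?_) _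
            rw [mul_assoc, ← nsmul_eq_mul]
            exact sum_le_card_nsmul _ _ _ fun ν' _ => mul_le_mul_right (hb _) _
        _ ≤ W j * pE p := by rw [mul_comm]; exact mul_le_mul_left hj _
    · have hpt : ∀ y, tau p (slabF F r) a y * (ind (lin ν y = r) * (pE p * errW p F (y + nb ν - a))) ≤
          tau p (slabF {ν} r) a y * ind (lin ν y = r) * pE p * (3 * G j) := fun y => by
        by_cases hy : lin ν y = r
        swap
        · simp [ind_false hy]
        have hl : lin ν (y + nb ν - a) = j + 1 := by rw [lin_sub, lin_add, lin_nb_self, hy, haj]; ring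
        have e1 : stepOp p (gg p 2) (y + nb ν - a) ≤ 2 * G j := by
          calc stepOp p (gg p 2) (y + nb ν - a) ≤ pE p * ∑ _ν : Dir d, G j := by
                refine mul_le_mul_right (sum_le_sum fun ν' _ => (gg_mono _ _).trans (hG ν j _ ?_)) _
                rw [lin_add, hl]
                have := (abs_le.1 (abs_lin_nb_le ν ν')).1
                omega
            _ = 2 * d * pE p * G j := by simp [Dir]; ring
            _ ≤ _ := mul_le_mul_left hd _
        have e2 : ∑ ν' ∈ F, pE p * gg p 3 (y + nb ν - a - nb ν') ≤ G j := by
          calc _ ≤ F.card • (pE p * G j) := by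
                refine sum_le_card_nsmul _ _ _ fun ν' _ => mul_le_mul_right (hG ν j _ ?_) _
                rw [lin_sub, hl]
                have := (abs_le.1 (abs_lin_nb_le ν ν')).2
                omega
            _ = F.card * pE p * G j := by rw [nsmul_eq_mul, mul_assoc]
            _ ≤ 1 * G j := mul_le_mul_left hF _
            _ = G j := one_mul _
        have e3 : errW p F (y + nb ν - a) ≤ 3 * G j := (add_le_add e1 e2).trans (le_of_eq (by ring))
        rw [mul_assoc, mul_assoc]
        exact mul_le_mul' (tau_mono (slabF_anti (by simpa using hν))) (mul_le_mul_right (mul_le_mul_right e3 _) _)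
      refine (tsum_le_tsum hpt).trans ?_
      rw [tsum_mul_right, tsum_mul_right]
      have hlay : ∑' y, tau p (slabF {ν} r) a y * ind (lin ν y = r) = lay p ν j 0 := by
        rw [lay, ← (addRight a).tsum_eq]
        refine tsum_congr fun y => ?_
        simp only [coe_addRight]
        have := tau_half_shift (p := p) (ν := ν) (x := 0) (y := y) (z := a) (r := r) (s := j) (by omega)
        rw [zero_add] at this
        rw [this, lin_add, haj]
        congr 2
        rw [eq_iff_iff]
        push_cast
        omega
      rw [hlay, ← phi_half]
      calc phi p (slabF {ν} j) 0 * (3 * G j) ≤ 2 * (3 * G j) := mul_le_mul_left (h2 ν j) _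
        _ = 6 * G j := by ring
        _ ≤ _ := hj
  calc _ ≤ ∑' a, ∑' j : ℕ, tau p (slabF {ν} r) 0 a * ind (lin ν a = r - j) * (W j * pE p) := by
        refine tsum_le_tsum fun a => ?_
        by_cases ha : a ∈ slabF F r
        swap
        · simp [tau_eq_zero_right ha]
        have h1 := ha ν hν
        have hj : lin ν a = r - ((r - lin ν a).toNat : ℕ) := by omega
        refine le_trans ?_ (le_tsum (r - lin ν a).toNat)
        rw [ind_true hj, mul_one]
        exact mul_le_mul' (tau_mono (slabF_anti (by simpa using hν))) (hE a _ ha hj)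
    _ = ∑' j : ℕ, lay p ν r j * pE p * W j := by
        rw [tsum_comm]
        refine tsum_congr fun j => ?_
        rw [tsum_mul_right, lay]; ring
    _ ≤ _ := tsum_le_tsum fun j => mul_le_mul_left (lay_le h (h2 ν)) _

theorem phi_singleton_zero : phi p ({0} : Set (V d)) 0 = 2 * d * pE p := by
  unfold phi
  simp_rw [tau_singleton]
  rw [tsum_ind_zero]
  simp_rw [show ∀ ν : Dir d, ind ((0 : V d) + nb ν ∉ ({0} : Set (V d))) = 1 from fun ν => ind_true (by simpa using nb_ne_zero ν)]
  simp [Dir]; ring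

theorem two_d_pE_le (hp0 : 0 ≤ p) (hp : p ≤ 1 / 2) (h : Subcrit d p) {s : ENNReal}
    (h1 : ∀ x : V d, stepOp p (gg p 1) x ≤ s) (h2 : ∀ x : V d, stepOp p (gg p 2) x ≤ s) :
    2 * d * pE p ≤ 1 + 2 * d * pE p * (2 * s) := by
  have key := phi_le hp0 hp h (S := ({0} : Set (V d))) (mem_singleton 0)
  have hout : ∀ ν : Dir d, ind ((0 : V d) + nb ν ∉ ({0} : Set (V d))) = 1 := fun ν => ind_true (by simpa using nb_ne_zero ν)
  rw [phi_singleton_zero] at key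
  refine key.trans (add_le_add le_rfl ?_)
  simp_rw [tau_singleton]
  rw [tsum_ind_zero]
  simp_rw [tau_singleton, mul_assoc]
  simp_rw [tsum_mul_left, tsum_ind_zero]
  have hpw : pairW p ({0} : Set (V d)) 0 0 = ∑ ν : Dir d, pE p * (stepOp p (gg p 1) (- nb ν) + stepOp p (gg p 2) (- nb ν)) := by
    rw [pairW]
    simp_rw [hout]
    refine sum_ext fun ν _ => ?_
    rw [one_mul, stepOp, stepOp, ← mul_add, ← mul_assoc, ← sum_add_distrib, mul_sum]
    refine sum_ext fun ν' _ => ?_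
    rw [gg_one, gg_two, one_mul]
    congr 3 <;> abel
  rw [hpw]
  calc _ ≤ ∑ _ν : Dir d, pE p * (s + s) := sum_le_sum fun ν _ => mul_le_mul_right (add_le_add (h1 _) (h2 _)) _
    _ = _ := by simp [Dir]; ring

end

section

theorem exists_taylor_uniform (K : ℕ) : ∃ C : ℝ, 0 ≤ C ∧ ∀ k ≤ K, QuadBound k C := by
  choose C hC0 hC using exists_taylor
  refine ⟨∑ k ∈ Finset.range (K + 1), C k, sum_nonneg fun k _ => hC0 k, fun k hk u hu => (hC k u hu).trans ?_⟩
  have : C k ≤ ∑ k ∈ Finset.range (K + 1), C k :=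
    single_le_sum (f := C) (fun k _ => hC0 k) (Finset.mem_range.2 (by omega))
  gcongr

/-- The gain constant of the bootstrap. -/
def gam (N : ℕ) : ℝ := 1 / (400 * N ^ 3)

theorem gam_nonneg (N : ℕ) : 0 ≤ gam N := by unfold gam; positivity

theorem gam_mul {N : ℕ} (hN : 1 ≤ N) : gam N * (400 * N ^ 3) = 1 := by
  have : (0 : ℝ) < N := mod_cast hN
  unfold gam; field_simp

/-- The bootstrap hypothesis with tolerance `c`. -/
structure Boot (d N : ℕ) (p c : ℝ) : Prop where
  le_d : N ^ 20 ≤ d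
  d_le : d ≤ (2 * N) ^ 20
  sub : Subcrit d p
  low : 1 ≤ 4 * d * p
  half : p ≤ 1 / 2
  exits : ∀ F : Finset (Dir d), F.card ≤ 2 * N → ∀ r, phi p (slabF F r) 0 ≤ ofReal (1 + c)
  deg : 2 * d * pE p ≤ ofReal (1 + c)

variable {N : ℕ}

theorem inv_mul_le_one {N c : ℕ} (h : c ≤ N) : (c : ENNReal) * (N : ENNReal)⁻¹ ≤ 1 := by
  rw [← div_eq_mul_inv]
  exact div_le_of_le_mul (by rw [one_mul]; exact_mod_cast h)

namespace Boot

theorem nonneg {c : ℝ} (h : Boot d N p c) : 0 ≤ p := by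
  have := h.low
  by_contra hp
  have hd : (0 : ℝ) ≤ d := cast_nonneg d
  nlinarith

theorem pE_eq {c : ℝ} (h : Boot d N p c) : pE p = ofReal p := by
  rw [pE, clamp]
  congr 1
  rw [min_eq_right (by linarith [h.half]), max_eq_right h.nonneg]

theorem gam_le (hN : 1 ≤ N) : gam N ≤ 1 / 400 := by
  have : (1 : ℝ) ≤ N ^ 3 := one_le_pow₀ (by exact_mod_cast hN)
  unfold gam
  exact one_div_le_one_div_of_le (by norm_num) (by linarith)

theorem one_add_gam_le (hN : 1 ≤ N) : ofReal (1 + gam N) ≤ 2 := by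
  have : (2 : ENNReal) = ofReal 2 := by simp
  rw [this]
  exact ofReal_le_ofReal (by linarith [gam_le hN])

theorem pow_pE_le (h : Boot d N p (gam N)) (hN : 1 ≤ N) : (N : ENNReal) ^ 20 * pE p ≤ 1 := by
  have h1 : 2 * d * pE p ≤ 2 := h.deg.trans (one_add_gam_le hN)
  have h2 : (N : ENNReal) ^ 20 ≤ d := mod_cast h.le_d
  have h3 : 2 * (N ^ 20 * pE p) ≤ 2 * 1 := by
    rw [mul_one, ← mul_assoc]
    exact (mul_le_mul_left (mul_le_mul_right h2 2) _).trans h1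
  exact (ENNReal.mul_le_mul_iff_right (by norm_num) (by norm_num)).1 h3

theorem one_le_pE {c : ℝ} (h : Boot d N p c) (hN : 2 ^ 22 ≤ N) : 1 ≤ pE p * N ^ 21 := by
  have h1 : (4 * d : ℝ) ≤ N ^ 21 := by
    have h2 : 4 * d ≤ N ^ 21 := by
      calc 4 * d ≤ 4 * (2 * N) ^ 20 := by have := h.d_le; omega
        _ = 2 ^ 22 * N ^ 20 := by rw [mul_pow]; ring
        _ ≤ N * N ^ 20 := Nat.mul_le_mul_right _ hN
        _ = N ^ 21 := by ring
    exact_mod_cast h2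
  rw [h.pE_eq, ← ofReal_natCast, ← ofReal_pow (by positivity), ← ofReal_mul h.nonneg, one_le_ofReal]
  have := mul_le_mul_of_nonneg_right h1 h.nonneg
  linarith [h.low]

theorem half_space {c : ℝ} (h : Boot d N p c) (hN : 1 ≤ N) (hc : c ≤ 1) (ν : Dir d) (r : ℕ) : phi p (slabF {ν} r) 0 ≤ 2 := by
  refine (h.exits {ν} (by simp; omega) r).trans ?_
  have : (2 : ENNReal) = ofReal 2 := by simp
  rw [this]
  exact ofReal_le_ofReal (by linarith)

end Boot

theorem ind_eq_zero_le_hpow {R : ℕ} (hR : 1 ≤ R) (I : Finset (Fin d)) (k : ℕ) (x : V d) : ind (x = 0) ≤ ofReal (hpow R I k x) := by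
  by_cases hx : x = 0
  · subst hx
    rw [hpow_near hR (by simp [sqI]), ofReal_one]
    exact ind_le_one
  · rw [ind_false hx]; exact zero_le

/-- Polynomial decay of the convolution powers under the bootstrap hypothesis. -/
theorem exists_gg_le : ∃ R N₀ : ℕ, 5 ≤ R ∧ ∀ N d p, N₀ ≤ N → Boot d N p (gam N) → ∀ I : Finset (Fin d), I.card = N →
    ∀ j ≤ 4, ∀ x, gg p j x ≤ N ^ (25 * j) * ofReal (hpow R I (200 - j) x) := by
  obtain ⟨C, hC0, hC⟩ := exists_taylor_uniform 200
  obtain ⟨R, hR⟩ := exists_nat_ge (8 * C + 5)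
  obtain ⟨N₁, hN₁⟩ := exists_nat_ge (32 * C)
  refine ⟨R, N₁ + 2 ^ 22 + 72 * 4 ^ 200 * R ^ 2 * 400, by
    have : (5 : ℝ) ≤ R := by linarith
    exact_mod_cast this, fun N d p hN hb I hI j => ?_⟩
  have hR5 : 5 ≤ R := by
    have : (5 : ℝ) ≤ R := by linarith
    exact_mod_cast this
  have hNc : 72 * 4 ^ 200 * R ^ 2 * 400 ≤ N := by omega
  have hN22 : 2 ^ 22 ≤ N := le_trans (Nat.le_add_left _ _) ((Nat.le_add_right _ _).trans hN)
  have hN1 : 1 ≤ N := le_trans (by norm_num) hN22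
  have hNN : N₁ ≤ N := le_trans ((Nat.le_add_right _ _).trans (Nat.le_add_right _ _)) hN
  have hIne : I.Nonempty := Finset.card_pos.1 (by omega)
  have hRC : 8 * C ≤ R ^ 2 := by
    have : (5 : ℝ) ≤ R := by linarith
    nlinarith
  have hCM : 32 * C ≤ I.card := by rw [hI]; exact hN₁.trans (by exact_mod_cast hNN)
  have hγ : gam N * (400 * I.card ^ 3) = 1 := by rw [hI]; exact gam_mul hN1
  have hphi : ∀ r, phi p (cubeI I r) 0 ≤ ofReal (1 + gam N) := fun r => hb.exits _ (by simp [hI]; omega) r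
  have hhalf := fun (ν : Dir d) r => hb.half_space hN1 (by linarith [Boot.gam_le hN1]) ν r
  induction j with
  | zero => intro _ x; simpa [gg] using ind_eq_zero_le_hpow (by omega) I 200 x
  | succ j ih =>
    intro hj x
    have hk : 200 - j = (200 - (j + 1)) + 1 := by omega
    have ih' := ih (by omega)
    rw [hk] at ih'
    have hBtop : (N : ENNReal) ^ (25 * j) ≠ ∞ := by finiteness
    have h1 := conv_tt_hpow_le hb.sub (k := 200 - (j + 1)) (by omega) hC0 (hC _ (by omega)) hIne hR5 hRC hCM hγ hphi hhalf hBtop ih' x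
    rw [← gg_succ] at h1
    set H := ofReal (hpow R I (200 - (j + 1)) x)
    have h2 : ofReal (72 * 4 ^ (200 - (j + 1) + 1) * (R : ℝ) ^ 2 * (400 * I.card ^ 3)) ≤ (N : ENNReal) ^ 4 := by
      rw [← ofReal_natCast, ← ofReal_pow (by positivity), hI]
      refine ofReal_le_ofReal ?_
      calc 72 * 4 ^ (200 - (j + 1) + 1) * (R : ℝ) ^ 2 * (400 * (N : ℝ) ^ 3) ≤ 72 * 4 ^ 200 * (R : ℝ) ^ 2 * (400 * (N : ℝ) ^ 3) := by
            gcongr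
            · norm_num
            · omega
        _ = (72 * 4 ^ 200 * (R : ℝ) ^ 2 * 400) * (N : ℝ) ^ 3 := by ring
        _ ≤ N * (N : ℝ) ^ 3 := by
            gcongr
            exact_mod_cast hNc
        _ = _ := by ring
    calc gg p (j + 1) x = gg p (j + 1) x * 1 := (mul_one _).symm
      _ ≤ gg p (j + 1) x * (pE p * (N : ENNReal) ^ 21) := mul_le_mul_right (hb.one_le_pE hN22) _
      _ = gg p (j + 1) x * pE p * N ^ 21 := by ring
      _ ≤ N ^ (25 * j) * N ^ 4 * H * N ^ 21 := by
          refine mul_le_mul_left (h1.trans (mul_le_mul_left (mul_le_mul_right h2 _) _)) _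
      _ = _ := by rw [show 25 * (j + 1) = 25 * j + 4 + 21 by ring, pow_add, pow_add]; ring

theorem exists_card_superset_of_mem {i : Fin d} (h1 : 1 ≤ N) (h : N ≤ d) : ∃ I : Finset (Fin d), i ∈ I ∧ I.card = N := by
  obtain ⟨I, hI, -, hc⟩ := Finset.exists_subsuperset_card_eq (s := {i}) (t := Finset.univ) (n := N) (by simp) (by simpa using h1) (by simpa using h)
  exact ⟨I, by simpa using hI, hc⟩

theorem hpow_le_of_le {R : ℕ} (hR : 1 ≤ R) {I : Finset (Fin d)} {k : ℕ} {t : ℝ} (ht : 0 < t) (h : t ≤ sqI I x) :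
    hpow R I k x ≤ (R ^ 2 / t) ^ k := by
  unfold hpow
  refine pow_le_pow_left₀ (hpow_base_pos hR).le ?_ _
  gcongr
  exact h.trans (le_max_right _ _)

theorem tsum_inv_sq_le : ∑' j : ℕ, (((j : ENNReal) + 1)⁻¹) ^ 2 ≤ 2 := by
  have h : ∀ n : ℕ, ∑ j ∈ Finset.range (n + 1), ((j : ℝ) + 1)⁻¹ ^ 2 ≤ 2 - ((n : ℝ) + 1)⁻¹ := fun n => by
    induction n with
    | zero => norm_num
    | succ n ih =>
      rw [sum_range_succ]
      have : (((n + 1 : ℕ) : ℝ) + 1)⁻¹ ^ 2 ≤ ((n : ℝ) + 1)⁻¹ - (((n + 1 : ℕ) : ℝ) + 1)⁻¹ := by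
        push_cast
        rw [← sub_nonneg]
        have : ((n : ℝ) + 1)⁻¹ - ((n : ℝ) + 1 + 1)⁻¹ - ((n : ℝ) + 1 + 1)⁻¹ ^ 2 = 1 / ((n + 1) * (n + 1 + 1) ^ 2) := by
          field_simp; ring
        rw [this]; positivity
      linarith
  refine ENNReal.tsum_le_of_sum_range_le fun n => ?_
  calc _ = ofReal (∑ j ∈ Finset.range n, ((j : ℝ) + 1)⁻¹ ^ 2) := by
        rw [ofReal_sum_of_nonneg fun _ _ => by positivity]
        refine sum_ext fun j _ => ?_
        rw [ofReal_pow (by positivity), ofReal_inv_of_pos (by positivity), ofReal_add (by positivity) (by norm_num)]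
        simp
    _ ≤ ofReal 2 := by
        refine ofReal_le_ofReal ?_
        have h1 := h n
        rw [sum_range_succ] at h1
        have h2 : (0 : ℝ) ≤ ((n : ℝ) + 1)⁻¹ := by positivity
        nlinarith [sq_nonneg ((n : ℝ) + 1)⁻¹]
    _ = 2 := by simp

end

section
variable {N : ℕ}

theorem stepOp_gg_zero_le (x : V d) : stepOp p (gg p 0) x ≤ pE p := by
  have : ∑ ν, gg p 0 (x + nb ν) ≤ 1 := by
    rw [sum_nb_eq_tsum (gg p 0) x]
    calc _ ≤ ∑' Y : V d, ind (Y = 0) * 1 := tsum_le_tsum fun Y => by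
          rw [mul_one]; exact mul_le_of_le_one_left' ind_le_one
      _ = 1 := tsum_ind_zero fun _ => 1
  exact (mul_le_mul_right this _).trans (mul_one _).le

theorem pow_one_add_gam_le (hN : 1 ≤ N) : ofReal (1 + gam N) ^ N ≤ 3 := by
  rw [show (3 : ENNReal) = ofReal 3 by simp, ← ofReal_pow (by linarith [gam_nonneg N])]
  refine ofReal_le_ofReal ?_
  have h1 : (1 + gam N) ^ N ≤ exp (N * gam N) := by
    rw [Real.exp_nat_mul]
    exact pow_le_pow_left₀ (by linarith [gam_nonneg N]) (by linarith [Real.add_one_le_exp (gam N)]) _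
  have h2 : (N : ℝ) * gam N ≤ 1 := by
    have hN1 : (1 : ℝ) ≤ N := mod_cast hN
    unfold gam
    rw [mul_one_div, div_le_one (by positivity)]
    nlinarith [mul_le_mul hN1 hN1 zero_le_one (by linarith), sq_nonneg (N : ℝ)]
  calc _ ≤ exp 1 := h1.trans (exp_le_exp.2 h2)
    _ ≤ 3 := by linarith [Real.exp_one_lt_d9]

theorem exists_boot_improve : ∃ N₀ : ℕ, ∀ N d p, N₀ ≤ N → Boot d N p (gam N) → Boot d N p (gam N / 2) := by
  obtain ⟨R, N₁, hR, hgg⟩ := exists_gg_le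
  refine ⟨N₁ + 2 ^ 22 + R ^ 400 + 10 ^ 6, fun N d p hN hb => ?_⟩
  have hN1 : N₁ ≤ N := by omega
  have hN22 : 2 ^ 22 ≤ N := by omega
  have hNR : R ^ 400 ≤ N := by omega
  have hN6 : 10 ^ 6 ≤ N := by omega
  have hNpos : 1 ≤ N := by omega
  have hNd : N ≤ d := (Nat.le_self_pow (by norm_num) N).trans hb.le_d
  set n : ENNReal := (N : ENNReal) with hn
  set ι : ENNReal := n⁻¹ with hι_def
  have hn0 : n ≠ 0 := by rw [hn]; exact_mod_cast (by omega : N ≠ 0)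
  have hnt : n ≠ ∞ := ENNReal.natCast_ne_top N
  have hι : n * ι = 1 := ENNReal.mul_inv_cancel hn0 hnt
  have hιpow : ∀ k, n ^ k * ι ^ k = 1 := fun k => by rw [← mul_pow, hι, one_pow]
  have hn1 : 1 ≤ n := by rw [hn]; exact_mod_cast hNpos
  have h12 : 1 ≤ 12 * n := hn1.trans (le_mul_of_one_le_left' (by norm_num))
  have hι1 : ι ≤ 1 := inv_le_one.2 hn1
  have hιanti : ∀ {k l : ℕ}, k ≤ l → ι ^ l ≤ ι ^ k := fun h => pow_le_pow_right_of_le_one' hι1 h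
  have hcι : ∀ c : ℕ, c ≤ N → (c : ENNReal) * ι ≤ 1 := fun c h => inv_mul_le_one h
  set P := pE p with hP_def
  have hP : P ≤ ι ^ 20 := by
    calc P = P * (n ^ 20 * ι ^ 20) := by rw [hιpow, mul_one]
      _ = (n ^ 20 * P) * ι ^ 20 := by ring
      _ ≤ 1 * ι ^ 20 := mul_le_mul_left (hb.pow_pE_le hNpos) _
      _ = ι ^ 20 := one_mul _
  have hPn : 1 ≤ P * n ^ 21 := hb.one_le_pE hN22
  have hRk : ∀ k ≤ 200, ((R : ENNReal) ^ 2) ^ k ≤ n := fun k hk => by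
    rw [← pow_mul]
    have : R ^ (2 * k) ≤ N := (Nat.pow_le_pow_right (by omega) (by omega)).trans hNR
    rw [hn]; exact_mod_cast this
  have ha : ∀ j ≤ 4, ∀ x : V d, N ≤ num0 x → gg p j x ≤ ι ^ 20 := fun j hj x hx => by
    obtain ⟨I, hI1, hI2⟩ := Finset.exists_subset_card_eq hx
    have hsq : (N : ℝ) ≤ sqI I x := by
      rw [← hI2, sqI, ← nsmul_one, ← sum_const]
      refine sum_le_sum fun i hi => ?_
      have h0 : x i ≠ 0 := by simpa using hI1 hi
      have h1 : 1 ≤ (x i) ^ 2 := by have := sq_pos_of_ne_zero h0; omega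
      exact_mod_cast h1
    have hN0 : (0 : ℝ) < N := mod_cast hNpos
    have h1 := hpow_le_of_le (R := R) (k := 200 - j) (by omega) hN0 hsq
    have h2 : ofReal ((R ^ 2 / N) ^ (200 - j)) ≤ n * ι ^ (200 - j) := by
      rw [ofReal_pow (by positivity), ofReal_div_of_pos hN0, ofReal_pow (by positivity),
        ofReal_natCast, ofReal_natCast, div_eq_mul_inv, mul_pow]
      exact mul_le_mul_left (hRk _ (by omega)) _
    calc gg p j x ≤ n ^ (25 * j) * (n * ι ^ (200 - j)) :=
          (hgg N d p hN1 hb I hI2 j hj x).trans (mul_le_mul_right ((ofReal_le_ofReal h1).trans h2) _)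
      _ = n ^ (25 * j + 1) * ι ^ (25 * j + 1) * ι ^ (200 - j - (25 * j + 1)) := by
          rw [mul_assoc, ← pow_add, pow_succ, mul_assoc]
          congr 3
          omega
      _ = ι ^ (200 - j - (25 * j + 1)) := by rw [hιpow, one_mul]
      _ ≤ ι ^ 20 := hιanti (by omega)
  set Λ := ofReal (1 + gam N) with hΛ
  have hΛ1 : 1 ≤ Λ := by rw [hΛ, one_le_ofReal]; linarith [gam_nonneg N]
  have hΛ2 : Λ ≤ 2 := Boot.one_add_gam_le hNpos
  have hΛ3 : Λ ^ N ≤ 3 := pow_one_add_gam_le hNpos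
  have hP12 : 12 * n ^ 2 * P ≤ 1 := by
    calc 12 * n ^ 2 * P ≤ 12 * n ^ 2 * ι ^ 20 := mul_le_mul_right hP _
      _ = (n ^ 2 * ι ^ 2) * ((12 : ℕ) * ι) * ι ^ 17 := by push_cast; ring
      _ ≤ 1 * 1 * 1 := mul_le_mul' (mul_le_mul' (hιpow 2).le (hcι 12 (by omega))) (pow_le_one' hι1 _)
      _ = 1 := by norm_num
  have hbs : ∀ j ≤ 4, ∀ x : V d, gg p j x ≤ (12 * n) ^ j := fun j => by
    induction j with
    | zero => intro _ x; simp [gg, ind_le_one]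
    | succ j ih =>
      intro hj x
      refine (sup_le_of_stepOp hb.deg hΛ1 hΛ3 hP12 (gg_succ_le hb.sub j) (ih (by omega)) (ha (j + 1) hj)
        (pow_ne_top hb.sub.chi_lt_top.ne) (gg_le_chi (j + 1)) x).trans ?_
      calc 6 * n * (12 * n) ^ j + 6 * ι ^ 20 ≤ 6 * n * (12 * n) ^ j + 6 * n * (12 * n) ^ j := by
            refine add_le_add le_rfl ?_
            rw [mul_assoc]
            refine mul_le_mul_right ((pow_le_one' hι1 _).trans ?_) _
            exact one_le_mul hn1 (one_le_pow₀ h12)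
        _ = (12 * n) ^ (j + 1) := by ring
  have hss : ∀ j ≤ 4, ∀ x : V d, stepOp p (gg p j) x ≤ 24 * ι ^ 18 * (12 * n) ^ j := fun j => by
    induction j with
    | zero =>
      intro _ x
      refine (stepOp_gg_zero_le x).trans (hP.trans ((hιanti (show 18 ≤ 20 by norm_num)).trans ?_))
      rw [pow_zero, mul_one]
      exact le_mul_of_one_le_left' (by norm_num)
    | succ j ih =>
      intro hj x
      refine (stepOp_sup_le hb.deg hΛ1 hΛ2 hΛ3 (gg_succ_le hb.sub j) (ih (by omega)) (ha (j + 1) hj) (hbs (j + 1) hj) x).trans ?_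
      calc 3 * n * (24 * ι ^ 18 * (12 * n) ^ j) + 6 * (ι ^ 20 + 2 * n ^ 2 * P * (12 * n) ^ (j + 1))
          ≤ 3 * n * (24 * ι ^ 18 * (12 * n) ^ j) + 6 * (ι ^ 18 * (12 * n) ^ (j + 1) + 2 * n ^ 2 * ι ^ 20 * (12 * n) ^ (j + 1)) := by
            gcongr
            exact (hιanti (show 18 ≤ 20 by norm_num)).trans (le_mul_of_one_le_right' (one_le_pow₀ h12))
        _ = 6 * ι ^ 18 * (12 * n) ^ (j + 1) + 6 * (ι ^ 18 * (12 * n) ^ (j + 1) + 2 * (n ^ 2 * ι ^ 2) * ι ^ 18 * (12 * n) ^ (j + 1)) := by ring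
        _ = 24 * ι ^ 18 * (12 * n) ^ (j + 1) := by rw [hιpow]; ring
  have hs3 : ∀ j ≤ 3, ∀ x : V d, stepOp p (gg p j) x ≤ ι ^ 14 := fun j hj x => by
    refine (hss j (by omega) x).trans ?_
    calc 24 * ι ^ 18 * (12 * n) ^ j ≤ 24 * ι ^ 18 * (12 * n) ^ 3 := mul_le_mul_right (pow_le_pow_right₀ h12 hj) _
      _ = (n ^ 3 * ι ^ 3) * ((41472 : ℕ) * ι) * ι ^ 14 := by push_cast; ring
      _ ≤ 1 * 1 * ι ^ 14 := mul_le_mul' (mul_le_mul' (hιpow 3).le (hcι _ (by omega))) le_rfl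
      _ = ι ^ 14 := by ring
  have hγ : ι ^ 4 ≤ ofReal (gam N / 2) := by
    have hN0 : (0 : ℝ) < N := mod_cast hNpos
    rw [hι_def, hn, ← ofReal_natCast, ← ofReal_inv_of_pos hN0, ← ofReal_pow (by positivity)]
    refine ofReal_le_ofReal ?_
    unfold gam
    rw [div_div, inv_pow, ← one_div]
    refine one_div_le_one_div_of_le (by positivity) ?_
    have : (800 : ℝ) ≤ N := mod_cast (by omega : 800 ≤ N)
    nlinarith [pow_pos hN0 3]
  have hdeg2 : 2 * d * P ≤ 2 := hb.deg.trans hΛ2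
  have hfinal : ∀ e : ENNReal, e ≤ ι ^ 4 → 1 + e ≤ ofReal (1 + gam N / 2) := fun e he => by
    rw [ofReal_add zero_le_one (by linarith [gam_nonneg N]), ofReal_one]
    exact add_le_add le_rfl (he.trans hγ)
  refine ⟨hb.le_d, hb.d_le, hb.sub, hb.low, hb.half, fun F hF r => ?_, ?_⟩
  swap
  · refine (two_d_pE_le hb.nonneg hb.half hb.sub (hs3 1 (by norm_num)) (hs3 2 (by norm_num))).trans (hfinal _ ?_)
    calc 2 * d * P * (2 * ι ^ 14) ≤ 2 * (2 * ι ^ 14) := mul_le_mul_left hdeg2 _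
      _ = ((4 : ℕ) * ι) * ι ^ 13 := by push_cast; ring
      _ ≤ 1 * ι ^ 4 := mul_le_mul' (hcι _ (by omega)) (hιanti (by norm_num))
      _ = ι ^ 4 := one_mul _
  have hFc : (F.card : ENNReal) ≤ 2 * n := by rw [hn]; exact_mod_cast hF
  have hFP : F.card * P ≤ 1 := by
    calc F.card * P ≤ 2 * n * ι ^ 20 := mul_le_mul' hFc hP
      _ = (n * ι) * ((2 : ℕ) * ι) * ι ^ 18 := by push_cast; ring
      _ ≤ 1 * 1 * 1 := mul_le_mul' (mul_le_mul' hι.le (hcι _ (by omega))) (pow_le_one' hι1 _)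
      _ = 1 := by norm_num
  set G : ℕ → ENNReal := fun j => if j < N then ∞ else n ^ 76 * (j : ENNReal)⁻¹ ^ 394 with hG
  set W : ℕ → ENNReal := fun j => 2 * ι ^ 14 * ind (j < N) + ι ^ 14 * (j + 1 : ENNReal)⁻¹ ^ 3 with hW
  have hGle : ∀ (ν : Dir d) (j : ℕ) x, (j : ℤ) ≤ lin ν x → gg p 3 x ≤ G j := fun ν j x hx => by
    by_cases hj : j < N
    · simp [hG, hj]
    simp only [hG, if_neg hj]
    obtain ⟨I, hνI, hI2⟩ := exists_card_superset_of_mem (i := ν.1) hNpos hNd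
    have hj0 : (0 : ℝ) < j := mod_cast (by omega : 0 < j)
    have hsq : (j : ℝ) ^ 2 ≤ sqI I x := by
      refine le_trans ?_ (sq_le_sqI hνI x)
      rw [← sq_abs (x ν.1 : ℝ)]
      refine pow_le_pow_left₀ hj0.le ?_ 2
      have : (j : ℤ) ≤ |x ν.1| := by
        refine hx.trans ?_
        unfold lin
        split_ifs
        · exact le_abs_self _
        · exact neg_le_abs _
      exact_mod_cast this
    have h1 := hpow_le_of_le (R := R) (k := 197) (by omega) (by positivity) hsq
    have h2 : ofReal (((R : ℝ) ^ 2 / (j : ℝ) ^ 2) ^ 197) ≤ n * (j : ENNReal)⁻¹ ^ 394 := by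
      rw [ofReal_pow (by positivity), ofReal_div_of_pos (by positivity), ofReal_pow (by positivity),
        ofReal_pow (by positivity), ofReal_natCast, ofReal_natCast, div_eq_mul_inv, mul_pow,
        ← ENNReal.inv_pow]
      refine mul_le_mul' (hRk 197 (by norm_num)) (le_of_eq ?_)
      rw [← pow_mul, ENNReal.inv_pow]
    calc gg p 3 x ≤ n ^ 75 * (n * (j : ENNReal)⁻¹ ^ 394) :=
          (hgg N d p hN1 hb I hI2 3 (by norm_num) x).trans (mul_le_mul_right ((ofReal_le_ofReal h1).trans h2) _)
      _ = _ := by rw [← mul_assoc, ← pow_succ]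
  have hWle : ∀ j, ι ^ 14 + F.card * P * (12 * n) ^ 4 ≤ W j ∨ 6 * G j ≤ W j * P := fun j => by
    by_cases hj : j < N
    · left
      simp only [hW]
      rw [ind_true hj, mul_one]
      refine le_trans ?_ le_self_add
      calc ι ^ 14 + F.card * P * (12 * n) ^ 4 ≤ ι ^ 14 + 2 * n * ι ^ 20 * (12 * n) ^ 4 := by gcongr
        _ = ι ^ 14 + (n ^ 5 * ι ^ 5) * ((41472 : ℕ) * ι) * ι ^ 14 := by push_cast; ring
        _ ≤ ι ^ 14 + 1 * 1 * ι ^ 14 := add_le_add le_rfl (mul_le_mul' (mul_le_mul' (hιpow 5).le (hcι _ (by omega))) le_rfl)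
        _ = 2 * ι ^ 14 := by ring
    · right
      simp only [hW, hG, if_neg hj]
      rw [ind_false hj, mul_zero, zero_add]
      set κ := (j : ENNReal)⁻¹
      set μ := (j + 1 : ENNReal)⁻¹
      have hκι : κ ≤ ι := inv_le_inv.2 (by rw [hn]; exact_mod_cast (by omega : N ≤ j))
      have hκμ : κ ≤ 2 * μ := by
        have hj0 : (j : ENNReal) ≠ 0 := mod_cast (by omega : j ≠ 0)
        have h1 : (j + 1 : ENNReal) ≤ 2 * j := mod_cast (by omega : j + 1 ≤ 2 * j)
        have h2 : (2 * (j : ENNReal))⁻¹ ≤ μ := inv_le_inv.2 h1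
        rw [ENNReal.mul_inv (by norm_num) (by norm_num)] at h2
        calc κ = 2 * (2⁻¹ * κ) := by rw [← mul_assoc, ENNReal.mul_inv_cancel (by norm_num) (by norm_num), one_mul]
          _ ≤ 2 * μ := mul_le_mul_right h2 _
      calc 6 * (n ^ 76 * κ ^ 394) = 6 * (n ^ 76 * κ ^ 394) * 1 := (mul_one _).symm
        _ ≤ 6 * (n ^ 76 * κ ^ 394) * (P * n ^ 21) := mul_le_mul_right hPn _
        _ = 6 * n ^ 97 * κ ^ 391 * κ ^ 3 * P := by ring
        _ ≤ 6 * n ^ 97 * ι ^ 391 * (2 * μ) ^ 3 * P := by gcongr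
        _ = (n ^ 97 * ι ^ 97) * ((48 : ℕ) * ι) * ι ^ 279 * (ι ^ 14 * μ ^ 3 * P) := by push_cast; ring
        _ ≤ 1 * 1 * 1 * (ι ^ 14 * μ ^ 3 * P) :=
            mul_le_mul' (mul_le_mul' (mul_le_mul' (hιpow 97).le (hcι _ (by omega))) (pow_le_one' hι1 _)) le_rfl
        _ = _ := by ring
  refine (phi_slabF_le hb.nonneg hb.half hb.sub (hb.half_space hNpos (by linarith [Boot.gam_le hNpos])) hdeg2 hFP
    (hs3 3 le_rfl) (hbs 4 le_rfl) hGle hWle).trans (hfinal _ ?_)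
  have hsum : ∑' j : ℕ, 4 * (j + 1 : ENNReal) * W j ≤ 16 * ι ^ 12 := by
    have e1 : ∀ j : ℕ, 4 * (j + 1 : ENNReal) * W j = 8 * ι ^ 14 * ((j + 1) * ind (j < N)) + 4 * ι ^ 14 * (j + 1 : ENNReal)⁻¹ ^ 2 := fun j => by
      simp only [hW]
      have : (j + 1 : ENNReal) * (j + 1 : ENNReal)⁻¹ = 1 := ENNReal.mul_inv_cancel (by positivity) (by finiteness)
      calc _ = 8 * ι ^ 14 * ((j + 1) * ind (j < N)) + 4 * ι ^ 14 * (((j + 1 : ENNReal) * (j + 1 : ENNReal)⁻¹) * (j + 1 : ENNReal)⁻¹ ^ 2) := by ring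
        _ = _ := by rw [this, one_mul]
    simp_rw [e1]
    rw [tsum_add, tsum_mul_left, tsum_mul_left]
    have e2 : ∑' j : ℕ, (j + 1 : ENNReal) * ind (j < N) ≤ n * n := by
      rw [tsum_eq_sum (s := Finset.range N) fun j hj => by rw [ind_false (by simpa using hj), mul_zero]]
      calc _ ≤ ∑ _j ∈ Finset.range N, n := by
            refine sum_le_sum fun j hj => (mul_le_of_le_one_right' ind_le_one).trans ?_
            have := Finset.mem_range.1 hj
            rw [hn]; exact_mod_cast this
        _ = n * n := by simp [hn]
    calc _ ≤ 8 * ι ^ 14 * (n * n) + 4 * ι ^ 14 * 2 := add_le_add (mul_le_mul_right e2 _) (mul_le_mul_right tsum_inv_sq_le _)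
      _ = 8 * ι ^ 12 * (n ^ 2 * ι ^ 2) + 8 * ι ^ 14 := by ring
      _ ≤ 8 * ι ^ 12 * 1 + 8 * ι ^ 12 := add_le_add (mul_le_mul_right (hιpow 2).le _) (mul_le_mul_right (hιanti (by norm_num)) _)
      _ = _ := by ring
  calc (F.card : ENNReal) * ∑' j : ℕ, 4 * (j + 1 : ENNReal) * W j ≤ 2 * n * (16 * ι ^ 12) := mul_le_mul' hFc hsum
    _ = (n * ι) * ((32 : ℕ) * ι) * ι ^ 10 := by push_cast; ring
    _ ≤ 1 * 1 * ι ^ 4 := mul_le_mul' (mul_le_mul' hι.le (hcι _ (by omega))) (hιanti (by norm_num))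
    _ = ι ^ 4 := by ring

end

open Filter Topology

section
variable {N : ℕ} {p q p₁ : ℝ} {S T : Set (V d)}

theorem continuous_tau_mul (hS : S.Finite) (T : Set (V d)) :
    Continuous fun p => tau p S x y * ∑ ν, ind (y + nb ν ∉ T) * pE p := by
  refine continuous_iff_continuousAt.2 fun p => ?_
  refine ENNReal.Tendsto.mul (continuous_tau hS).continuousAt (.inr ?_) ?_ (.inr ?_)
  · exact sum_ne_top.2 fun ν _ => mul_ne_top (ind_le_one.trans_lt (by simp)).ne (by simp [pE])
  · refine tendsto_finsetSum _ fun ν _ => ?_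
    by_cases h : y + nb ν ∉ T
    · simp only [ind_true h, one_mul]
      exact continuous_pE.continuousAt
    · simp only [ind_false h, zero_mul]
      exact tendsto_const_nhds
  · exact (tau_le_one.trans_lt (by simp)).ne

theorem isClosed_phi_le (S : Set (V d)) (x : V d) (c : ENNReal) : IsClosed {p | phi p S x ≤ c} := by
  have h : LowerSemicontinuous fun p => phi p S x := by
    refine lowerSemicontinuous_tsum fun y => ?_
    have : (fun p => tau p S x y * ∑ ν, ind (y + nb ν ∉ S) * pE p) =
        fun p => ⨆ n : ℕ, tau p (S ∩ box 0 n) x y * ∑ ν, ind (y + nb ν ∉ S) * pE p := by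
      ext p
      rw [tau_eq_iSup, iSup_mul]
    rw [this]
    exact lowerSemicontinuous_iSup fun n => (continuous_tau_mul ((box_finite 0 n).inter_of_right S) S).lowerSemicontinuous
  exact h.isClosed_preimage c

theorem sum_ind_pE_le (P : Dir d → Prop) : ∑ ν, ind (P ν) * pE p ≤ 2 * d := by
  calc ∑ ν, ind (P ν) * pE p ≤ ∑ _ν : Dir d, 1 := sum_le_sum fun ν _ => mul_le_one' ind_le_one pE_le_one
    _ = 2 * d := by simp [Dir]; ring

/-- Truncation of `phi` to a box, uniformly in the set. -/
theorem phi_le_trunc (hs : Subcrit d p₁) (hq : q ≤ p₁) (h0 : 0 ∈ S) (m : ℕ) :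
    phi q S 0 ≤ ∑ y ∈ boxF 0 (m + 1), tau q (S ∩ box 0 (m + 1)) 0 y * ∑ ν, ind (y + nb ν ∉ S ∩ box 0 (m + 2)) * pE q +
      2 * d * (2 * d * chi d p₁) * ∑' a : V d, tt p₁ a * ind (a ∉ box 0 m) := by
  set B := S ∩ box (0 : V d) (m + 1)
  have h0B : (0 : V d) ∈ B := ⟨h0, fun i => by simp; positivity⟩
  have hfin : FinCl q B 0 := (hs.mono hq).finCl _ _
  have hterm : ∀ y, tau q S 0 y * ∑ ν, ind (y + nb ν ∉ S) * pE q ≤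
      tau q B 0 y * ∑ ν, ind (y + nb ν ∉ S) * pE q +
      2 * d * ∑' a, tt p₁ a * ind (a ∉ box 0 m) * ∑ ν, tt p₁ (y - (a + nb ν)) := fun y => by
    refine (mul_le_mul_left (simon_lieb (S := B) h0B hfin) _).trans ?_
    rw [add_mul]
    refine add_le_add le_rfl ?_
    rw [mul_comm]
    refine mul_le_mul' (sum_ind_pE_le _) (tsum_le_tsum fun a => ?_)
    by_cases ha : a ∈ B
    swap
    · rw [tau_eq_zero_right ha, zero_mul]; exact zero_le
    rw [mul_assoc, mul_sum _ _ (ind (a ∉ box 0 m))]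
    refine mul_le_mul' ((tau_mono_p hq).trans (tau_mono (subset_univ _))) (sum_le_sum fun ν _ => ?_)
    refine mul_le_mul' (ind_mono fun h hb => h.2 ⟨h.1, add_nb_mem_box hb ν⟩) ?_
    refine (mul_le_of_le_one_left' pE_le_one).trans ?_
    rw [← tau_univ_eq]
    exact (tau_mono_p hq).trans (tau_mono (subset_univ _))
  refine (tsum_le_tsum hterm).trans ?_
  rw [tsum_add]
  refine add_le_add (le_of_eq ?_) ?_
  · rw [tsum_eq_sum (s := boxF 0 (m + 1)) fun y hy => by
      rw [tau_eq_zero_right fun h => hy (by rw [← mem_coe, coe_boxF]; exact h.2), zero_mul]]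
    refine sum_ext fun y hy => ?_
    congr 1
    refine sum_ext fun ν _ => ?_
    have hy2 : y + nb ν ∈ box (0 : V d) (m + 2) := add_nb_mem_box (mem_boxF.1 hy) ν
    rw [show (y + nb ν ∉ S) = (y + nb ν ∉ S ∩ box 0 (m + 2)) by simp [hy2]]
  · rw [tsum_mul_left, mul_assoc (2 * (d : ENNReal)), tsum_comm]
    refine mul_le_mul' le_rfl ?_
    rw [← tsum_mul_left]
    refine tsum_le_tsum fun a => ?_
    rw [tsum_mul_left, mul_comm]
    refine mul_le_mul_left ?_ _
    rw [tsum_fsum]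
    calc _ ≤ ∑ _ν : Dir d, chi d p₁ := sum_le_sum fun ν _ => by
          rw [chi]; exact le_of_eq ((subRight (a + nb ν)).tsum_eq fun y => tt p₁ y)
      _ = _ := by simp [Dir]; ring

theorem exists_tail_lt {f : V d → ENNReal} (hf : ∑' a, f a ≠ ∞) {η : ENNReal} (hη : η ≠ 0) : ∃ m : ℕ, ∑' a, f a * ind (a ∉ box 0 m) < η := by
  obtain ⟨s, hs⟩ := ((ENNReal.tendsto_tsum_compl_atTop_zero hf).eventually_lt_const (pos_iff_ne_zero.2 hη)).exists
  obtain ⟨m, hm⟩ := exists_box s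
  refine ⟨m, lt_of_le_of_lt ?_ hs⟩
  have : ∑' b : {x // x ∉ s}, f b = ∑' a, ({x | x ∉ s} : Set (V d)).indicator f a := tsum_subtype _ _
  rw [this]
  refine tsum_le_tsum fun a => ?_
  by_cases ha : a ∈ s
  · rw [ind_false (by simpa using hm a ha)]; simp
  · rw [indicator_of_mem (by exact ha)]
    exact mul_le_of_le_one_right' ind_le_one

theorem phi_right (hs : Subcrit d p₁) (hp : p < p₁) {η : ENNReal} (hη : η ≠ 0) :
    ∀ᶠ q in 𝓝[>] p, ∀ S : Set (V d), 0 ∈ S → phi q S 0 ≤ phi p S 0 + η := by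
  have hchi : chi d p₁ ≠ ∞ := hs.chi_lt_top.ne
  set D : ENNReal := 2 * d * (2 * d * chi d p₁) with hD
  have hDt : D ≠ ∞ := by
    have : (2 * (d : ENNReal)) ≠ ∞ := by finiteness
    exact mul_ne_top this (mul_ne_top this hchi)
  have hη2 : η / 2 ≠ 0 := ENNReal.div_ne_zero.2 ⟨hη, by norm_num⟩
  obtain ⟨m, hm⟩ := exists_tail_lt (f := tt p₁) hchi (η := η / 2 / (D + 1))
    (ENNReal.div_ne_zero.2 ⟨hη2, by finiteness⟩)
  have hm' : D * ∑' a, tt p₁ a * ind (a ∉ box (0 : V d) m) ≤ η / 2 :=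
    calc _ ≤ (D + 1) * (η / 2 / (D + 1)) := mul_le_mul' le_self_add hm.le
      _ ≤ η / 2 := ENNReal.mul_div_le
  set Ψ : ℝ → Set (V d) → ENNReal := fun q T => ∑ y ∈ boxF 0 (m + 1), tau q (T ∩ box 0 (m + 1)) 0 y * ∑ ν, ind (y + nb ν ∉ T ∩ box 0 (m + 2)) * pE q with hΨ
  have hcont : ∀ T, Continuous fun q => Ψ q T := fun T =>
    continuous_finsetSum _ fun y _ => continuous_tau_mul ((box_finite 0 _).inter_of_right T) _
  have hΨt : ∀ T, Ψ p T ≠ ∞ := fun T => sum_ne_top.2 fun y _ =>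
    mul_ne_top (tau_le_one.trans_lt (by simp)).ne ((sum_ind_pE_le _).trans_lt (by finiteness)).ne
  have hev : ∀ᶠ q in 𝓝 p, ∀ T ∈ (boxF (0 : V d) (m + 2)).powerset, Ψ q T < Ψ p T + η / 2 := by
    rw [eventually_all_finset]
    exact fun T _ => (hcont T).continuousAt.eventually_lt continuousAt_const (ENNReal.lt_add_right (hΨt T) hη2)
  have hev2 : ∀ᶠ q in 𝓝[>] p, q < p₁ := eventually_nhdsWithin_of_eventually_nhds (eventually_lt_nhds hp)
  filter_upwards [eventually_nhdsWithin_of_eventually_nhds hev, hev2] with q h1 h2 S h0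
  have h3 := h1 _ (Finset.mem_powerset.2 (filter_subset (· ∈ S) _))
  have hcoe : (((boxF (0 : V d) (m + 2)).filter (· ∈ S) : Finset (V d)) : Set (V d)) = S ∩ box 0 (m + 2) := by
    ext v; simp [← coe_boxF, and_comm]
  have hsub : box (0 : V d) (m + 1) ⊆ box 0 (m + 2) := box_mono (by omega)
  have hΨS : ∀ q, Ψ q (S ∩ box 0 (m + 2)) = Ψ q S := fun q => by
    simp only [hΨ]
    rw [inter_assoc, inter_eq_right.2 hsub, inter_assoc, inter_self]
  rw [hcoe, hΨS, hΨS] at h3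
  have h4 : Ψ p S ≤ phi p S 0 := by
    refine le_trans ?_ (sum_le_tsum (boxF 0 (m + 1)))
    exact sum_le_sum fun y hy => mul_le_mul' (tau_mono inter_subset_left) (sum_le_sum fun ν _ =>
      mul_le_mul_left (ind_mono fun h hS => h ⟨hS, add_nb_mem_box (mem_boxF.1 hy) ν⟩) _)
  calc phi q S 0 ≤ Ψ q S + D * ∑' a, tt p₁ a * ind (a ∉ box (0 : V d) m) := phi_le_trunc hs h2.le h0 m
    _ ≤ (phi p S 0 + η / 2) + η / 2 := add_le_add (h3.le.trans (add_le_add h4 le_rfl)) hm'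
    _ = phi p S 0 + η := by rw [add_assoc, ENNReal.add_halves]

theorem chi_le_two (hs : Subcrit d p) (h : 2 * d * pE p ≤ 1 / 2) : chi d p ≤ 2 := by
  have hchi : chi d p ≠ ∞ := hs.chi_lt_top.ne
  have h1 : chi d p ≤ 1 + 1 / 2 * chi d p := by
    calc chi d p ≤ ∑' x : V d, (gg p 0 x + stepOp p (tt p) x) := tsum_le_tsum fun x => by
          have := gg_succ_le hs 0 x
          rwa [zero_add, gg_one] at this
      _ = 1 + 2 * d * pE p * chi d p := by
          rw [tsum_add]
          congr 1
          · simpa [gg] using tsum_ind_zero (d := d) fun _ => 1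
          · simp only [stepOp]
            rw [tsum_mul_left, tsum_fsum]
            have : ∀ ν : Dir d, ∑' x : V d, tt p (x + nb ν) = chi d p := fun ν => (addRight (nb ν)).tsum_eq fun x => tt p x
            simp_rw [this]
            simp [Dir]; ring
      _ ≤ _ := by gcongr
  lift chi d p to NNReal using hchi with c
  have h2 : (c : ENNReal) ≤ ((1 + 1 / 2 * c : NNReal) : ENNReal) := by
    refine h1.trans (le_of_eq ?_)
    push_cast
    congr 2
  have h3 : c ≤ 1 + 1 / 2 * c := mod_cast h2
  have h4 : (c : ℝ) ≤ 1 + 1 / 2 * c := mod_cast h3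
  exact_mod_cast (by linarith : (c : ℝ) ≤ 2)

theorem exists_boot : ∃ N₀ : ℕ, ∀ N d p, N₀ ≤ N → N ^ 20 ≤ d → d ≤ (2 * N) ^ 20 → Subcrit d p → 1 ≤ 4 * d * p → Boot d N p (gam N) := by
  obtain ⟨N₀, himp⟩ := exists_boot_improve
  refine ⟨N₀ + 2, fun N d p₁ hN hd1 hd2 hs hlow => ?_⟩
  have hN1 : 1 ≤ N := by omega
  have hd : 2 ≤ d := le_trans (by omega) ((Nat.le_self_pow (by norm_num) N).trans hd1)
  have hd0 : (0 : ℝ) < d := mod_cast (by omega : 0 < d)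
  set a : ℝ := 1 / (4 * d) with ha
  have hap : a ≤ p₁ := by rw [ha, div_le_iff₀ (by positivity)]; linarith
  have ha0 : 0 < a := by positivity
  set c := ofReal (1 + gam N) with hc
  set s : Set ℝ := {p | (∀ F : Finset (Dir d), F.card ≤ 2 * N → ∀ r, phi p (slabF F r) 0 ≤ c) ∧ 2 * d * pE p ≤ c} with hs_def
  have hclosed : IsClosed s := by
    have : s = (⋂ F : Finset (Dir d), ⋂ _ : F.card ≤ 2 * N, ⋂ r, {p | phi p (slabF F r) 0 ≤ c}) ∩ {p | 2 * d * pE p ≤ c} := by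
      ext p; simp [hs_def]
    rw [this]
    refine IsClosed.inter (isClosed_iInter fun F => isClosed_iInter fun _ => isClosed_iInter fun r => isClosed_phi_le _ _ _) ?_
    refine isClosed_le ?_ continuous_const
    exact ENNReal.continuous_const_mul (by finiteness) |>.comp continuous_pE
  have hboot : ∀ p ∈ s, a ≤ p → p ≤ p₁ → Boot d N p (gam N) := fun p hp h1 h2 => by
    refine ⟨hd1, hd2, hs.mono h2, ?_, ?_, hp.1, hp.2⟩
    · rw [ha, div_le_iff₀ (by positivity)] at h1; linarith
    · have h3 : 2 * d * pE p ≤ 2 := hp.2.trans (Boot.one_add_gam_le hN1)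
      have h4 : (2 * d * clamp p : ℝ) ≤ 2 := by
        have e : 2 * d * pE p = ofReal (2 * d * clamp p) := by
          rw [ofReal_mul (by positivity), ofReal_mul (by norm_num)]; simp [pE]
        have e2 : (2 : ENNReal) = ofReal 2 := by simp
        rw [e, e2] at h3
        exact (ofReal_le_ofReal_iff (by norm_num)).1 h3
      have h5 : (2 : ℝ) ≤ d := mod_cast hd
      have h6 : clamp p ≤ 1 / 2 := by nlinarith
      unfold clamp at h6
      by_contra h7
      push Not at h7
      have : 1 / 2 < max 0 (min 1 p) := lt_max_of_lt_right (lt_min (by norm_num) h7)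
      linarith
  have hstart : a ∈ s := by
    have hpa : 2 * d * pE a = 1 / 2 := by
      have : pE a = ofReal a := by
        rw [pE, clamp_of_mem ⟨ha0.le, ?_⟩]
        rw [ha, div_le_one (by positivity)]
        have : (2 : ℝ) ≤ d := mod_cast hd
        linarith
      rw [this, show (2 * d : ENNReal) = ofReal (2 * d) by rw [ofReal_mul (by norm_num)]; simp,
        ← ofReal_mul (by positivity), ha, show (2 * d * (1 / (4 * d)) : ℝ) = 1 / 2 by field_simp; norm_num,
        ofReal_div_of_pos (by norm_num)]
      simp
    have hc1 : 1 ≤ c := by rw [hc, one_le_ofReal]; linarith [gam_nonneg N]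
    refine ⟨fun F _ r => le_trans ?_ hc1, by rw [hpa]; exact le_trans (by norm_num) hc1⟩
    calc phi a (slabF F r) 0 ≤ ∑' y : V d, tt a y * (2 * d * pE a) := by
          refine tsum_le_tsum fun y => mul_le_mul' (tau_mono (subset_univ _)) ?_
          calc _ ≤ ∑ _ν : Dir d, pE a := sum_le_sum fun ν _ => mul_le_of_le_one_left' ind_le_one
            _ = _ := by simp [Dir]; ring
      _ = chi d a * (1 / 2) := by rw [tsum_mul_right, hpa]; rfl
      _ ≤ 2 * (1 / 2) := mul_le_mul_left (chi_le_two (hs.mono hap) hpa.le) _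
      _ = 1 := by rw [mul_one_div, ENNReal.div_self (by norm_num) (by norm_num)]
  have hsub : Icc a p₁ ⊆ s := by
    refine IsClosed.Icc_subset_of_forall_exists_gt (hclosed.inter isClosed_Icc) hstart fun p hp y hy => ?_
    have hp' := himp N d p (by omega) (hboot p hp.1 hp.2.1 hp.2.2.le)
    have hgap : ofReal (1 + gam N / 2) + ofReal (gam N / 2) = c := by
      rw [← ofReal_add (by linarith [gam_nonneg N]) (by linarith [gam_nonneg N]), hc]
      congr 1; ring
    have hgpos : 0 < gam N := by
      have : (0 : ℝ) < N := mod_cast hN1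
      unfold gam; positivity
    have hη : ofReal (gam N / 2) ≠ 0 := by simpa using by linarith
    have e1 := phi_right hs hp.2.2 hη
    have e2 : ∀ᶠ q in 𝓝[>] p, 2 * d * pE q < c := by
      refine eventually_nhdsWithin_of_eventually_nhds ?_
      have hlt : 2 * d * pE p < c := by
        refine hp'.deg.trans_lt ?_
        rw [hc, ENNReal.ofReal_lt_ofReal_iff (by linarith)]
        linarith
      exact ((ENNReal.continuous_const_mul (a := 2 * (d : ENNReal)) (by finiteness)).comp continuous_pE).continuousAt.eventually_lt
        continuousAt_const hlt
    have e3 : ∀ᶠ q in 𝓝[>] p, q ∈ Ioc p y := Ioc_mem_nhdsGT hy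
    obtain ⟨q, h1, h2, h3⟩ := (e1.and (e2.and e3)).exists
    refine ⟨q, ⟨fun F hF r => ?_, h2.le⟩, h3⟩
    rw [← hgap]
    exact (h1 _ zero_mem_slabF).trans (add_le_add (hp'.exits F hF r) le_rfl)
  exact hboot p₁ (hsub ⟨hap, le_rfl⟩) hap le_rfl

end

section
variable {p pc : ℝ}

theorem bern_forall_eq {ι : Type*} {P : ι → ℝ} (E : Finset ι) (b : Bool) :
    bern P {ω | ∀ e ∈ E, ω e = b} = ∏ e ∈ E, bern P {ω | ω e = b} := by
  induction E using induction_on with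
  | empty => simp
  | insert e E he ih =>
    have hdep : ∀ F : Finset ι, Dep (F : Set ι) {ω : ι → Bool | ∀ e ∈ F, ω e = b} := fun F ω ω' h hω e he => by
      rw [← h e he]; exact hω e he
    rw [prod_insert he, ← ih, ← bern_inter (J := {e}) (K := (E : Set ι)) ?_ (hdep E) (by simpa using he)
      (meas_coord e b) (meas_of_dep (hdep E))]
    · congr 1; ext ω; simp
    · have := hdep {e}
      simpa using this

theorem perc_closed (e : Edge d) : perc d p {ω | ω e = false} = 1 - pE p := by
  have h : {ω : Config d | ω e = false} = {ω | ω e = true}ᶜ := by ext ω; simp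
  rw [h, prob_compl_eq_one_sub (meas_coord e true), perc_open]

theorem IsCrit.lower (hc : IsCrit d pc) (hd : 0 < d) : 1 / (4 * d) < pc := by
  by_contra! h
  refine hc.not_subcrit ⟨{0}, by simp, ?_⟩
  rw [Finset.coe_singleton, phi_singleton_zero]
  have hd' : (0 : ℝ) < d := mod_cast hd
  have : pE pc ≤ ofReal (1 / (4 * d)) := by
    rw [pE]
    refine ofReal_le_ofReal (le_trans ?_ h)
    rw [clamp_of_mem ⟨hc.pos.le, hc.lt_one.le⟩]
  calc 2 * d * pE pc ≤ 2 * d * ofReal (1 / (4 * d)) := mul_le_mul_right this _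
    _ = ofReal (1 / 2) := by
        rw [show (2 * d : ENNReal) = ofReal (2 * d) by rw [ofReal_mul (by norm_num)]; simp, ← ofReal_mul (by positivity)]
        congr 1; field_simp; norm_num
    _ < 1 := by rw [ENNReal.ofReal_lt_one]; norm_num

theorem mem_of_isClosed_of_lt {s : Set ℝ} (hs : IsClosed s) {a : ℝ} (ha : a < pc) (h : ∀ p, a ≤ p → p < pc → p ∈ s) : pc ∈ s := by
  have : Ico a pc ⊆ s := fun p hp => h p hp.1 hp.2
  have h2 := hs.closure_subset_iff.2 this
  rw [closure_Ico ha.ne] at h2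
  exact h2 ⟨ha.le, le_rfl⟩

theorem isClosed_gg_two_le (x : V d) (c : ENNReal) : IsClosed {p | gg p 2 x ≤ c} := by
  have h : LowerSemicontinuous fun p => gg p 2 x := by
    simp_rw [gg_two]
    refine lowerSemicontinuous_tsum fun y => ?_
    have : (fun p => tt p y * tt p (x - y)) =
        fun p => ⨆ n : ℕ, ⨆ m : ℕ, tau p (univ ∩ box 0 n) 0 y * tau p (univ ∩ box 0 m) 0 (x - y) := by
      ext p
      rw [tt, tt, tau_eq_iSup, tau_eq_iSup (y := x - y), iSup_mul]
      simp_rw [ENNReal.mul_iSup]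
    rw [this]
    refine lowerSemicontinuous_iSup fun n => lowerSemicontinuous_iSup fun m => Continuous.lowerSemicontinuous ?_
    refine continuous_iff_continuousAt.2 fun p => ?_
    exact ENNReal.Tendsto.mul (continuous_tau ((box_finite 0 n).inter_of_right _)).continuousAt (.inr (tau_le_one.trans_lt (by simp)).ne)
      (continuous_tau ((box_finite 0 m).inter_of_right _)).continuousAt (.inr (tau_le_one.trans_lt (by simp)).ne)
  exact h.isClosed_preimage c

/-- Polynomial decay of the triple convolution of the two-point function. -/
abbrev Decay (d : ℕ) (pc : ℝ) (A : ENNReal) : Prop :=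
  ∀ (x : V d) i, gg pc 2 x ≤ A * ((x i).natAbs + 1 : ENNReal)⁻¹ ^ 20

/-- Polynomial decay at the critical point in high dimensions. -/
theorem exists_critical_decay : ∃ d₀ : ℕ, 2 ≤ d₀ ∧ ∀ d, d₀ ≤ d → ∀ pc, IsCrit d pc →
    (∃ A : ENNReal, A ≠ ∞ ∧ Decay d pc A) ∧
      ∀ (ν : Dir d) r, phi pc (slabF {ν} r) 0 ≤ 2 := by
  obtain ⟨N₀, hboot⟩ := exists_boot
  obtain ⟨R, N₁, hR, hgg⟩ := exists_gg_le
  refine ⟨(N₀ + N₁ + 2) ^ 20, (Nat.le_self_pow (by norm_num) 2).trans (Nat.pow_le_pow_left (by omega) _), fun d hd pc hc => ?_⟩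
  set N := Nat.findGreatest (fun N => N ^ 20 ≤ d) d with hN
  have h0d : N₀ + N₁ + 2 ≤ d := (Nat.le_self_pow (by norm_num) _).trans hd
  have hN0 : N₀ + N₁ + 2 ≤ N := Nat.le_findGreatest h0d hd
  have hN1 : N ^ 20 ≤ d := Nat.findGreatest_spec (P := fun N => N ^ 20 ≤ d) h0d hd
  have hN2 : d ≤ (2 * N) ^ 20 := by
    have : ¬ (N + 1) ^ 20 ≤ d := by
      rcases lt_or_ge d (N + 1) with h | h
      · have := Nat.le_self_pow (by norm_num : 20 ≠ 0) (N + 1); omega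
      · exact Nat.findGreatest_is_greatest (P := fun N => N ^ 20 ≤ d) (Nat.lt_succ_self N) h
    have h2 : (N + 1) ^ 20 ≤ (2 * N) ^ 20 := Nat.pow_le_pow_left (by omega) _
    omega
  have hlow := hc.lower (by omega)
  have hd' : (0 : ℝ) < d := mod_cast (by omega : 0 < d)
  have hB : ∀ p : ℝ, 1 / (4 * d) ≤ p → p < pc → Boot d N p (gam N) := fun p h1 h2 =>
    hboot N d p (by omega) hN1 hN2 (hc.subcrit p h2) (by rw [div_le_iff₀ (by positivity)] at h1; linarith)
  refine ⟨⟨(N : ENNReal) ^ 50 * (4 * R ^ 2) ^ 10, by finiteness, fun x i => ?_⟩, fun ν r =>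
    mem_of_isClosed_of_lt (isClosed_phi_le _ _ _) hlow fun p h1 h2 => (hB p h1 h2).half_space (by omega) (by linarith [Boot.gam_le (N := N) (by omega)]) ν r⟩
  refine mem_of_isClosed_of_lt (isClosed_gg_two_le x _) hlow fun p h1 h2 => ?_
  obtain ⟨I, hiI, hI⟩ := exists_card_superset_of_mem (i := i) (by omega : 1 ≤ N) ((Nat.le_self_pow (by norm_num) N).trans hN1)
  refine (hgg N d p (by omega) (hB p h1 h2) I hI 2 (by norm_num) x).trans ?_
  rw [mul_assoc]
  refine mul_le_mul' le_rfl ?_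
  set m := (x i).natAbs
  have hm : ((m : ℝ)) ^ 2 ≤ sqI I x := by
    refine le_trans (le_of_eq ?_) (sq_le_sqI hiI x)
    rw [← sq_abs (x i : ℝ)]
    congr 1
    rw [Nat.cast_natAbs]; simp
  have hbase : (R : ℝ) ^ 2 / max ((R : ℝ) ^ 2) (sqI I x) ≤ 4 * (R : ℝ) ^ 2 * ((m + 1 : ℝ)⁻¹) ^ 2 := by
    have hR5 : (5 : ℝ) ≤ R := mod_cast hR
    have h3 : ((m : ℝ) + 1) ^ 2 ≤ 4 * max ((R : ℝ) ^ 2) (sqI I x) := by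
      have e1 := le_max_left ((R : ℝ) ^ 2) (sqI I x)
      have e2 := le_max_right ((R : ℝ) ^ 2) (sqI I x)
      nlinarith [sq_nonneg ((m : ℝ) - 1)]
    rw [inv_pow, ← div_eq_mul_inv, div_le_div_iff₀ (lt_max_of_lt_left (by positivity)) (by positivity)]
    nlinarith [sq_nonneg (R : ℝ)]
  have h4 : hpow R I (200 - 2) x ≤ (4 * (R : ℝ) ^ 2) ^ 10 * ((m + 1 : ℝ)⁻¹) ^ 20 := by
    unfold hpow
    refine (pow_le_pow_of_le_one (hpow_base_pos (by omega)).le (hpow_base_le (by omega)) (show 10 ≤ 200 - 2 by norm_num)).trans ?_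
    refine (pow_le_pow_left₀ (hpow_base_pos (by omega)).le hbase 10).trans (le_of_eq ?_)
    rw [mul_pow, ← pow_mul]
  refine (ofReal_le_ofReal h4).trans (le_of_eq ?_)
  rw [ofReal_mul (by positivity), ofReal_pow (by positivity), ofReal_mul (by norm_num), ofReal_pow (by positivity),
    ofReal_pow (by positivity), ofReal_inv_of_pos (by positivity), ofReal_add (by positivity) (by norm_num)]
  simp

theorem box_eq_slabF (n : ℕ) : box (0 : V d) n = slabF Finset.univ n := by
  ext x
  simp only [box, slabF, mem_ofPred_eq, Pi.zero_apply, sub_zero, Finset.mem_univ, true_implies, Prod.forall, Bool.forall_bool, lin, abs_le]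
  refine forall_congr' fun i => ?_
  grind

theorem phi_box_le (h2 : ∀ (ν : Dir d) r, phi p (slabF {ν} r) 0 ≤ 2) (n : ℕ) : phi p (box (0 : V d) n) 0 ≤ 4 * d := by
  rw [box_eq_slabF, phi_slabF]
  calc _ ≤ ∑ ν : Dir d, phi p (slabF {ν} n) 0 := by
        refine sum_le_sum fun ν _ => ?_
        rw [phi_half, lay]
        refine mul_le_mul_left (tsum_le_tsum fun y => mul_le_mul' (tau_mono (slabF_anti (by simp))) ?_) _
        simp
    _ ≤ ∑ _ν : Dir d, 2 := sum_le_sum fun ν _ => h2 ν n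
    _ = 4 * d := by simp [Dir]; ring

/-- The exit edges of a set from a box. -/
def exitE (n : ℕ) (A : Finset (V d)) : Finset (V d × Dir d) :=
  (A ×ˢ Finset.univ).filter fun a => a.1 + nb a.2 ∉ box (0 : V d) n

theorem mem_exitE {n : ℕ} {A : Finset (V d)} {a : V d × Dir d} : a ∈ exitE n A ↔ a.1 ∈ A ∧ a.1 + nb a.2 ∉ box (0 : V d) n := by
  simp [exitE]

/-- A critical one-arm bound: bounded exit mass forces the arm probability to vanish. -/
theorem exists_reach_le (hp : pE p ≠ 1) (hp0 : pE p ≠ 0) {C : ENNReal} (hC : C ≠ ∞) (hphi : ∀ n, phi p (box (0 : V d) n) 0 ≤ C)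
    {η : ENNReal} (hη : η ≠ 0) : ∃ n : ℕ, perc d p {ω | Reach (box 0 n) ω 0} ≤ η := by
  set r := 1 - pE p with hr
  have hr0 : r ≠ 0 := (tsub_pos_of_lt (lt_of_le_of_ne pE_le_one hp)).ne'
  have hrt : r ≠ ∞ := (tsub_le_self.trans_lt one_lt_top).ne
  have hr1 : r ≤ 1 := tsub_le_self
  set m : ℕ → Finset (V d) → ENNReal := fun n A => perc d p {ω | cl (box 0 n) ω 0 = A} with hm
  set D : ℕ → Set (Config d) := fun n => {ω | (∃ t ∈ cl univ ω 0, ∃ ν, t + nb ν ∉ box 0 n) ∧ cl univ ω 0 ⊆ box 0 n} with hD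
  have hconn : ∀ u, MeasurableSet {ω : Config d | u ∈ cl univ ω 0} := fun u => meas_connIn
  have hDm : ∀ n, MeasurableSet (D n) := fun n => by
    have : D n = (⋃ t : V d, {ω | t ∈ cl univ ω 0} ∩ {_ω | ∃ ν, t + nb ν ∉ box 0 n}) ∩ ⋂ u : V d, {ω | u ∈ cl univ ω 0}ᶜ ∪ {_ω | u ∈ box 0 n} := by
      ext ω
      simp only [hD, mem_ofPred_eq, mem_inter_iff, mem_iUnion, mem_iInter, mem_union, mem_compl_iff, subset_def, exists_prop, imp_iff_not_or]
    rw [this]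
    exact (MeasurableSet.iUnion fun t => (hconn t).inter (.const _)).inter (MeasurableSet.iInter fun u => (hconn u).compl.union (.const _))
  have hDd : Pairwise (Function.onFun Disjoint D) := by
    have key : ∀ n k : ℕ, n < k → Disjoint (D n) (D k) := fun n k hnk => by
      refine disjoint_left.2 ?_
      rintro ω ⟨-, h1⟩ ⟨⟨t, ht, ν, h2⟩, -⟩
      exact h2 (box_mono hnk (add_nb_mem_box (h1 ht) ν))
    intro n k hnk
    rcases lt_or_gt_of_ne hnk with h | h
    · exact key n k h
    · exact (key k n h).symm
  have hDsum : ∑' n, perc d p (D n) ≠ ∞ := by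
    rw [← measure_iUnion hDd hDm]
    exact measure_ne_top _ _
  have hfin : ∀ n, FinCl p (box (0 : V d) n) 0 := fun n => finCl_of_finite (box_finite 0 n)
  have h0 : ∀ n : ℕ, (0 : V d) ∈ box (0 : V d) n := fun n i => by simp
  have hDA : ∀ n, ∑' A : Finset (V d), m n A * (ind ((exitE n A).Nonempty) * r ^ (exitE n A).card) ≤ perc d p (D n) := fun n => by
    have hE : ∀ A : Finset (V d), m n A * (ind ((exitE n A).Nonempty) * r ^ (exitE n A).card) ≤ perc d p ({ω | cl (box 0 n) ω 0 = A} ∩ D n) := fun A => by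
      by_cases hne : (exitE n A).Nonempty
      swap
      · rw [ind_false hne]; simp
      set F : Finset (Edge d) := (exitE n A).image fun a => edge a.1 a.2
      have hcl : perc d p {ω | ∀ e ∈ F, ω e = false} = r ^ F.card := by
        rw [perc, bern_forall_eq, prod_congr rfl fun e _ => perc_closed e, Finset.prod_const]
      have hdep : Dep (F : Set (Edge d)) {ω : Config d | ∀ e ∈ F, ω e = false} := fun ω ω' h hω e he => by
        rw [← h e he]; exact hω e he
      rw [ind_true hne, one_mul]
      calc m n A * r ^ (exitE n A).card ≤ m n A * r ^ F.card := by
            gcongr 1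
            exact pow_le_pow_right_of_le_one' hr1 card_image_le
        _ = perc d p ({ω | cl (box 0 n) ω 0 = A} ∩ {ω | ∀ e ∈ F, ω e = false}) := by
            rw [perc_cl_inter (h0 n) hdep (meas_of_dep hdep) ?_, hcl]
            refine disjoint_left.2 ?_
            rintro e ⟨he, -⟩ heF
            obtain ⟨a, ha, rfl⟩ := Finset.mem_image.1 (mem_coe.1 heF)
            exact (mem_exitE.1 ha).2 (edge_mem_edgesIn.1 he).2
        _ ≤ _ := by
            refine measure_mono ?_
            rintro ω ⟨h1, h2⟩
            rw [mem_ofPred_eq] at h1 h2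
            have hsub : cl univ ω 0 ⊆ A := fun u hu => by
              refine ConnIn.ind (p := fun u => u ∈ (A : Set (V d))) hu (by rw [← h1]; exact .refl (h0 n)) fun a b _ hab _ ha => ?_
              obtain ⟨ν, rfl, ho⟩ := openAdj_iff.1 hab
              rw [← h1] at ha ⊢
              by_cases hb : a + nb ν ∈ box 0 n
              · exact ConnIn.trans ha (.single hab (ConnIn.right ha) hb)
              · have := h2 (edge a ν) (Finset.mem_image.2 ⟨(a, ν), mem_exitE.2 ⟨by rw [← mem_coe, ← h1]; exact ha, hb⟩, rfl⟩)
                rw [ho] at this; cases this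
            obtain ⟨a, ha⟩ := hne
            obtain ⟨ha1, ha2⟩ := mem_exitE.1 ha
            refine ⟨h1, ⟨a.1, ?_, a.2, ha2⟩, fun u hu => ?_⟩
            · have : a.1 ∈ cl (box 0 n) ω 0 := by rw [h1]; exact ha1
              exact ConnIn.mono (subset_univ _) this
            · have := hsub hu
              rw [← h1] at this
              exact ConnIn.right this
    refine (tsum_le_tsum hE).trans ?_
    rw [← measure_iUnion]
    · exact measure_mono (iUnion_subset fun A => inter_subset_right)
    · intro A B hAB
      exact disjoint_left.2 fun ω h1 h2 => hAB (coe_injective (h1.1.symm.trans h2.1))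
    · exact fun A => meas_cl_eq.inter (hDm n)
  have hreach : ∀ n, perc d p {ω | Reach (box 0 n) ω 0} ≤ ∑' A : Finset (V d), m n A * ind ((exitE n A).Nonempty) := fun n => by
    calc _ ≤ perc d p (⋃ A : Finset (V d), {ω | cl (box 0 n) ω 0 = A ∧ (exitE n A).Nonempty}) := by
          refine measure_mono ?_
          rintro ω ⟨t, ⟨ν, hν⟩, ht⟩
          refine mem_iUnion.2 ⟨((box_finite (0 : V d) n).subset (cl_subset (ω := ω) (x := 0))).toFinset, by simp, (t, ν), mem_exitE.2 ⟨by rw [Finite.mem_toFinset]; exact ht, hν⟩⟩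
      _ ≤ ∑' A : Finset (V d), perc d p {ω | cl (box 0 n) ω 0 = A ∧ (exitE n A).Nonempty} := measure_iUnion_le _
      _ ≤ _ := tsum_le_tsum fun A => by
          by_cases h : (exitE n A).Nonempty <;> simp [h, ind, hm]
  have hcount : ∀ n, (∑' A : Finset (V d), m n A * (exitE n A).card) * pE p ≤ C := fun n => by
    refine le_trans (le_of_eq ?_) (hphi n)
    rw [phi_eq_tsum (hfin n), ← tsum_mul_right]
    refine tsum_congr fun A => ?_
    rw [mul_assoc]
    congr 1
    rw [exitE, Finset.card_filter, sum_product]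
    push_cast
    rw [sum_mul]
    refine sum_ext fun y _ => ?_
    rw [sum_mul]
    exact sum_ext fun ν _ => by by_cases h : y + nb ν ∉ box 0 n <;> simp [ind, h]
  obtain ⟨K, hK⟩ := ENNReal.exists_nat_mul_gt (a := η / 2 * pE p) (b := C) (mul_ne_zero (ENNReal.div_ne_zero.2 ⟨hη, by norm_num⟩) hp0) hC
  have hK0 : K ≠ 0 := by rintro rfl; simp at hK
  have hev := (ENNReal.tendsto_atTop_zero_of_tsum_ne_top hDsum).eventually_lt_const
    (show 0 < η / 2 * r ^ K from pos_iff_ne_zero.2 (mul_ne_zero (ENNReal.div_ne_zero.2 ⟨hη, by norm_num⟩) (pow_ne_zero _ hr0)))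
  obtain ⟨n, hn⟩ := hev.exists
  refine ⟨n, (hreach n).trans ?_⟩
  have hpt : ∀ A : Finset (V d), m n A * ind ((exitE n A).Nonempty) ≤
      (m n A * (ind ((exitE n A).Nonempty) * r ^ (exitE n A).card)) * (r ^ K)⁻¹ + (m n A * (exitE n A).card) * (K : ENNReal)⁻¹ := fun A => by
    rcases lt_or_ge K (exitE n A).card with h | h
    · refine le_trans ?_ le_add_self
      rw [mul_assoc]
      refine mul_le_mul_right (ind_le_one.trans ?_) _
      rw [← div_eq_mul_inv, le_div_iff_mul_le (.inl (by exact_mod_cast hK0)) (.inl (by finiteness)), one_mul]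
      exact_mod_cast h.le
    · refine le_trans ?_ le_self_add
      rw [mul_assoc, mul_assoc]
      refine mul_le_mul_right (le_mul_of_one_le_right' ?_) _
      rw [← div_eq_mul_inv, le_div_iff_mul_le (.inl (pow_ne_zero _ hr0)) (.inl (by finiteness)), one_mul]
      exact pow_le_pow_right_of_le_one' hr1 h
  refine (tsum_le_tsum hpt).trans ?_
  rw [tsum_add, tsum_mul_right, tsum_mul_right]
  calc _ ≤ η / 2 + η / 2 := by
        refine add_le_add ?_ ?_
        · rw [← div_eq_mul_inv, div_le_iff (pow_ne_zero _ hr0) (by finiteness)]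
          exact (hDA n).trans hn.le
        · rw [← div_eq_mul_inv, div_le_iff (by exact_mod_cast hK0) (by finiteness)]
          have h1 := (hcount n).trans hK.le
          have h2 : (∑' A : Finset (V d), m n A * (exitE n A).card) * pE p ≤ (η / 2 * K) * pE p := h1.trans (le_of_eq (by ring))
          exact (ENNReal.mul_le_mul_iff_left hp0 (pE_le_one.trans_lt one_lt_top).ne).1 h2
    _ = η := ENNReal.add_halves η

end

section

/-- The supremum norm on `ℤ²`. -/
def nrm (x : ℤ × ℤ) : ℕ := max x.1.natAbs x.2.natAbs

theorem inv_le_mul_inv {m m' c : ℕ} (h : m + 1 ≤ c * (m' + 1)) : (m' + 1 : ENNReal)⁻¹ ≤ c * (m + 1 : ENNReal)⁻¹ := by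
  have h' : (m + 1 : ENNReal) ≤ c * (m' + 1) := mod_cast h
  rw [← div_eq_mul_inv, le_div_iff_mul_le (.inl (by simp)) (.inl (by finiteness)), mul_comm, ← div_eq_mul_inv]
  exact div_le_of_le_mul h'

theorem tsum_nrm_ne_top : ∑' x : ℤ × ℤ, (nrm x + 1 : ENNReal)⁻¹ ^ 4 ≠ ∞ := by
  set g : ℤ → ENNReal := fun z => (z.natAbs + 1 : ENNReal)⁻¹ ^ 2
  have hg : ∑' z, g z ≠ ∞ := by
    rw [← Equiv.intEquivNatSumNat.symm.tsum_eq, Summable.tsum_sum summable summable]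
    refine ENNReal.add_ne_top.2 ⟨(tsum_inv_sq_le.trans_lt (by norm_num)).ne, ?_⟩
    refine (lt_of_le_of_lt (tsum_le_tsum fun j => ?_) (tsum_inv_sq_le.trans_lt (by norm_num))).ne
    refine pow_le_pow_left' (inv_le_inv.2 ?_) 2
    rw [show (Equiv.intEquivNatSumNat.symm (Sum.inr j)).natAbs = j + 1 from rfl]; push_cast
    exact le_self_add
  refine (lt_of_le_of_lt (b := (∑' z, g z) * ∑' z, g z) ?_ (mul_lt_top hg.lt_top hg.lt_top)).ne
  rw [ENNReal.tsum_prod', ← tsum_mul_right]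
  refine tsum_le_tsum fun a => ?_
  rw [← tsum_mul_left]
  refine tsum_le_tsum fun b => ?_
  rw [show 4 = 2 + 2 from rfl, pow_add]
  refine mul_le_mul' (pow_le_pow_left' (inv_le_inv.2 ?_) 2) (pow_le_pow_left' (inv_le_inv.2 ?_) 2)
  · have : a.natAbs ≤ nrm (a, b) := le_max_left _ _
    gcongr
  · have : b.natAbs ≤ nrm (a, b) := le_max_right _ _
    gcongr

/-- A bound in each of the first two coordinates gives one in the norm of the plane. -/
theorem le_nrm_of_coord (hd : 2 ≤ d) {f : ENNReal} {A : ENNReal} {x : ℤ × ℤ}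
    (h : ∀ i, f ≤ A * ((emb d x i).natAbs + 1 : ENNReal)⁻¹ ^ 20) : f ≤ A * (nrm x + 1 : ENNReal)⁻¹ ^ 20 := by
  have h0 := h ⟨0, by omega⟩
  have h1 := h ⟨1, by omega⟩
  simp only [emb, if_pos, one_ne_zero, if_false] at h0 h1
  rcases le_total x.1.natAbs x.2.natAbs with h | h
  · rwa [nrm, max_eq_right h]
  · rwa [nrm, max_eq_left h]

theorem emb_sub (x y : ℤ × ℤ) : emb d (x - y) = emb d x - emb d y := by
  ext i
  simp only [emb, Pi.sub_apply, Prod.fst_sub, Prod.snd_sub]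
  split_ifs <;> simp

theorem emb_injective (hd : 2 ≤ d) : Injective (emb d) := fun x y h => by
  have h0 := congrFun h ⟨0, by omega⟩
  have h1 := congrFun h ⟨1, by omega⟩
  simp only [emb, if_pos, one_ne_zero, if_false] at h0 h1
  exact Prod.ext h0 h1

end

section
variable {p pc q : ℝ}

theorem IsCrit.one_le_phi (hc : IsCrit d pc) {S : Finset (V d)} {v : V d} (hv : v ∈ S) : 1 ≤ phi pc S v := by
  by_contra h
  refine hc.not_subcrit ⟨S.map (subRight v).toEmbedding, Finset.mem_map.2 ⟨v, hv, sub_self v⟩, lt_of_le_of_lt (le_of_eq ?_) (not_le.1 h)⟩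
  have hS : ((S.map (subRight v).toEmbedding : Finset (V d)) : Set (V d)) = (· + v) ⁻¹' (S : Set (V d)) := by
    ext y; simp [sub_eq_iff_eq_add]
  rw [hS]
  unfold phi
  conv_rhs => rw [← (addRight v).tsum_eq]
  refine tsum_congr fun y => ?_
  rw [coe_addRight, ← tau_add, zero_add]
  congr 1
  refine sum_ext fun ν _ => ?_
  congr 2
  rw [mem_preimage, add_right_comm]

/-- The set reached by the seeds. -/
def seedCl (W S : Finset (V d)) (ω : Config d) : Finset (V d) := S.filter fun y => ∃ w ∈ W, ConnIn S ω w y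

theorem mem_seedCl {W S : Finset (V d)} : y ∈ seedCl W S ω ↔ ∃ w ∈ W, ConnIn S ω w y := by
  simp only [seedCl, mem_filter, and_iff_right_iff_imp]
  rintro ⟨w, -, h⟩
  exact h.right

theorem dep_seedCl {W S A : Finset (V d)} (hW : W ⊆ S) : Dep (edgesIn S ∩ touch A) {ω | seedCl W S ω = A} := fun ω ω' h hA => by
  rw [mem_ofPred_eq] at hA
  have key : ∀ w ∈ W, cl S ω' w = cl S ω w := fun w hw => by
    refine dep_cl_eq (.refl (hW hw)) ω ω' (fun e he => h e ⟨he.1, ?_⟩) rfl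
    obtain ⟨v, hv, hc⟩ := he.2
    exact ⟨v, hv, by rw [← hA]; exact mem_seedCl.2 ⟨w, hw, hc⟩⟩
  rw [mem_ofPred_eq, ← hA]
  ext y
  rw [mem_seedCl, mem_seedCl]
  refine exists_congr fun w => and_congr_right fun hw => ?_
  exact Set.ext_iff.1 (key w hw) y

/-- The probability that `v`, but no seed, is connected to `y`. -/
abbrev offConn (p : ℝ) (W S : Finset (V d)) (v y : V d) : ENNReal :=
  perc d p ({ω | ∃ w ∈ W, ConnIn S ω w y}ᶜ ∩ {ω | ConnIn S ω v y})

theorem one_le_exit_off (hc : IsCrit d pc) {W S : Finset (V d)} (hW : W ⊆ S) {v : V d} (hv : v ∈ S) :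
    1 ≤ pE pc * ∑ y ∈ S, ∑ ν, ind (y + nb ν ∉ S) * offConn pc W S v y +
      ∑ w ∈ W, (tt pc (v - w) + stepOp pc (gg pc 2) (v - w)) := by
  set m : Finset (V d) → ENNReal := fun A => perc d pc {ω | seedCl W S ω = A} with hm
  set g : V d → ENNReal := fun a => stepOp pc (gg pc 1) (a - v) with hg
  have hmeas : ∀ A : Finset (V d), MeasurableSet {ω | seedCl W S ω = A} := fun A =>
    meas_of_dep (F := edgesOf S) ((dep_seedCl hW).mono (inter_subset_left.trans (edgesIn_subset_edgesOf S)))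
  have hunion : ∀ E : Set (Config d), MeasurableSet E → ∑ A ∈ S.powerset, perc d pc ({ω | seedCl W S ω = A} ∩ E) = perc d pc E := fun E hE => by
    rw [← measure_biUnion_finset (fun A _ B _ hAB => disjoint_left.2 fun ω h1 h2 => hAB (h1.1.symm.trans h2.1)) fun A _ => (hmeas A).inter hE]
    congr 1
    ext ω
    simp only [mem_iUnion, mem_inter_iff, mem_ofPred_eq, Finset.mem_powerset, exists_prop]
    exact ⟨fun ⟨_, _, _, h⟩ => h, fun h => ⟨_, filter_subset _ _, rfl, h⟩⟩
  have hmsum : ∑ A ∈ S.powerset, m A = 1 := by simpa using hunion univ .univ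
  have hmem : ∀ a, ∑ A ∈ S.powerset, m A * ind (a ∈ A) ≤ ∑ w ∈ W, tt pc (a - w) := fun a => by
    calc _ ≤ ∑ A ∈ S.powerset, perc d pc ({ω | seedCl W S ω = A} ∩ {ω | ∃ w ∈ W, ConnIn S ω w a}) := by
          refine sum_le_sum fun A _ => ?_
          by_cases h : a ∈ A
          · rw [ind_true h, mul_one]
            exact measure_mono fun ω hω => ⟨hω, mem_seedCl.1 (by rw [show seedCl W S ω = A from hω]; exact h)⟩
          · simp [ind_false h]
      _ = perc d pc {ω | ∃ w ∈ W, ConnIn S ω w a} := hunion _ meas_conn_seeds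
      _ ≤ ∑ w ∈ W, perc d pc {ω | ConnIn S ω w a} := by
          refine le_trans (measure_mono ?_) (measure_biUnion_finset_le W _)
          rintro ω ⟨w, hw, h⟩
          exact mem_iUnion₂.2 ⟨w, hw, h⟩
      _ ≤ _ := sum_le_sum fun w _ => by rw [← tau_univ_eq]; exact tau_mono (subset_univ _)
  have hA : ∀ A : Finset (V d), 1 ≤ ind (v ∈ A) + pE pc * ∑ y ∈ S, ∑ ν, ind (y + nb ν ∉ S) * tau pc (S \ A) v y + ∑ a ∈ A, g a := fun A => by
    by_cases hvA : v ∈ A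
    · rw [ind_true hvA, add_assoc]; exact le_self_add
    rw [ind_false hvA, zero_add]
    refine (hc.one_le_phi (S := S \ A) (Finset.mem_sdiff.2 ⟨hv, hvA⟩)).trans ?_
    rw [phi_finset, Finset.coe_sdiff]
    calc _ ≤ ∑ y ∈ S, ∑ ν, (pE pc * (ind (y + nb ν ∉ S) * tau pc (S \ A) v y) + pE pc * (ind (y + nb ν ∈ A) * tt pc (y - v))) := by
          refine (sum_le_sum_of_subset Finset.sdiff_subset).trans (sum_le_sum fun y _ => ?_)
          rw [mul_sum]
          refine sum_le_sum fun ν _ => ?_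
          have h1 : tau pc (S \ A : Set (V d)) v y ≤ tt pc (y - v) := by rw [← tau_univ_eq]; exact tau_mono (subset_univ _)
          by_cases hS : y + nb ν ∈ S
          · by_cases hAA : y + nb ν ∈ A
            · rw [ind_true hAA, ind_true (by simp [hAA])]
              refine le_trans ?_ le_add_self
              rw [one_mul, one_mul, mul_comm]
              exact mul_le_mul_right h1 _
            · rw [ind_false (by simp [hAA, hS])]; simp
          · rw [ind_true (P := y + nb ν ∉ S) hS, ind_true (by simp [hS])]
            refine le_trans (le_of_eq ?_) le_self_add
            ring
      _ ≤ _ := by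
          simp_rw [sum_add_distrib, ← mul_sum]
          refine add_le_add le_rfl ?_
          simp only [hg, stepOp, gg_one]
          rw [← mul_sum]
          refine mul_le_mul_right ?_ _
          calc _ ≤ ∑' y, ∑ ν, ind (y + nb ν ∈ A) * tt pc (y - v) := sum_le_tsum _
            _ = ∑' y, ∑' a, ind (Adjacent y a) * (ind (a ∈ A) * tt pc (y - v)) := tsum_congr fun y =>
                sum_nb_eq_tsum (fun a => ind (a ∈ A) * tt pc (y - v)) y
            _ = ∑' a, ind (a ∈ A) * ∑' y, ind (Adjacent a y) * tt pc (y - v) := by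
                rw [tsum_comm]
                refine tsum_congr fun a => ?_
                rw [← tsum_mul_left]
                refine tsum_congr fun y => ?_
                rw [show Adjacent y a ↔ Adjacent a y from ⟨Adjacent.symm, Adjacent.symm⟩]
                ring
            _ = ∑ a ∈ A, ∑ ν, tt pc (a - v + nb ν) := by
                rw [tsum_eq_sum (s := A) fun a ha => by rw [ind_false ha, zero_mul]]
                refine sum_ext fun a ha => ?_
                rw [ind_true ha, one_mul, ← sum_nb_eq_tsum (fun y => tt pc (y - v)) a]
                exact sum_ext fun ν _ => by rw [sub_add_eq_add_sub]
  have hoff : ∀ y ∈ S, ∑ A ∈ S.powerset, m A * tau pc (S \ A) v y ≤ offConn pc W S v y := fun y hy => by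
    rw [offConn, ← hunion _ (meas_conn_seeds.compl.inter meas_connIn)]
    refine sum_le_sum fun A _ => ?_
    rw [hm, tau, ← bern_inter (dep_seedCl hW) dep_connIn ?_ (hmeas A) meas_connIn]
    · refine measure_mono ?_
      rintro ω ⟨h1, h2⟩
      refine ⟨h1, fun h3 => ?_, ConnIn.mono sdiff_subset h2⟩
      exact (ConnIn.right h2).2 (by rw [← show seedCl W S ω = A from h1]; exact mem_seedCl.2 h3)
    · refine disjoint_left.2 ?_
      rintro e ⟨-, u, hu, huA⟩ h
      exact (h u hu).2 huA
  calc (1 : ENNReal) = ∑ A ∈ S.powerset, m A * 1 := by simp [hmsum]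
    _ ≤ ∑ A ∈ S.powerset, m A * (ind (v ∈ A) + pE pc * ∑ y ∈ S, ∑ ν, ind (y + nb ν ∉ S) * tau pc (S \ A) v y + ∑ a ∈ A, g a) :=
        sum_le_sum fun A _ => mul_le_mul_right (hA A) _
    _ = ∑ A ∈ S.powerset, m A * ind (v ∈ A) + pE pc * ∑ y ∈ S, ∑ ν, ind (y + nb ν ∉ S) * ∑ A ∈ S.powerset, m A * tau pc (S \ A) v y +
          ∑ a ∈ S, (∑ A ∈ S.powerset, m A * ind (a ∈ A)) * g a := by
        simp_rw [mul_add, sum_add_distrib]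
        congr 1
        · congr 1
          simp_rw [mul_sum]
          rw [sum_comm]
          refine sum_ext fun y _ => ?_
          rw [sum_comm]
          refine sum_ext fun ν _ => sum_ext fun A _ => by ring
        · simp_rw [sum_mul]
          rw [sum_comm]
          refine sum_ext fun A hAS => ?_
          rw [mul_sum, ← sum_subset (Finset.mem_powerset.1 hAS) fun a _ ha => by rw [ind_false ha]; simp]
          exact sum_ext fun a ha => by rw [ind_true ha, mul_one]
    _ ≤ ∑ w ∈ W, tt pc (v - w) + pE pc * ∑ y ∈ S, ∑ ν, ind (y + nb ν ∉ S) * offConn pc W S v y +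
          ∑' a, (∑ w ∈ W, tt pc (a - w)) * g a := by
        refine add_le_add (add_le_add (hmem v) (mul_le_mul_right ?_ _)) ((sum_le_sum fun a _ => mul_le_mul_left (hmem a) _).trans (sum_le_tsum _))
        exact sum_le_sum fun y hy => sum_le_sum fun ν _ => mul_le_mul_right (hoff y hy) _
    _ = _ := by
        simp_rw [sum_mul]
        rw [tsum_fsum, sum_add_distrib, add_comm (∑ w ∈ W, tt pc (v - w)), add_assoc]
        congr 2
        refine sum_ext fun w _ => ?_
        simp_rw [hg, stepOp_gg_sub_comm]
        rw [conv_sub, conv_tt_stepOp, gg_one, gg_two]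

theorem half_card_le_flux (hc : IsCrit d pc) {W S : Finset (V d)} (hW : W ⊆ S)
    (hs : ∀ v ∈ W, ∑ w ∈ W.erase v, (tt pc (v - w) + stepOp pc (gg pc 2) (v - w)) ≤ 1 / 2) :
    (W.card : ENNReal) / 2 ≤ pE pc * flux pc W S := by
  suffices h : ∀ W' : Finset (V d), W' ⊆ W → (W'.card : ENNReal) / 2 ≤ pE pc * flux pc W' S from h W subset_rfl
  intro W'
  induction W' using induction_on with
  | empty => simp
  | insert v W' hv ih =>
    intro hsub
    rw [Finset.insert_subset_iff] at hsub
    have h1 := one_le_exit_off hc (hsub.2.trans hW) (hW hsub.1)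
    have h2 : ∑ w ∈ W', (tt pc (v - w) + stepOp pc (gg pc 2) (v - w)) ≤ 1 / 2 :=
      (sum_le_sum_of_subset fun w hw => mem_erase.2 ⟨ne_of_mem_of_not_mem hw hv, hsub.2 hw⟩).trans (hs v hsub.1)
    have h3 : (1 / 2 : ENNReal) ≤ pE pc * ∑ y ∈ S, ∑ ν, ind (y + nb ν ∉ S) * offConn pc W' S v y := by
      have h4 := h1.trans (add_le_add_right h2 _)
      have h5 : (1 / 2 : ENNReal) + 1 / 2 = 1 := ENNReal.add_halves 1
      exact ENNReal.le_of_add_le_add_right (a := 1 / 2) (by norm_num) (h5.trans_le h4)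
    rw [Finset.card_insert_of_notMem hv]
    push_cast
    rw [ENNReal.add_div]
    refine (add_le_add (ih hsub.2) h3).trans ?_
    rw [← mul_add]
    refine mul_le_mul_right ?_ _
    simp_rw [flux, ← sum_add_distrib, ← mul_add]
    refine sum_le_sum fun y _ => sum_le_sum fun ν _ => mul_le_mul_right ?_ _
    rw [← measure_union (disjoint_left.2 fun ω h1 h2 => h2.1 h1) (meas_conn_seeds.compl.inter meas_connIn)]
    refine measure_mono ?_
    rintro ω (⟨w, hw, h⟩ | ⟨-, h⟩)
    · exact ⟨w, Finset.mem_insert_of_mem hw, h⟩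
    · exact ⟨v, Finset.mem_insert_self _ _, h⟩

/-- Above the critical point a box of side proportional to `k` is connected to the boundary of any larger
region, up to an error that is Gaussian in `k`. -/
theorem exists_seed_bound (hd : 2 ≤ d) (hc : IsCrit d pc) {A : ENNReal} (hA : A ≠ ∞)
    (hgg : Decay d pc A) :
    ∃ K : ℕ, 1 ≤ K ∧ ∀ q, pc ≤ q → q ≤ 1 → ∀ (k : ℕ) (x : V d) (Λ : Finset (V d)), box x (K * k) ⊆ Λ →
      perc d q {ω | ∃ v ∈ box x (K * k), Reach Λ ω v}ᶜ ≤ ofReal (exp (-(k ^ 2 / 2) * (q - pc))) := by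
  set h : V d → ENNReal := fun x => tt pc x + stepOp pc (gg pc 2) x with hh
  set B : ENNReal := A + 2 * d * (A * 2 ^ 20) with hB
  have hbound : ∀ x i, h x ≤ B * ((x i).natAbs + 1 : ENNReal)⁻¹ ^ 20 := fun x i => by
    rw [hB, add_mul]
    refine add_le_add ?_ ?_
    · rw [← gg_one]; exact (gg_mono 1 x).trans (hgg x i)
    · refine (mul_le_of_le_one_left' pE_le_one).trans ?_
      calc _ ≤ ∑ _ν : Dir d, A * 2 ^ 20 * ((x i).natAbs + 1 : ENNReal)⁻¹ ^ 20 := by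
            refine sum_le_sum fun ν _ => (hgg _ i).trans ?_
            rw [mul_assoc, ← mul_pow]
            refine mul_le_mul_right (pow_le_pow_left' ?_ 20) _
            have := inv_le_mul_inv (m := (x i).natAbs) (m' := ((x + nb ν) i).natAbs) (c := 2) (by
              have := abs_le.1 (abs_nb_le ν i)
              simp only [Pi.add_apply]
              omega)
            simpa using this
        _ = _ := by simp [Dir]; ring
  have hsum : ∑' x : ℤ × ℤ, h (emb d x) ≠ ∞ := by
    refine (lt_of_le_of_lt (tsum_le_tsum fun x => (le_nrm_of_coord hd (hbound (emb d x))).trans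
      (mul_le_mul_right (pow_le_pow_right_of_le_one' (n := 4) ?_ (by norm_num)) _)) ?_).ne
    · exact inv_le_one.2 le_add_self
    · rw [tsum_mul_left]
      exact mul_lt_top (by finiteness) tsum_nrm_ne_top.lt_top
  obtain ⟨s, hs⟩ := ((ENNReal.tendsto_tsum_compl_atTop_zero hsum).eventually_lt_const (show (0 : ENNReal) < 1 / 2 by norm_num)).exists
  set K := s.sup nrm + 1 with hK
  refine ⟨K, by omega, fun q hq hq1 k x Λ hΛ => ?_⟩
  set f : ℕ × ℕ → ℤ × ℤ := fun a => ((K * a.1 : ℕ), (K * a.2 : ℕ)) with hf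
  have hfinj : Injective f := fun a b hab => by
    simp only [hf, Prod.mk.injEq, Nat.cast_inj] at hab
    have hK0 : 0 < K := by omega
    exact Prod.ext (Nat.eq_of_mul_eq_mul_left hK0 hab.1) (Nat.eq_of_mul_eq_mul_left hK0 hab.2)
  set T : Finset (ℤ × ℤ) := (Finset.range k ×ˢ Finset.range k).map ⟨f, hfinj⟩ with hT
  have hinj : Injective fun a => x + emb d a := fun a b hab => emb_injective hd (add_left_cancel hab)
  set W : Finset (V d) := T.map ⟨_, hinj⟩ with hW
  have hWbox : (W : Set (V d)) ⊆ box x (K * k) := by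
    intro v hv i
    simp only [hW, hT, Finset.coe_map, Function.Embedding.coeFn_mk, mem_image, mem_coe, mem_product, Finset.mem_range] at hv
    obtain ⟨_, ⟨⟨a, b⟩, ⟨ha, hb⟩, rfl⟩, rfl⟩ := hv
    simp only [Pi.add_apply, add_sub_cancel_left, emb, hf]
    have e1 : K * a ≤ K * k := Nat.mul_le_mul_left _ ha.le
    have e2 : K * b ≤ K * k := Nat.mul_le_mul_left _ hb.le
    split_ifs <;> [rw [Nat.abs_cast]; rw [Nat.abs_cast]; skip]
    · exact_mod_cast e1
    · exact_mod_cast e2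
    · rw [abs_zero]; positivity
  have hcard : W.card = k ^ 2 := by simp [hW, hT, sq]
  have hsep : ∀ v ∈ W, ∑ w ∈ W.erase v, h (v - w) ≤ 1 / 2 := fun v hv => by
    obtain ⟨a, ha, rfl⟩ := Finset.mem_map.1 hv
    simp only [Function.Embedding.coeFn_mk]
    have hinj2 : Injective fun b => a - b := sub_right_injective
    calc _ = ∑ b ∈ (T.erase a).map ⟨_, hinj2⟩, h (emb d b) := by
          rw [hW, show x + emb d a = (⟨_, hinj⟩ : (ℤ × ℤ) ↪ V d) a from rfl, ← Finset.map_erase, sum_map, sum_map]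
          refine sum_ext fun b _ => ?_
          simp [emb_sub]
      _ ≤ ∑' b : {b // b ∉ s}, h (emb d b) := by
          rw [← Finset.sum_subtype_of_mem (p := fun b => b ∉ s)]
          · exact sum_le_tsum _
          · intro b hb hbs
            obtain ⟨c, hc, rfl⟩ := Finset.mem_map.1 hb
            have h1 := le_sup (f := nrm) hbs
            obtain ⟨hca, hcT⟩ := mem_erase.1 hc
            obtain ⟨a', -, rfl⟩ := Finset.mem_map.1 ha
            obtain ⟨c', -, rfl⟩ := Finset.mem_map.1 hcT
            have h2 : K ≤ nrm (f a' - f c') := by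
              have hne : a'.1 ≠ c'.1 ∨ a'.2 ≠ c'.2 := by
                by_contra! h; exact hca (congrArg _ (Prod.ext h.1.symm h.2.symm))
              have key : ∀ m n : ℕ, m ≠ n → K ≤ (((K * m : ℕ) : ℤ) - (K * n : ℕ)).natAbs := fun m n hmn => by
                rw [Nat.cast_mul, Nat.cast_mul, ← mul_sub, Int.natAbs_mul, Int.natAbs_natCast]
                exact Nat.le_mul_of_pos_right _ (by omega)
              rcases hne with h | h
              · exact (key _ _ h).trans (le_max_left _ _)
              · exact (key _ _ h).trans (le_max_right _ _)
            simp only [Function.Embedding.coeFn_mk] at h1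
            omega
      _ ≤ 1 / 2 := hs.le
  have hfin := perc_not_reach_le (W := W) (Λ := Λ) (c := k ^ 2 / 2) hc.pos.le hq hq1 (by positivity)
    (fun v hv => hΛ (hWbox hv)) fun S hS _ _ => by
      have := (half_card_le_flux hc hS hsep).trans (mul_le_of_le_one_left' pE_le_one)
      rw [hcard] at this
      refine le_trans (le_of_eq ?_) this
      rw [ofReal_div_of_pos (by norm_num), ofReal_pow (by positivity)]
      simp
  refine le_trans (measure_mono (compl_subset_compl.2 ?_)) hfin
  rintro ω ⟨v, hv, h⟩
  exact ⟨v, hWbox hv, h⟩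

end

section

theorem Reach.mono_conf {Λ : Set (V d)} {ω ω' : Config d} (hω : ∀ e, ω e = true → ω' e = true) (hr : Reach Λ ω x) : Reach Λ ω' x := by
  obtain ⟨t, ht, h⟩ := hr
  exact ⟨t, ht, h.mono_conf hω⟩

/-- Two vertices are joined by a monotone lattice path. -/
theorem exists_staircase (a b : V d) : ∃ E : Finset (Edge d), E.card ≤ nrm1 (b - a) ∧ (E : Set (Edge d)) ⊆ edgesIn (uIcc a b) ∧
    ∀ ω : Config d, (∀ e ∈ E, ω e = true) → ConnIn (uIcc a b) ω a b := by
  induction hn : nrm1 (b - a) using Nat.strong_induction_on generalizing a with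
  | _ n ih =>
    by_cases hab : a = b
    · subst hab
      exact ⟨∅, by simp, by simp, fun ω _ => .refl left_mem_uIcc⟩
    obtain ⟨i, hi⟩ := Function.ne_iff.1 hab
    set ν : Dir d := (i, decide (a i < b i)) with hν
    have hval : ∀ j, (nb ν j = 0 ∧ j ≠ i) ∨ (j = i ∧ (a i < b i ∧ nb ν j = 1 ∨ b i < a i ∧ nb ν j = -1)) := fun j => by
      by_cases hj : j = i
      · subst hj
        rcases lt_or_gt_of_ne hi with h | h
        · simp [nb, hν, h]
        · simp [nb, hν, h, h.le]
      · simp [nb, hν, hj]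
    have hlt : nrm1 (b - (a + nb ν)) < n := by
      rw [← hn]
      refine Finset.sum_lt_sum (fun j _ => ?_) ⟨i, Finset.mem_univ i, ?_⟩
      · rcases hval j with h | ⟨rfl, h⟩ <;> simp only [Pi.sub_apply, Pi.add_apply] <;> omega
      · rcases hval i with h | ⟨-, h⟩ <;> simp only [Pi.sub_apply, Pi.add_apply] <;> omega
    have hmem : a + nb ν ∈ uIcc a b := by
      constructor <;> intro j <;> simp only [Pi.inf_apply, Pi.sup_apply, Pi.add_apply] <;>
        rcases hval j with h | ⟨rfl, h⟩ <;> omega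
    obtain ⟨E, h1, h2, h3⟩ := ih _ hlt (a + nb ν) rfl
    have hsub : uIcc (a + nb ν) b ⊆ uIcc a b := uIcc_subset_uIcc hmem right_mem_uIcc
    refine ⟨insert (edge a ν) E, (Finset.card_insert_le _ _).trans (by omega), ?_, fun ω hω => ?_⟩
    · rw [Finset.coe_insert, insert_subset_iff]
      exact ⟨edge_mem_edgesIn.2 ⟨left_mem_uIcc, hmem⟩, fun e he v hv => hsub (h2 he v hv)⟩
    · exact (ConnIn.single (openAdj_iff.2 ⟨ν, rfl, hω _ (Finset.mem_insert_self _ _)⟩) left_mem_uIcc hmem).trans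
        ((h3 ω fun e he => hω e (Finset.mem_insert_of_mem he)).mono hsub)

/-- Spheres are connected. -/
theorem sphere_ind (hd : 2 ≤ d) {ρ : ℕ} {P : V d → Prop}
    (hP : ∀ x ν, x ∈ sphere z ρ → x + nb ν ∈ sphere z ρ → P x → P (x + nb ν)) {a b : V d} (ha : a ∈ sphere z ρ)
    (hb : b ∈ sphere z ρ) (hPa : P a) : P b := by
  have face : ∀ a b : V d, a ∈ sphere z ρ → b ∈ sphere z ρ → ∀ i, |a i - z i| = ρ → a i = b i → P a → P b := fun a b ha hb i hi hab hPa => by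
    obtain ⟨E, -, -, h⟩ := exists_staircase a b
    have hsub : uIcc a b ⊆ sphere z ρ := fun y hy => by
      refine ⟨fun j => ?_, i, ?_⟩
      · have h1 := hy.1 j
        have h2 := hy.2 j
        have h3 := abs_le.1 (ha.1 j)
        have h4 := abs_le.1 (hb.1 j)
        simp only [Pi.inf_apply, Pi.sup_apply] at h1 h2
        rw [abs_le]; omega
      · have h1 := hy.1 i
        have h2 := hy.2 i
        simp only [Pi.inf_apply, Pi.sup_apply, ← hab, min_self, max_self] at h1 h2
        rw [le_antisymm h2 h1, hi]
    refine (h (fun _ => true) fun _ _ => rfl).ind (p := P) hPa fun x y hx hxy hy hPx => ?_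
    obtain ⟨ν, rfl, -⟩ := openAdj_iff.1 hxy
    exact hP x ν (hsub hx.right) (hsub hy) hPx
  have upd : ∀ (a : V d) i (c : ℤ), a ∈ sphere z ρ → |c - z i| = ρ → update a i c ∈ sphere z ρ := fun a i c ha hc => by
    refine ⟨fun j => ?_, i, by simpa using hc⟩
    by_cases hj : j = i
    · subst hj; simp [hc]
    · simpa [hj] using ha.1 j
  have two : ∀ a b : V d, a ∈ sphere z ρ → b ∈ sphere z ρ → ∀ i j, i ≠ j → |a i - z i| = ρ → |b j - z j| = ρ → P a → P b :=
    fun a b ha hb i j hij hi hj hPa => by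
      have hc := upd b i (a i) hb hi
      exact face _ b hc hb j (by simpa [hij.symm] using hj) (by simp [hij.symm]) (face a _ ha hc i hi (by simp) hPa)
  obtain ⟨i, hi⟩ := ha.2
  obtain ⟨j, hj⟩ := hb.2
  by_cases hij : i = j
  · subst hij
    haveI : Nontrivial (Fin d) := Fin.nontrivial_iff_two_le.2 hd
    obtain ⟨l, hl⟩ := exists_ne i
    have hρ : |z l + ρ - z l| = (ρ : ℤ) := by simp
    have hc := upd a l (z l + ρ) ha hρ
    exact two _ b hc hb l i hl (by simpa using hρ) hj (face a _ ha hc i hi (by simp [hl.symm]) hPa)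
  · exact two a b ha hb i j hij hi hj hPa

theorem Reach.exists_sphere {z w : V d} {r N : ℕ} (hw : w ∈ box z r) (hr : r ≤ N) (h : Reach (box z N) ω w) :
    ∃ x ∈ sphere z r, ConnIn (box z N) ω w x := by
  obtain ⟨t, ⟨ν, ht⟩, hc⟩ := Reach.anti (box_mono hr) hw h
  refine ⟨t, ⟨hc.right, ?_⟩, hc.mono (box_mono hr)⟩
  by_contra! hne
  refine ht fun i => ?_
  have h1 := abs_le.1 (hc.right i)
  have h2 := hne i
  have h3 := abs_le.1 (abs_nb_le ν i)
  simp only [Pi.add_apply]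
  rw [abs_le]
  rcases abs_cases (t i - z i) with h4 | h4 <;> omega

theorem mem_box_trans {m n : ℕ} (h1 : x ∈ box y m) (h2 : y ∈ box z n) : x ∈ box z (n + m) := fun i => by
  have := abs_le.1 (h1 i)
  have := abs_le.1 (h2 i)
  rw [abs_le]; push_cast; omega

/-- If two different clusters cross a sphere along which marks are dense, a short bridge at the sphere joins
the first cluster to another marked one. -/
theorem exists_bridge (hd : 2 ≤ d) {z w w' : V d} {k ρ R N : ℕ} {ξ : Config d} {Mk : Set (V d)} (hρ : ρ + k + 1 ≤ R) (hR : R ≤ N)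
    (hMk : ∀ v ∈ Mk, Reach (box z N) ξ v) (hocc : ∀ x ∈ box z R, ∃ v ∈ Mk, v ∈ box x k)
    (hw : w ∈ Mk) (hw' : w' ∈ Mk) (hwr : w ∈ box z ρ) (hwr' : w' ∈ box z ρ) (hne : ¬ ConnIn (box z N) ξ w w') :
    ∃ E : Finset (Edge d), E.card ≤ d * (2 * k + 2) ∧ (∃ y ∈ sphere z ρ, (E : Set (Edge d)) ⊆ edgesIn (box y (k + 1))) ∧
      ∃ v ∈ Mk, v ∈ box z R ∧ ¬ ConnIn (box z N) ξ w v ∧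
        ∀ ξ' : Config d, (∀ e, ξ e = true → ξ' e = true) → (∀ e ∈ E, ξ' e = true) → ConnIn (box z N) ξ' w v := by
  suffices h : ∃ y ∈ sphere z ρ, ∃ a ∈ box y (k + 1), ∃ b ∈ box y (k + 1), ConnIn (box z N) ξ w a ∧ ∃ v ∈ Mk, v ∈ box z R ∧
      ¬ ConnIn (box z N) ξ w v ∧ ConnIn (box z N) ξ b v by
    obtain ⟨y, hy, a, ha, b, hb, hwa, v, hv, hvR, hnv, hbv⟩ := h
    obtain ⟨E, h1, h2, h3⟩ := exists_staircase a b
    have hsub : uIcc a b ⊆ box y (k + 1) := fun c hc i => by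
      have h1 := hc.1 i
      have h2 := hc.2 i
      have h3 := abs_le.1 (ha i)
      have h4 := abs_le.1 (hb i)
      simp only [Pi.inf_apply, Pi.sup_apply] at h1 h2
      rw [abs_le]; omega
    refine ⟨E, h1.trans ?_, ⟨y, hy, fun e he v hv => hsub (h2 he v hv)⟩, v, hv, hvR, hnv, fun ξ' hξ hE => ?_⟩
    · calc nrm1 (b - a) ≤ ∑ _i : Fin d, (2 * k + 2) := sum_le_sum fun i _ => by
            have h3 := abs_le.1 (ha i)
            have h4 := abs_le.1 (hb i)
            push_cast at h3 h4
            simp only [Pi.sub_apply]; omega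
        _ = _ := by simp
    · refine (hwa.mono_conf hξ).trans (((h3 ξ' hE).mono fun c hc => ?_).trans (hbv.mono_conf hξ))
      exact box_mono (by omega) (mem_box_trans (hsub hc) hy.1)
  obtain ⟨a, ha, hwa⟩ := (hMk w hw).exists_sphere hwr (by omega)
  obtain ⟨b, hb, hwb⟩ := (hMk w' hw').exists_sphere hwr' (by omega)
  have self : ∀ (x : V d) m, x ∈ box x m := fun x m i => by simp
  by_cases hPb : ∃ c ∈ box b k, ConnIn (box z N) ξ w c
  · obtain ⟨c, hc, hwc⟩ := hPb
    exact ⟨b, hb, c, box_mono (by omega) hc, b, self _ _, hwc, w', hw', box_mono (by omega) hwr', hne, hwb.symm⟩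
  · by_contra hno
    refine hPb (sphere_ind (P := fun x => ∃ c ∈ box x k, ConnIn (box z N) ξ w c) hd (fun x ν hx hxν hP => ?_) ha hb ⟨a, self _ _, hwa⟩)
    obtain ⟨c, hc, hwc⟩ := hP
    by_contra hcon
    obtain ⟨v, hv, hvx⟩ := hocc (x + nb ν) (box_mono (by omega) hxν.1)
    have hvR : v ∈ box z R := box_mono (by omega) (mem_box_trans hvx hxν.1)
    have hstep : v ∈ box x (k + 1) := by
      rw [add_comm]
      exact mem_box_trans hvx fun i => by simpa using abs_nb_le ν i
    exact hno ⟨x, hx, c, box_mono (by omega) hc, v, hstep, hwc, v, hv, hvR, fun h => hcon ⟨v, hvx, h⟩, .refl (box_mono hR hvR)⟩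

end

section
variable {ι : Type*} {P : ι → ℝ}

/-- A bound that holds conditionally on any values of the coordinates in `J` holds unconditionally. -/
theorem bern_le_of_piecewise (J : Set ι) [∀ i, Decidable (i ∈ J)] {A : Set (ι → Bool)} (mA : MeasurableSet A) {b : ENNReal}
    (h : ∀ η : ι → Bool, bern P {ω | J.piecewise η ω ∈ A} ≤ b) : bern P A ≤ b := by
  have hm : Measurable fun x : (ι → Bool) × (ι → Bool) => J.piecewise x.1 x.2 := measurable_pi_lambda _ fun i => by
    by_cases hi : i ∈ J <;> simp only [piecewise, hi, if_true, if_false] <;> fun_prop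
  have hmap : ((bern P).prod (bern P)).map (fun x => J.piecewise x.1 x.2) = bern P := by
    refine Measure.eq_infinitePi _ fun s t ht => ?_
    rw [map_apply hm (MeasurableSet.pi s.countable_toSet fun i _ => ht i),
      show (fun x : (ι → Bool) × (ι → Bool) => J.piecewise x.1 x.2) ⁻¹' (s : Set ι).pi t =
        ((s.filter (· ∈ J) : Finset ι) : Set ι).pi t ×ˢ ((s.filter (· ∉ J) : Finset ι) : Set ι).pi t from ?_, Measure.prod_prod]
    · unfold bern
      rw [Measure.infinitePi_pi _ fun i _ => ht i, Measure.infinitePi_pi _ fun i _ => ht i, Finset.prod_filter_mul_prod_filter_not]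
    · ext x
      simp only [mem_preimage, Set.mem_pi, mem_coe, mem_prod, mem_filter]
      refine ⟨fun h => ⟨fun i hi => by simpa [hi.2] using h i hi.1, fun i hi => by simpa [hi.2] using h i hi.1⟩, fun h i hi => ?_⟩
      by_cases hJ : i ∈ J
      · simpa [hJ] using h.1 i ⟨hi, hJ⟩
      · simpa [hJ] using h.2 i ⟨hi, hJ⟩
  rw [← hmap, map_apply hm mA, Measure.prod_apply (hm mA)]
  exact (lintegral_mono h).trans (by simp)

theorem bern_all_blocked_le {s : ENNReal} {m : ℕ} {E : ℕ → Finset ι} (hE : ∀ i < m, ∀ j < m, i ≠ j → Disjoint (E i) (E j))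
    (hs : ∀ j < m, s ≤ bern P {ω | ∀ e ∈ E j, ω e = true}) : bern P {ω | ∀ j < m, ∃ e ∈ E j, ω e = false} ≤ (1 - s) ^ m := by
  have hdep : ∀ j, Dep (E j : Set ι) {ω : ι → Bool | ∃ e ∈ E j, ω e = false} := fun j ω ω' h ⟨e, he, h'⟩ => ⟨e, he, by rw [← h e he, h']⟩
  induction m with
  | zero => simp
  | succ m ih =>
    have h1 : bern P {ω | ∃ e ∈ E m, ω e = false} ≤ 1 - s := by
      have hc : {ω : ι → Bool | ∃ e ∈ E m, ω e = false} = {ω | ∀ e ∈ E m, ω e = true}ᶜ := by ext ω; simp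
      rw [hc, prob_compl_eq_one_sub (by rw [← MeasurableSet.compl_iff, ← hc]; exact meas_of_dep (hdep m))]
      exact tsub_le_tsub_left (hs m (by omega)) 1
    have hd : Dep (((Finset.range m).biUnion E : Finset ι) : Set ι) {ω : ι → Bool | ∀ j < m, ∃ e ∈ E j, ω e = false} := fun ω ω' h hω j hj =>
      hdep j ω ω' (fun e he => h e (by simpa using ⟨j, hj, he⟩)) (hω j hj)
    have hset : {ω : ι → Bool | ∀ j < m + 1, ∃ e ∈ E j, ω e = false} = {ω | ∀ j < m, ∃ e ∈ E j, ω e = false} ∩ {ω | ∃ e ∈ E m, ω e = false} := by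
      ext ω; simp only [mem_ofPred_eq, mem_inter_iff, Nat.forall_lt_succ_right]
    rw [hset, bern_inter hd (hdep m) ?_ (meas_of_dep hd) (meas_of_dep (hdep m)), pow_succ]
    · exact mul_le_mul' (ih (fun i hi j hj => hE i (by omega) j (by omega)) fun j hj => hs j (by omega)) h1
    · rw [Finset.disjoint_coe, Finset.disjoint_biUnion_left]
      exact fun j hj => hE j (by have := Finset.mem_range.1 hj; omega) m (by omega) (Finset.mem_range.1 hj).ne

end

section
variable {s : ℝ}

theorem card_boxF (z : V d) (L : ℕ) : (boxF z L).card = (2 * L + 1) ^ d := by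
  have : boxF z L = Finset.Icc (fun i => z i - L) (fun i => z i + L) := by
    rw [← Finset.coe_inj, coe_boxF, box_eq, Finset.coe_Icc]
  rw [this, Pi.card_Icc]
  simp only [Int.card_Icc]
  rw [prod_congr rfl fun i _ => show (z i + L + 1 - (z i - L)).toNat = 2 * L + 1 by omega]
  simp

/-- The union of `ω` and `σ`, the latter used only off the box of radius `R`. -/
def cmb (z : V d) (ω σ : Config d) (R : ℕ) : Config d := fun e => ω e || (σ e && decide (e ∉ edgesIn (box z R)))

theorem cmb_anti {ω σ : Config d} {R R' : ℕ} (h : R' ≤ R) (e : Edge d) (he : cmb z ω σ R e = true) : cmb z ω σ R' e = true := by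
  simp only [cmb, Bool.or_eq_true, Bool.and_eq_true, decide_eq_true_eq] at he ⊢
  exact he.imp_right fun h' => ⟨h'.1, fun h2 => h'.2 fun v hv => box_mono h (h2 v hv)⟩

/-- The marked vertex `w` fails to be merged with another marked cluster between the radii `R'` and `R`. -/
def noMerge (z : V d) (ω : Config d) (Mk : Set (V d)) (N R R' : ℕ) (w : V d) : Set (Config d) :=
  {σ | w ∈ Mk ∧ w ∈ box z R' ∧ (∃ w' ∈ Mk, w' ∈ box z R' ∧ ¬ ConnIn (box z N) (cmb z ω σ R) w w') ∧
    ∀ v ∈ Mk, v ∈ box z R → ConnIn (box z N) (cmb z ω σ R') w v → ConnIn (box z N) (cmb z ω σ R) w v}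

theorem meas_noMerge {z w : V d} {Mk : Set (V d)} {N R R' : ℕ} : MeasurableSet (noMerge z ω Mk N R R' w) := by
  refine meas_of_dep (F := edgesOf (boxF z N)) (Dep.mono (J := edgesIn (box z N)) ?_ (by rw [← coe_boxF]; exact edgesIn_subset_edgesOf _))
  intro σ σ' h hσ
  have key : ∀ R a b, ConnIn (box z N) (cmb z ω σ R) a b ↔ ConnIn (box z N) (cmb z ω σ' R) a b := fun R a b =>
    dep_connIn.iff (A := {ω | ConnIn (box z N) ω a b}) fun e he => by simp [cmb, h e he]
  simpa only [noMerge, mem_ofPred_eq, key] using hσ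

theorem perc_noMerge_le (hd : 2 ≤ d) {z w : V d} {Mk : Set (V d)} {N R R' k m : ℕ} (hRR : R = R' + m * (2 * k + 4)) (hRN : R ≤ N)
    (hMk : ∀ v ∈ Mk, Reach (box z N) ω v) (hocc : ∀ x ∈ box z R, ∃ v ∈ Mk, v ∈ box x k) :
    perc d s (noMerge z ω Mk N R R' w) ≤ (1 - pE s ^ (d * (2 * k + 2))) ^ m := by
  refine bern_le_of_piecewise (edgesIn (box z R))ᶜ meas_noMerge fun η => ?_
  have hξ : ∀ σ, cmb z ω ((edgesIn (box z R))ᶜ.piecewise η σ) R = cmb z ω η R := fun σ => by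
    ext e
    by_cases he : e ∈ edgesIn (box z R) <;> simp [cmb, he]
  set ξ := cmb z ω η R with hξ'
  simp only [noMerge, mem_ofPred_eq, hξ]
  by_cases hpre : w ∈ Mk ∧ w ∈ box z R' ∧ ∃ w' ∈ Mk, w' ∈ box z R' ∧ ¬ ConnIn (box z N) ξ w w'
  swap
  · refine le_trans (le_of_eq ?_) zero_le
    rw [show {σ : Config d | _} = ∅ from eq_empty_of_forall_notMem fun σ hσ => hpre ⟨hσ.1, hσ.2.1, hσ.2.2.1⟩, measure_empty]
  obtain ⟨hw, hwR, w', hw', hwR', hne⟩ := hpre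
  have hbr : ∀ j, j < m → _ := fun j hj => exists_bridge hd (ρ := R' + j * (2 * k + 4) + k + 2) (by
      have : (j + 1) * (2 * k + 4) ≤ m * (2 * k + 4) := Nat.mul_le_mul_right _ hj
      rw [hRR]; linarith) hRN (fun v hv => (hMk v hv).mono_conf fun e he => by simp [hξ', cmb, he]) hocc hw hw'
      (box_mono (by omega) hwR) (box_mono (by omega) hwR') hne
  choose! E hcard hsph v hv hvR hnv hconn using hbr
  have hsep : ∀ i < m, ∀ e ∈ E i, ∀ x ∈ e.1, ∃ l, R' + i * (2 * k + 4) < |x l - z l| ∧ |x l - z l| ≤ R' + i * (2 * k + 4) + (2 * k + 3) ∧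
      ∀ l, |x l - z l| ≤ R' + i * (2 * k + 4) + (2 * k + 3) := fun i hi e he x hx => by
    obtain ⟨y, ⟨hy1, l, hl⟩, hsub⟩ := hsph i hi
    have hxy := hsub he x hx
    have hall : ∀ l, |x l - z l| ≤ R' + i * (2 * k + 4) + (2 * k + 3) := fun l => by
      have h1 := abs_le.1 (hxy l)
      have h2 := abs_le.1 (hy1 l)
      push_cast at h1 h2
      rw [abs_le]; constructor <;> linarith
    refine ⟨l, ?_, hall l, hall⟩
    have h1 := abs_le.1 (hxy l)
    push_cast at h1 hl
    rw [lt_abs]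
    rcases abs_cases (y l - z l) with h | h
    · left; linarith
    · right; linarith
  have hlt : ∀ i j : ℕ, i < m → j < m → i < j → Disjoint (E i) (E j) := fun i j hi hj hij => Finset.disjoint_left.2 fun e he he' => by
    obtain ⟨-, -, -, h1⟩ := hsep i hi _ he _ (out_fst_mem _)
    obtain ⟨l, h2, -⟩ := hsep j hj _ he' _ (out_fst_mem _)
    have h3 := h1 l
    have h4 : ((i + 1 : ℕ) : ℤ) * (2 * k + 4) ≤ j * (2 * k + 4) := mul_le_mul_of_nonneg_right (by exact_mod_cast hij) (by positivity)
    push_cast at h4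
    linarith
  refine le_trans (measure_mono ?_) (bern_all_blocked_le (E := E) (m := m) (fun i hi j hj hij => ?_) fun j hj => ?_)
  · intro σ hσ j hj
    by_contra! hall
    refine hnv j hj (hσ.2.2.2 (v j) (hv j hj) (hvR j hj) (hconn j hj _ (fun e he => ?_) fun e he => ?_))
    · exact cmb_anti (by omega) e (hξ σ ▸ he)
    · have hin : e ∈ edgesIn (box z R) := fun x hx i => by
        obtain ⟨-, -, -, h1⟩ := hsep j hj e he x hx
        have h4 : ((j + 1 : ℕ) : ℤ) * (2 * k + 4) ≤ m * (2 * k + 4) := mul_le_mul_of_nonneg_right (by exact_mod_cast hj) (by positivity)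
        have := h1 i
        rw [hRR]; push_cast at h4 ⊢
        linarith
      have hout : e ∉ edgesIn (box z R') := fun hin' => by
        obtain ⟨l, h2, -⟩ := hsep j hj _ he _ (out_fst_mem _)
        have h3 := hin' _ (out_fst_mem _) l
        have : (0 : ℤ) ≤ j * (2 * k + 4) := by positivity
        linarith
      have := hall e he
      simp_all [cmb]
  · rcases lt_or_gt_of_ne hij with h | h
    · exact hlt i j hi hj h
    · exact (hlt j i hj hi h).symm
  · rw [bern_forall_eq, prod_congr rfl fun e _ => perc_open e, Finset.prod_const]
    exact pow_le_pow_right_of_le_one' pE_le_one (hcard j hj)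

/-- Sprinkling merges all marked clusters of a box. -/
theorem perc_not_merged_le (hd : 2 ≤ d) {n k m T : ℕ} (hT : T * (m * (2 * k + 4)) ≤ n) (hT2 : (8 * n + 1) ^ d < 2 ^ T)
    (hocc : ∀ x ∈ box z (3 * n), ∃ v ∈ box x k, Reach (box z (4 * n)) ω v) :
    perc d s {σ | ¬ ∀ w ∈ box z (2 * n), ∀ w' ∈ box z (2 * n), Reach (box z (4 * n)) ω w → Reach (box z (4 * n)) ω w' →
      ConnIn (box z (4 * n)) (fun e => ω e || σ e) w w'} ≤ T * ((8 * n + 1) ^ d * (1 - pE s ^ (d * (2 * k + 2))) ^ m) := by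
  set M := m * (2 * k + 4) with hM
  set R : ℕ → ℕ := fun i => 2 * n + (T - i) * M with hR
  set Mk : Set (V d) := {v | Reach (box z (4 * n)) ω v} with hMk
  have hR1 : ∀ i < T, R i = R (i + 1) + M := fun i hi => by
    simp only [hR]
    rw [show T - i = (T - (i + 1)) + 1 by omega]; ring
  have hR3 : ∀ i, R i ≤ 3 * n := fun i => by
    have : (T - i) * M ≤ T * M := Nat.mul_le_mul_right _ (Nat.sub_le _ _)
    simp only [hR]; omega
  refine (measure_mono (t := ⋃ i ∈ Finset.range T, ⋃ w ∈ boxF z (4 * n), noMerge z ω Mk (4 * n) (R i) (R (i + 1)) w) fun σ hσ => ?_).trans ?_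
  swap
  · calc _ ≤ ∑ i ∈ Finset.range T, ∑ w ∈ boxF z (4 * n), perc d s (noMerge z ω Mk (4 * n) (R i) (R (i + 1)) w) :=
          (measure_biUnion_finset_le _ _).trans (sum_le_sum fun i _ => measure_biUnion_finset_le _ _)
      _ ≤ ∑ _i ∈ Finset.range T, ∑ _w ∈ boxF z (4 * n), (1 - pE s ^ (d * (2 * k + 2))) ^ m :=
        sum_le_sum fun i hi => sum_le_sum fun w _ =>
          perc_noMerge_le hd (hR1 i (Finset.mem_range.1 hi)) ((hR3 i).trans (by omega)) (fun v hv => hv) fun x hx =>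
            let ⟨v, hv, h⟩ := hocc x (box_mono (hR3 i) hx)
            ⟨v, h, hv⟩
      _ = _ := by simp [card_boxF, show 2 * (4 * n) + 1 = 8 * n + 1 by ring]
  by_contra hno
  simp only [mem_iUnion, not_exists, Finset.mem_range, ← mem_coe, coe_boxF] at hno
  have H : ∀ i ≤ T, (∀ w ∈ Mk, w ∈ box z (R i) → ∀ w' ∈ Mk, w' ∈ box z (R i) → ConnIn (box z (4 * n)) (cmb z ω σ (R i)) w w') ∨
      ∀ w ∈ Mk, w ∈ box z (R i) → 2 ^ i ≤ (cl (box z (4 * n)) (cmb z ω σ (R i)) w).ncard := fun i => by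
    have hfin : ∀ R w, (cl (box z (4 * n)) (cmb z ω σ R) w).Finite := fun R w => (box_finite z (4 * n)).subset cl_subset
    induction i with
    | zero =>
      refine fun _ => .inr fun w _ hw => ?_
      rw [pow_zero, Nat.one_le_iff_ne_zero, Ne, Set.ncard_eq_zero (hfin _ _)]
      exact Set.Nonempty.ne_empty ⟨w, .refl (box_mono (by have := hR3 0; omega) hw)⟩
    | succ i ih =>
      intro hi
      have hle : R (i + 1) ≤ R i := by have := hR1 i (by omega); omega
      have hmono : ∀ a b, ConnIn (box z (4 * n)) (cmb z ω σ (R i)) a b → ConnIn (box z (4 * n)) (cmb z ω σ (R (i + 1))) a b :=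
        fun a b h => h.mono_conf (cmb_anti hle)
      by_cases hall : ∀ w ∈ Mk, w ∈ box z (R (i + 1)) → ∀ w' ∈ Mk, w' ∈ box z (R (i + 1)) → ConnIn (box z (4 * n)) (cmb z ω σ (R i)) w w'
      · exact .inl fun w hw hwR w' hw' hwR' => hmono _ _ (hall w hw hwR w' hw' hwR')
      refine .inr fun w hw hwR => ?_
      push Not at hall
      obtain ⟨a, ha, haR, b, hb, hbR, hab⟩ := hall
      have hother : ∃ w' ∈ Mk, w' ∈ box z (R (i + 1)) ∧ ¬ ConnIn (box z (4 * n)) (cmb z ω σ (R i)) w w' := by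
        by_contra! hc
        exact hab ((hc a ha haR).symm.trans (hc b hb hbR))
      have h1 := hno i (mem_coe.2 (Finset.mem_range.2 (by omega))) w (box_mono (by have := hR3 (i + 1); omega) hwR)
      simp only [noMerge, mem_ofPred_eq, not_and, not_forall] at h1
      obtain ⟨v, hv, hvR, hc, hnc⟩ := h1 hw hwR hother
      have hcard := (ih (by omega)).resolve_left fun h => hab (h a ha (box_mono hle haR) b hb (box_mono hle hbR))
      rw [pow_succ, mul_two]
      refine (add_le_add (hcard w hw (box_mono hle hwR)) (hcard v hv hvR)).trans ?_
      have hdis : Disjoint (cl (box z (4 * n)) (cmb z ω σ (R i)) w) (cl (box z (4 * n)) (cmb z ω σ (R i)) v) :=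
        disjoint_left.2 fun x h1 h2 => hnc (ConnIn.trans h1 (ConnIn.symm h2))
      rw [← Set.ncard_union_eq hdis (hfin _ _) (hfin _ _)]
      refine Set.ncard_le_ncard (union_subset (fun x hx => hmono _ _ hx) fun x hx => hc.trans (hmono _ _ hx)) (hfin _ _)
  refine hσ fun w hw w' hw' hr hr' => ?_
  have hRT : R T = 2 * n := by simp [hR]
  rcases H T le_rfl with h | h
  · rw [hRT] at h
    exact (h w hr hw w' hr' hw').mono_conf fun e he => by
      simp only [cmb, Bool.or_eq_true, Bool.and_eq_true] at he ⊢
      exact he.imp_right And.left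
  · exfalso
    have h1 := (h w hr (by rwa [hRT])).trans (Set.ncard_le_ncard (t := (boxF z (4 * n) : Set (V d))) (by rw [coe_boxF]; exact cl_subset) (Finset.finite_toSet _))
    rw [Set.ncard_coe_finset, card_boxF, show 2 * (4 * n) + 1 = 8 * n + 1 by ring] at h1
    omega

end

section

/-- The parameters of the layered configuration space. -/
def par (d : ℕ) (p q s : ℝ) (i : ℕ × Edge d) : ℝ := if i.1 = 0 then p else if i.1 = 1 then q else s

/-- A layer of a layered configuration. -/
def layer (j : ℕ) (η : ℕ × Edge d → Bool) : Config d := fun e => η (j, e)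

/-- The vertices of `box z (3 * n)` are close to long clusters of `ω`, and these are merged by `σ` near `z`. -/
def Good (z : V d) (n k : ℕ) (ω σ : Config d) : Prop := (∀ x ∈ box z (3 * n), ∃ v ∈ box x k, Reach (box z (6 * n)) ω v) ∧
  ∀ w ∈ box z (2 * n), ∀ w' ∈ box z (2 * n), Reach (box z (4 * n)) ω w → Reach (box z (4 * n)) ω w' →
      ConnIn (box z (4 * n)) (fun e => ω e || σ e) w w'

theorem bern_layer {P : ℕ × Edge d → ℝ} {j : ℕ} (h : ∀ e, P (j, e) = p) (mA : MeasurableSet A) :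
    bern P {η | layer j η ∈ A} = perc d p A :=
  (bern_reindex (f := fun e : Edge d => (j, e)) (Prod.mk_right_injective j) mA).trans (by simp only [h])

theorem Reach.congr {Λ : Set (V d)} {ω ω' : Config d} (h : ∀ e ∈ edgesIn Λ, ω e = ω' e) : Reach Λ ω x ↔ Reach Λ ω' x :=
  exists_congr fun _ => and_congr_right fun _ => ⟨fun hc => hc.congr h, fun hc => hc.congr fun e he => (h e he).symm⟩

theorem Good.congr {n k : ℕ} {ω ω' σ σ' : Config d} (hω : ∀ e ∈ edgesIn (box z (6 * n)), ω e = ω' e)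
    (hσ : ∀ e ∈ edgesIn (box z (6 * n)), σ e = σ' e) (h : Good z n k ω σ) : Good z n k ω' σ' := by
  have hsub : ∀ e ∈ edgesIn (box z (4 * n)), e ∈ edgesIn (box z (6 * n)) := fun e he v hv => box_mono (by omega) (he v hv)
  have h4 : ∀ e ∈ edgesIn (box z (4 * n)), ω e = ω' e := fun e he => hω e (hsub e he)
  refine ⟨fun x hx => ?_, fun w hw w' hw' hr hr' => ?_⟩
  · obtain ⟨v, hv, hr⟩ := h.1 x hx
    exact ⟨v, hv, (Reach.congr hω).1 hr⟩
  · exact (h.2 w hw w' hw' ((Reach.congr h4).2 hr) ((Reach.congr h4).2 hr')).congr fun e he => by rw [h4 e he, hσ e (hsub e he)]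

theorem dep_good {n k : ℕ} : Dep {i : ℕ × Edge d | (i.1 = 1 ∨ i.1 = 2) ∧ i.2 ∈ edgesIn (box z (6 * n))} {η | Good z n k (layer 1 η) (layer 2 η)} :=
  fun _ _ h hg => hg.congr (fun e he => h (1, e) ⟨.inl rfl, he⟩) fun e he => h (2, e) ⟨.inr rfl, he⟩

theorem dep_edges {N : ℕ} {A : Set (ℕ × Edge d → Bool)} (h : Dep {i | i.1 ≤ 2 ∧ i.2 ∈ edgesIn (box z N)} A) :
    Dep ((Finset.range 3 ×ˢ edgesOf (boxF z N) : Finset (ℕ × Edge d)) : Set (ℕ × Edge d)) A := h.mono fun i hi => by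
  rw [Finset.coe_product]
  refine ⟨by simpa using Nat.lt_succ_of_le hi.1, edgesIn_subset_edgesOf _ ?_⟩
  rw [coe_boxF]; exact hi.2

theorem meas_good {n k : ℕ} : MeasurableSet {η : ℕ × Edge d → Bool | Good z n k (layer 1 η) (layer 2 η)} :=
  meas_of_dep (dep_edges (dep_good.mono fun _ hi => ⟨by have := hi.1; omega, hi.2⟩))

theorem bern_not_good_le (hd : 2 ≤ d) {P : ℕ × Edge d → ℝ} {q s : ℝ} (hq : ∀ e, P (1, e) = q) (hs : ∀ e, P (2, e) = s) {n k m T : ℕ}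
    {b : ENNReal} (hseed : ∀ x ∈ box z (3 * n), perc d q {ω | ∃ v ∈ box x k, Reach (box z (6 * n)) ω v}ᶜ ≤ b)
    (hk : k ≤ n) (hT : T * (m * (2 * k + 4)) ≤ n) (hT2 : (8 * n + 1) ^ d < 2 ^ T) :
    bern P {η | ¬ Good z n k (layer 1 η) (layer 2 η)} ≤ (6 * n + 1) ^ d * b + T * ((8 * n + 1) ^ d * (1 - pE s ^ (d * (2 * k + 2))) ^ m) := by
  set O : V d → Set (Config d) := fun x => {ω | ∃ v ∈ box x k, Reach (box z (6 * n)) ω v} with hO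
  have mO : ∀ x, MeasurableSet (O x) := fun x => by
    have : O x = ⋃ v ∈ box x k, {ω | Reach (box z (6 * n)) ω v} := by ext ω; simp [hO]
    rw [this]
    exact MeasurableSet.biUnion (to_countable _) fun v _ => meas_reach
  set A : Set (ℕ × Edge d → Bool) := {η | ∀ x ∈ box z (3 * n), layer 1 η ∈ O x} ∩ {η | Good z n k (layer 1 η) (layer 2 η)}ᶜ with hA
  have hlay : ∀ j, Measurable (layer (d := d) j) := fun j => measurable_pi_lambda _ fun e => measurable_pi_apply _
  have mA : MeasurableSet A := by
    refine MeasurableSet.inter ?_ meas_good.compl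
    have : {η : ℕ × Edge d → Bool | ∀ x ∈ box z (3 * n), layer 1 η ∈ O x} = ⋂ x ∈ box z (3 * n), layer 1 ⁻¹' O x := by ext; simp
    rw [this]
    exact MeasurableSet.biInter (to_countable _) fun x _ => hlay 1 (mO x)
  refine (measure_mono (t := (⋃ x ∈ boxF z (3 * n), {η | layer 1 η ∈ (O x)ᶜ}) ∪ A) fun η hη => ?_).trans ((measure_union_le _ _).trans (add_le_add ?_ ?_))
  · by_cases h : ∀ x ∈ box z (3 * n), layer 1 η ∈ O x
    · exact .inr ⟨h, hη⟩
    · push Not at h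
      obtain ⟨x, hx, h⟩ := h
      exact .inl (mem_iUnion₂.2 ⟨x, by rwa [← mem_coe, coe_boxF], h⟩)
  · refine (measure_biUnion_finset_le _ _).trans ((sum_le_sum fun x hx => ?_).trans (b := ∑ _x ∈ boxF z (3 * n), b) ?_)
    · rw [bern_layer hq (mO x).compl]
      exact hseed x (by rwa [← mem_coe, coe_boxF] at hx)
    · rw [sum_const, card_boxF, nsmul_eq_mul]
      push_cast
      ring_nf; rfl
  · refine bern_le_of_piecewise {i | i.1 ≠ 2} mA fun η => ?_
    have h1 : ∀ η' : ℕ × Edge d → Bool, layer 1 (({i | i.1 ≠ 2} : Set (ℕ × Edge d)).piecewise η η') = layer 1 η := fun η' => by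
      ext e; simp [layer, piecewise]
    have h2 : ∀ η' : ℕ × Edge d → Bool, layer 2 (({i | i.1 ≠ 2} : Set (ℕ × Edge d)).piecewise η η') = layer 2 η' := fun η' => by
      ext e; simp [layer, piecewise]
    by_cases hocc : ∀ x ∈ box z (3 * n), layer 1 η ∈ O x
    swap
    · rw [show {η' | _ ∈ A} = (∅ : Set (ℕ × Edge d → Bool)) from eq_empty_of_forall_notMem fun η' h => hocc fun x hx => by
        have := h.1 x hx
        rwa [h1] at this, measure_empty]
      exact zero_le
    set C : Set (Config d) := {σ | ∀ w ∈ box z (2 * n), ∀ w' ∈ box z (2 * n), Reach (box z (4 * n)) (layer 1 η) w →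
      Reach (box z (4 * n)) (layer 1 η) w' → ConnIn (box z (4 * n)) (fun e => layer 1 η e || σ e) w w'} with hC
    have mC : MeasurableSet C := by
      refine meas_of_dep (F := edgesOf (boxF z (4 * n))) (Dep.mono (J := edgesIn (box z (4 * n))) ?_ (by
        rw [← coe_boxF]; exact edgesIn_subset_edgesOf _))
      exact fun σ σ' h hσ w hw w' hw' hr hr' => (hσ w hw w' hw' hr hr').congr fun e he => by rw [h e he]
    refine le_trans (measure_mono (t := {η' | layer 2 η' ∈ Cᶜ}) fun η' h hc => h.2 ?_) ?_
    · rw [mem_ofPred_eq, h1, h2]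
      exact ⟨hocc, hc⟩
    · rw [bern_layer hs mC.compl]
      exact perc_not_merged_le hd hT hT2 fun x hx => by
        obtain ⟨v, hv, h⟩ := hocc x hx
        exact ⟨v, hv, h.anti (box_mono (by omega)) (box_mono (by omega) (mem_box_trans hv hx))⟩

/-- Blocks are good with high probability above the critical point. -/
theorem exists_good_block (hd : 2 ≤ d) {pc : ℝ} (hc : IsCrit d pc) {A : ENNReal} (hA : A ≠ ∞)
    (hgg : Decay d pc A) {q s : ℝ} (hq : pc < q) (hq1 : q ≤ 1) (hs : 0 < s) (hs1 : s ≤ 1)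
    {δ : ℝ} (hδ : 0 < δ) : ∃ n k : ℕ, 1 ≤ n ∧ k ≤ n ∧ ∀ (P : ℕ × Edge d → ℝ), (∀ e, P (1, e) = q) → (∀ e, P (2, e) = s) → ∀ z : V d,
      bern P {η | ¬ Good z n k (layer 1 η) (layer 2 η)} ≤ ofReal δ := by
  obtain ⟨K, hK, hseed⟩ := exists_seed_bound hd hc hA hgg
  obtain ⟨b, hb⟩ := exists_pow_lt_of_lt_one (pow_pos hs (2 * d)) (show (1 / 2 : ℝ) < 1 by norm_num)
  set c := min ((q - pc) / 2) 1 with hcdef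
  have hc0 : 0 < c := lt_min (by linarith) one_pos
  have h4 : 0 < log 4 := Real.log_pos (by norm_num)
  set a := d * (b + 1) * K * log 4 with ha
  set a' := d * (b + 5) * log 4 with ha'
  have e1 : ∀ᶠ j : ℕ in atTop, (4 * d * (b + 5) * j ^ 4 : ℕ) ≤ 2 ^ j := by
    have h := tendsto_pow_const_div_const_pow_of_one_lt 4 (show (1 : ℝ) < 2 by norm_num)
    filter_upwards [h.eventually_lt_const (show (0 : ℝ) < (4 * d * (b + 5) + 1 : ℝ)⁻¹ by positivity)] with j hj
    rw [div_lt_iff₀ (by positivity), inv_mul_eq_div, lt_div_iff₀ (by positivity)] at hj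
    have h2 : (4 * d * (b + 5) * j ^ 4 : ℝ) ≤ 2 ^ j := by nlinarith [pow_nonneg (cast_nonneg (α := ℝ) j) 4]
    exact_mod_cast h2
  have e2 : Tendsto (fun k : ℕ => K * k + 1) atTop atTop := tendsto_atTop_mono (fun k => show k ≤ K * k + 1 by nlinarith) tendsto_id
  obtain ⟨k, hk1, hk2, hk3⟩ := ((e2.eventually e1).and ((eventually_ge_atTop 1).and
    (tendsto_natCast_atTop_atTop.eventually_ge_atTop ((a + a' + |log (δ / 2)|) / c)))).exists
  set k' := K * k with hk'
  set m := 2 ^ (b * (k' + 1)) * (k' + 1) ^ 2 with hm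
  set n := 2 ^ ((b + 1) * (k' + 1)) with hn
  set T := d * ((b + 1) * (k' + 1) + 4) with hT
  have hkn : k' ≤ n := by
    have h1 : k' + 1 ≤ 2 ^ (k' + 1) := Nat.lt_two_pow_self.le
    have h2 : 2 ^ (k' + 1) ≤ n := Nat.pow_le_pow_right (by norm_num) (by nlinarith)
    omega
  have hTn : T * (m * (2 * k' + 4)) ≤ n := by
    have hT' : T ≤ d * (b + 5) * (k' + 1) := by
      rw [hT, mul_assoc]; exact Nat.mul_le_mul_left _ (by nlinarith)
    calc _ ≤ d * (b + 5) * (k' + 1) * (2 ^ (b * (k' + 1)) * (k' + 1) ^ 2 * (4 * (k' + 1))) :=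
          Nat.mul_le_mul hT' (Nat.mul_le_mul_left _ (by omega))
      _ = 2 ^ (b * (k' + 1)) * (4 * d * (b + 5) * (k' + 1) ^ 4) := by ring
      _ ≤ 2 ^ (b * (k' + 1)) * 2 ^ (k' + 1) := Nat.mul_le_mul_left _ hk1
      _ = n := by rw [← pow_add, hn]; congr 1; ring
  have h16 : (16 * n) ^ d = 2 ^ T := by
    rw [hn, hT, show 16 = 2 ^ 4 by norm_num, ← pow_add, ← pow_mul]
    congr 1; ring
  have hn1 : 1 ≤ n := Nat.one_le_two_pow
  have hT2 : (8 * n + 1) ^ d < 2 ^ T := by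
    rw [← h16]; exact Nat.pow_lt_pow_left (by omega) (by omega)
  refine ⟨n, k', hn1, hkn, fun P hPq hPs z => ?_⟩
  have hmain := bern_not_good_le hd hPq hPs (z := z) (b := ofReal (exp (-((k : ℝ) ^ 2 / 2) * (q - pc)))) (fun x hx => by
    have := hseed q hq.le hq1 k x (boxF z (6 * n)) (by
      rw [coe_boxF]
      exact fun v hv => box_mono (by omega) (mem_box_trans hv hx))
    rwa [coe_boxF] at this) hkn hTn hT2
  refine hmain.trans ?_
  have hpow : (1 - pE s ^ (d * (2 * k' + 2))) ^ m ≤ ofReal (exp (-(k' + 1 : ℝ) ^ 2)) := by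
    have h1 : ofReal ((1 / 2) ^ (b * (k' + 1))) ≤ pE s ^ (d * (2 * k' + 2)) := by
      rw [pE, clamp_of_mem ⟨hs.le, hs1⟩, ← ofReal_pow hs.le, show d * (2 * k' + 2) = 2 * d * (k' + 1) by ring, pow_mul, pow_mul]
      exact ofReal_le_ofReal (pow_le_pow_left₀ (by positivity) hb.le _)
    have h2 : 1 - pE s ^ (d * (2 * k' + 2)) ≤ ofReal (exp (-(1 / 2) ^ (b * (k' + 1)))) := by
      refine (tsub_le_tsub_left h1 1).trans ?_
      rw [← ofReal_one, ← ofReal_sub _ (by positivity)]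
      refine ofReal_le_ofReal ?_
      have := Real.add_one_le_exp (-(1 / 2 : ℝ) ^ (b * (k' + 1)))
      linarith
    refine (pow_le_pow_left' h2 m).trans ?_
    rw [← ofReal_pow (exp_pos _).le, ← Real.exp_nat_mul]
    refine ofReal_le_ofReal (exp_le_exp.2 (le_of_eq ?_))
    have : (2 : ℝ) ^ (b * (k' + 1)) * (1 / 2) ^ (b * (k' + 1)) = 1 := by rw [← mul_pow]; norm_num
    rw [hm]; push_cast
    linear_combination (-(k' + 1 : ℝ) ^ 2) * this
  have hexp1 : exp (-((k : ℝ) ^ 2 / 2) * (q - pc)) ≤ exp (-c * k ^ 2) := by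
    refine exp_le_exp.2 ?_
    have := min_le_left ((q - pc) / 2) 1
    nlinarith [sq_nonneg (k : ℝ)]
  have hexp2 : exp (-(k' + 1 : ℝ) ^ 2) ≤ exp (-c * k ^ 2) := by
    refine exp_le_exp.2 ?_
    have h1 : (k : ℝ) ≤ k' := mod_cast (show k ≤ K * k by nlinarith)
    have h2 := min_le_right ((q - pc) / 2) 1
    have h3 : (k : ℝ) ^ 2 ≤ (k' + 1) ^ 2 := by nlinarith [cast_nonneg (α := ℝ) k]
    nlinarith [sq_nonneg (k : ℝ)]
  have hfin : (4 : ℝ) ^ T * exp (-c * k ^ 2) ≤ δ / 2 := by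
    have hk2' : (1 : ℝ) ≤ k := mod_cast hk2
    rw [show (4 : ℝ) ^ T = exp (T * log 4) by rw [mul_comm, Real.exp_mul, Real.exp_log (by norm_num), Real.rpow_natCast], ← Real.exp_add,
      ← Real.exp_log (show 0 < δ / 2 by positivity)]
    refine exp_le_exp.2 ?_
    have hTr : T * log 4 = a * k + a' := by rw [hT, ha, ha', hk']; push_cast; ring
    rw [div_le_iff₀ hc0] at hk3
    have h1 := neg_abs_le (log (δ / 2))
    have ha0 : 0 ≤ a := by positivity
    have ha0' : 0 ≤ a' := by positivity
    have := abs_nonneg (log (δ / 2))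
    rw [hTr]
    nlinarith
  have hT4 : ∀ x y : ℕ, x ≤ 2 ^ T → y ≤ 2 ^ T → ((x * y : ℕ) : ENNReal) * ofReal (exp (-c * k ^ 2)) ≤ ofReal (δ / 2) := fun x y hx hy => by
    rw [← ofReal_natCast, ← ofReal_mul (by positivity)]
    refine ofReal_le_ofReal (le_trans (mul_le_mul_of_nonneg_right ?_ (exp_pos _).le) hfin)
    have : x * y ≤ 4 ^ T := (Nat.mul_le_mul hx hy).trans (by rw [← mul_pow]; norm_num)
    exact_mod_cast this
  rw [← add_halves δ, ofReal_add (by positivity) (by positivity)]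
  refine add_le_add ?_ ?_
  · refine le_trans (mul_le_mul_right (ofReal_le_ofReal hexp1) _) (le_trans (le_of_eq ?_) (hT4 ((6 * n + 1) ^ d) 1
      ((Nat.pow_le_pow_left (by omega) d).trans h16.le) Nat.one_le_two_pow))
    push_cast; ring
  · refine le_trans (mul_le_mul_right (mul_le_mul_right (hpow.trans (ofReal_le_ofReal hexp2)) _) _) (le_trans (le_of_eq ?_)
      (hT4 T ((8 * n + 1) ^ d) Nat.lt_two_pow_self.le hT2.le))
    push_cast; ring

end

section
open Relation

theorem nrm_le {x : ℤ × ℤ} {n : ℕ} : nrm x ≤ n ↔ |x.1| ≤ n ∧ |x.2| ≤ n := by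
  rw [nrm, max_le_iff, Int.abs_eq_natAbs, Int.abs_eq_natAbs]; norm_cast

theorem nrm_neg (x : ℤ × ℤ) : nrm (-x) = nrm x := by simp [nrm]

theorem nrm_sub_le (x y z : ℤ × ℤ) : nrm (x - z) ≤ nrm (x - y) + nrm (y - z) := by
  rw [nrm_le, Nat.cast_add]
  obtain ⟨h1, h2⟩ := nrm_le.1 (le_refl (nrm (x - y)))
  obtain ⟨h3, h4⟩ := nrm_le.1 (le_refl (nrm (y - z)))
  exact ⟨(abs_sub_le _ y.1 _).trans (add_le_add h1 h3), (abs_sub_le _ y.2 _).trans (add_le_add h2 h4)⟩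

/-- `*`-connection through sites satisfying `B`. -/
abbrev Link (B : ℤ × ℤ → Prop) : ℤ × ℤ → ℤ × ℤ → Prop := ReflTransGen fun a b => nrm (b - a) ≤ 1 ∧ B a ∧ B b

/-- `v` is reached from the origin through sites of norm at most `K` or not satisfying `B`. -/
abbrev Escape (K : ℕ) (B : ℤ × ℤ → Prop) (v : ℤ × ℤ) : Prop :=
  ReflTransGen (fun a b => Adjacent₂ a b ∧ (nrm b ≤ K ∨ ¬ B b)) 0 v

/-- There is a `*`-path of sites satisfying `B` from `u` to distance `R`. -/
def SPath (B : ℤ × ℤ → Prop) (u : ℤ × ℤ) (R : ℕ) : Prop :=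
  ∃ y, R ≤ nrm (y - u) ∧ Link B u y

/-- Planar duality: if only finitely many sites are reached from the origin through sites that are open or close to the origin, a long
`*`-path of closed sites starts on the axis. -/
theorem exists_sPath_of_finite {B : ℤ × ℤ → Prop} {K : ℕ}
    (hC : {v | Escape K B v}.Finite) : ∃ a : ℕ, K < a ∧ SPath B ((a : ℤ), 0) a := by
  set C := {v | Escape K B v} with hCdef
  obtain ⟨N, hN⟩ : ∃ N : ℕ, ∀ v ∈ C, nrm v < N := ⟨hC.toFinset.sup nrm + 1, fun v hv => Nat.lt_succ_of_le (le_sup (f := nrm) (hC.mem_toFinset.2 hv))⟩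
  have hN' : ∀ v ∈ C, v.1 < N ∧ v.2 < N := fun v hv => by
    obtain ⟨h1, h2⟩ := nrm_le.1 (le_refl (nrm v))
    have := abs_le.1 h1; have := abs_le.1 h2; have := hN v hv
    omega
  have hax : ∀ x : ℕ, x ≤ K → ((x : ℤ), (0 : ℤ)) ∈ C := fun x hx => by
    induction x with
    | zero => exact .refl
    | succ x ih => exact (ih (by omega)).tail ⟨by simp [Adjacent₂], .inl (by rw [nrm]; simp; omega)⟩
  set a := Nat.findGreatest (fun x : ℕ => ((x : ℤ), (0 : ℤ)) ∈ C) N with ha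
  have hKN : K ≤ N := by have := (hN' _ (hax K le_rfl)).1; simp only at this; omega
  have haC : ((a : ℤ), (0 : ℤ)) ∈ C := Nat.findGreatest_spec (P := fun x : ℕ => ((x : ℤ), (0 : ℤ)) ∈ C) hKN (hax K le_rfl)
  have hKa : K ≤ a := Nat.le_findGreatest hKN (hax K le_rfl)
  have hout : ∀ x : ℤ, a < x → (x, (0 : ℤ)) ∉ C := fun x hx h => by
    lift x to ℕ using by omega
    exact Nat.findGreatest_is_greatest (P := fun x : ℕ => ((x : ℤ), (0 : ℤ)) ∈ C) (by exact_mod_cast hx) (by have := (hN' _ h).1; simp only at this; omega) h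
  set bd : ℤ × ℤ → Prop := fun v => v ∉ C ∧ ∃ c ∈ C, Adjacent₂ c v with hbd
  have hbB : ∀ v, bd v → B v := fun v hv => by
    obtain ⟨h1, c, hc, hcv⟩ := hv
    by_contra hB
    exact h1 (ReflTransGen.tail hc ⟨hcv, .inr hB⟩)
  set o : ℤ × ℤ := ((a + 1 : ℕ), 0) with ho
  have hobd : bd o := ⟨hout _ (by push_cast; omega), _, haC, by simp [Adjacent₂, ho]⟩
  set Q : Set (ℤ × ℤ) := {v | ReflTransGen (fun a b => nrm (b - a) ≤ 1 ∧ bd a ∧ bd b) o v} with hQ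
  refine ⟨a + 1, by omega, ?_⟩
  by_contra hno
  have hQbd : ∀ v ∈ Q, bd v := fun v hv => by
    rcases ReflTransGen.cases_tail hv with h | ⟨b, -, h⟩
    · exact h ▸ hobd
    · exact h.2.2
  have hQpos : ∀ v ∈ Q, 0 < v.1 := fun v hv => by
    by_contra h
    refine hno ⟨v, ?_, (show ReflTransGen _ o v from hv).lift id fun x y h => ⟨h.1, hbB _ h.2.1, hbB _ h.2.2⟩⟩
    have : (v - (((a + 1 : ℕ) : ℤ), (0 : ℤ))).1 = v.1 - (a + 1) := by simp
    refine le_trans ?_ (le_max_left _ _)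
    omega
  have hQext : ∀ v w, v ∈ Q → bd w → nrm (w - v) ≤ 1 → w ∈ Q := fun v w hv hw h => ReflTransGen.tail hv ⟨h, hQbd v hv, hw⟩
  set f : ℤ × ℤ → ℤ × ℤ → ZMod 2 := fun u v => if (u ∈ C ∧ v ∈ Q) ∨ (v ∈ C ∧ u ∈ Q) then 1 else 0 with hf
  set χ : ℤ × ℤ → ZMod 2 := fun u => if u ∈ C then 1 else 0 with hχ
  have f0 : ∀ u v, u ∉ Q → v ∉ Q → f u v = 0 := fun u v hu hv => by simp [hf, hu, hv]
  have fC : ∀ u v, u ∉ C → v ∉ C → f u v = 0 := fun u v hu hv => by simp [hf, hu, hv]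
  have fCC : ∀ u v, u ∈ C → v ∈ C → f u v = 0 := fun u v hu hv => f0 u v (fun h => (hQbd u h).1 hu) fun h => (hQbd v h).1 hv
  have f1 : ∀ u v w, Adjacent₂ u v → w ∈ Q → nrm (u - w) ≤ 1 → nrm (v - w) ≤ 1 → f u v = χ u + χ v := fun u v w huv hw h1 h2 => by
    by_cases hu : u ∈ C <;> by_cases hv : v ∈ C
    · rw [fCC u v hu hv]; simp [hχ, hu, hv]; rfl
    · simp [hf, hχ, hu, hv, hQext w v hw ⟨hv, u, hu, huv⟩ h2]
    · have huv' : Adjacent₂ v u := by rw [Adjacent₂, abs_sub_comm, abs_sub_comm v.2]; exact huv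
      simp [hf, hχ, hu, hv, hQext w u hw ⟨hu, v, hv, huv'⟩ h1]
    · rw [fC u v hu hv]; simp [hχ, hu, hv]
  have face : ∀ x y : ℤ, f (x, y) (x + 1, y) + f (x, y + 1) (x + 1, y + 1) = f (x, y) (x, y + 1) + f (x + 1, y) (x + 1, y + 1) := fun x y => by
    by_cases hex : ∃ w ∈ Q, (w.1 = x ∨ w.1 = x + 1) ∧ (w.2 = y ∨ w.2 = y + 1)
    · obtain ⟨w, hw, hwx, hwy⟩ := hex
      have hn : ∀ s t : ℤ, (s = x ∨ s = x + 1) → (t = y ∨ t = y + 1) → nrm ((s, t) - w) ≤ 1 := fun s t hs ht => by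
        rw [nrm_le]; simp only [Prod.fst_sub, Prod.snd_sub, abs_le]; push_cast; omega
      rw [f1 _ _ w (by simp [Adjacent₂]) hw, f1 _ _ w (by simp [Adjacent₂]) hw, f1 _ _ w (by simp [Adjacent₂]) hw, f1 _ _ w (by simp [Adjacent₂]) hw]
      · ring
      all_goals apply hn <;> simp
    · have hnot : ∀ s t : ℤ, (s = x ∨ s = x + 1) → (t = y ∨ t = y + 1) → (s, t) ∉ Q := fun s t hs ht h => hex ⟨_, h, hs, ht⟩
      rw [f0, f0, f0, f0]
      all_goals apply hnot <;> simp
  set G : ℕ → ℤ → ZMod 2 := fun j y => ∑ i ∈ Finset.range j, f ((N : ℤ) - i - 1, y) ((N : ℤ) - i, y) with hG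
  have vert : ∀ j y, G j y + G j (y + 1) = f ((N : ℤ) - j, y) ((N : ℤ) - j, y + 1) := fun j y => by
    induction j with
    | zero =>
      rw [fC _ _ (fun h => by simpa using (hN' _ h).1) fun h => by simpa using (hN' _ h).1]
      simp [hG]
    | succ j ih =>
      have h1 := face ((N : ℤ) - j - 1) y
      rw [sub_add_cancel] at h1
      simp only [hG, sum_range_succ] at ih ⊢
      rw [add_add_add_comm, ih, h1, show ((N : ℤ) - (j + 1 : ℕ)) = N - j - 1 by push_cast; ring, add_comm, add_assoc, CharTwo.add_self_eq_zero, add_zero]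
  set g : ℤ × ℤ → ZMod 2 := fun v => G (N - v.1).toNat v.2 with hg
  have horiz : ∀ x y : ℤ, x < N → g (x, y) = g (x + 1, y) + f (x, y) (x + 1, y) := fun x y hx => by
    have h1 : (N - x).toNat = (N - (x + 1)).toNat + 1 := by omega
    have h2 : (N : ℤ) - (N - (x + 1)).toNat = x + 1 := by omega
    simp only [hg, hG, h1, sum_range_succ, h2, add_sub_cancel_right]
  have vert' : ∀ x y : ℤ, x ≤ N → g (x, y) + g (x, y + 1) = f (x, y) (x, y + 1) := fun x y hx => by
    have := vert (N - x).toNat y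
    rwa [show (N : ℤ) - (N - x).toNat = x by omega] at this
  have gC : ∀ u v, u ∈ C → v ∈ C → Adjacent₂ u v → g u = g v := fun u v hu hv h => by
    obtain ⟨x, y⟩ := u
    obtain ⟨x', y'⟩ := v
    have h1 := (hN' _ hu).1
    have h2 := (hN' _ hv).1
    simp only at h1 h2
    have h3 : (x' = x + 1 ∧ y' = y) ∨ (x = x' + 1 ∧ y' = y) ∨ (x' = x ∧ y' = y + 1) ∨ (x' = x ∧ y = y' + 1) := by
      simp only [Adjacent₂] at h
      rcases abs_cases (x - x') with h5 | h5 <;> rcases abs_cases (y - y') with h6 | h6 <;> omega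
    rcases h3 with ⟨rfl, rfl⟩ | ⟨rfl, rfl⟩ | ⟨rfl, rfl⟩ | ⟨rfl, rfl⟩
    · rw [horiz x _ h1, fCC _ _ hu hv, add_zero]
    · rw [horiz x' _ h2, fCC _ _ hv hu, add_zero]
    · exact CharTwo.add_eq_zero.1 ((vert' _ _ h1.le).trans (fCC _ _ hu hv))
    · exact (CharTwo.add_eq_zero.1 ((vert' _ _ h1.le).trans (fCC _ _ hv hu))).symm
  have g0 : ∀ v ∈ C, g 0 = g v := fun v hv => by
    have hv' : Escape K B v := hv
    induction hv' with
    | refl => rfl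
    | tail hb hbc ih => exact (ih hb).trans (gC _ _ hb hv hbc.1)
  have gright : ∀ j : ℕ, j ≤ N - (a + 1) → G j 0 = 0 := fun j hj => sum_eq_zero fun i hi => by
    have := Finset.mem_range.1 hi
    exact fC _ _ (hout _ (by omega)) (hout _ (by omega))
  have haN := (hN' _ haC).1
  simp only at haN
  have hone : g ((a : ℤ), 0) = 1 := by
    rw [horiz _ _ haN, show g ((a : ℤ) + 1, 0) = 0 from gright _ (by omega), zero_add]
    have : ((a : ℤ) + 1, (0 : ℤ)) ∈ Q := by
      have h : o = ((a : ℤ) + 1, (0 : ℤ)) := by simp [ho]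
      rw [← h]; exact ReflTransGen.refl
    simp [hf, haC, this]
  have hup : ∀ y : ℕ, g (0, 0) = g (0, (y : ℤ)) := fun y => by
    induction y with
    | zero => rfl
    | succ y ih =>
      rw [ih, Nat.cast_succ]
      exact CharTwo.add_eq_zero.1 ((vert' _ _ (by omega)).trans (f0 _ _ (fun h => by simpa using hQpos _ h) fun h => by simpa using hQpos _ h))
  have htop : g (0, (N : ℤ)) = 0 := sum_eq_zero fun i _ => fC _ _ (fun h => by simpa using (hN' _ h).2) fun h => by simpa using (hN' _ h).2
  have := (g0 _ haC).symm.trans ((hup N).trans htop)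
  rw [hone] at this
  exact one_ne_zero this

end

section
open Relation

theorem SPath.mono {B B' : ℤ × ℤ → Prop} {u : ℤ × ℤ} {R : ℕ} (h : ∀ a, B a → B' a) (hp : SPath B u R) : SPath B' u R := by
  obtain ⟨y, hy, hp⟩ := hp
  exact ⟨y, hy, hp.lift id fun _ _ h' => ⟨h'.1, h _ h'.2.1, h _ h'.2.2⟩⟩

theorem SPath.head {B : ℤ × ℤ → Prop} {u : ℤ × ℤ} {R : ℕ} (hR : 1 ≤ R) (hp : SPath B u R) : B u := by
  obtain ⟨y, hy, hp⟩ := hp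
  rcases ReflTransGen.cases_head hp with rfl | ⟨c, h, -⟩
  · rw [sub_self] at hy
    exact absurd (hR.trans hy) (by decide)
  · exact h.2.1

/-- Cutting a path at its last visit to a set. -/
theorem SPath.split {B Q : ℤ × ℤ → Prop} {u : ℤ × ℤ} {R : ℕ} (hp : SPath B u R) (hu : Q u) :
    ∃ x, Q x ∧ ∃ x', nrm (x' - x) ≤ 1 ∧ SPath (fun a => B a ∧ ¬ Q a) x' (R - (nrm (x - u) + 1)) := by
  obtain ⟨y, hy, hp⟩ := hp
  have key : ∃ x, Q x ∧ (y = x ∨ ¬ Q y ∧ ∃ x', nrm (x' - x) ≤ 1 ∧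
      ReflTransGen (fun a b => nrm (b - a) ≤ 1 ∧ (B a ∧ ¬ Q a) ∧ B b ∧ ¬ Q b) x' y) := by
    clear hy
    induction hp with
    | refl => exact ⟨u, hu, .inl rfl⟩
    | @tail b c _ hbc ih =>
      by_cases hc : Q c
      · exact ⟨c, hc, .inl rfl⟩
      obtain ⟨x, hx, rfl | ⟨hb, x', hx', hp⟩⟩ := ih
      · exact ⟨b, hx, .inr ⟨hc, c, hbc.1, .refl⟩⟩
      · exact ⟨x, hx, .inr ⟨hc, x', hx', hp.tail ⟨hbc.1, ⟨hbc.2.1, hb⟩, hbc.2.2, hc⟩⟩⟩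
  obtain ⟨x, hx, rfl | ⟨-, x', hx', hp⟩⟩ := key
  · exact ⟨y, hx, y, by simp [nrm], y, by omega, .refl⟩
  · refine ⟨x, hx, x', hx', y, ?_, hp⟩
    have h1 := nrm_sub_le y x' u
    have h2 := nrm_sub_le x' x u
    omega

theorem chain_bound {f : ℕ → ENNReal} {κ : ℤ × ℤ → ENNReal} (h1 : ∀ R, f R ≤ 1) (hκ : ∑' x, κ x * ((nrm x + 2 : ℕ) : ENNReal) ^ 3 ≤ 1)
    (hrec : ∀ R, 1 ≤ R → f R ≤ ∑' x, κ x * f (R - (nrm x + 1))) (R : ℕ) : f R ≤ (R + 1 : ENNReal)⁻¹ ^ 3 := by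
  induction R using Nat.strong_induction_on with
  | _ R ih =>
    rcases Nat.eq_zero_or_pos R with rfl | hR
    · simpa using h1 0
    calc f R ≤ ∑' x, κ x * (((nrm x + 2 : ℕ) : ENNReal) ^ 3 * (R + 1 : ENNReal)⁻¹ ^ 3) := by
          refine (hrec R hR).trans (tsum_le_tsum fun x => mul_le_mul_right ((ih _ (by omega)).trans ?_) _)
          rw [← mul_pow]
          refine pow_le_pow_left' (inv_le_mul_inv ?_) 3
          rcases le_total R (nrm x + 1) with h | h
          · rw [Nat.sub_eq_zero_of_le h]; omega
          · obtain ⟨t, rfl⟩ := Nat.exists_eq_add_of_le h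
            rw [Nat.add_sub_cancel_left]; nlinarith
      _ ≤ _ := by
          simp_rw [← mul_assoc]
          rw [tsum_mul_right]
          exact mul_le_of_le_one_left' hκ

/-- The neighbourhood of the origin. -/
def nine : Finset (ℤ × ℤ) := Finset.Icc (-1) 1 ×ˢ Finset.Icc (-1) 1

theorem card_nine : nine.card = 9 := by simp [nine]

theorem mem_nine {x : ℤ × ℤ} : x ∈ nine ↔ nrm x ≤ 1 := by
  rw [nrm_le, abs_le, abs_le]; simp [nine]

/-- `v` has an arm of length `L` avoiding `A`. -/
def Arm (A : Set (V d)) (L : ℕ) (ω : Config d) (v : V d) : Prop := ∃ t, (∃ ν, t + nb ν ∉ box v L) ∧ ConnIn (box v L \ A) ω v t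

/-- The site `u ∉ W` is bad or contains the start of an arm avoiding `A`. -/
def Blk (bad : ℤ × ℤ → Set (ℕ × Edge d → Bool)) (j : ℕ) (Bl : ℤ × ℤ → Finset (V d)) (L : ℕ) (A : Finset (V d)) (W : Set (ℤ × ℤ))
    (η : ℕ × Edge d → Bool) (u : ℤ × ℤ) : Prop := u ∉ W ∧ (η ∈ bad u ∨ ∃ v ∈ Bl u, Arm A L (layer j η) v)

variable {bad : ℤ × ℤ → Set (ℕ × Edge d → Bool)} {J : ℤ × ℤ → Set (ℕ × Edge d)} {j L r : ℕ} {Bl : ℤ × ℤ → Finset (V d)} {A : Finset (V d)}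
  {W : Set (ℤ × ℤ)} {u : ℤ × ℤ} {R : ℕ}

theorem measurable_layer : Measurable (layer (d := d) j) := measurable_pi_lambda _ fun _ => measurable_pi_apply _

theorem meas_exists_connIn {v : V d} (q : V d → Prop) : MeasurableSet {ω : Config d | ∃ t, q t ∧ ConnIn S ω v t} := by
  have : {ω : Config d | ∃ t, q t ∧ ConnIn S ω v t} = ⋃ t, {_ω | q t} ∩ {ω | ConnIn S ω v t} := by ext; simp
  rw [this]
  exact MeasurableSet.iUnion fun t => (MeasurableSet.const _).inter meas_connIn

theorem meas_blk (mbad : ∀ u, MeasurableSet (bad u)) : MeasurableSet {η | Blk bad j Bl L A W η u} := by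
  have : {η | Blk bad j Bl L A W η u} = {_η | u ∉ W} ∩ (bad u ∪ ⋃ v ∈ Bl u, layer j ⁻¹' {ω | Arm A L ω v}) := by
    ext; simp [Blk]
  rw [this]
  exact (MeasurableSet.const _).inter ((mbad u).union (measurableSet_biUnion _ fun v _ => measurable_layer (meas_exists_connIn _)))

theorem meas_sPath {Ω : Type*} [MeasurableSpace Ω] {B : Ω → ℤ × ℤ → Prop} (h : ∀ u, MeasurableSet {η | B η u}) :
    MeasurableSet {η | SPath (B η) u R} := by
  have : {η | SPath (B η) u R} = ⋃ y, {_η | R ≤ nrm (y - u)} ∩ {η | ReflTransGen (fun a b => nrm (b - a) ≤ 1 ∧ B η a ∧ B η b) u y} := by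
    ext; simp [SPath]
  rw [this]
  refine MeasurableSet.iUnion fun y => (MeasurableSet.const _).inter (meas_reflTransGen _ (fun a b => ?_) _ _)
  exact (MeasurableSet.const _).inter ((h a).inter (h b))

theorem dep_sPath_blk (hbad : ∀ u, Dep (J u) (bad u)) : Dep ((⋃ y ∈ Wᶜ, J y) ∪ {i | i.1 = j ∧ i.2 ∈ edgesIn Aᶜ})
    {η | SPath (Blk bad j Bl L A W η) u R} := fun η η' h hp => hp.mono fun a ⟨haW, ha⟩ => ⟨haW, ha.imp (fun hb => hbad a η η'
      (fun i hi => h i (.inl (mem_iUnion₂.2 ⟨a, haW, hi⟩))) hb) fun ⟨v, hv, t, ht, hc⟩ => ⟨v, hv, t, ht, hc.congr fun e he =>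
        h (j, e) (.inr ⟨rfl, fun x hx => (he x hx).2⟩)⟩⟩

/-- Decay of the length of chains of blocked sites. -/
theorem chain_decay {P : ℕ × Edge d → ℝ} {qb : ENNReal} {S : ℤ × ℤ → ENNReal} (hbad : ∀ u, Dep (J u) (bad u)) (mbad : ∀ u, MeasurableSet (bad u))
    (hJ : ∀ u y, r < nrm (y - u) → Disjoint (J u) (J y)) (hj : ∀ u, ∀ i ∈ J u, i.1 ≠ j) (hP : ∀ e, P (j, e) = p)
    (hfin : ∀ u, ∀ v ∈ Bl u, FinCl p univ v) (hq : ∀ u, bern P (bad u) ≤ qb)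
    (hS : ∀ u x, ∑ v ∈ Bl u, perc d p ({ω | ∃ t, (∃ ν, t + nb ν ∉ box v L) ∧ ConnIn univ ω v t} ∩ {ω | ∃ w, w ∈ Bl (u + x) ∧ ConnIn univ ω v w}) ≤ S x)
    (hκ : ∑' x, 9 * (qb * ind (nrm x ≤ r) + S x) * ((nrm x + 2 : ℕ) : ENNReal) ^ 3 ≤ 1) (u : ℤ × ℤ) (R : ℕ) :
    bern P {η | SPath (Blk bad j Bl L ∅ ∅ η) u R} ≤ (R + 1 : ENNReal)⁻¹ ^ 3 := by
  set SP : Finset (V d) → Set (ℤ × ℤ) → ℤ × ℤ → ℕ → Set (ℕ × Edge d → Bool) := fun A W u R => {η | SPath (Blk bad j Bl L A W η) u R} with hSP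
  set f : ℕ → ENNReal := fun R => ⨆ A, ⨆ W, ⨆ u, bern P (SP A W u R) with hf
  have hle : ∀ A W u R, bern P (SP A W u R) ≤ f R := fun A W u R => le_iSup_of_le A (le_iSup_of_le W (le_iSup (fun u => bern P (SP A W u R)) u))
  have mSP : ∀ A W u R, MeasurableSet (SP A W u R) := fun A W u R => meas_sPath fun u => meas_blk mbad
  have h1 : ∀ R, f R ≤ 1 := fun R => iSup_le fun _ => iSup_le fun _ => iSup_le fun _ => prob_le_one
  refine (hle ∅ ∅ u R).trans (chain_bound h1 hκ (fun R hR => ?_) R)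
  clear u hκ h1
  refine iSup_le fun A => iSup_le fun W => iSup_le fun u => ?_
  have hsplit : ∀ η ∈ SP A W u R, ∀ Q : ℤ × ℤ → Prop, Q u → ∀ A' W', (∀ a, Blk bad j Bl L A W η a → ¬ Q a → Blk bad j Bl L A' W' η a) →
      ∃ x, Q (u + x) ∧ ∃ e ∈ nine, η ∈ SP A' W' (u + x + e) (R - (nrm x + 1)) := fun η hη Q hu A' W' h => by
    obtain ⟨x, hx, x', hx', hp⟩ := SPath.split hη hu
    refine ⟨x - u, by simpa using hx, x' - x, ?_, ?_⟩
    · exact mem_nine.2 hx'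
    · rw [add_sub_cancel, add_sub_cancel]
      exact hp.mono fun a ha => h a ha.1 ha.2
  set Wu : Set (ℤ × ℤ) := W ∪ {y | nrm (y - u) ≤ r} with hWu
  set cC : V d → Finset (V d) → Set (ℕ × Edge d → Bool) := fun v C => {η | cl Aᶜ (layer j η) v = C} with hcC
  set ex : V d → Finset (V d) → ℤ × ℤ → Prop := fun v C x => (∃ t, (∃ ν, t + nb ν ∉ box v L) ∧ t ∈ C) ∧ ∃ w, w ∈ Bl (u + x) ∧ w ∈ C with hex
  set N : Set (ℕ × Edge d → Bool) := ⋃ v ∈ Bl u, {η | layer j η ∈ {ω | (cl univ ω v).Finite}ᶜ} with hN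
  have hNull : bern P N = 0 := (measure_biUnion_null_iff (Bl u).countable_toSet).2 fun v hv => by
    rw [bern_layer hP meas_cl_finite.compl]
    exact hfin u v hv
  have hcover : SP A W u R ⊆ (⋃ x, ⋃ e ∈ nine, ({_η | nrm x ≤ r} ∩ bad u) ∩ SP A Wu (u + x + e) (R - (nrm x + 1))) ∪ (N ∪
      ⋃ v ∈ Bl u, ⋃ C, ⋃ x, ⋃ e ∈ nine, ({_η | ex v C x} ∩ cC v C) ∩ SP (A ∪ C) W (u + x + e) (R - (nrm x + 1))) := fun η hη => by
    obtain ⟨huW, hb | ⟨v, hv, t, ht, hc⟩⟩ := SPath.head hR hη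
    · obtain ⟨x, hx, e, he, h⟩ := hsplit η hη (fun a => nrm (a - u) ≤ r) (by simp [nrm]) A Wu fun a ha hQ => ⟨fun h => h.elim ha.1 hQ, ha.2⟩
      exact .inl (mem_iUnion.2 ⟨x, mem_iUnion₂.2 ⟨e, he, ⟨by simpa using hx, hb⟩, h⟩⟩)
    · by_cases hinf : (cl univ (layer j η) v).Finite
      swap
      · exact .inr (.inl (mem_iUnion₂.2 ⟨v, hv, hinf⟩))
      have hCfin := hinf.subset (cl_mono (S := (A : Set (V d))ᶜ) (subset_univ _))
      obtain ⟨x, ⟨w, hw, hwC⟩, e, he, h⟩ := hsplit η hη (fun a => ∃ w ∈ Bl a, w ∈ hCfin.toFinset) ⟨v, hv, hCfin.mem_toFinset.2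
          (.refl hc.left.2)⟩ (A ∪ hCfin.toFinset) W fun a ha hQ => ⟨ha.1, ha.2.imp_right fun ⟨v', hv', t', ht', hc'⟩ => ⟨v', hv', t', ht', by
        have hv'C : v' ∉ cl Aᶜ (layer j η) v := fun h => hQ ⟨v', hv', hCfin.mem_toFinset.2 h⟩
        rw [Finset.coe_union, ← sdiff_sdiff, Finite.coe_toFinset]
        refine hc'.ind (.refl ⟨hc'.left, hv'C⟩) fun a b _ hab hb ha => ha.trans (.single hab ha.right ⟨hb, fun hbC => ha.right.2 ?_⟩)
        exact ConnIn.trans hbC (.single hab.symm hb.2 ha.right.1.2)⟩⟩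
      refine .inr (.inr (mem_iUnion₂.2 ⟨v, hv, mem_iUnion.2 ⟨hCfin.toFinset, mem_iUnion.2 ⟨x, mem_iUnion₂.2 ⟨e, he, ⟨⟨⟨t, ht, ?_⟩, w, hw, hwC⟩, ?_⟩, h⟩⟩⟩⟩))
      · exact hCfin.mem_toFinset.2 (hc.mono fun y hy => hy.2)
      · rw [hcC, mem_ofPred_eq, Finite.coe_toFinset]
  refine (measure_mono hcover).trans ((measure_union_le _ _).trans ((add_le_add le_rfl ((measure_union_le _ _).trans (by rw [hNull, zero_add]))).trans ?_))
  have hnsum : ∀ {E : ℤ × ℤ → Set (ℕ × Edge d → Bool)} {c : ENNReal}, (∀ e ∈ nine, bern P (E e) ≤ c) → bern P (⋃ e ∈ nine, E e) ≤ 9 * c := fun h =>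
    (measure_biUnion_finset_le _ _).trans ((sum_le_sum h).trans (by rw [sum_const, card_nine]; simp))
  calc _ ≤ (∑' x, 9 * (qb * ind (nrm x ≤ r) * f (R - (nrm x + 1)))) + ∑ v ∈ Bl u, ∑' C, ∑' x, 9 * (bern P ({_η | ex v C x} ∩ cC v C) * f (R - (nrm x + 1))) := by
        refine add_le_add ((measure_iUnion_le _).trans (tsum_le_tsum fun x => hnsum fun e _ => ?_))
          ((measure_biUnion_finset_le _ _).trans (sum_le_sum fun v hv => (measure_iUnion_le _).trans (tsum_le_tsum fun C =>
            (measure_iUnion_le _).trans (tsum_le_tsum fun x => hnsum fun e _ => ?_))))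
        · by_cases hx : nrm x ≤ r
          · rw [ind_true hx, mul_one, show {_η : ℕ × Edge d → Bool | nrm x ≤ r} = univ from eq_univ_of_forall fun _ => hx, univ_inter,
              bern_inter (hbad u) (dep_sPath_blk hbad) ?_ (mbad u) (mSP _ _ _ _)]
            · exact mul_le_mul' (hq u) (hle _ _ _ _)
            · rw [disjoint_union_right]
              refine ⟨disjoint_iUnion₂_right.2 fun y hy => hJ u y ?_, disjoint_left.2 fun i hi h => hj u i hi h.1⟩
              by_contra hc
              exact hy (.inr (not_lt.1 hc))
          · rw [show {_η : ℕ × Edge d → Bool | nrm x ≤ r} = ∅ from eq_empty_of_forall_notMem fun _ h => hx h]; simp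
        · by_cases hx : ex v C x
          · have hvC : ∀ η ∈ cC v C, v ∈ C := fun η hη => by
              obtain ⟨⟨t, -, ht⟩, -⟩ := hx
              rw [← mem_coe, ← show cl _ _ v = (C : Set (V d)) from hη] at ht ⊢
              exact .refl ht.left
            by_cases hv' : v ∈ C
            swap
            · rw [show cC v C = ∅ from eq_empty_of_forall_notMem fun η h => hv' (hvC η h)]; simp
            have hdC : Dep {i : ℕ × Edge d | i.1 = j ∧ i.2 ∈ edgesIn Aᶜ ∩ touch C} (cC v C) := fun η η' h hη =>
              dep_cl_eq (mem_coe.2 hv') (layer j η) (layer j η') (fun e he => h (j, e) ⟨rfl, he⟩) hη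
            rw [show {_η : ℕ × Edge d → Bool | ex v C x} = univ from eq_univ_of_forall fun _ => hx, univ_inter, bern_inter hdC
              (dep_sPath_blk hbad) ?_ (measurable_layer meas_cl_eq) (mSP _ _ _ _)]
            · exact mul_le_mul_right (hle _ _ _ _) _
            · rw [disjoint_union_right]
              refine ⟨disjoint_iUnion₂_right.2 fun y hy => disjoint_left.2 fun i h hi => hj y i hi h.1, disjoint_left.2 ?_⟩
              rintro i ⟨-, -, a, ha, haC⟩ ⟨-, h⟩
              exact h a ha (by simp [mem_coe.1 haC])
          · rw [show {_η : ℕ × Edge d → Bool | ex v C x} = ∅ from eq_empty_of_forall_notMem fun _ h => hx h]; simp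
    _ ≤ (∑' x, 9 * (qb * ind (nrm x ≤ r) * f (R - (nrm x + 1)))) + ∑' x, 9 * (S x * f (R - (nrm x + 1))) := by
        refine add_le_add le_rfl ?_
        simp_rw [fun v => tsum_comm (f := fun C x => 9 * (bern P ({_η | ex v C x} ∩ cC v C) * f (R - (nrm x + 1))))]
        rw [← tsum_fsum]
        refine tsum_le_tsum fun x => ?_
        simp_rw [tsum_mul_left, tsum_mul_right]
        rw [← mul_sum, ← sum_mul]
        refine mul_le_mul_right (mul_le_mul_left (le_trans (sum_le_sum fun v _ => ?_) (hS u x)) _) _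
        rw [← bern_layer hP ((meas_exists_connIn _).inter (meas_exists_connIn _)), ← measure_iUnion]
        · refine measure_mono (iUnion_subset fun C => ?_)
          rintro η ⟨⟨⟨t, ht, htC⟩, w, hw, hwC⟩, hη⟩
          rw [← mem_coe, ← show cl _ _ v = (C : Set (V d)) from hη] at htC hwC
          exact ⟨⟨t, ht, htC.mono (subset_univ _)⟩, w, hw, hwC.mono (subset_univ _)⟩
        · exact fun C C' hCC => disjoint_left.2 fun η h1 h2 => hCC (coe_injective (h1.2.symm.trans h2.2))
        · exact fun C => (MeasurableSet.const _).inter (measurable_layer meas_cl_eq)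
    _ = _ := by
        rw [← tsum_add]
        exact tsum_congr fun x => by ring

end

section

theorem self_mem_box (v : V d) (L : ℕ) : v ∈ box v L := fun i => by simp

theorem perc_reach_box (v : V d) (L : ℕ) : perc d p {ω | Reach (box v L) ω v} = perc d p {ω | Reach (box 0 L) ω 0} := by
  conv_rhs => rw [← perc_edgeMap (addRight v) (fun x y => (adjacent_add v x y).1) meas_reach]
  congr 1
  ext ω
  have hbox : addRight v ⁻¹' box v L = box 0 L := by ext x; simp [box]
  have h := fun y => connIn_edgeMap (S := box v L) (addRight v) (adjacent_add v) (ω := ω) (x := 0) (y := y)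
  rw [hbox] at h
  simp only [coe_addRight, zero_add] at h
  simp only [mem_ofPred_eq, Reach, ← (addRight v).exists_congr_right (q := fun t => (∃ ν, t + nb ν ∉ box v L) ∧ ConnIn (box v L) ω v t)]
  refine exists_congr fun t => and_congr (exists_congr fun ν => not_congr ?_) (h t).symm
  simp [box, add_right_comm _ (v _)]

/-- The centre of a block. -/
def ctr (d n : ℕ) (u : ℤ × ℤ) : V d := fun i => n * emb d u i

theorem nrm_le_of_mem (hd : 2 ≤ d) {n r r' : ℕ} {a b : ℤ × ℤ} (ha : x ∈ box (ctr d n a) r) (hb : x ∈ box (ctr d n b) r') :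
    n * nrm (a - b) ≤ r + r' := by
  have key : ∀ i, n * (emb d (a - b) i).natAbs ≤ r + r' := fun i => by
    have h1 := abs_le.1 (ha i)
    have h2 := abs_le.1 (hb i)
    rw [emb_sub, ← Int.natAbs_natCast n, ← Int.natAbs_mul, Pi.sub_apply, mul_sub]
    simp only [ctr] at h1 h2
    omega
  have h0 := key ⟨0, by omega⟩
  have h1 := key ⟨1, by omega⟩
  simp only [emb, if_pos, one_ne_zero, if_false] at h0 h1
  rcases max_choice (a - b).1.natAbs (a - b).2.natAbs with h | h <;> rw [nrm, h] <;> assumption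

theorem ctr_mem_box {n r : ℕ} {a b : ℤ × ℤ} (h : nrm (a - b) ≤ r) : ctr d n a ∈ box (ctr d n b) (n * r) := fun i => by
  have h1 := nrm_le.1 h
  have h2 : |emb d a i - emb d b i| ≤ r := by
    simp only [emb]
    split_ifs
    exacts [h1.1, h1.2, by simp]
  simp only [ctr]
  rw [← mul_sub, abs_mul, Nat.abs_cast, Nat.cast_mul]
  exact mul_le_mul_of_nonneg_left h2 (by positivity)

/-- The configurations for which the block at `u` is not good. -/
def badB (d n k : ℕ) (u : ℤ × ℤ) : Set (ℕ × Edge d → Bool) := {η | Good (ctr d n u) n k (layer 1 η) (layer 2 η)}ᶜ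

/-- The vertices of a block. -/
def blB (d n : ℕ) (u : ℤ × ℤ) : Finset (V d) := boxF (ctr d n u) (4 * n)

theorem tsum_ind_nrm_ne_top (r : ℕ) (c : ENNReal) (hc : c ≠ ∞) : ∑' x : ℤ × ℤ, c * ind (nrm x ≤ r) * ((nrm x + 2 : ℕ) : ENNReal) ^ 3 ≠ ∞ := by
  refine (lt_of_le_of_lt (tsum_le_tsum fun x => ?_) (b := ∑' x : ℤ × ℤ, c * ((r + 2 : ℕ) : ENNReal) ^ 7 * (nrm x + 1 : ENNReal)⁻¹ ^ 4) ?_).ne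
  · by_cases h : nrm x ≤ r
    · have h1 : 1 ≤ ((r + 2 : ℕ) : ENNReal) * (nrm x + 1 : ENNReal)⁻¹ := by
        rw [← div_eq_mul_inv, le_div_iff_mul_le (.inl (by simp)) (.inl (by finiteness)), one_mul]
        exact_mod_cast (by omega)
      rw [ind_true h, mul_one, mul_assoc, show 7 = 3 + 4 from rfl, pow_add, mul_assoc, ← mul_pow]
      refine mul_le_mul_right ((pow_le_pow_left' ?_ 3).trans (le_mul_of_one_le_right' (one_le_pow₀ h1))) _
      exact_mod_cast (by omega)
    · simp [ind_false h]
  · rw [tsum_mul_left]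
    exact mul_lt_top (by finiteness) tsum_nrm_ne_top.lt_top

theorem exists_mul_le {c : ENNReal} (hc : c ≠ ∞) : ∃ ε : ℝ, 0 < ε ∧ ofReal ε * c ≤ 1 / 3 := by
  refine ⟨(3 * (c.toReal + 1))⁻¹, by positivity, ?_⟩
  conv_lhs => rw [← ofReal_toReal hc]
  rw [toReal_ofReal toReal_nonneg, ← ofReal_mul (by positivity), show (1 / 3 : ENNReal) = ofReal (1 / 3) by
    rw [ofReal_div_of_pos (by norm_num)]; simp]
  refine ofReal_le_ofReal ?_
  have := toReal_nonneg (a := c)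
  rw [inv_mul_le_iff₀ (by positivity)]; linarith

/-- Chains of blocked sites at the critical point. -/
theorem exists_critical_chain_decay (hd : 2 ≤ d) {pc : ℝ} (hc : IsCrit d pc) {A : ENNReal} (hA : A ≠ ∞)
    (hgg : Decay d pc A) (hphi : ∀ (ν : Dir d) r, phi pc (slabF {ν} r) 0 ≤ 2)
    {q s : ℝ} (hq : pc < q) (hq1 : q ≤ 1) (hs : 0 < s) (hs1 : s ≤ 1) : ∃ n k L : ℕ, 1 ≤ n ∧ k ≤ n ∧ ∀ u R,
      bern (par d pc q s) {η | SPath (Blk (badB d n k) 0 (blB d n) L ∅ ∅ η) u R} ≤ (R + 1 : ENNReal)⁻¹ ^ 3 := by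
  have harm : ∀ ε : ℝ, 0 < ε → ∃ L : ℕ, ∀ v : V d, perc d pc {ω | Reach (box v L) ω v} ≤ ofReal ε := fun ε hε => by
    have h1 : pE pc ≠ 1 := by rw [pE, clamp_of_mem ⟨hc.pos.le, hc.lt_one.le⟩]; simpa using hc.lt_one.ne
    have h0 : pE pc ≠ 0 := by rw [pE, clamp_of_mem ⟨hc.pos.le, hc.lt_one.le⟩]; simpa using hc.pos
    obtain ⟨L, hL⟩ := exists_reach_le h1 h0 (C := 4 * d) (by finiteness) (phi_box_le hphi) (η := ofReal ε) (by simpa using hε)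
    exact ⟨L, fun v => (perc_reach_box v L).trans_le hL⟩
  have hfin : ∀ v : V d, FinCl pc univ v := fun v => by
    rw [FinCl, ae_iff]
    refine le_antisymm (ENNReal.le_of_forall_pos_le_add fun ε hε _ => ?_) zero_le
    obtain ⟨L, hL⟩ := harm ε hε
    rw [zero_add, ← ofReal_coe_nnreal]
    refine (measure_mono fun ω hω => ?_).trans (hL v)
    by_contra hr
    exact hω ((box_finite v L).subset fun t ht => (ConnIn.of_not_reach (self_mem_box v L) hr ht).right)
  obtain ⟨ε₁, hε₁, h1⟩ := exists_mul_le (tsum_ind_nrm_ne_top 12 9 (by norm_num))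
  obtain ⟨n, k, hn, hk, hgood⟩ := exists_good_block hd hc hA hgg hq hq1 hs hs1 hε₁
  set b : ENNReal := (((8 * n + 1) ^ d : ℕ) : ENNReal) with hb
  have hbl : ∀ u, ((blB d n u).card : ENNReal) = b := fun u => by rw [blB, card_boxF, hb]; congr 3; ring
  set D : ENNReal := b * (b * (A * (9 * n : ℕ) ^ 20)) with hD
  have hDsum : ∑' x : ℤ × ℤ, 9 * (D * (nrm x + 1 : ENNReal)⁻¹ ^ 20) * ((nrm x + 2 : ℕ) : ENNReal) ^ 3 ≠ ∞ := by
    refine (lt_of_le_of_lt (tsum_le_tsum fun x => ?_) (b := ∑' x : ℤ × ℤ, 9 * D * 2 ^ 3 * (nrm x + 1 : ENNReal)⁻¹ ^ 4) ?_).ne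
    · have h2 : ((nrm x + 2 : ℕ) : ENNReal) * (nrm x + 1 : ENNReal)⁻¹ ≤ 2 := by
        rw [← div_eq_mul_inv]
        refine div_le_of_le_mul ?_
        exact_mod_cast (by omega)
      have h3 : (nrm x + 1 : ENNReal)⁻¹ ≤ 1 := inv_le_one.2 le_add_self
      calc _ = 9 * D * (((nrm x + 2 : ℕ) : ENNReal) * (nrm x + 1 : ENNReal)⁻¹) ^ 3 * (nrm x + 1 : ENNReal)⁻¹ ^ 17 := by ring
        _ ≤ _ := mul_le_mul' (mul_le_mul_right (pow_le_pow_left' h2 3) _) (pow_le_pow_right_of_le_one' h3 (by norm_num))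
    · rw [tsum_mul_left]
      exact mul_lt_top (by finiteness) tsum_nrm_ne_top.lt_top
  obtain ⟨F, hF⟩ := ((ENNReal.tendsto_tsum_compl_atTop_zero hDsum).eventually_lt_const (show (0 : ENNReal) < 1 / 3 by norm_num)).exists
  obtain ⟨ε₂, hε₂, h2⟩ := exists_mul_le (c := ∑ x ∈ F, 9 * b * ((nrm x + 2 : ℕ) : ENNReal) ^ 3) (sum_ne_top.2 fun _ _ => by finiteness)
  obtain ⟨L, hL⟩ := harm ε₂ hε₂
  refine ⟨n, k, L, hn, hk, chain_decay (J := fun u => {i | (i.1 = 1 ∨ i.1 = 2) ∧ i.2 ∈ edgesIn (box (ctr d n u) (6 * n))}) (r := 12) (p := pc) (qb := ofReal ε₁)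
    (S := fun x => if x ∈ F then b * ofReal ε₂ else D * (nrm x + 1 : ENNReal)⁻¹ ^ 20) (fun u => dep_good.compl) (fun u => meas_good.compl)
    (fun u y huy => ?_) (fun u i hi => by have := hi.1; omega) (fun e => by simp [par]) (fun _ v _ => hfin v)
    (fun u => hgood _ (fun e => by simp [par]) (fun e => by simp [par]) _) (fun u x => ?_) ?_⟩
  · refine disjoint_left.2 fun i hi hi' => ?_
    have := nrm_le_of_mem hd (hi'.2 _ (out_fst_mem _)) (hi.2 _ (out_fst_mem _))
    nlinarith
  · split_ifs with hx
    · refine (sum_le_sum fun v _ => (measure_mono (inter_subset_left.trans ?_)).trans (hL v)).trans (by rw [sum_const, nsmul_eq_mul, hbl])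
      rintro ω ⟨t, ht, hc⟩
      by_contra hr
      exact hr ⟨t, ht, hc.of_not_reach (self_mem_box v L) hr⟩
    · rw [hD, mul_assoc, mul_assoc, ← hbl u, ← nsmul_eq_mul, ← sum_const]
      refine sum_le_sum fun v hv => (measure_mono inter_subset_right).trans ?_
      rw [hbl u, ← hbl (u + x), ← nsmul_eq_mul, ← sum_const]
      refine le_trans (measure_mono ?_) ((measure_biUnion_finset_le (blB d n (u + x)) fun w => {ω | ConnIn univ ω v w}).trans (sum_le_sum fun w hw => ?_))
      · rintro ω ⟨w, hw, h⟩
        exact mem_iUnion₂.2 ⟨w, hw, h⟩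
      · refine (le_of_eq (tau_univ_eq v w)).trans (le_nrm_of_coord hd fun i => ?_)
        rw [← gg_one, mul_assoc, ← mul_pow]
        refine ((gg_mono 1 _).trans (hgg _ i)).trans (mul_le_mul_right (pow_le_pow_left' (inv_le_mul_inv ?_) 20) _)
        have h1 := abs_le.1 (mem_boxF.1 hv i)
        have h2 := abs_le.1 (mem_boxF.1 hw i)
        have h3 : emb d (u + x) i - emb d u i = emb d x i := by rw [← Pi.sub_apply, ← emb_sub, add_sub_cancel_left]
        have h4 : n * (emb d x i).natAbs ≤ (w i - v i).natAbs + 8 * n := by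
          rw [← Int.natAbs_natCast n, ← Int.natAbs_mul, ← h3, mul_sub]
          simp only [ctr] at h1 h2
          push_cast at h1 h2 ⊢
          omega
        have h5 := Nat.le_mul_of_pos_left (w i - v i).natAbs hn
        have h6 : (emb d x i).natAbs ≤ (w i - v i).natAbs + 8 := Nat.le_of_mul_le_mul_left (h4.trans (by linarith)) hn
        rw [Pi.sub_apply, mul_assoc, Nat.mul_succ]
        omega
  · calc _ = ofReal ε₁ * (∑' x : ℤ × ℤ, 9 * ind (nrm x ≤ 12) * ((nrm x + 2 : ℕ) : ENNReal) ^ 3) +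
          ∑' x, (if x ∈ F then ofReal ε₂ * (9 * b * ((nrm x + 2 : ℕ) : ENNReal) ^ 3) else 9 * (D * (nrm x + 1 : ENNReal)⁻¹ ^ 20) * ((nrm x + 2 : ℕ) : ENNReal) ^ 3) := by
          rw [← tsum_mul_left, ← tsum_add]
          refine tsum_congr fun x => ?_
          split_ifs <;> ring
      _ ≤ 1 / 3 + (1 / 3 + 1 / 3) := by
          refine add_le_add h1 ?_
          rw [← ENNReal.sum_add_tsum_compl F]
          refine add_le_add ?_ ?_
          · rw [sum_ext fun x hx => if_pos hx, ← mul_sum]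
            exact h2
          · refine le_trans (le_of_eq (tsum_congr fun x => if_neg fun h => x.2 (mem_coe.2 h))) hF.le
      _ = 1 := by rw [← add_assoc, ENNReal.add_thirds]

end

section
open Relation

theorem SPath.trunc {B : ℤ × ℤ → Prop} {u : ℤ × ℤ} {R : ℕ} (h : SPath B u R) : SPath (fun a => B a ∧ nrm (a - u) ≤ R) u R := by
  by_contra hno
  obtain ⟨y, hy, h⟩ := h
  have key : nrm (y - u) < R ∧ ReflTransGen (fun a b => nrm (b - a) ≤ 1 ∧ (B a ∧ nrm (a - u) ≤ R) ∧ B b ∧ nrm (b - u) ≤ R) u y := by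
    clear hy
    induction h with
    | refl => exact ⟨not_le.1 fun h => hno ⟨u, h, .refl⟩, .refl⟩
    | @tail b c _ hbc ih =>
      have h1 := nrm_sub_le c b u
      have h2 := ih.2.tail (c := c) ⟨hbc.1, ⟨hbc.2.1, by omega⟩, hbc.2.2, by omega⟩
      exact ⟨not_le.1 fun h => hno ⟨c, h, h2⟩, h2⟩
  omega

/-- The sites of a cell. -/
def cell (R : ℕ) (w : ℤ × ℤ) : Finset (ℤ × ℤ) :=
  (Finset.Ico (0 : ℤ) R ×ˢ Finset.Ico (0 : ℤ) R).image fun c => (R * w.1 + c.1, R * w.2 + c.2)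

/-- A long path visits many cells from which a path of the size of the cell starts. -/
theorem SPath.coarse {B : ℤ × ℤ → Prop} {u : ℤ × ℤ} {R a : ℕ} (hR : 1 ≤ R) (ha : 2 * R ≤ a) (h : SPath B u a) :
    SPath (fun w => ∃ x ∈ cell R w, SPath B x R) (u.1 / R, u.2 / R) (a / R - 1) := by
  have hR' : (0 : ℤ) < R := mod_cast hR
  set g : ℤ × ℤ → ℤ × ℤ := fun x => (x.1 / R, x.2 / R) with hg
  obtain ⟨y, hy, h⟩ := h
  have hcell : ∀ x, x ∈ cell R (g x) := fun x => by
    refine Finset.mem_image.2 ⟨(x.1 % R, x.2 % R), ?_, by simp only [hg, Int.mul_ediv_add_emod]⟩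
    simp only [mem_product, Finset.mem_Ico]
    exact ⟨⟨Int.emod_nonneg _ hR'.ne', Int.emod_lt_of_pos _ hR'⟩, Int.emod_nonneg _ hR'.ne', Int.emod_lt_of_pos _ hR'⟩
  have hstep : ∀ x z, nrm (x - z) ≤ 1 → nrm (g x - g z) ≤ 1 := fun x z hxz => by
    have key : ∀ x z : ℤ, x ≤ z + 1 → x / R < z / R + 2 := fun x z h => by
      have := Int.lt_ediv_add_one_mul_self z hR'
      rw [Int.ediv_lt_iff_lt_mul hR']
      linarith
    simp only [nrm_le, abs_le, Prod.fst_sub, Prod.snd_sub, Nat.cast_one] at hxz ⊢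
    have := key x.1 z.1; have := key z.1 x.1; have := key x.2 z.2; have := key z.2 x.2
    simp only [hg]
    omega
  have hdist : nrm (y - u) ≤ R * (nrm (g y - g u) + 1) := by
    have key : ∀ (x z : ℤ) (D : ℕ), |x / R - z / R| ≤ D → |x - z| ≤ R * (D + 1) := fun x z D h => by
      have h1 := mul_le_mul_of_nonneg_left h hR'.le
      rw [← abs_of_pos hR', ← abs_mul, abs_of_pos hR', mul_sub, abs_le] at h1
      have := Int.lt_ediv_add_one_mul_self z hR'; have := Int.lt_ediv_add_one_mul_self x hR'
      have := Int.ediv_mul_le z hR'.ne'; have := Int.ediv_mul_le x hR'.ne'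
      rw [abs_le]
      constructor <;> linarith
    have h1 := nrm_le.1 (le_refl (nrm (g y - g u)))
    rw [nrm_le]; push_cast
    exact ⟨key _ _ _ h1.1, key _ _ _ h1.2⟩
  have hsym : ∀ x z, Link B x z → Link B z x :=
    fun x z h => h.swap.lift id fun a b hab => ⟨by rw [← neg_sub, nrm_neg]; exact hab.1, hab.2.2, hab.2.1⟩
  have harm : ∀ x, Link B u x → Link B x y →
      SPath B x R := fun x h1 h2 => by
    by_cases hx : R ≤ nrm (y - x)
    · exact ⟨y, hx, h2⟩
    · refine ⟨u, ?_, hsym _ _ h1⟩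
      have := nrm_sub_le y x u
      rw [← neg_sub, nrm_neg]; omega
  refine ⟨g y, ?_, ?_⟩
  · have := Nat.div_le_of_le_mul (hy.trans hdist)
    exact Nat.sub_le_of_le_add this
  · have key : ∀ x, Link B u x → Link B x y →
        ReflTransGen (fun a b => nrm (b - a) ≤ 1 ∧ (∃ x ∈ cell R a, SPath B x R) ∧ ∃ x ∈ cell R b, SPath B x R) (g u) (g x) := fun x h1 => by
      induction h1 with
      | refl => exact fun _ => .refl
      | tail hb hbc ih => exact fun hc => (ih (hc.head hbc)).tail ⟨hstep _ _ hbc.1, ⟨_, hcell _, harm _ hb (hc.head hbc)⟩, _, hcell _, harm _ (hb.tail hbc) hc⟩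
    exact key y h .refl

/-- Continuity of local events in the parameters. -/
theorem bern_le_add {ι : Type*} {P Q : ι → ℝ} {F : Finset ι} {A : Set (ι → Bool)} (hA : Dep (F : Set ι) A) {t : ℝ}
    (h : ∀ i ∈ F, Q i ≤ P i ∧ P i - Q i ≤ t) : bern P A ≤ bern Q A + F.card * ofReal t := by
  have mA := meas_of_dep hA
  rw [← unif_map, ← unif_map, map_apply (measurable_threshold P) mA, map_apply (measurable_threshold Q) mA]
  refine (measure_mono (t := _ ∪ ⋃ i ∈ F, (fun u => u i) ⁻¹' Ioc (Q i) (P i)) fun u hu => ?_).trans ((measure_union_le _ _).trans (add_le_add le_rfl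
    ((measure_biUnion_finset_le _ _).trans ((sum_le_card_nsmul _ _ (ofReal t) fun i hi => ?_).trans (nsmul_eq_mul _ _).le))))
  · by_cases hex : ∃ i ∈ F, u i ∈ Ioc (Q i) (P i)
    · obtain ⟨i, hi, hu⟩ := hex
      exact .inr (mem_iUnion₂.2 ⟨i, hi, hu⟩)
    · refine .inl (hA _ _ (fun i hi => decide_eq_decide.2 ⟨fun hP => not_lt.1 fun hQ => hex ⟨i, hi, hQ, hP⟩, fun hQ => hQ.trans (h i hi).1⟩) hu)
  · rw [unif, (measurePreserving_eval_infinitePi _ i).measure_preimage measurableSet_Ioc.nullMeasurableSet]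
    exact (Measure.restrict_apply_le _ _).trans (by rw [Real.volume_Ioc]; exact ofReal_le_ofReal (h i hi).2)

/-- The site `u` is blocked. -/
abbrev Bk (d n k L : ℕ) (η : ℕ × Edge d → Bool) (u : ℤ × ℤ) : Prop := Blk (badB d n k) 0 (blB d n) L ∅ ∅ η u

theorem dep_bk {n k L : ℕ} {u : ℤ × ℤ} : Dep {i | i.1 ≤ 2 ∧ i.2 ∈ edgesIn (box (ctr d n u) (6 * n + L))} {η | Bk d n k L η u} := by
  rintro η η' h ⟨hu, hb⟩
  refine ⟨hu, hb.imp (dep_good.compl η η' fun i hi => h i ⟨by have := hi.1; omega, fun x hx => box_mono (by omega) (hi.2 x hx)⟩) ?_⟩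
  rintro ⟨v, hv, t, ht, hc⟩
  exact ⟨v, hv, t, ht, hc.congr fun e he => h (0, e) ⟨by simp, fun x hx => box_mono (by omega) (mem_box_trans (he x hx).1 (mem_boxF.1 hv))⟩⟩

theorem dep_cell {n k L R : ℕ} (hn : 1 ≤ n) (hR : L + 6 ≤ R) (w : ℤ × ℤ) :
    Dep {i | i.1 ≤ 2 ∧ i.2 ∈ edgesIn (box (ctr d (n * R) w) (3 * (n * R)))} {η | ∃ x ∈ cell R w, SPath (Bk d n k L η) x R} := by
  rintro η η' h ⟨x, hx, hp⟩
  refine ⟨x, hx, hp.trunc.mono fun a ⟨ha, hn⟩ => dep_bk η η' (fun i hi => h i ⟨hi.1, fun y hy => ?_⟩) ha⟩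
  have hx' : ctr d n x ∈ box (ctr d (n * R) w) (n * R) := by
    obtain ⟨c, hc, rfl⟩ := Finset.mem_image.1 hx
    simp only [mem_product, Finset.mem_Ico] at hc
    have := ctr_mem_box (d := d) (n := n) (r := R) (a := (R * w.1 + c.1, R * w.2 + c.2)) (b := (R * w.1, R * w.2))
      (nrm_le.2 (by simp only [Prod.mk_sub_mk, abs_le]; omega))
    convert this using 2
    ext i
    simp only [ctr, emb]
    split_ifs <;> push_cast <;> ring
  refine box_mono ?_ (mem_box_trans (hi.2 y hy) (mem_box_trans (ctr_mem_box hn) hx'))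
  nlinarith

/-- Chains of blocked sites slightly above the critical point. -/
theorem exists_chain_decay (hd : 2 ≤ d) {pc : ℝ} (hc : IsCrit d pc) {A : ENNReal} (hA : A ≠ ∞)
    (hgg : Decay d pc A) (hphi : ∀ (ν : Dir d) r, phi pc (slabF {ν} r) 0 ≤ 2)
    {q s : ℝ} (hq : pc < q) (hq1 : q ≤ 1) (hs : 0 < s) (hs1 : s ≤ 1) : ∃ (p : ℝ) (n k L R : ℕ), pc < p ∧ p < 1 ∧ 1 ≤ n ∧ k ≤ n ∧ ∀ u a, 2 * R ≤ a →
      bern (par d p q s) {η | SPath (Bk d n k L η) u a} ≤ ((2 * R : ℕ) * (a + 1 : ENNReal)⁻¹) ^ 3 := by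
  obtain ⟨n, k, L, hn, hk, hmic⟩ := exists_critical_chain_decay hd hc hA hgg hphi hq hq1 hs hs1
  obtain ⟨ε, hε, h1⟩ := exists_mul_le (tsum_ind_nrm_ne_top 6 9 (by norm_num))
  obtain ⟨R₀, hR₀⟩ := exists_nat_gt (2 / ε)
  set R := L + 6 + R₀ with hR
  have hR1 : 1 ≤ R := by omega
  have hinv : (R + 1 : ENNReal)⁻¹ ≤ ofReal (ε / 2) := by
    rw [ENNReal.inv_le_iff_inv_le, ← ofReal_inv_of_pos (by positivity), inv_div]
    refine (ofReal_le_ofReal hR₀.le).trans ?_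
    rw [ofReal_natCast]
    exact_mod_cast (by omega)
  set F : ℤ × ℤ → Finset (ℕ × Edge d) := fun w => Finset.range 3 ×ˢ edgesOf (boxF (ctr d (n * R) w) (3 * (n * R))) with hF
  set c : ℕ := 3 * ((2 * (3 * (n * R)) + 1) ^ d * (d * 2)) with hcdef
  have hFc : ∀ w, (F w).card ≤ c := fun w => by
    rw [hF, card_product, Finset.card_range]
    refine Nat.mul_le_mul_left _ (card_image_le.trans ?_)
    rw [card_product, card_boxF]; simp
  set t := min (ε / 2 / (c + 1)) ((1 - pc) / 2) with ht
  have ht0 : 0 < t := lt_min (by positivity) (by linarith [hc.lt_one])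
  set MB : ℤ × ℤ → Set (ℕ × Edge d → Bool) := fun w => {η | ∃ x ∈ cell R w, SPath (Bk d n k L η) x R} with hMB
  have hdep := fun w => dep_cell (d := d) (k := k) hn (show L + 6 ≤ R by omega) w
  have hdepF : ∀ w, Dep (F w : Set (ℕ × Edge d)) (MB w) := fun w => dep_edges (hdep w)
  have hpc : ∀ w, bern (par d pc q s) (MB w) ≤ ofReal (ε / 2) := fun w => by
    calc _ ≤ bern (par d pc q s) (⋃ x ∈ cell R w, {η | SPath (Bk d n k L η) x R}) := measure_mono (by rintro η ⟨x, hx, h⟩; exact mem_iUnion₂.2 ⟨x, hx, h⟩)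
      _ ≤ (cell R w).card * (R + 1 : ENNReal)⁻¹ ^ 3 := (measure_biUnion_finset_le _ _).trans ((sum_le_card_nsmul _ _ _ fun x _ => hmic x R).trans (nsmul_eq_mul _ _).le)
      _ ≤ (R * R : ℕ) * (R + 1 : ENNReal)⁻¹ ^ 3 := by
          refine mul_le_mul_left (Nat.cast_le.2 (card_image_le.trans ?_)) _
          simp
      _ = (R * (R + 1 : ENNReal)⁻¹) ^ 2 * (R + 1 : ENNReal)⁻¹ := by push_cast; ring
      _ ≤ 1 * ofReal (ε / 2) := by
          refine mul_le_mul' (pow_le_one' ?_ 2) hinv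
          rw [← div_eq_mul_inv]
          exact div_le_of_le_mul (by rw [one_mul]; exact le_self_add)
      _ = _ := one_mul _
  refine ⟨pc + t, n, k, L, R, by linarith, by linarith [min_le_right (ε / 2 / (c + 1)) ((1 - pc) / 2), hc.lt_one], hn, hk, fun u a ha => ?_⟩
  have hp : ∀ w, bern (par d (pc + t) q s) (MB w) ≤ ofReal ε := fun w => by
    refine (bern_le_add (hdepF w) (Q := par d pc q s) (t := t) fun i _ => ?_).trans ?_
    · unfold par; split_ifs <;> constructor <;> linarith
    · rw [← add_halves ε, ofReal_add (by positivity) (by positivity)]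
      refine add_le_add (hpc w) ((mul_le_mul_left (Nat.cast_le.2 (hFc w)) _).trans ?_)
      rw [← ofReal_natCast, ← ofReal_mul (by positivity)]
      refine ofReal_le_ofReal ((mul_le_mul_of_nonneg_left (min_le_left _ _) (by positivity)).trans ?_)
      rw [mul_div_assoc', div_le_iff₀ (by positivity)]
      nlinarith
  have hmac := chain_decay (bad := MB) (J := fun w => {i | i.1 ≤ 2 ∧ i.2 ∈ edgesIn (box (ctr d (n * R) w) (3 * (n * R)))}) (r := 6) (j := 7) (L := 0)
    (Bl := fun _ => ∅) (P := par d (pc + t) q s) (p := s) (qb := ofReal ε) (S := fun _ => 0) hdep (fun w => meas_of_dep (hdepF w))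
    (fun w y hwy => disjoint_left.2 fun i hi hi' => by
      have := nrm_le_of_mem hd (hi'.2 _ (out_fst_mem _)) (hi.2 _ (out_fst_mem _))
      nlinarith [Nat.mul_pos hn hR1]) (fun u i hi => by have := hi.1; omega) (fun e => by simp [par]) (by simp) hp (by simp) (by
      refine le_trans (le_of_eq ?_) (h1.trans (by norm_num))
      rw [← tsum_mul_left]
      exact tsum_congr fun x => by ring) (u.1 / R, u.2 / R) (a / R - 1)
  refine ((measure_mono ?_).trans hmac).trans (pow_le_pow_left' (inv_le_mul_inv ?_) 3)
  · exact fun η hη => (SPath.coarse hR1 ha hη).mono fun w hw => ⟨notMem_empty _, .inl hw⟩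
  · have h2 : 2 ≤ a / R := (Nat.le_div_iff_mul_le hR1).2 ha
    have h3 := Nat.lt_mul_div_succ a hR1
    rw [Nat.sub_add_cancel (by omega)]
    nlinarith

end

section
open Relation

/-- The union of two layers. -/
def both (η : ℕ × Edge d → Bool) : Config d := fun e => layer 1 η e || layer 2 η e

/-- An unbounded open path of blocks carries a long path of vertices without arms. -/
theorem exists_escape (hd : 2 ≤ d) {n k L K M : ℕ} {η : ℕ × Edge d → Bool} (hn : 1 ≤ n) (hk : k ≤ n) (hM : n * (K + 1) + n ≤ M)
    (hinf : ¬ {v | Escape K (Bk d n k L η) v}.Finite) :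
    ∃ v ∈ box (0 : V d) (n * (K + 1) + n), ∃ t, (∃ ν, t + nb ν ∉ box 0 M) ∧
      ConnIn ({x | ¬ Arm ∅ L (layer 0 η) x} ∩ box 0 M) (both η) v t := by
  have h0 : ctr d n 0 = 0 := by ext i; simp [ctr, emb]
  have key : ∀ v, Escape K (Bk d n k L η) v → nrm v ≤ K ∨
      ∃ w ∈ box (0 : V d) (n * (K + 1) + n), ∃ w' ∈ box (ctr d n v) n, Reach (box (ctr d n v) (6 * n)) (layer 1 η) w' ∧
        ConnIn {x | ¬ Arm ∅ L (layer 0 η) x} (both η) w w' := fun v hv => by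
    induction hv with
    | refl => exact .inl (by simp [nrm])
    | @tail a b _ hab ih =>
      refine or_iff_not_imp_left.2 fun hbK => ?_
      obtain ⟨hb, hbB⟩ := hab
      have hB := hbB.resolve_left hbK
      simp only [Bk, Blk, notMem_empty, not_false_eq_true, true_and, not_or, badB, not_exists, not_and] at hB
      obtain ⟨hg, hU⟩ := hB
      replace hg := not_not.1 hg
      obtain ⟨w', hw', hr⟩ := hg.1 _ (self_mem_box _ _)
      have hab : nrm (a - b) ≤ 1 := by
        rw [nrm_le, abs_le, abs_le]
        simp only [Adjacent₂, Prod.fst_sub, Prod.snd_sub] at hb ⊢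
        have := abs_nonneg (a.1 - b.1); have := abs_nonneg (a.2 - b.2)
        have := neg_abs_le (a.1 - b.1); have := neg_abs_le (a.2 - b.2); have := le_abs_self (a.1 - b.1); have := le_abs_self (a.2 - b.2)
        push_cast; omega
      have hba : nrm (b - a) ≤ 1 := by rwa [← nrm_neg, neg_sub]
      have hw2 := box_mono hk hw'
      have hU' : box (ctr d n b) (4 * n) ⊆ {x | ¬ Arm ∅ L (layer 0 η) x} := fun x hx => by simpa using hU x (mem_boxF.2 hx)
      rcases ih with ha | ⟨w, hw, x, hx, hxr, hc⟩
      · refine ⟨w', mem_box_trans hw2 ?_, w', hw2, hr, .refl (hU' (box_mono (by omega) hw2))⟩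
        rw [← h0]
        refine ctr_mem_box ?_
        have := nrm_sub_le b a 0
        simp only [sub_zero] at this ⊢; omega
      · have hcab := ctr_mem_box (d := d) (n := n) hab
        have hcba := ctr_mem_box (d := d) (n := n) hba
        have hx2 : x ∈ box (ctr d n b) (2 * n) := box_mono (by omega) (mem_box_trans hx hcab)
        exact ⟨w, hw, w', hw2, hr, hc.trans ((hg.2 x hx2 w' (box_mono (by omega) hw2)
          (hxr.anti (fun y hy => box_mono (by omega) (mem_box_trans hy hcba)) (box_mono (by omega) hx2))
          (hr.anti (box_mono (by omega)) (box_mono (by omega) hw2))).mono hU')⟩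
  obtain ⟨v, hv, hvn⟩ : ∃ v, Escape K (Bk d n k L η) v ∧ max K (M + 1) < nrm v := by
    by_contra! hc
    refine hinf ((Set.finite_Icc (-((max K (M + 1) : ℕ) : ℤ), -((max K (M + 1) : ℕ) : ℤ)) (((max K (M + 1) : ℕ) : ℤ), ((max K (M + 1) : ℕ) : ℤ))).subset fun v hv => ?_)
    obtain ⟨h1, h2⟩ := nrm_le.1 (hc v hv)
    exact ⟨⟨(abs_le.1 h1).1, (abs_le.1 h2).1⟩, (abs_le.1 h1).2, (abs_le.1 h2).2⟩
  obtain ⟨w, hw, w', hw', -, hc⟩ := (key v hv).resolve_left (by omega)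
  have hM' : w' ∉ box 0 M := fun h => by
    rw [← h0] at h
    have := nrm_le_of_mem hd hw' h
    rw [sub_zero] at this
    nlinarith [(le_max_right K (M + 1)).trans_lt hvn]
  exact ⟨w, hw, (hc.inter_or_exit (box_mono hM hw)).resolve_left fun h => hM' h.right.2⟩

theorem measurable_both : Measurable (both (d := d)) := measurable_pi_lambda _ fun e => measurable_to_bool (by
  have : (fun η : ℕ × Edge d → Bool => both η e) ⁻¹' {true} = {η | η (1, e) = true} ∪ {η | η (2, e) = true} := by ext; simp [both, layer]
  rw [this]
  exact (meas_coord _ _).union (meas_coord _ _))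

theorem bern_both {P : ℕ × Edge d → ℝ} {q s : ℝ} (hq : q ∈ Icc (0 : ℝ) 1) (hs : s ∈ Icc (0 : ℝ) 1) (h1 : ∀ e, P (1, e) = q) (h2 : ∀ e, P (2, e) = s)
    (mA : MeasurableSet A) : bern P {η | both η ∈ A} = perc d (1 - (1 - q) * (1 - s)) A := by
  have h0 : 0 ≤ (1 - q) * (1 - s) := mul_nonneg (sub_nonneg.2 hq.2) (sub_nonneg.2 hs.2)
  rw [perc, ← eq_bern (μ := (bern P).map both) (fun _ => ⟨by nlinarith [hq.1, hs.1, hq.2, hs.2], by linarith⟩) fun t f => ?_, map_apply measurable_both mA]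
  · rfl
  have hdep : ∀ t : Finset (Edge d), Dep {i : ℕ × Edge d | i.2 ∈ t} {η | ∀ e ∈ t, both η e = f e} := fun t ω ω' h hω e he => by
    rw [both, layer, layer, ← h (1, e) he, ← h (2, e) he]; exact hω e he
  have mt : ∀ t : Finset (Edge d), MeasurableSet {ω : Config d | ∀ e ∈ t, ω e = f e} := fun t =>
    meas_of_dep (F := t) fun ω ω' h hω e he => by rw [← h e he, hω e he]
  rw [map_apply measurable_both (mt t)]
  change bern P {η | ∀ e ∈ t, both η e = f e} = _
  induction t using induction_on with
  | empty => simp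
  | insert a t ha ih =>
    have hset : {η : ℕ × Edge d → Bool | ∀ e ∈ insert a t, both η e = f e} = {η | ∀ e ∈ ({a} : Finset (Edge d)), both η e = f e} ∩ {η | ∀ e ∈ t, both η e = f e} := by
      ext; simp
    rw [prod_insert ha, ← ih, hset, bern_inter (hdep _) (hdep t) (disjoint_left.2 fun i hi hi' => ha (by rwa [← Finset.mem_singleton.1 hi]))
      (measurable_both (mt _)) (measurable_both (mt t))]
    congr 1
    have hF : bern P {η | both η a = false} = ofReal ((1 - q) * (1 - s)) := by
      have hb : ∀ i, bern P {η | η i = false} = ofReal (1 - clamp (P i)) := fun i => by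
        rw [show {η : ℕ × Edge d → Bool | η i = false} = {η | η i = true}ᶜ by ext; simp, prob_compl_eq_one_sub (meas_coord i true), bern_true,
          ofReal_sub _ (clamp_mem _).1, ofReal_one]
      have := bern_forall_eq (P := P) {(1, a), (2, a)} false
      rw [Finset.prod_pair (by simp), hb, hb, h1, h2, clamp_of_mem hq, clamp_of_mem hs, ← ofReal_mul (sub_nonneg.2 hq.2)] at this
      rw [← this]; congr 1; ext; simp [both, layer]
    simp only [Finset.mem_singleton, forall_eq]
    cases hf : f a
    · rw [hF]; simp [bernoulliCyl]
    · rw [show {η : ℕ × Edge d → Bool | both η a = true} = {η | both η a = false}ᶜ by ext; simp,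
        prob_compl_eq_one_sub (s := {η | both η a = false}) (measurable_both (meas_coord a false)), hF]
      simp [bernoulliCyl, ofReal_sub, h0]

/-- Outside the region explored by the first layer, the second configuration is still independent. -/
theorem bern_lost_le {P : ℕ × Edge d → ℝ} {p q s r : ℝ} (hq : q ∈ Icc (0 : ℝ) 1) (hs : s ∈ Icc (0 : ℝ) 1) (h0 : ∀ e, P (0, e) = p) (h1 : ∀ e, P (1, e) = q)
    (h2 : ∀ e, P (2, e) = s) (hr : 1 - (1 - q) * (1 - s) ≤ r) {Λ : Finset (V d)} {E : Finset (V d) → Set (Config d)}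
    (hE : ∀ S : Finset (V d), Dep (edgesIn S) (E S)) (mE : ∀ S, MeasurableSet (E S)) (iE : ∀ S, Incr (E S)) :
    MeasurableSet {u : Edge d → ℝ | level r u ∈ E (lost Λ (level p u))} ∧
      bern P {η | (both η) ∈ E (lost Λ (layer 0 η))} ≤ unif (Edge d) {u | level r u ∈ E (lost Λ (level p u))} := by
  have hm : ∀ r : ℝ, Measurable (level (d := d) r) := fun r => measurable_threshold fun _ => r
  have hl : ∀ (r : ℝ) {A : Set (Config d)}, MeasurableSet A → unif (Edge d) (level r ⁻¹' A) = perc d r A := fun r A mA => by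
    rw [perc, ← unif_map]; exact (map_apply (hm r) mA).symm
  have hset : {u : Edge d → ℝ | level r u ∈ E (lost Λ (level p u))} = ⋃ S ∈ Λ.powerset, level p ⁻¹' {ω | lost Λ ω = S} ∩ level r ⁻¹' E S := by
    ext u
    simp only [mem_iUnion₂, mem_ofPred_eq]
    exact ⟨fun h => ⟨_, Finset.mem_powerset.2 (filter_subset _ _), rfl, h⟩, fun ⟨S, _, h, h'⟩ => by rw [show lost Λ (level p u) = S from h]; exact h'⟩
  have mS : ∀ S, MeasurableSet (level p ⁻¹' {ω | lost Λ ω = S} ∩ level r ⁻¹' E S) := fun S => (hm p meas_lost).inter (hm r (mE S))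
  refine ⟨hset ▸ measurableSet_biUnion _ fun S _ => mS S, ?_⟩
  rw [hset, measure_biUnion_finset (fun S _ S' _ h => disjoint_left.2 fun u h1 h2 => h (h1.1.symm.trans h2.1)) fun S _ => mS S]
  refine (measure_mono (t := ⋃ S ∈ Λ.powerset, {η | layer 0 η ∈ {ω | lost Λ ω = S}} ∩ {η | (both η) ∈ E S}) fun η hη => ?_).trans
    ((measure_biUnion_finset_le _ _).trans (sum_le_sum fun S _ => ?_))
  · exact mem_iUnion₂.2 ⟨_, Finset.mem_powerset.2 (filter_subset _ _), rfl, hη⟩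
  · rw [unif, infinitePi_inter_of_dep _ (J := edgesIn Λ ∩ touch ((S : Set (V d))ᶜ)) (K := edgesIn S) ?_ ?_ ?_
      (hm p meas_lost) (hm r (mE S)), ← unif, hl p meas_lost, hl r (mE S)]
    · rw [bern_inter (A := {η | layer 0 η ∈ {ω | lost Λ ω = S}}) (B := {η | both η ∈ E S}) (J := {i : ℕ × Edge d | i.1 = 0}) (K := {i | i.1 ≠ 0}) ?_ ?_ (disjoint_left.2 fun i hi hi' => hi' hi) (measurable_layer meas_lost)
        (measurable_both (mE S)), bern_layer h0 meas_lost, bern_both hq hs h1 h2 (mE S)]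
      · exact mul_le_mul_right (bern_mono (fun _ => hr) (iE S) (mE S)) _
      · exact fun η η' h hη => by rwa [mem_ofPred_eq, ← show layer 0 η = layer 0 η' from funext fun e => h (0, e) rfl]
      · exact fun η η' h hη => by
          rwa [mem_ofPred_eq, ← show both η = both η' from funext fun e => by simp only [both, layer, h (1, e) one_ne_zero, h (2, e) two_ne_zero]]
    · exact fun u u' h hu => dep_lost _ _ (fun e he => by simp only [level, h e he]) hu
    · exact fun u u' h hu => hE S _ _ (fun e he => by simp only [level, h e he]) hu
    · rw [disjoint_left]
      rintro e ⟨-, v, hv, hvS⟩ h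
      exact hvS (h v hv)

/-- For all sufficiently large `d` and every `ε > 0` with
`p_c(d) + ε ≤ 1`, there is `p ∈ (p_c(d), 1)` such that, under the monotone coupling,
almost surely removing all edges touching `𝒞∞(ω_p)` from `ω_{p_c + ε}` leaves an
infinite open cluster. -/
theorem thin_minus_thinner_percolates :
    ∃ d₀ : ℕ, ∀ d : ℕ, d₀ ≤ d →
      ∀ P : ℝ → Measure (Config d), (∀ p ∈ Icc (0 : ℝ) 1, IsBernoulli d p (P p)) →
        ∀ U : Measure (Edge d → ℝ), IsUniform d U →
          ∀ ε : ℝ, 0 < ε → pcOf d P + ε ≤ 1 →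
            ∃ p : ℝ, pcOf d P < p ∧ p < 1 ∧
              U {u | HasInfCluster
                  (closeOn (Cinf (level p u)) (level (pcOf d P + ε) u))} = 1 := by
  obtain ⟨d₀, hd₀, hdecay⟩ := exists_critical_decay
  refine ⟨d₀, fun d hd P hP U hU ε hε hε1 => ?_⟩
  have hc : IsCrit d (pcOf d P) := isCrit_pcOf (by omega) hP (by linarith)
  set pc := pcOf d P
  obtain ⟨⟨A, hA, hgg⟩, hphi⟩ := hdecay d hd pc hc
  have hpc := hc.pos
  obtain ⟨p, n, k, L, R, hp, hp1, hn, hk, hdec⟩ := exists_chain_decay (hd₀.trans hd) hc hA hgg hphi (q := pc + ε / 2) (s := ε / 2)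
    (by linarith) (by linarith) (by linarith) (by linarith)
  have := hU.1
  rw [eq_unif hU.2]
  refine ⟨p, hp, hp1, le_antisymm prob_le_one (ENNReal.le_of_forall_pos_le_add fun δ hδ _ => ?_)⟩
  have hsum : ∑' a : ℕ, ((2 * R : ℕ) * (a + 1 : ENNReal)⁻¹) ^ 3 ≠ ∞ := by
    refine (lt_of_le_of_lt (tsum_le_tsum fun a => ?_) (b := ∑' a : ℕ, ((2 * R : ℕ) : ENNReal) ^ 3 * (a + 1 : ENNReal)⁻¹ ^ 2) ?_).ne
    · rw [mul_pow]
      exact mul_le_mul_right (pow_le_pow_right_of_le_one' (inv_le_one.2 le_add_self) (by norm_num)) _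
    · rw [tsum_mul_left]
      exact mul_lt_top (by finiteness) (tsum_inv_sq_le.trans_lt (by norm_num))
  obtain ⟨K', hK', hKR⟩ := (((ENNReal.tendsto_sum_nat_add _ hsum).eventually_lt_const (show (0 : ENNReal) < δ by exact_mod_cast hδ)).and
    (eventually_ge_atTop (2 * R + 1))).exists
  obtain ⟨K, rfl⟩ : ∃ K, K' = K + 1 := ⟨K' - 1, by omega⟩
  set Q : Set (ℕ × Edge d → Bool) := ⋃ a : ℕ, {η | SPath (Bk d n k L η) (((a + (K + 1) : ℕ) : ℤ), 0) (a + (K + 1))} with hQ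
  have hQδ : bern (par d p (pc + ε / 2) (ε / 2)) Q ≤ δ :=
    (measure_iUnion_le _).trans ((tsum_le_tsum fun a => hdec _ _ (by omega)).trans hK'.le)
  have mQ : MeasurableSet Q := MeasurableSet.iUnion fun a => meas_sPath fun u => meas_blk fun u => meas_good.compl
  set W := boxF (0 : V d) (n * (K + 1) + n) with hW
  set E : ℕ → Finset (V d) → Set (Config d) := fun M S => {ω | ∃ v ∈ W, ∃ t, (∃ ν, t + nb ν ∉ box 0 M) ∧ ConnIn (S ∩ box 0 M) ω v t} with hE
  set H : ℕ → Set (Edge d → ℝ) := fun M => {u | level (pc + ε) u ∈ E M (lost (boxF 0 (M + L)) (level p u))} with hH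
  have hlost := fun M => bern_lost_le (P := par d p (pc + ε / 2) (ε / 2)) (p := p) (q := pc + ε / 2) (s := ε / 2) (r := pc + ε)
    (Λ := boxF 0 (M + L)) (E := E M) ⟨by linarith, by linarith⟩ ⟨by linarith, by linarith⟩ (fun e => by simp [par]) (fun e => by simp [par]) (fun e => by simp [par])
    (by nlinarith) (fun S ω ω' h ⟨v, hv, t, ht, hc⟩ => ⟨v, hv, t, ht, hc.congr fun e he => h e fun x hx => (he x hx).1⟩) (fun S => by
      have : E M S = ⋃ v ∈ W, {ω | ∃ t, (∃ ν, t + nb ν ∉ box 0 M) ∧ ConnIn (S ∩ box 0 M) ω v t} := by ext; simp [hE]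
      rw [this]
      exact measurableSet_biUnion _ fun v _ => meas_exists_connIn _)
    fun S ω ω' h ⟨v, hv, t, ht, hc⟩ => ⟨v, hv, t, ht, hc.mono_conf h⟩
  have hHδ : ∀ M, n * (K + 1) + n ≤ M → 1 ≤ unif (Edge d) (H M) + δ := fun M hM => by
    rw [← prob_add_prob_compl (μ := bern (par d p (pc + ε / 2) (ε / 2))) mQ, add_comm]
    refine add_le_add ((measure_mono fun η hη => ?_).trans (hlost M).2) hQδ
    obtain ⟨v, hv, t, ht, hc⟩ := exists_escape (hd₀.trans hd) (K := K) hn hk hM fun hfin => by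
      obtain ⟨a, ha, hp⟩ := exists_sPath_of_finite hfin
      obtain ⟨b, rfl⟩ := Nat.exists_eq_add_of_le (show K + 1 ≤ a from ha)
      rw [add_comm] at hp
      exact hη (mem_iUnion.2 ⟨b, hp⟩)
    refine ⟨v, mem_boxF.2 hv, t, ht, hc.mono fun x hx => ⟨mem_filter.2 ⟨mem_boxF.2 (box_mono (by omega) hx.2), fun hr => hx.1 ?_⟩, hx.2⟩⟩
    rw [coe_boxF] at hr
    simpa [Arm, Reach] using hr.anti (fun y hy => mem_box_trans hy hx.2) (self_mem_box x L)
  have hlim : 1 ≤ unif (Edge d) (⋂ m, ⋃ M ∈ Ici m, H M) + δ := by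
    rw [Antitone.measure_iInter (fun m m' h => biUnion_subset_biUnion_left (Ici_subset_Ici.2 h))
      (fun m => (MeasurableSet.biUnion (to_countable _) fun M _ => (hlost M).1).nullMeasurableSet) ⟨0, measure_ne_top _ _⟩, ENNReal.iInf_add]
    exact le_iInf fun m => (hHδ (max m (n * (K + 1) + n)) (le_max_right _ _)).trans
      (add_le_add (measure_mono (subset_biUnion_of_mem (u := H) (le_max_left m _))) le_rfl)
  refine hlim.trans (add_le_add (measure_mono fun u hu => ?_) le_rfl)
  by_contra hno
  have hev : ∀ᶠ M in atTop, ∀ v ∈ W, ¬ Reach (box 0 M) (closeOn (Cinf (level p u)) (level (pc + ε) u)) v := by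
    refine (Filter.eventually_all_finset W).2 fun v _ => ?_
    by_contra hfr
    refine hno ⟨v, ?_⟩
    rw [InInfinite, cluster_eq]
    refine infinite_of_reach fun m hm => ?_
    obtain ⟨M, hmM, hM⟩ := (Filter.frequently_atTop.1 hfr) m
    exact hM.anti (box_mono hmM) hm
  obtain ⟨m, hm⟩ := eventually_atTop.1 hev
  obtain ⟨M, hM, v, hv, t, ht, hc⟩ := mem_iUnion₂.1 (mem_iInter.1 hu m)
  refine hm M hM v hv ⟨t, ht, (hc.congr fun e he => ?_).mono inter_subset_right⟩
  refine (if_neg ?_).symm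
  rintro ⟨x, hx, hxC⟩
  obtain ⟨h1, h2⟩ := mem_filter.1 (he x hx).1
  refine hxC ((boxF 0 (M + L)).finite_toSet.subset ?_)
  rw [cluster_eq]
  exact fun y hy => (ConnIn.of_not_reach h1 h2 hy).right

end

end

end Perc
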